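/- For every prime p ≥ 5, the number L^{(3*)}(p) of distinct roots of ss_p^{(3*)}(X) in 𝔽_p equals δ·L(p) + (1/8)·(2 + (1 + (−1|p))·(2 + (−2|p)))·h(√−3p). -/

import Mathlib

open Polynomial

noncomputable section

/-- The class number h(√-d) of the imaginary quadratic field ℚ(√-d),
realized as the subfield of ℂ generated by i·√d. -/
def classNumberSqrtNeg (d : ℕ) : ℕ :=
  haveI : FiniteDimensional ℚ (IntermediateField.adjoin ℚ {(Complex.I * Real.sqrt d : ℂ)}) :=
    IntermediateField.adjoin.finiteDimensional
      ⟨X ^ 2 + C (d : ℚ), monic_X_pow_add_C _ (by norm_num), by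
        have h : (Complex.I * (Real.sqrt d : ℂ)) ^ 2 = -(d : ℂ) := by
          rw [mul_pow, Complex.I_sq, ← Complex.ofReal_pow, Real.sq_sqrt (Nat.cast_nonneg d)]
          simp
        simp [h]⟩
  haveI : NumberField (IntermediateField.adjoin ℚ {(Complex.I * Real.sqrt d : ℂ)}) := ⟨⟩
  NumberField.classNumber (IntermediateField.adjoin ℚ {(Complex.I * Real.sqrt d : ℂ)})

variable (p : ℕ) [Fact p.Prime]

/-- ε = (1 - (-1|p))/2 -/
def eps : ℕ := ((1 - legendreSym p (-1)) / 2).toNat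
/-- δ = (1 - (-3|p))/2 -/
def del : ℕ := ((1 - legendreSym p (-3)) / 2).toNat
/-- ν = (1 - (-2|p))/2 -/
def nu : ℕ := ((1 - legendreSym p (-2)) / 2).toNat

/-- The Pochhammer symbol (x)_n = x(x+1)⋯(x+n-1) in 𝔽_p. -/
def poch (x : ZMod p) (n : ℕ) : ZMod p := (ascPochhammer (ZMod p) n).eval x

/-- Deuring's supersingular polynomial ss_p(X) ∈ 𝔽_p[X], via its hypergeometric
expression: (X-1728)^ε · Σ_{n=0}^{m} ((-m)_n (β)_n / (n!)²) 1728^n X^{m+δ-n},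
with m = ⌊p/12⌋ and β = 5/12 - (2δ-3ε)/6. -/
def ssPoly : (ZMod p)[X] :=
  (X - C 1728) ^ eps p *
    ∑ n ∈ Finset.range (p / 12 + 1),
      C (poch p (-(p / 12 : ℕ) : ZMod p) n *
         poch p ((5 : ZMod p) / 12 - (((2 * (del p : ℤ) - 3 * (eps p : ℤ)) : ℤ) : ZMod p) / 6) n /
         ((n.factorial : ZMod p)) ^ 2 * 1728 ^ n) *
      X ^ (p / 12 + del p - n)

/-- L(p): the number of distinct roots of ss_p(X) in 𝔽_p. -/
def LL : ℕ := (ssPoly p).roots.toFinset.card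

/-- The level-3 Fricke supersingular polynomial ss_p^{(3*)}(X) ∈ 𝔽_p[X]:
(X-108)^δ · Σ_{n=0}^{m₃} ((-m₃)_n (β₃)_n / (n!)²) 108^n X^{m₃+δ-n},
with m₃ = ⌊p/6⌋ and β₃ = 1/3 + δ/3. -/
def ss3Star : (ZMod p)[X] :=
  (X - C 108) ^ del p *
    ∑ n ∈ Finset.range (p / 6 + 1),
      C (poch p (-(p / 6 : ℕ) : ZMod p) n *
         poch p ((1 : ZMod p) / 3 + (del p : ZMod p) / 3) n /
         ((n.factorial : ZMod p)) ^ 2 * 108 ^ n) *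
      X ^ (p / 6 + del p - n)

/-- L^{(3*)}(p): the number of distinct roots of ss_p^{(3*)}(X) in 𝔽_p. -/
def L3Star : ℕ := (ss3Star p).roots.toFinset.card

namespace SS3

open Filter Topology Complex
open Finset (range mem_univ sum_congr univ prod_congr card_univ prod_const mem_range sum_eq_single
  sum_add_distrib prod_mul_distrib sum_range_succ mul_prod_erase mem_range_succ_iff coe_filter
  prod_insert prod_div_distrib prod_eq_zero card_pair filter_singleton)
open PowerSeries (coeff_zero_eq_constantCoeff_apply invOfUnit mul_invOfUnit coeff_one_mul rescale
  constantCoeff_X coeff_mk coeff_rescale)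
open IsLocalRing (residue ResidueField residue_eq_zero_iff maximalIdeal)

/-- The constant coefficient of a power series. -/
notation "constCoeff" => PowerSeries.constantCoeff

/-- The homomorphism from the integers to a ring. -/
notation "ιℤ" => Int.castRingHom

theorem constantCoeff_map {R S : Type*} [Semiring R] [Semiring S] (f : R →+* S)
    (φ : PowerSeries R) : constCoeff (φ.map f) = f (constCoeff φ) := by
  rw [← coeff_zero_eq_constantCoeff_apply, PowerSeries.coeff_map, coeff_zero_eq_constantCoeff_apply]

/-- `PS F φ`: the function `F` is given near `0` by the convergent power series `φ`. -/
def PS (F : ℂ → ℂ) (φ : PowerSeries ℂ) : Prop :=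
  ∀ᶠ z in 𝓝 (0 : ℂ), HasSum (fun n => PowerSeries.coeff n φ * z ^ n) (F z)

namespace PS
variable {F G : ℂ → ℂ} {φ ψ : PowerSeries ℂ}

theorem iff_hasFPowerSeriesAt : PS F φ ↔ HasFPowerSeriesAt F
    (FormalMultilinearSeries.ofScalars ℂ (fun n => PowerSeries.coeff n φ)) 0 := by
  rw [hasFPowerSeriesAt_iff]
  simp only [FormalMultilinearSeries.coeff_ofScalars, zero_add, smul_eq_mul, PS, mul_comm]

theorem analyticAt (h : PS F φ) : AnalyticAt ℂ F 0 := ⟨_, iff_hasFPowerSeriesAt.1 h⟩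

theorem of_analyticAt (h : AnalyticAt ℂ F 0) :
    PS F (PowerSeries.mk fun n => iteratedDeriv n F 0 / n.factorial) := by
  rw [iff_hasFPowerSeriesAt]
  simpa using h.hasFPowerSeriesAt

theorem congr (h : PS F φ) (hFG : F =ᶠ[𝓝 0] G) : PS G φ := by
  filter_upwards [h, hFG] with z h1 h2
  rwa [← h2]

theorem unique (h : PS F φ) (h' : PS F ψ) : φ = ψ := by
  have := (iff_hasFPowerSeriesAt.1 h).eq_formalMultilinearSeries (iff_hasFPowerSeriesAt.1 h')
  rw [FormalMultilinearSeries.ofScalars_series_eq_iff] at this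
  ext n
  exact congrFun this n

theorem coeff_eq (h : PS F φ) (n : ℕ) :
    PowerSeries.coeff n φ = iteratedDeriv n F 0 / n.factorial := by
  rw [h.unique (of_analyticAt h.analyticAt)]; simp

theorem add (h : PS F φ) (h' : PS G ψ) : PS (fun z => F z + G z) (φ + ψ) := by
  filter_upwards [h, h'] with z h1 h2
  simpa [add_mul] using h1.add h2

theorem const (c : ℂ) : PS (fun _ => c) (PowerSeries.C c) := by
  refine Eventually.of_forall fun z => ?_
  have := hasSum_single (f := fun n => PowerSeries.coeff n (PowerSeries.C c) * z ^ n) 0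
    (by intro n hn; simp [PowerSeries.coeff_C, hn])
  simpa using this

theorem id : PS (fun z => z) PowerSeries.X := by
  refine Eventually.of_forall fun z => ?_
  have := hasSum_single (f := fun n => PowerSeries.coeff n (PowerSeries.X : PowerSeries ℂ) * z ^ n) 1
    (by intro n hn; simp [PowerSeries.coeff_X, hn])
  simpa using this

theorem mul (h : PS F φ) (h' : PS G ψ) : PS (fun z => F z * G z) (φ * ψ) := by
  filter_upwards [h, h'] with z h1 h2
  have s1 := h1.summable.norm
  have s2 := h2.summable.norm
  have key := tsum_mul_tsum_eq_tsum_sum_antidiagonal_of_summable_norm s1 s2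
  have hs := (summable_norm_sum_mul_antidiagonal_of_summable_norm s1 s2).of_norm
  rw [h1.tsum_eq, h2.tsum_eq] at key
  rw [key]
  refine hs.hasSum.congr_fun fun n => ?_
  rw [PowerSeries.coeff_mul, Finset.sum_mul]
  refine sum_congr rfl fun x hx => ?_
  rw [← Finset.HasAntidiagonal.mem_antidiagonal.1 hx, pow_add]; ring

theorem neg (h : PS F φ) : PS (fun z => -F z) (-φ) := by
  filter_upwards [h] with z h1
  simpa using h1.neg

theorem sub (h : PS F φ) (h' : PS G ψ) : PS (fun z => F z - G z) (φ - ψ) := by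
  simpa [sub_eq_add_neg] using h.add h'.neg

theorem pow (h : PS F φ) (n : ℕ) : PS (fun z => F z ^ n) (φ ^ n) := by
  induction n with
  | zero => simpa using const 1
  | succ n ih => simpa [pow_succ] using ih.mul h

theorem eval_zero (h : PS F φ) : F 0 = constCoeff φ := by
  have := h.coeff_eq 0
  simpa using this.symm

theorem inv (h : PS F φ) (h0 : constCoeff φ ≠ 0) :
    PS (fun z => (F z)⁻¹) φ⁻¹ := by
  have hF : F 0 ≠ 0 := by rwa [h.eval_zero]
  have hi := of_analyticAt (h.analyticAt.inv hF)
  have h1 := h.mul hi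
  have hne : ∀ᶠ z in 𝓝 (0:ℂ), F z ≠ 0 := h.analyticAt.continuousAt.eventually_ne hF
  have h2 : PS (fun _ => (1:ℂ)) (φ * _) := h1.congr (by
    filter_upwards [hne] with z hz
    simp [hz])
  have h3 := h2.unique (const 1)
  have : φ⁻¹ = _ := ((PowerSeries.eq_inv_iff_mul_eq_one h0).2 (by
    rw [mul_comm]; simpa using h3)).symm
  rw [this]; exact hi

theorem deriv (h : PS F φ) : PS (_root_.deriv F) (PowerSeries.derivative ℂ φ) := by
  have h1 := of_analyticAt h.analyticAt.deriv
  convert h1 using 1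
  ext n
  simp only [PowerSeries.coeff_derivative, coeff_mk, h.coeff_eq]
  rw [iteratedDeriv_succ', Nat.factorial_succ]
  push_cast
  field_simp

theorem comp_smul (h : PS F φ) (c : ℂ) : PS (fun z => F (c * z)) (rescale c φ) := by
  have : Tendsto (fun z : ℂ => c * z) (𝓝 0) (𝓝 0) := by
    have : Continuous (fun z : ℂ => c * z) := by fun_prop
    simpa using this.tendsto 0
  filter_upwards [this.eventually h] with z hz
  convert hz using 1
  funext n
  simp [mul_pow]; ring

theorem comp_pow (h : PS F φ) {k : ℕ} (hk : k ≠ 0) :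
    PS (fun z => F (z ^ k)) (PowerSeries.expand k hk φ) := by
  have : Tendsto (fun z : ℂ => z ^ k) (𝓝 0) (𝓝 0) := by
    have : Continuous (fun z : ℂ => z ^ k) := by fun_prop
    simpa [hk] using this.tendsto 0
  filter_upwards [this.eventually h] with z hz
  have hinj : Function.Injective (fun n : ℕ => k * n) :=
    fun a b hab => Nat.eq_of_mul_eq_mul_left (Nat.pos_of_ne_zero hk) hab
  rw [← hinj.hasSum_iff]
  · convert hz using 1
    funext n
    simp [PowerSeries.coeff_expand_mul, pow_mul]
  · intro n hn
    rw [PowerSeries.coeff_expand_of_not_dvd, zero_mul]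
    rintro ⟨m, rfl⟩
    exact hn ⟨m, rfl⟩

theorem unique_of_punctured (h : PS F φ) (h' : PS G ψ)
    (hFG : ∀ᶠ z in 𝓝[≠] (0:ℂ), F z = G z) : φ = ψ := by
  have := (h.analyticAt.frequently_eq_iff_eventually_eq h'.analyticAt).1 hFG.frequently
  exact (h.congr this).unique h'

end PS

/-- The nome `exp (2πiτ / N)`. -/
def qq (N : ℕ) (τ : ℂ) : ℂ := exp (2 * Real.pi * I * τ / N)

theorem norm_qq (N : ℕ) (τ : ℂ) : ‖qq N τ‖ = Real.exp (-(2 * Real.pi * τ.im / N)) := by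
  rw [qq, norm_exp]
  congr 1
  have : (2 * Real.pi * I * τ / N : ℂ) = ((2 * Real.pi / N : ℝ) : ℂ) * (I * τ) := by
    push_cast; ring
  rw [this, re_ofReal_mul]
  simp
  ring

theorem qq_ne_zero (N : ℕ) (τ : ℂ) : qq N τ ≠ 0 := exp_ne_zero _

theorem qq_mul_pow {N M : ℕ} (hN : N ≠ 0) (τ : ℂ) : qq (N * M) τ ^ N = qq M τ := by
  rw [qq, ← exp_nat_mul, qq]
  congr 1
  have : (N : ℂ) ≠ 0 := by exact_mod_cast hN
  grind

theorem tendsto_qq {N : ℕ} (hN : N ≠ 0) : Tendsto (qq N) (comap im atTop) (𝓝 0) := by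
  rw [tendsto_zero_iff_norm_tendsto_zero]
  simp only [norm_qq]
  have : Tendsto (fun y : ℝ => Real.exp (-(2 * Real.pi * y / N))) atTop (𝓝 0) := by
    refine Real.tendsto_exp_atBot.comp (tendsto_neg_atTop_atBot.comp ?_)
    have : (fun y : ℝ => 2 * Real.pi * y / N) = fun y => (2 * Real.pi / N) * y := by
      funext y; ring
    rw [this]
    exact tendsto_id.const_mul_atTop (by positivity)
  exact this.comp tendsto_comap

/-- Every nonzero complex number is a value of `qq N`. -/
theorem exists_qq_eq {N : ℕ} (hN : N ≠ 0) {z : ℂ} (hz : z ≠ 0) : ∃ τ, qq N τ = z := by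
  refine ⟨N * log z / (2 * Real.pi * I), ?_⟩
  rw [qq]
  have : (2 * Real.pi * I * (N * log z / (2 * Real.pi * I)) / N : ℂ) = log z := by
    field_simp
  rw [this, exp_log hz]

/-- `HasQ N f φ`: for large imaginary part, `f` is given by the power series `φ` in
`exp (2πiτ / N)`. -/
def HasQ (N : ℕ) (f : ℂ → ℂ) (φ : PowerSeries ℂ) : Prop :=
  ∃ F, PS F φ ∧ ∀ᶠ τ in comap im atTop, f τ = F (qq N τ)

theorem eventually_im_iff {P : ℂ → Prop} :
    (∀ᶠ τ in comap im atTop, P τ) ↔ ∃ Y : ℝ, ∀ τ : ℂ, Y < τ.im → P τ := by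
  rw [(atTop_basis_Ioi.comap im).eventually_iff]
  simp

namespace HasQ
variable {N : ℕ} {f g : ℂ → ℂ} {φ ψ : PowerSeries ℂ}

theorem congr (h : HasQ N f φ) (hfg : ∀ᶠ τ in comap im atTop, f τ = g τ) : HasQ N g φ := by
  obtain ⟨F, hF, h⟩ := h
  exact ⟨F, hF, by filter_upwards [h, hfg] with τ h1 h2; rw [← h2, h1]⟩

theorem of_PS {F : ℂ → ℂ} (h : PS F φ) : HasQ N (fun τ => F (qq N τ)) φ :=
  ⟨F, h, Eventually.of_forall fun _ => rfl⟩

theorem const (c : ℂ) : HasQ N (fun _ => c) (PowerSeries.C c) := of_PS (PS.const c)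

theorem one : HasQ N (fun _ => 1) 1 := by simpa using const (N := N) 1

theorem add (h : HasQ N f φ) (h' : HasQ N g ψ) : HasQ N (fun τ => f τ + g τ) (φ + ψ) := by
  obtain ⟨F, hF, h⟩ := h
  obtain ⟨G, hG, h'⟩ := h'
  exact ⟨_, hF.add hG, by filter_upwards [h, h'] with τ h1 h2; rw [h1, h2]⟩

theorem mul (h : HasQ N f φ) (h' : HasQ N g ψ) : HasQ N (fun τ => f τ * g τ) (φ * ψ) := by
  obtain ⟨F, hF, h⟩ := h
  obtain ⟨G, hG, h'⟩ := h'
  exact ⟨_, hF.mul hG, by filter_upwards [h, h'] with τ h1 h2; rw [h1, h2]⟩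

theorem const_mul (c : ℂ) (h : HasQ N f φ) :
    HasQ N (fun τ => c * f τ) (PowerSeries.C c * φ) := (const c).mul h

theorem neg (h : HasQ N f φ) : HasQ N (fun τ => -f τ) (-φ) := by
  obtain ⟨F, hF, h⟩ := h
  exact ⟨_, hF.neg, by filter_upwards [h] with τ h1; rw [h1]⟩

theorem sub (h : HasQ N f φ) (h' : HasQ N g ψ) : HasQ N (fun τ => f τ - g τ) (φ - ψ) := by
  simpa [sub_eq_add_neg] using h.add h'.neg

theorem pow (h : HasQ N f φ) (n : ℕ) : HasQ N (fun τ => f τ ^ n) (φ ^ n) := by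
  obtain ⟨F, hF, h⟩ := h
  exact ⟨_, hF.pow n, by filter_upwards [h] with τ h1; rw [h1]⟩

theorem prod {ι : Type*} (s : Finset ι) {f : ι → ℂ → ℂ} {φ : ι → PowerSeries ℂ}
    (h : ∀ i ∈ s, HasQ N (f i) (φ i)) : HasQ N (fun τ => ∏ i ∈ s, f i τ) (∏ i ∈ s, φ i) := by
  classical
  induction s using Finset.induction_on with
  | empty => simpa using one
  | insert a s ha ih =>
    simp only [prod_insert ha]
    exact (h a (by simp)).mul (ih fun i hi => h i (by simp [hi]))

theorem sum {ι : Type*} (s : Finset ι) {f : ι → ℂ → ℂ} {φ : ι → PowerSeries ℂ}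
    (h : ∀ i ∈ s, HasQ N (f i) (φ i)) : HasQ N (fun τ => ∑ i ∈ s, f i τ) (∑ i ∈ s, φ i) := by
  classical
  induction s using Finset.induction_on with
  | empty => simpa using const (N := N) 0
  | insert a s ha ih =>
    simp only [Finset.sum_insert ha]
    exact (h a (by simp)).add (ih fun i hi => h i (by simp [hi]))

theorem inv (h : HasQ N f φ) (h0 : constCoeff φ ≠ 0) :
    HasQ N (fun τ => (f τ)⁻¹) φ⁻¹ := by
  obtain ⟨F, hF, h⟩ := h
  exact ⟨_, hF.inv h0, by filter_upwards [h] with τ h1; rw [h1]⟩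

theorem unique (hN : N ≠ 0) (h : HasQ N f φ) (h' : HasQ N f ψ) : φ = ψ := by
  obtain ⟨F, hF, h⟩ := h
  obtain ⟨G, hG, h'⟩ := h'
  obtain ⟨Y, hY⟩ := eventually_im_iff.1 (h.and h')
  refine hF.unique_of_punctured hG ?_
  rw [eventually_nhdsWithin_iff]
  have hr : (0:ℝ) < Real.exp (-(2 * Real.pi * Y / N)) := Real.exp_pos _
  filter_upwards [Metric.ball_mem_nhds (0:ℂ) hr] with z hz hz0
  obtain ⟨τ, rfl⟩ := exists_qq_eq hN hz0
  have : Y < τ.im := by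
    rw [Metric.mem_ball, dist_zero_right, norm_qq, Real.exp_lt_exp, neg_lt_neg_iff] at hz
    have hN' : (0:ℝ) < N := by positivity
    have := (div_lt_div_iff_of_pos_right hN').1 hz
    exact lt_of_mul_lt_mul_left this (by positivity)
  grind

theorem tendsto (hN : N ≠ 0) (h : HasQ N f φ) :
    Tendsto f (comap im atTop) (𝓝 (constCoeff φ)) := by
  obtain ⟨F, hF, h⟩ := h
  have h1 : Tendsto F (𝓝 0) (𝓝 (constCoeff φ)) := by
    rw [← hF.eval_zero]; exact hF.analyticAt.continuousAt
  exact (h1.comp (tendsto_qq hN)).congr' (by filter_upwards [h] with τ h1; simp [h1])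

theorem theta (h : HasQ 1 f φ) :
    HasQ 1 (fun τ => deriv f τ / (2 * Real.pi * I)) (PowerSeries.X * PowerSeries.derivative ℂ φ) := by
  obtain ⟨F, hF, h⟩ := h
  refine ⟨_, PS.id.mul hF.deriv, ?_⟩
  have h2 := (tendsto_qq one_ne_zero).eventually hF.analyticAt.eventually_analyticAt
  obtain ⟨Y, hY⟩ := eventually_im_iff.1 (h.and h2)
  refine eventually_im_iff.2 ⟨Y, fun τ hτ => ?_⟩
  have hev : f =ᶠ[𝓝 τ] fun τ => F (qq 1 τ) := by
    have : ∀ᶠ σ in 𝓝 τ, Y < σ.im := (continuous_im.tendsto τ).eventually (lt_mem_nhds hτ)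
    filter_upwards [this] with σ hσ using (hY σ hσ).1
  simp only
  rw [hev.deriv_eq]
  have hq : HasDerivAt (qq 1) (qq 1 τ * (2 * Real.pi * I)) τ := by
    have : HasDerivAt (fun τ : ℂ => 2 * Real.pi * I * τ / ((1:ℕ) : ℂ)) (2 * Real.pi * I) τ := by
      simpa using (hasDerivAt_id τ).const_mul (2 * Real.pi * I)
    exact this.cexp
  have hd := ((hY τ hτ).2.differentiableAt.hasDerivAt.comp τ hq)
  rw [show (fun τ => F (qq 1 τ)) = F ∘ qq 1 from rfl, hd.deriv]
  field_simp

/-- Expansion of `f` in terms of a root of the nome. -/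
theorem expand {M : ℕ} (hN : N ≠ 0) (h : HasQ M f φ) :
    HasQ (N * M) f (PowerSeries.expand N hN φ) := by
  obtain ⟨F, hF, h⟩ := h
  refine ⟨_, hF.comp_pow hN, ?_⟩
  filter_upwards [h] with τ h1
  rw [h1, qq_mul_pow hN]

theorem comp_mul (hN : N ≠ 0) (h : HasQ 1 f φ) :
    HasQ 1 (fun τ => f (N * τ)) (PowerSeries.expand N hN φ) := by
  obtain ⟨F, hF, h⟩ := h
  refine ⟨_, hF.comp_pow hN, ?_⟩
  have : Tendsto (fun τ : ℂ => (N : ℂ) * τ) (comap im atTop) (comap im atTop) := by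
    rw [tendsto_comap_iff]
    have : (im ∘ fun τ : ℂ => (N : ℂ) * τ) = fun τ => (N : ℝ) * τ.im := by
      funext τ; simp
    rw [this]
    exact tendsto_comap.const_mul_atTop (by positivity)
  filter_upwards [this.eventually h] with τ h1
  rw [h1]
  congr 1
  rw [qq, qq, ← exp_nat_mul]
  congr 1; push_cast; ring

theorem comp_div (hN : N ≠ 0) (b : ℕ) (h : HasQ 1 f φ) :
    HasQ N (fun τ => f ((τ + b) / N)) (rescale (qq N b) φ) := by
  obtain ⟨F, hF, h⟩ := h
  refine ⟨_, hF.comp_smul _, ?_⟩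
  have : Tendsto (fun τ : ℂ => (τ + b) / N) (comap im atTop) (comap im atTop) := by
    rw [tendsto_comap_iff]
    have : (im ∘ fun τ : ℂ => (τ + b) / N) = fun τ : ℂ => τ.im / N := by
      funext τ; simp
    rw [this]
    exact tendsto_comap.atTop_div_const (by positivity)
  filter_upwards [this.eventually h] with τ h1
  rw [h1]
  congr 1
  rw [qq, qq, qq, ← exp_add]
  congr 1; push_cast; ring

theorem comp_add (b : ℕ) (h : HasQ N f φ) :
    HasQ N (fun τ => f (τ + b)) (rescale (qq N b) φ) := by
  obtain ⟨F, hF, h⟩ := h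
  refine ⟨_, hF.comp_smul _, ?_⟩
  have : Tendsto (fun τ : ℂ => τ + b) (comap im atTop) (comap im atTop) := by
    rw [tendsto_comap_iff]
    have : (im ∘ fun τ : ℂ => τ + b) = fun τ : ℂ => τ.im := by
      funext τ; simp
    rw [this]
    exact tendsto_comap
  filter_upwards [this.eventually h] with τ h1
  rw [h1]
  congr 1
  rw [qq, qq, qq, ← exp_add]
  congr 1; ring

end HasQ

variable {τ σ : ℂ}

/-- The Euler product `∏ (1 - z ^ (n + 1))`. -/
def DD (z : ℂ) : ℂ := ∏' n : ℕ, (1 - z ^ (n + 1))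

theorem DD_ne_zero {z : ℂ} (hz : ‖z‖ < 1) : DD z ≠ 0 := by
  have : (fun n : ℕ => 1 - z ^ (n + 1)) = fun n => 1 + -z ^ (n + 1) := by
    funext n; ring
  rw [DD, this]
  refine tprod_one_add_ne_zero_of_summable (f := fun n ↦ -z ^ (n + 1)) (fun i hi => ?_) ?_
  · have h1 : z ^ (i + 1) = 1 := by linear_combination -hi
    have h2 : ‖z‖ ^ (i + 1) = 1 := by rw [← norm_pow, h1, norm_one]
    exact absurd h2 (pow_lt_one₀ (norm_nonneg _) hz (by omega)).ne
  · simpa using (summable_nat_add_iff 1).mpr (summable_geometric_of_lt_one (norm_nonneg _) hz)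

theorem differentiableOn_DD : DifferentiableOn ℂ DD (Metric.ball 0 1) :=
  ModularForm.differentiableOn_tprod_one_sub_pow

theorem differentiableAt_DD {z : ℂ} (hz : ‖z‖ < 1) : DifferentiableAt ℂ DD z :=
  differentiableOn_DD.differentiableAt (Metric.isOpen_ball.mem_nhds (by simpa using hz))

/-- Partial products of the Euler product. -/
def DDpart (N : ℕ) : PowerSeries ℤ := ∏ i ∈ range N, (1 - PowerSeries.X ^ (i + 1))

theorem PS_DDpart (N : ℕ) : PS (fun z => ∏ i ∈ range N, (1 - z ^ (i + 1)))
    ((DDpart N).map (ιℤ ℂ)) := by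
  induction N with
  | zero => simpa [DDpart] using PS.const 1
  | succ N ih =>
    have := ih.mul ((PS.const 1).sub (PS.id.pow (N + 1)))
    simpa [DDpart, Finset.prod_range_succ] using this

theorem constantCoeff_DDpart (N : ℕ) : constCoeff (DDpart N) = 1 := by
  simp [DDpart, map_prod]

theorem coeff_one_DDpart (N : ℕ) : PowerSeries.coeff 1 (DDpart (N + 1)) = -1 := by
  induction N with
  | zero => simp [DDpart, PowerSeries.coeff_one]
  | succ N ih =>
    rw [DDpart, Finset.prod_range_succ, ← DDpart, coeff_one_mul, ih,
      constantCoeff_DDpart]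
    simp

theorem tendsto_coeff_DDpart (n : ℕ) :
    Tendsto (fun N => ((PowerSeries.coeff n (DDpart N) : ℤ) : ℂ)) atTop
      (𝓝 (iteratedDeriv n DD 0 / n.factorial)) := by
  have hU : IsOpen (Metric.ball (0:ℂ) 1) := Metric.isOpen_ball
  have h0 : TendstoLocallyUniformlyOn
      (fun (N : ℕ) (z : ℂ) => ∏ i ∈ range N, (1 - z ^ (i + 1))) DD atTop
      (Metric.ball 0 1) := by
    have := ModularForm.multipliableLocallyUniformlyOn_one_sub_pow.hasProdLocallyUniformlyOn
    have := this.tendstoLocallyUniformlyOn_finsetRange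
    change TendstoLocallyUniformlyOn _ (fun z : ℂ => ∏' n : ℕ, (1 - z ^ (n + 1))) _ _
    simpa using this
  have hdiff : ∀ (N m : ℕ), DifferentiableOn ℂ
      (iteratedDeriv m (fun z : ℂ => ∏ i ∈ range N, (1 - z ^ (i + 1))))
      (Metric.ball 0 1) := by
    fun_prop
  have h1 : ∀ m, TendstoLocallyUniformlyOn
      (fun (N : ℕ) => iteratedDeriv m fun z : ℂ => ∏ i ∈ range N, (1 - z ^ (i + 1)))
      (iteratedDeriv m DD) atTop (Metric.ball 0 1) := by
    intro m
    induction m with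
    | zero => simpa using h0
    | succ m ih =>
      simp only [iteratedDeriv_succ]
      exact ih.deriv (Eventually.of_forall fun N => hdiff N m) hU
  have h2 := ((h1 n).tendsto_at (show (0:ℂ) ∈ Metric.ball 0 1 by simp)).div_const (n.factorial : ℂ)
  refine h2.congr fun N => ?_
  rw [← (PS_DDpart N).coeff_eq n]
  simp

theorem exists_int_DD (n : ℕ) : ∃ m : ℤ, (m : ℂ) = iteratedDeriv n DD 0 / n.factorial := by
  have h1 : IsClosed (Set.range ((↑) : ℤ → ℂ)) := by
    have := (isometry_ofReal.isClosedEmbedding.comp Int.isClosedEmbedding_coe_real).isClosed_range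
    convert this using 2
    funext m; simp
  exact h1.mem_of_tendsto (tendsto_coeff_DDpart n) (Eventually.of_forall fun N => ⟨_, rfl⟩)

/-- The integral expansion of the Euler product. -/
def dser : PowerSeries ℤ := PowerSeries.mk fun n => (exists_int_DD n).choose

theorem PS_DD : PS DD (dser.map (ιℤ ℂ)) := by
  have h := PS.of_analyticAt (F := DD)
    (differentiableOn_DD.analyticAt (Metric.ball_mem_nhds 0 one_pos))
  convert h using 1
  ext n
  simp [dser, (exists_int_DD n).choose_spec]

theorem coeff_zero_dser : constCoeff dser = 1 := by
  have := PS_DD.coeff_eq 0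
  have h2 := tendsto_coeff_DDpart 0
  rw [← this] at h2
  have h3 : Tendsto (fun _ : ℕ => (1:ℂ)) atTop (𝓝 1) := tendsto_const_nhds
  have := tendsto_nhds_unique (h3.congr fun N => ?_) h2
  · simp at this
    exact_mod_cast this.symm
  · have := constantCoeff_DDpart N
    simp [this]

theorem coeff_one_dser : PowerSeries.coeff 1 dser = -1 := by
  have := PS_DD.coeff_eq 1
  have h2 := tendsto_coeff_DDpart 1
  rw [← this] at h2
  have h3 : Tendsto (fun _ : ℕ => (-1:ℂ)) atTop (𝓝 (-1)) := tendsto_const_nhds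
  have := tendsto_nhds_unique (h3.congr' ?_) h2
  · simp at this
    exact_mod_cast this.symm
  · filter_upwards [eventually_ge_atTop 1] with N hN
    obtain ⟨M, rfl⟩ := Nat.exists_eq_add_of_le' hN
    simp [coeff_one_DDpart M]

theorem norm_qq_lt_one (hτ : 0 < τ.im) : ‖qq 1 τ‖ < 1 := by
  rw [norm_qq, Real.exp_lt_one_iff]
  simp; positivity

theorem eta_eq : ModularForm.eta τ = Function.Periodic.qParam 24 τ * DD (qq 1 τ) := by
  rw [ModularForm.eta, DD]
  simp [ModularForm.eta_q_eq_pow, qq]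

/-- Hauptmodul germ. -/
def wz (z : ℂ) : ℂ := z * (DD (z ^ 3) * (DD z)⁻¹) ^ 12
/-- Weight six germ. -/
def gz (z : ℂ) : ℂ := z * (DD z * DD (z ^ 3)) ^ 6

/-- `w = (η(3τ)/η(τ))^12`. -/
def ww (τ : ℂ) : ℂ := wz (qq 1 τ)
/-- `g = (η(τ)η(3τ))^6`. -/
def gg (τ : ℂ) : ℂ := gz (qq 1 τ)

theorem qq_one_three (τ : ℂ) : qq 1 (3 * τ) = qq 1 τ ^ 3 := by
  rw [qq, qq, ← exp_nat_mul]
  congr 1; push_cast; ring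

theorem qParam_pow (τ : ℂ) : Function.Periodic.qParam 24 τ ^ 24 = qq 1 τ := by
  rw [qq, Function.Periodic.qParam, ← exp_nat_mul]
  congr 1; push_cast; ring

theorem qParam_three (τ : ℂ) :
    Function.Periodic.qParam 24 (3 * τ) = Function.Periodic.qParam 24 τ ^ 3 := by
  rw [Function.Periodic.qParam, Function.Periodic.qParam, ← exp_nat_mul]
  congr 1; push_cast; ring

theorem ww_eq_eta : ww τ = (ModularForm.eta (3 * τ) / ModularForm.eta τ) ^ 12 := by
  have hq : Function.Periodic.qParam 24 τ ≠ 0 := exp_ne_zero _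
  rw [eta_eq, eta_eq, qParam_three, ww, wz, qq_one_three, ← qParam_pow]
  field_simp

theorem gg_eq_eta : gg τ = (ModularForm.eta τ * ModularForm.eta (3 * τ)) ^ 6 := by
  rw [eta_eq, eta_eq, qParam_three, gg, gz, qq_one_three, ← qParam_pow]
  ring

theorem im_three (hτ : 0 < τ.im) : 0 < (3 * τ).im := by simpa using hτ

theorem eta_three_ne_zero (hτ : 0 < τ.im) : ModularForm.eta (3 * τ) ≠ 0 :=
  ModularForm.eta_ne_zero (im_three hτ)

theorem ww_ne_zero (hτ : 0 < τ.im) : ww τ ≠ 0 := by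
  rw [ww_eq_eta]
  exact pow_ne_zero _ (div_ne_zero (eta_three_ne_zero hτ) (ModularForm.eta_ne_zero hτ))

theorem gg_ne_zero (hτ : 0 < τ.im) : gg τ ≠ 0 := by
  rw [gg_eq_eta]
  exact pow_ne_zero _ (mul_ne_zero (ModularForm.eta_ne_zero hτ) (eta_three_ne_zero hτ))

theorem eta_S (hτ : 0 < τ.im) :
    ModularForm.eta (-1 / τ) = (sqrt I)⁻¹ * (sqrt τ * ModularForm.eta τ) := by
  simpa using ModularForm.eta_comp_eq_csqrt_I_inv hτ

theorem sqrt_pow_twelve {z : ℂ} (hz : z ≠ 0) : sqrt z ^ 12 = z ^ 6 := by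
  rw [sqrt_eq_exp hz, ← exp_nat_mul]
  rw [show ((12 : ℕ) * (log z / 2) : ℂ) = (6 : ℕ) * log z by push_cast; ring, exp_nat_mul,
    exp_log hz]

theorem ne_zero_of_im (hτ : 0 < τ.im) : τ ≠ 0 := by
  rintro rfl; simp at hτ

theorem ww_W (hτ : 0 < τ.im) : ww (-1 / (3 * τ)) = 1 / (729 * ww τ) := by
  have h0 := ne_zero_of_im hτ
  have h3 := ne_zero_of_im (im_three hτ)
  have e1 : 3 * (-1 / (3 * τ)) = -1 / τ := by field_simp
  have hs := sqrt_pow_twelve h0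
  have hs3 := sqrt_pow_twelve h3
  have n1 := ModularForm.eta_ne_zero hτ
  have hI : sqrt I ≠ 0 := by
    intro h; have := sqrt_pow_twelve I_ne_zero; simp [h] at this
  rw [ww_eq_eta, ww_eq_eta, e1, eta_S hτ, eta_S (im_three hτ)]
  simp only [mul_pow, div_pow, hs, hs3]
  field_simp
  norm_num

theorem gg_W (hτ : 0 < τ.im) : gg (-1 / (3 * τ)) = -27 * τ ^ 6 * gg τ := by
  have h0 := ne_zero_of_im hτ
  have h3 := ne_zero_of_im (im_three hτ)
  have e1 : 3 * (-1 / (3 * τ)) = -1 / τ := by field_simp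
  have hI : (sqrt I) ^ 12 = -1 := by
    rw [sqrt_pow_twelve I_ne_zero, show I ^ 6 = I ^ 4 * I ^ 2 by ring, I_pow_four, I_sq]; ring
  have q : ∀ {z : ℂ}, z ≠ 0 → sqrt z ^ 6 = z ^ 3 := by
    intro z hz
    rw [sqrt_eq_exp hz, ← exp_nat_mul]
    rw [show ((6 : ℕ) * (log z / 2) : ℂ) = (3 : ℕ) * log z by push_cast; ring, exp_nat_mul,
      exp_log hz]
  rw [gg_eq_eta, gg_eq_eta, e1, eta_S hτ, eta_S (im_three hτ)]
  grind

theorem qq_one_add_one (τ : ℂ) : qq 1 (τ + 1) = qq 1 τ := by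
  rw [qq, qq, show (2 * Real.pi * I * (τ + 1) / ((1:ℕ) : ℂ) : ℂ)
    = 2 * Real.pi * I * τ / ((1:ℕ) : ℂ) + 2 * Real.pi * I by push_cast; ring, exp_add,
    exp_two_pi_mul_I, mul_one]

theorem ww_T (τ : ℂ) : ww (τ + 1) = ww τ := by rw [ww, ww, qq_one_add_one]
theorem gg_T (τ : ℂ) : gg (τ + 1) = gg τ := by rw [gg, gg, qq_one_add_one]

theorem norm_pow_three_lt {z : ℂ} (hz : ‖z‖ < 1) : ‖z ^ 3‖ < 1 := by
  rw [norm_pow]; exact pow_lt_one₀ (norm_nonneg _) hz (by norm_num)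

theorem differentiableAt_wz {z : ℂ} (hz : ‖z‖ < 1) : DifferentiableAt ℂ wz z := by
  have h1 := differentiableAt_DD hz
  have h2 : DifferentiableAt ℂ (fun z : ℂ => DD (z ^ 3)) z := by
    have h3 := differentiableAt_DD (norm_pow_three_lt hz)
    fun_prop
  exact differentiableAt_id.mul ((h2.mul (h1.inv (DD_ne_zero hz))).pow 12)

theorem differentiableAt_gz {z : ℂ} (hz : ‖z‖ < 1) : DifferentiableAt ℂ gz z := by
  have h1 := differentiableAt_DD hz
  have h2 : DifferentiableAt ℂ (fun z : ℂ => DD (z ^ 3)) z := by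
    have h3 := differentiableAt_DD (norm_pow_three_lt hz)
    fun_prop
  exact differentiableAt_id.mul ((h1.mul h2).pow 6)

theorem differentiable_qq (N : ℕ) : Differentiable ℂ (qq N) := by
  unfold qq; fun_prop

theorem differentiableAt_ww (hτ : 0 < τ.im) : DifferentiableAt ℂ ww τ :=
  (differentiableAt_wz (norm_qq_lt_one hτ)).comp τ (differentiable_qq 1 τ)

theorem differentiableAt_gg (hτ : 0 < τ.im) : DifferentiableAt ℂ gg τ :=
  (differentiableAt_gz (norm_qq_lt_one hτ)).comp τ (differentiable_qq 1 τ)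

/-- Unit part of the expansion of `w`. -/
def wu : PowerSeries ℤ :=
  (PowerSeries.expand 3 three_ne_zero dser * invOfUnit dser 1) ^ 12
/-- Unit part of the expansion of `g`. -/
def gu : PowerSeries ℤ := (dser * PowerSeries.expand 3 three_ne_zero dser) ^ 6

/-- The expansion of `w`. -/
def wser : PowerSeries ℤ := PowerSeries.X * wu
/-- The expansion of `g`. -/
def gser : PowerSeries ℤ := PowerSeries.X * gu

theorem map_expand {R S : Type*} [CommRing R] [CommRing S] (f : R →+* S) {k : ℕ} (hk : k ≠ 0)
    (φ : PowerSeries R) :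
    (PowerSeries.expand k hk φ).map f = PowerSeries.expand k hk (φ.map f) := by
  simp

theorem constantCoeff_map_dser :
    constCoeff (dser.map (ιℤ ℂ)) = 1 := by
  rw [constantCoeff_map, coeff_zero_dser]
  simp

theorem map_invOfUnit_dser : (invOfUnit dser 1).map (ιℤ ℂ) =
    (dser.map (ιℤ ℂ))⁻¹ := by
  symm
  rw [PowerSeries.inv_eq_iff_mul_eq_one]
  · rw [← map_mul, mul_comm, mul_invOfUnit _ _ (by simp [coeff_zero_dser]), map_one]
  · rw [constantCoeff_map_dser]; exact one_ne_zero

theorem PS_wz : PS wz (wser.map (ιℤ ℂ)) := by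
  have h := PS.id.mul ((((PS_DD.comp_pow three_ne_zero)).mul (PS_DD.inv (by
    rw [constantCoeff_map_dser]; exact one_ne_zero))).pow 12)
  simp only [wser, wu, map_mul, map_pow, map_expand, map_invOfUnit_dser, PowerSeries.map_X]
  exact h

theorem PS_gz : PS gz (gser.map (ιℤ ℂ)) := by
  have h := PS.id.mul ((PS_DD.mul (PS_DD.comp_pow three_ne_zero)).pow 6)
  simp only [gser, gu, map_mul, map_pow, map_expand, PowerSeries.map_X]
  exact h

theorem hasQ_ww : HasQ 1 ww (wser.map (ιℤ ℂ)) := HasQ.of_PS PS_wz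
theorem hasQ_gg : HasQ 1 gg (gser.map (ιℤ ℂ)) := HasQ.of_PS PS_gz

theorem constantCoeff_expand_dser :
    constCoeff (PowerSeries.expand 3 three_ne_zero dser) = 1 := by
  simp [coeff_zero_dser]

theorem coeff_one_expand_dser :
    PowerSeries.coeff 1 (PowerSeries.expand 3 three_ne_zero dser) = 0 :=
  PowerSeries.coeff_expand_of_not_dvd _ _ _ (by norm_num)

theorem constantCoeff_wu : constCoeff wu = 1 := by
  simp [wu, coeff_zero_dser]

theorem constantCoeff_gu : constCoeff gu = 1 := by
  simp [gu, coeff_zero_dser]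

theorem coeff_one_inv_dser : PowerSeries.coeff 1 (invOfUnit dser 1) = 1 := by
  have h := mul_invOfUnit dser 1 (by simp [coeff_zero_dser])
  have h1 := congrArg (PowerSeries.coeff 1) h
  rw [coeff_one_mul, coeff_one_dser, coeff_zero_dser] at h1
  simp [PowerSeries.coeff_one] at h1
  linarith

theorem coeff_one_wu : PowerSeries.coeff 1 wu = 12 := by
  rw [wu, PowerSeries.coeff_one_pow, coeff_one_mul, coeff_one_inv_dser,
    coeff_one_expand_dser, constantCoeff_expand_dser]
  simp [coeff_zero_dser]

theorem coeff_one_gu : PowerSeries.coeff 1 gu = -6 := by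
  rw [gu, PowerSeries.coeff_one_pow, coeff_one_mul, coeff_one_dser,
    coeff_one_expand_dser, constantCoeff_expand_dser]
  simp [coeff_zero_dser]

open Matrix

/-- Integral two by two matrices. -/
abbrev Mat := Matrix (Fin 2) (Fin 2) ℤ

/-- The automorphy factor. -/
def jf (M : Mat) (τ : ℂ) : ℂ := M 1 0 * τ + M 1 1
/-- Möbius transformation. -/
def mob (M : Mat) (τ : ℂ) : ℂ := (M 0 0 * τ + M 0 1) / jf M τ

theorem jf_ne_zero {M : Mat} (hM : M.det ≠ 0) (hτ : 0 < τ.im) : jf M τ ≠ 0 := by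
  intro h
  have h1 := congrArg im h
  have h2 := congrArg re h
  simp [jf] at h1 h2
  have hc : M 1 0 = 0 := by
    grind
  rw [hc] at h2
  simp at h2
  apply hM
  rw [det_fin_two, hc, h2]; simp

theorem im_mob {M : Mat} (τ : ℂ) :
    (mob M τ).im = M.det * τ.im / normSq (jf M τ) := by
  rw [mob, div_im, jf, det_fin_two]
  simp only [add_re, mul_re, intCast_re, intCast_im, add_im, mul_im, zero_mul, sub_zero, add_zero]
  push_cast
  ring

theorem im_mob_pos {M : Mat} (hM : 0 < M.det) (hτ : 0 < τ.im) : 0 < (mob M τ).im := by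
  rw [im_mob]
  have := normSq_pos.2 (jf_ne_zero hM.ne' hτ)
  positivity

theorem mob_mul_jf {N : Mat} (hN : N.det ≠ 0) (hτ : 0 < τ.im) :
    mob N τ * jf N τ = N 0 0 * τ + N 0 1 := div_mul_cancel₀ _ (jf_ne_zero hN hτ)

theorem jf_mul {M N : Mat} (hN : N.det ≠ 0) (hτ : 0 < τ.im) :
    jf (M * N) τ = jf M (mob N τ) * jf N τ := by
  have e := mob_mul_jf hN hτ
  generalize mob N τ = m at *
  simp only [jf, Matrix.mul_apply, Fin.sum_univ_two] at e ⊢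
  push_cast
  linear_combination -(M 1 0 : ℂ) * e

theorem mob_mul {M N : Mat} (hM : M.det ≠ 0) (hN : 0 < N.det) (hτ : 0 < τ.im) :
    mob (M * N) τ = mob M (mob N τ) := by
  have h1 := jf_ne_zero hN.ne' hτ
  have h2 := jf_ne_zero hM (im_mob_pos hN hτ)
  have e := mob_mul_jf hN.ne' hτ
  have e2 := mob_mul_jf hM (im_mob_pos hN hτ)
  rw [mob, jf_mul hN.ne' hτ, div_eq_iff (mul_ne_zero h2 h1), ← mul_assoc, e2]
  generalize mob N τ = m at *
  simp only [jf, Matrix.mul_apply, Fin.sum_univ_two] at e ⊢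
  push_cast
  linear_combination -(M 0 0 : ℂ) * e

theorem mob_one (τ : ℂ) : mob 1 τ = τ := by simp [mob, jf]

theorem mob_smul {k : ℤ} (hk : k ≠ 0) (M : Mat) (τ : ℂ) : mob (k • M) τ = mob M τ := by
  have hk' : (k : ℂ) ≠ 0 := by exact_mod_cast hk
  simp only [mob, jf, Matrix.smul_apply, smul_eq_mul, Int.cast_mul, mul_assoc, ← mul_add]
  exact mul_div_mul_left _ _ hk'

theorem mob_neg (M : Mat) (τ : ℂ) : mob (-M) τ = mob M τ := by
  have := mob_smul (k := -1) (by norm_num) M τ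
  simpa using this

theorem continuousAt_mob {M : Mat} (hM : M.det ≠ 0) (hτ : 0 < τ.im) :
    ContinuousAt (mob M) τ := by
  unfold mob
  refine ContinuousAt.div (by fun_prop) (by unfold jf; fun_prop) (jf_ne_zero hM hτ)

theorem differentiableAt_mob {M : Mat} (hM : M.det ≠ 0) (hτ : 0 < τ.im) :
    DifferentiableAt ℂ (mob M) τ := by
  unfold mob
  refine DifferentiableAt.div (by fun_prop) (by unfold jf; fun_prop) (jf_ne_zero hM hτ)

theorem hasDerivAt_mob {M : Mat} (hM : M.det ≠ 0) (hτ : 0 < τ.im) :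
    HasDerivAt (mob M) (M.det / jf M τ ^ 2) τ := by
  have h1 : HasDerivAt (fun τ : ℂ => (M 0 0 * τ + M 0 1 : ℂ)) (M 0 0) τ := by
    simpa using ((hasDerivAt_id τ).const_mul (M 0 0 : ℂ)).add_const (M 0 1 : ℂ)
  have h2 : HasDerivAt (fun τ : ℂ => (M 1 0 * τ + M 1 1 : ℂ)) (M 1 0) τ := by
    simpa using ((hasDerivAt_id τ).const_mul (M 1 0 : ℂ)).add_const (M 1 1 : ℂ)
  refine (h1.div h2 (jf_ne_zero hM hτ)).congr_deriv ?_
  change _ / jf M τ ^ 2 = _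
  congr 1
  rw [det_fin_two]; push_cast; ring

/-- The matrices of `Γ₀(3)`. -/
def G0 (M : Mat) : Prop := M.det = 1 ∧ 3 ∣ M 1 0

/-- Translations. -/
def Tn (n : ℤ) : Mat := !![1, n; 0, 1]
/-- Lower triangular unipotents. -/
def Vn (n : ℤ) : Mat := !![1, 0; 3 * n, 1]

theorem G0_Tn (n : ℤ) : G0 (Tn n) := by simp [G0, Tn, det_fin_two]
theorem G0_Vn (n : ℤ) : G0 (Vn n) := by simp [G0, Vn, det_fin_two]
theorem G0_one : G0 1 := by simp [G0]

theorem G0.mul {M N : Mat} (hM : G0 M) (hN : G0 N) : G0 (M * N) := by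
  refine ⟨by rw [det_mul, hM.1, hN.1, one_mul], ?_⟩
  simp only [Matrix.mul_apply, Fin.sum_univ_two]
  exact dvd_add (hM.2.mul_right _) (hN.2.mul_left _)

theorem G0.det_pos {M : Mat} (hM : G0 M) : 0 < M.det := by rw [hM.1]; norm_num
theorem G0.det_ne {M : Mat} (hM : G0 M) : M.det ≠ 0 := hM.det_pos.ne'

theorem G0.adj {M : Mat} (hM : G0 M) : G0 M.adjugate := by
  refine ⟨by simp [det_adjugate, hM.1], ?_⟩
  rw [adjugate_fin_two]; simpa using hM.2

theorem G0.neg {M : Mat} (hM : G0 M) : G0 (-M) := by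
  refine ⟨?_, by simpa using hM.2⟩
  have := hM.1
  rw [det_fin_two] at this ⊢; simpa using this

theorem G0.adj_mul {M : Mat} (hM : G0 M) : M.adjugate * M = 1 := by
  rw [adjugate_mul, hM.1, one_smul]

theorem mob_Tn (n : ℤ) (τ : ℂ) : mob (Tn n) τ = τ + n := by simp [mob, jf, Tn]
theorem mob_Vn (n : ℤ) (τ : ℂ) : mob (Vn n) τ = τ / (3 * n * τ + 1) := by
  simp [mob, jf, Vn]

/-- `Γ₀(3)` is generated by `-1`, translations and their lower triangular analogues. -/
theorem G0_induction {P : Mat → Prop} (h1 : P 1) (hneg : ∀ M, G0 M → P M → P (-M))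
    (hT : ∀ M n, G0 M → P M → P (M * Tn n)) (hV : ∀ M n, G0 M → P M → P (M * Vn n)) :
    ∀ M, G0 M → P M := by
  have hTn : ∀ n, P (Tn n) := fun n => by simpa using hT 1 n G0_one h1
  have key : ∀ k : ℕ, ∀ M, G0 M → (M 1 0).natAbs = k → P M := by
    intro k
    induction k using Nat.strong_induction_on with
    | _ k ih =>
      intro M hM hk
      by_cases hc : M 1 0 = 0
      · have hdet := hM.1
        rw [det_fin_two, hc, mul_zero, sub_zero] at hdet
        rcases Int.mul_eq_one_iff_eq_one_or_neg_one.1 hdet with ⟨ha, hd⟩ | ⟨ha, hd⟩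
        · have : M = Tn (M 0 1) := by
            ext i j; fin_cases i <;> fin_cases j <;> simp [Tn, ha, hd, hc]
          rw [this]; exact hTn _
        · have : M = -Tn (-M 0 1) := by
            ext i j; fin_cases i <;> fin_cases j <;> simp [Tn, ha, hd, hc]
          rw [this]; exact hneg _ (G0_Tn _) (hTn _)
      · obtain ⟨c, hc3⟩ := hM.2
        -- reduce the lower right entry
        obtain ⟨n, hn⟩ : ∃ n : ℤ, 2 * |M 1 1 + n * M 1 0| ≤ |M 1 0| := by
          refine ⟨-round ((M 1 1 : ℚ) / M 1 0), ?_⟩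
          have hq : (M 1 0 : ℚ) ≠ 0 := by exact_mod_cast hc
          have := abs_sub_round ((M 1 1 : ℚ) / M 1 0)
          have h2 : (M 1 1 : ℚ) + -(round ((M 1 1 : ℚ) / M 1 0) : ℚ) * M 1 0
              = ((M 1 1 : ℚ) / M 1 0 - round ((M 1 1 : ℚ) / M 1 0)) * M 1 0 := by
            field_simp
            ring
          have h3 : 2 * |(M 1 1 : ℚ) + -(round ((M 1 1 : ℚ) / M 1 0) : ℚ) * M 1 0|
              ≤ |(M 1 0 : ℚ)| := by
            rw [h2, abs_mul]
            nlinarith [abs_nonneg (M 1 0 : ℚ)]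
          exact_mod_cast h3
        set N := M * Tn n with hN
        have hN0 : G0 N := hM.mul (G0_Tn n)
        have e10 : N 1 0 = M 1 0 := by simp [hN, Tn, Matrix.mul_apply]
        have e11 : N 1 1 = M 1 1 + n * M 1 0 := by
          simp [hN, Tn, Matrix.mul_apply]; ring
        have hd0 : N 1 1 ≠ 0 := by
          intro h
          have hdet := hN0.1
          rw [det_fin_two, h, e10, hc3] at hdet
          have : (3:ℤ) ∣ 1 := ⟨-(N 0 1 * c), by linarith⟩
          norm_num at this
        rw [← e11] at hn
        obtain ⟨m, hm⟩ : ∃ m : ℤ, |N 1 0 + 3 * m * N 1 1| < |M 1 0| := by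
          have hpos := abs_pos.2 hd0
          rcases le_total 0 (N 1 0) with h0 | h0 <;> rcases le_total 0 (N 1 1) with h1 | h1
          · refine ⟨-1, ?_⟩
            rw [← e10, abs_of_nonneg h0, abs_of_nonneg h1] at hn
            rw [abs_of_nonneg h1] at hpos
            rw [← e10, abs_of_nonneg h0, abs_lt]; constructor <;> linarith
          · refine ⟨1, ?_⟩
            rw [← e10, abs_of_nonneg h0, abs_of_nonpos h1] at hn
            rw [abs_of_nonpos h1] at hpos
            rw [← e10, abs_of_nonneg h0, abs_lt]; constructor <;> linarith
          · refine ⟨1, ?_⟩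
            rw [← e10, abs_of_nonpos h0, abs_of_nonneg h1] at hn
            rw [abs_of_nonneg h1] at hpos
            rw [← e10, abs_of_nonpos h0, abs_lt]; constructor <;> linarith
          · refine ⟨-1, ?_⟩
            rw [← e10, abs_of_nonpos h0, abs_of_nonpos h1] at hn
            rw [abs_of_nonpos h1] at hpos
            rw [← e10, abs_of_nonpos h0, abs_lt]; constructor <;> linarith
        have hR0 : G0 (N * Vn m) := hN0.mul (G0_Vn m)
        have e : (N * Vn m) 1 0 = N 1 0 + 3 * m * N 1 1 := by
          simp [Vn, Matrix.mul_apply]; ring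
        have hlt : ((N * Vn m) 1 0).natAbs < k := by
          rw [e, ← hk]
          rw [Int.abs_eq_natAbs, Int.abs_eq_natAbs] at hm; exact_mod_cast hm
        have hP := ih _ hlt (N * Vn m) hR0 rfl
        have hP2 := hT _ (-n) (hR0.mul (G0_Vn (-m))) (hV _ (-m) hR0 hP)
        have hVV : Vn m * Vn (-m) = 1 := by
          ext i j; fin_cases i <;> fin_cases j <;> simp [Vn, Matrix.mul_apply]
        have hTT : Tn n * Tn (-n) = 1 := by
          ext i j; fin_cases i <;> fin_cases j <;> simp [Tn, Matrix.mul_apply]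
        grind
  exact fun M hM => key _ M hM rfl

/-- The Fricke involution. -/
def Wt (τ : ℂ) : ℂ := -1 / (3 * τ)
/-- The matrix of the Fricke involution. -/
def WM : Mat := !![0, -1; 3, 0]

theorem mob_WM (τ : ℂ) : mob WM τ = Wt τ := by simp [mob, jf, WM, Wt]
theorem jf_WM (τ : ℂ) : jf WM τ = 3 * τ := by simp [jf, WM]
theorem det_WM : WM.det = 3 := by simp [WM, det_fin_two]

theorem im_Wt (τ : ℂ) : (Wt τ).im = τ.im / (3 * normSq τ) := by
  rw [← mob_WM, im_mob, det_WM, jf_WM, normSq_mul]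
  have : normSq (3:ℂ) = 9 := by norm_num [normSq_apply]
  grind

theorem im_Wt_pos (hτ : 0 < τ.im) : 0 < (Wt τ).im := by
  rw [← mob_WM]; exact im_mob_pos (by rw [det_WM]; norm_num) hτ

theorem Wt_Wt (hτ : 0 < τ.im) : Wt (Wt τ) = τ := by
  have := ne_zero_of_im hτ
  rw [Wt, Wt]; field_simp

theorem im_add_int (n : ℤ) : (τ + n).im = τ.im := by simp

/-- Invariance under the two generators gives invariance under translations. -/
theorem inv_int_of_T {α : Type*} {f : ℂ → α} (hT : ∀ τ : ℂ, 0 < τ.im → f (τ + 1) = f τ)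
    (n : ℤ) : ∀ τ : ℂ, 0 < τ.im → f (τ + n) = f τ := by
  induction n with
  | zero => intro τ _; simp
  | succ n ih =>
    intro τ hτ
    rw [← ih τ hτ, ← hT (τ + (n : ℤ)) (by simpa using hτ)]
    congr 1; push_cast; ring
  | pred n ih =>
    intro τ hτ
    rw [← ih τ hτ, ← hT (τ + (-(n:ℤ) - 1 : ℤ)) (by simpa using hτ)]
    congr 1; push_cast; ring

theorem mob_Vn_eq {n : ℤ} (hτ : 0 < τ.im) : mob (Vn n) τ = Wt (Wt τ + (-n : ℤ)) := by
  have h0 := ne_zero_of_im hτ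
  rw [mob_Vn, Wt, Wt]
  have h2 : 3 * (-1 / (3 * τ) + -(n : ℂ)) = -(3 * n * τ + 1) / τ := by field_simp; ring
  push_cast
  rw [h2]
  field_simp

/-- A function such that it and its Fricke transform are translation invariant is invariant
under `Γ₀(3)`. -/
theorem inv_G0 {α : Type*} {f : ℂ → α} (hT : ∀ τ : ℂ, 0 < τ.im → f (τ + 1) = f τ)
    (hW : ∀ τ : ℂ, 0 < τ.im → f (Wt (τ + 1)) = f (Wt τ)) {M : Mat} (hM : G0 M) :
    ∀ τ : ℂ, 0 < τ.im → f (mob M τ) = f τ := by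
  refine G0_induction (P := fun M => ∀ τ : ℂ, 0 < τ.im → f (mob M τ) = f τ) ?_ ?_ ?_ ?_ M hM
  · intro τ _; rw [mob_one]
  · intro M _ h τ hτ; rw [mob_neg, h τ hτ]
  · intro M n hM h τ hτ
    rw [mob_mul hM.det_ne (G0_Tn n).det_pos hτ, h _ (im_mob_pos (G0_Tn n).det_pos hτ), mob_Tn,
      inv_int_of_T hT n τ hτ]
  · intro M n hM h τ hτ
    rw [mob_mul hM.det_ne (G0_Vn n).det_pos hτ, h _ (im_mob_pos (G0_Vn n).det_pos hτ),
      mob_Vn_eq hτ, inv_int_of_T (f := fun τ => f (Wt τ)) hW (-n) (Wt τ) (im_Wt_pos hτ), Wt_Wt hτ]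

/-- Equivalence under `Γ₀(3)`. -/
def E0 (τ σ : ℂ) : Prop := ∃ M, G0 M ∧ mob M τ = σ
/-- Equivalence under the Fricke group. -/
def EF (τ σ : ℂ) : Prop := E0 τ σ ∨ E0 (Wt τ) σ

theorem E0.refl (τ : ℂ) : E0 τ τ := ⟨1, G0_one, mob_one τ⟩

theorem E0.im_pos (hτ : 0 < τ.im) (h : E0 τ σ) : 0 < σ.im := by
  obtain ⟨M, hM, rfl⟩ := h
  exact im_mob_pos hM.det_pos hτ

theorem E0.symm (hτ : 0 < τ.im) (h : E0 τ σ) : E0 σ τ := by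
  obtain ⟨M, hM, rfl⟩ := h
  exact ⟨_, hM.adj, by rw [← mob_mul hM.adj.det_ne hM.det_pos hτ, hM.adj_mul, mob_one]⟩

theorem E0.trans {τ σ ρ : ℂ} (hτ : 0 < τ.im) (h : E0 τ σ) (h' : E0 σ ρ) : E0 τ ρ := by
  obtain ⟨M, hM, rfl⟩ := h
  obtain ⟨N, hN, rfl⟩ := h'
  exact ⟨_, hN.mul hM, by rw [mob_mul hN.det_ne hM.det_pos hτ]⟩

theorem E0.Wt (hτ : 0 < τ.im) (h : E0 τ σ) : E0 (Wt τ) (Wt σ) := by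
  obtain ⟨M, hM, rfl⟩ := h
  obtain ⟨c, hc⟩ := hM.2
  have hdet := hM.1
  rw [det_fin_two, hc] at hdet
  have hN : G0 !![M 1 1, -c; -3 * M 0 1, M 0 0] := by
    refine ⟨?_, by simp⟩
    rw [det_fin_two]; simp; linarith
  refine ⟨_, hN, ?_⟩
  rw [← mob_WM, ← mob_WM, ← mob_mul hN.det_ne (by rw [det_WM]; norm_num) hτ,
    ← mob_mul (by rw [det_WM]; norm_num) hM.det_pos hτ]
  congr 1
  ext i j; fin_cases i <;> fin_cases j <;> simp [WM, Matrix.mul_apply, hc] <;> ring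

theorem EF.symm (hτ : 0 < τ.im) (h : EF τ σ) : EF σ τ := by
  rcases h with h | h
  · exact Or.inl (h.symm hτ)
  · right
    have := (h.symm (im_Wt_pos hτ)).Wt (h.im_pos (im_Wt_pos hτ))
    rwa [Wt_Wt hτ] at this

theorem EF.trans {τ σ ρ : ℂ} (hτ : 0 < τ.im) (h : EF τ σ) (h' : EF σ ρ) : EF τ ρ := by
  rcases h with h | h <;> rcases h' with h' | h'
  · exact Or.inl (h.trans hτ h')
  · exact Or.inr ((h.Wt hτ).trans (im_Wt_pos hτ) h')
  · exact Or.inr (h.trans (im_Wt_pos hτ) h')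
  · left
    have := (h.Wt (im_Wt_pos hτ)).trans (im_Wt_pos (im_Wt_pos hτ)) h'
    rwa [Wt_Wt hτ] at this

theorem EF_Wt (τ : ℂ) : EF τ (Wt τ) := Or.inr (E0.refl _)
theorem EF_add_int (τ : ℂ) (n : ℤ) : EF τ (τ + n) := Or.inl ⟨Tn n, G0_Tn n, mob_Tn n τ⟩

/-- Functions invariant under the two generators are invariant under the Fricke group. -/
theorem EF.inv {α : Type*} {f : ℂ → α} (hT : ∀ τ : ℂ, 0 < τ.im → f (τ + 1) = f τ)
    (hW : ∀ τ : ℂ, 0 < τ.im → f (Wt τ) = f τ) (hτ : 0 < τ.im) (h : EF τ σ) :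
    f τ = f σ := by
  have hTW : ∀ τ : ℂ, 0 < τ.im → f (SS3.Wt (τ + 1)) = f (SS3.Wt τ) := fun τ hτ => by
    simp_all
  rcases h with ⟨M, hM, rfl⟩ | ⟨M, hM, rfl⟩
  · exact (inv_G0 hT hTW hM τ hτ).symm
  · rw [inv_G0 hT hTW hM _ (im_Wt_pos hτ), hW τ hτ]

/-- Reduction to a Siegel domain. -/
theorem exists_reduced (hτ : 0 < τ.im) :
    ∃ σ, EF τ σ ∧ |σ.re| ≤ 1 / 2 ∧ 1 / 4 ≤ σ.im := by
  obtain ⟨k, hk⟩ : ∃ k : ℕ, (1 / 4 : ℝ) * (15 / 16) ^ k ≤ τ.im := by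
    obtain ⟨k, hk⟩ := exists_pow_lt_of_lt_one (mul_pos four_pos hτ) (by norm_num : (15/16 : ℝ) < 1)
    exact ⟨k, by linarith⟩
  induction k generalizing τ with
  | zero =>
    refine ⟨τ + (-round τ.re : ℤ), EF_add_int _ _, ?_, by simpa using hk⟩
    have := abs_sub_round τ.re
    simpa [sub_eq_add_neg] using this
  | succ k ih =>
    set σ := τ + (-round τ.re : ℤ) with hσ
    have hre : |σ.re| ≤ 1 / 2 := by
      have := abs_sub_round τ.re
      simpa [hσ, sub_eq_add_neg] using this
    have him : σ.im = τ.im := by simp [hσ]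
    by_cases h4 : 1 / 4 ≤ σ.im
    · exact ⟨σ, EF_add_int _ _, hre, h4⟩
    · push Not at h4
      have hσp : 0 < σ.im := by rw [him]; exact hτ
      have hn : normSq σ ≤ 5 / 16 := by
        rw [normSq_apply]
        have := abs_le.1 hre
        nlinarith
      have hn0 : 0 < normSq σ := normSq_pos.2 (ne_zero_of_im hσp)
      have hW : (1 / 4 : ℝ) * (15 / 16) ^ k ≤ (Wt σ).im := by
        rw [im_Wt, le_div_iff₀ (by positivity), him]
        rw [pow_succ] at hk
        nlinarith
      obtain ⟨ρ, h1, h2⟩ := ih (im_Wt_pos hσp) hW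
      exact ⟨ρ, ((EF_add_int τ _).trans hτ (EF_Wt σ)).trans hτ h1, h2⟩

/-- The open upper half plane. -/
def HH : Set ℂ := {τ | 0 < τ.im}

theorem mem_HH : τ ∈ HH ↔ 0 < τ.im := Iff.rfl
theorem isOpen_HH : IsOpen HH := isOpen_lt continuous_const continuous_im
theorem convex_HH : Convex ℝ HH := convex_halfSpace_im_gt 0
theorem isPreconnected_HH : IsPreconnected HH := convex_HH.isPreconnected

/-- A holomorphic function on the upper half plane invariant under the Fricke group and vanishing
at infinity is zero. -/
theorem eq_zero_of_invariant {f : ℂ → ℂ} (hd : ∀ τ, 0 < τ.im → DifferentiableAt ℂ f τ)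
    (hT : ∀ τ : ℂ, 0 < τ.im → f (τ + 1) = f τ) (hW : ∀ τ : ℂ, 0 < τ.im → f (Wt τ) = f τ)
    (h0 : Tendsto f (comap im atTop) (𝓝 0)) (hτ : 0 < τ.im) : f τ = 0 := by
  by_contra hne
  have hpos : 0 < ‖f τ‖ := norm_pos_iff.2 hne
  obtain ⟨Y, hY⟩ := eventually_im_iff.1 ((h0.norm).eventually (gt_mem_nhds (by rw [norm_zero]; exact hpos)))
  set K : Set ℂ := Set.Icc (-(1/2) : ℝ) (1/2) ×ℂ Set.Icc (1/4 : ℝ) Y with hK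
  have hKc : IsCompact K := isCompact_Icc.reProdIm isCompact_Icc
  have hred : ∀ σ : ℂ, 0 < σ.im → ‖f σ‖ < ‖f τ‖ ∨ ∃ ρ ∈ K, f σ = f ρ := by
    intro σ hσ
    obtain ⟨ρ, h1, h2, h3⟩ := exists_reduced hσ
    have e := EF.inv hT hW hσ h1
    by_cases h : Y < ρ.im
    · left; rw [e]; exact hY ρ h
    · right
      refine ⟨ρ, ?_, e⟩
      rw [hK, mem_reProdIm]
      exact ⟨abs_le.1 h2, h3, not_lt.1 h⟩
  have hKH : ∀ σ ∈ K, 0 < σ.im := fun σ hσ => by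
    rw [hK, mem_reProdIm] at hσ
    have := hσ.2.1; linarith
  obtain ⟨τ', hτ', e'⟩ := (hred τ hτ).resolve_left (lt_irrefl _)
  obtain ⟨σ, hσK, hσ⟩ := hKc.exists_isMaxOn ⟨τ', hτ'⟩
    (f := fun τ => ‖f τ‖) (fun ρ hρ => (hd ρ (hKH ρ hρ)).continuousAt.norm.continuousWithinAt)
  have hmax : IsMaxOn (norm ∘ f) HH σ := by
    intro ρ hρ
    rcases hred ρ hρ with h | ⟨ρ', h1, h2⟩
    · have := hσ hτ'
      simp only [Set.mem_ofPred_eq, Function.comp] at this ⊢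
      rw [← e'] at this
      exact h.le.trans this
    · simp only [Set.mem_ofPred_eq, Function.comp]
      rw [h2]; exact hσ h1
  have hc := eqOn_of_isPreconnected_of_isMaxOn_norm isPreconnected_HH isOpen_HH
    (fun ρ hρ => (hd ρ hρ).differentiableWithinAt) (hKH σ hσK) hmax
  have h1 : f σ ≠ 0 := by
    intro h
    have := hc (show τ ∈ HH from hτ)
    simp only [Function.const] at this
    exact hne (this.trans h)
  obtain ⟨Z, hZ⟩ := eventually_im_iff.1 ((h0.norm).eventually
    (gt_mem_nhds (by rw [norm_zero]; exact norm_pos_iff.2 h1)))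
  have hm : (I * ((max Z 0 + 1 : ℝ) : ℂ)).im = max Z 0 + 1 := by simp
  have h2 := hZ (I * ((max Z 0 + 1 : ℝ) : ℂ)) (by rw [hm]; have := le_max_left Z 0; linarith)
  have h3 := hc (show I * ((max Z 0 + 1 : ℝ) : ℂ) ∈ HH by
    rw [mem_HH, hm]; have := le_max_right Z 0; linarith)
  simp only [Function.const] at h3
  rw [h3] at h2
  exact lt_irrefl _ h2

/-- The Hauptmodul of the Fricke group. -/
def xx (τ : ℂ) : ℂ := (1 + 27 * ww τ) ^ 2 / ww τ

theorem xx_mul (hτ : 0 < τ.im) : ww τ * xx τ = (1 + 27 * ww τ) ^ 2 :=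
  mul_div_cancel₀ _ (ww_ne_zero hτ)

theorem xx_T (τ : ℂ) : xx (τ + 1) = xx τ := by rw [xx, ww_T, xx]
theorem ww_Wt (hτ : 0 < τ.im) : ww (Wt τ) = 1 / (729 * ww τ) := ww_W hτ
theorem gg_Wt (hτ : 0 < τ.im) : gg (Wt τ) = -27 * τ ^ 6 * gg τ := gg_W hτ
theorem xx_W (hτ : 0 < τ.im) : xx (Wt τ) = xx τ := by
  have := ww_ne_zero hτ
  rw [xx, ww_Wt hτ, xx]
  field_simp
  ring
theorem differentiableAt_xx (hτ : 0 < τ.im) : DifferentiableAt ℂ xx τ := by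
  unfold xx
  have := differentiableAt_ww hτ
  have := ww_ne_zero hτ
  fun_prop (disch := assumption)

theorem eventually_im_pos : ∀ᶠ τ : ℂ in comap im atTop, 0 < τ.im :=
  eventually_im_iff.2 ⟨0, fun _ h => h⟩

/-- Division by the nome. -/
theorem HasQ.div_X {f : ℂ → ℂ} {φ : PowerSeries ℂ} (h : HasQ 1 f (PowerSeries.X * φ)) :
    HasQ 1 (fun τ => f τ / qq 1 τ) φ := by
  obtain ⟨F, hF, h⟩ := h
  have hF0 : F 0 = 0 := by rw [hF.eval_zero]; simp
  have ha : AnalyticAt ℂ (dslope F 0) 0 := by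
    have := hF.analyticAt
    obtain ⟨pw, hp⟩ := this
    exact hp.has_fpower_series_dslope_fslope.analyticAt
  have h1 := PS.of_analyticAt ha
  have h2 := (PS.id.mul h1).congr (G := F) (Eventually.of_forall fun z => by
    have := sub_smul_dslope F 0 z
    simpa [hF0] using this)
  have h3 := h2.unique hF
  have h4 := mul_left_cancel₀ PowerSeries.X_ne_zero h3
  rw [h4] at h1
  refine ⟨_, h1, ?_⟩
  filter_upwards [h] with τ hτ
  rw [hτ, div_eq_iff (qq_ne_zero 1 τ)]
  have := sub_smul_dslope F 0 (qq 1 τ)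
  rw [hF0] at this
  simp at this
  rw [mul_comm]; exact this.symm

section Coeff
variable {R : Type*} [CommRing R] (ι : R →+* ℂ)

theorem map_intCast (φ : PowerSeries ℤ) :
    (φ.map (ιℤ R)).map ι = φ.map (ιℤ ℂ) := by
  ext n; simp

theorem map_invOfUnit (φ : PowerSeries R) (h : constCoeff φ = 1) :
    (invOfUnit φ 1).map ι = (φ.map ι)⁻¹ := by
  symm
  have hc : constCoeff (φ.map ι) = 1 := by
    rw [constantCoeff_map, h, map_one]
  rw [PowerSeries.inv_eq_iff_mul_eq_one]
  · rw [← map_mul, mul_comm, mul_invOfUnit _ _ (by simpa using h), map_one]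
  · rw [hc]; exact one_ne_zero

/-- Division by `w`. -/
theorem HasQ.div_ww {f : ℂ → ℂ} {φ : PowerSeries R}
    (h : HasQ 1 f ((PowerSeries.X * φ).map ι)) :
    HasQ 1 (fun τ => f τ / ww τ)
      ((φ * (invOfUnit wu 1).map (ιℤ R)).map ι) := by
  rw [map_mul, PowerSeries.map_X] at h
  have hw := hasQ_ww
  rw [wser, map_mul, PowerSeries.map_X] at hw
  have hc : constCoeff (wu.map (ιℤ ℂ)) = 1 := by
    rw [constantCoeff_map, constantCoeff_wu, map_one]
  have := h.div_X.mul (hw.div_X.inv (by rw [hc]; exact one_ne_zero))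
  rw [map_mul, map_intCast, map_invOfUnit _ _ constantCoeff_wu]
  refine this.congr (Eventually.of_forall fun τ => ?_)
  have := qq_ne_zero 1 τ
  show f τ / qq 1 τ * (ww τ / qq 1 τ)⁻¹ = _
  rw [inv_div, div_mul_div_cancel₀ this]

/-- A holomorphic function invariant under the Fricke group with a pole of order at most `n` at
infinity is a polynomial in the Hauptmodul, with coefficients in any ring of definition. -/
theorem exists_poly (n : ℕ) : ∀ {f : ℂ → ℂ} {φ : PowerSeries R},
    (∀ τ, 0 < τ.im → DifferentiableAt ℂ f τ) →
    (∀ τ : ℂ, 0 < τ.im → f (τ + 1) = f τ) → (∀ τ : ℂ, 0 < τ.im → f (Wt τ) = f τ) →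
    HasQ 1 (fun τ => ww τ ^ n * f τ) (φ.map ι) →
    ∃ P : R[X], P.natDegree ≤ n ∧ P.coeff n = constCoeff φ ∧
      ∀ τ : ℂ, 0 < τ.im → f τ = P.eval₂ ι (xx τ) := by
  induction n with
  | zero =>
    intro f φ hd hT hW h
    refine ⟨C (constCoeff φ), by simp, by simp, fun τ hτ => ?_⟩
    rw [eval₂_C, ← sub_eq_zero]
    refine eq_zero_of_invariant (f := fun τ => f τ - ι (constCoeff φ))
      (fun τ hτ => (hd τ hτ).sub_const _)
      (fun τ hτ => by simp only [hT τ hτ]) (fun τ hτ => by simp only [hW τ hτ]) ?_ hτ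
    have := h.tendsto one_ne_zero
    simp only [pow_zero, one_mul] at this
    have e : constCoeff (φ.map ι) = ι (constCoeff φ) := by
      rw [constantCoeff_map]
    rw [e] at this
    simpa using this.sub_const (ι (constCoeff φ))
  | succ n ih =>
    intro f φ hd hT hW h
    set c := constCoeff φ with hc
    set χ : PowerSeries R := φ - PowerSeries.C c *
      (1 + PowerSeries.C 27 * wser.map (ιℤ R)) ^ (2 * (n + 1)) with hχ
    have hχ0 : PowerSeries.X ∣ χ := by
      rw [PowerSeries.X_dvd_iff, hχ]
      simp [wser, hc]
    obtain ⟨χ', hχ'⟩ := hχ0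
    have h1 : HasQ 1 (fun τ => ww τ ^ (n + 1) * (f τ - ι c * xx τ ^ (n + 1))) (χ.map ι) := by
      have h2 := h.sub (((HasQ.one.add (hasQ_ww.const_mul 27)).pow (2 * (n + 1))).const_mul (ι c))
      have e : χ.map ι = φ.map ι - PowerSeries.C (ι c) *
          (1 + PowerSeries.C 27 * wser.map (ιℤ ℂ)) ^ (2 * (n + 1)) := by
        rw [hχ]
        simp only [map_sub, map_mul, map_pow, map_add, map_one, map_intCast, PowerSeries.map_C,
          map_ofNat]
      rw [e]
      refine h2.congr ?_
      filter_upwards [eventually_im_pos] with τ hτ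
      rw [mul_sub, mul_left_comm, ← mul_pow, xx_mul hτ, ← pow_mul]
    rw [hχ'] at h1
    have h3 := h1.div_ww
    obtain ⟨P, hP1, -, hP2⟩ := ih (f := fun τ => f τ - ι c * xx τ ^ (n + 1))
      (fun τ hτ => (hd τ hτ).sub (((differentiableAt_xx hτ).pow _).const_mul _))
      (fun τ hτ => by simp only [hT τ hτ, xx_T])
      (fun τ hτ => by simp only [hW τ hτ, xx_W hτ]) (h3.congr (by
        filter_upwards [eventually_im_pos] with τ hτ
        have := ww_ne_zero hτ
        rw [pow_succ]
        field_simp))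
    refine ⟨P + C c * X ^ (n + 1), ?_, ?_, fun τ hτ => ?_⟩
    · refine (natDegree_add_le _ _).trans (max_le (hP1.trans n.le_succ) ?_)
      exact natDegree_C_mul_X_pow_le _ _
    · rw [coeff_add, coeff_C_mul, coeff_X_pow_self, mul_one,
        coeff_eq_zero_of_natDegree_lt (Nat.lt_succ_of_le hP1), zero_add]
    · have := hP2 τ hτ
      simp only [eval₂_add, eval₂_mul, eval₂_C, eval₂_pow, eval₂_X]
      rw [← this]; ring
end Coeff

theorem two_pi_I_ne : (2 * Real.pi * I : ℂ) ≠ 0 := two_pi_I_ne_zero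

/-- The normalized derivation. -/
def td (f : ℂ → ℂ) (τ : ℂ) : ℂ := deriv f τ / (2 * Real.pi * I)

/-- Logarithmic derivative of `w`. -/
def aa (τ : ℂ) : ℂ := td ww τ / ww τ
/-- Logarithmic derivative of `g`. -/
def sg (τ : ℂ) : ℂ := td gg τ / gg τ

theorem differentiableAt_td {f : ℂ → ℂ} (hf : ∀ τ, 0 < τ.im → DifferentiableAt ℂ f τ)
    (hτ : 0 < τ.im) : DifferentiableAt ℂ (td f) τ := by
  have h : DifferentiableOn ℂ f HH := fun σ hσ => (hf σ hσ).differentiableWithinAt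
  exact ((h.deriv isOpen_HH).differentiableAt (isOpen_HH.mem_nhds hτ)).div_const _

theorem differentiableAt_aa (hτ : 0 < τ.im) : DifferentiableAt ℂ aa τ :=
  (differentiableAt_td (fun _ => differentiableAt_ww) hτ).div (differentiableAt_ww hτ)
    (ww_ne_zero hτ)
theorem differentiableAt_sg (hτ : 0 < τ.im) : DifferentiableAt ℂ sg τ :=
  (differentiableAt_td (fun _ => differentiableAt_gg) hτ).div (differentiableAt_gg hτ)
    (gg_ne_zero hτ)

theorem td_T {f : ℂ → ℂ} (hf : ∀ τ, f (τ + 1) = f τ) (τ : ℂ) : td f (τ + 1) = td f τ := by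
  have : (fun τ => f (τ + 1)) = f := funext hf
  rw [td, td, ← deriv_comp_add_const, this]

theorem aa_T (τ : ℂ) : aa (τ + 1) = aa τ := by rw [aa, td_T ww_T, ww_T, aa]
theorem sg_T (τ : ℂ) : sg (τ + 1) = sg τ := by rw [sg, td_T gg_T, gg_T, sg]

theorem hasDerivAt_Wt (hτ : 0 < τ.im) : HasDerivAt Wt (1 / (3 * τ ^ 2)) τ := by
  have h := hasDerivAt_mob (M := WM) (by rw [det_WM]; norm_num) hτ
  rw [show mob WM = Wt from funext mob_WM, det_WM, jf_WM] at h
  grind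

theorem eventually_HH (hτ : 0 < τ.im) : ∀ᶠ σ in 𝓝 τ, 0 < σ.im :=
  isOpen_HH.mem_nhds hτ

theorem td_comp_Wt {f F : ℂ → ℂ} (hτ : 0 < τ.im) (hf : DifferentiableAt ℂ f (Wt τ))
    (h : ∀ σ : ℂ, 0 < σ.im → f (Wt σ) = F σ) : td f (Wt τ) = 3 * τ ^ 2 * td F τ := by
  have h1 := (hf.hasDerivAt.comp τ (hasDerivAt_Wt hτ))
  have h2 : F =ᶠ[𝓝 τ] f ∘ Wt := by
    filter_upwards [eventually_HH hτ] with σ hσ using (h σ hσ).symm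
  rw [td, td, h2.deriv_eq, h1.deriv]
  have := ne_zero_of_im hτ
  field_simp

theorem td_eq {f : ℂ → ℂ} {f' τ : ℂ} (h : HasDerivAt f f' τ) : td f τ = f' / (2 * Real.pi * I) := by
  rw [td, h.deriv]

theorem hasDerivAt_td {f : ℂ → ℂ} (h : DifferentiableAt ℂ f τ) :
    HasDerivAt f (2 * Real.pi * I * td f τ) τ := by
  have := two_pi_I_ne
  rw [td, mul_div_cancel₀ _ this]; exact h.hasDerivAt

theorem td_ww (hτ : 0 < τ.im) : td ww τ = aa τ * ww τ :=
  (div_mul_cancel₀ _ (ww_ne_zero hτ)).symm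
theorem td_gg (hτ : 0 < τ.im) : td gg τ = sg τ * gg τ :=
  (div_mul_cancel₀ _ (gg_ne_zero hτ)).symm

theorem aa_W (hτ : 0 < τ.im) : aa (Wt τ) = -3 * τ ^ 2 * aa τ := by
  have hw := ww_ne_zero hτ
  have hd := (((hasDerivAt_td (differentiableAt_ww hτ)).const_mul 729).fun_inv (by simpa using hw))
  have h := td_comp_Wt hτ (differentiableAt_ww (im_Wt_pos hτ)) (F := fun τ => (729 * ww τ)⁻¹)
    fun σ hσ => by rw [ww_Wt hσ, one_div]
  rw [td_eq hd, td_ww (im_Wt_pos hτ), ww_Wt hτ, td_ww hτ] at h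
  field_simp at h
  linear_combination h

theorem sg_W (hτ : 0 < τ.im) :
    sg (Wt τ) = 3 * τ ^ 2 * sg τ + 18 * τ / (2 * Real.pi * I) := by
  have hw := gg_ne_zero hτ
  have h0 := ne_zero_of_im hτ
  have hd := ((((hasDerivAt_pow 6 τ).const_mul (-27)).mul
    (hasDerivAt_td (differentiableAt_gg hτ))))
  have h := td_comp_Wt hτ (differentiableAt_gg (im_Wt_pos hτ))
    (F := (fun τ => -27 * τ ^ 6) * gg) fun σ hσ => gg_Wt hσ
  rw [td_eq hd, td_gg (im_Wt_pos hτ), gg_Wt hτ, td_gg hτ] at h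
  grind [two_pi_I_ne_zero]

theorem td_sg_W (hτ : 0 < τ.im) :
    td sg (Wt τ) = 9 * τ ^ 4 * td sg τ + 18 * τ ^ 3 * sg τ / (2 * Real.pi * I)
      + 54 * τ ^ 2 / (2 * Real.pi * I) ^ 2 := by
  have hd := ((((hasDerivAt_pow 2 τ).const_mul 3).mul
    (hasDerivAt_td (differentiableAt_sg hτ)))).add
      (((hasDerivAt_id τ).const_mul 18).div_const (2 * Real.pi * I))
  have h := td_comp_Wt hτ (differentiableAt_sg (im_Wt_pos hτ))
    (F := (fun τ => 3 * τ ^ 2) * sg + fun τ => 18 * id τ / (2 * Real.pi * I)) fun σ hσ => sg_W hσ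
  rw [td_eq hd] at h
  rw [h]
  push_cast
  field_simp
  ring

/-- The expansion of `a`. -/
def aser : PowerSeries ℤ :=
  (wu + PowerSeries.X * PowerSeries.derivative ℤ wu) * invOfUnit wu 1
/-- The expansion of `s`. -/
def sser : PowerSeries ℤ :=
  (gu + PowerSeries.X * PowerSeries.derivative ℤ gu) * invOfUnit gu 1

theorem map_derivative {R S : Type*} [CommRing R] [CommRing S] (f : R →+* S) (φ : PowerSeries R) :
    (PowerSeries.derivative R φ).map f = PowerSeries.derivative S (φ.map f) := by
  ext n; simp [PowerSeries.coeff_derivative]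

/-- Division by a function with a simple zero at infinity. -/
theorem HasQ.div_unit {f v : ℂ → ℂ} {φ : PowerSeries ℂ} {υ : PowerSeries ℤ}
    (hυ : constCoeff υ = 1)
    (hv : HasQ 1 v ((PowerSeries.X * υ).map (ιℤ ℂ)))
    (h : HasQ 1 f (PowerSeries.X * φ)) :
    HasQ 1 (fun τ => f τ / v τ)
      (φ * (invOfUnit υ 1).map (ιℤ ℂ)) := by
  rw [map_mul, PowerSeries.map_X] at hv
  have hc : constCoeff (υ.map (ιℤ ℂ)) = 1 := by
    rw [constantCoeff_map, hυ, map_one]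
  have := h.div_X.mul (hv.div_X.inv (by rw [hc]; exact one_ne_zero))
  rw [map_invOfUnit _ _ hυ]
  refine this.congr (Eventually.of_forall fun τ => ?_)
  have := qq_ne_zero 1 τ
  grind

theorem X_mul_derivative_X_mul {R : Type*} [CommRing R] (φ : PowerSeries R) :
    PowerSeries.X * PowerSeries.derivative R (PowerSeries.X * φ) =
      PowerSeries.X * (φ + PowerSeries.X * PowerSeries.derivative R φ) := by
  rw [Derivation.leibniz, PowerSeries.derivative_X]
  simp only [smul_eq_mul]; ring

theorem hasQ_aa : HasQ 1 aa (aser.map (ιℤ ℂ)) := by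
  have h := hasQ_ww.theta
  rw [wser, map_mul, PowerSeries.map_X, X_mul_derivative_X_mul] at h
  have := HasQ.div_unit constantCoeff_wu hasQ_ww h
  simp only [aser, map_mul, map_add, PowerSeries.map_X, map_derivative]
  exact this

theorem hasQ_sg : HasQ 1 sg (sser.map (ιℤ ℂ)) := by
  have h := hasQ_gg.theta
  rw [gser, map_mul, PowerSeries.map_X, X_mul_derivative_X_mul] at h
  have := HasQ.div_unit constantCoeff_gu hasQ_gg h
  simp only [sser, map_mul, map_add, PowerSeries.map_X, map_derivative]
  exact this

theorem constantCoeff_invOfUnit_one (φ : PowerSeries ℤ) :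
    constCoeff (invOfUnit φ 1) = 1 := by simp

theorem coeff_one_invOfUnit {φ : PowerSeries ℤ} (h : constCoeff φ = 1) :
    PowerSeries.coeff 1 (invOfUnit φ 1) = -PowerSeries.coeff 1 φ := by
  have h1 := congrArg (PowerSeries.coeff 1) (mul_invOfUnit φ 1 (by simpa using h))
  rw [coeff_one_mul, h, constantCoeff_invOfUnit_one, PowerSeries.coeff_one] at h1
  simp at h1
  linarith

theorem coeff_one_X_mul (φ : PowerSeries ℤ) :
    PowerSeries.coeff 1 (PowerSeries.X * φ) = constCoeff φ := by
  rw [coeff_one_mul]; simp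

theorem constantCoeff_derivative (φ : PowerSeries ℤ) :
    constCoeff (PowerSeries.derivative ℤ φ) = PowerSeries.coeff 1 φ := by
  rw [← coeff_zero_eq_constantCoeff_apply]
  simp [PowerSeries.coeff_derivative]

theorem constantCoeff_aser : constCoeff aser = 1 := by
  simp [aser, constantCoeff_wu]
theorem coeff_one_aser : PowerSeries.coeff 1 aser = 12 := by
  rw [aser, coeff_one_mul, coeff_one_invOfUnit constantCoeff_wu, map_add, map_add,
    coeff_one_X_mul, constantCoeff_derivative, coeff_one_wu, constantCoeff_invOfUnit_one]
  simp [constantCoeff_wu]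
theorem constantCoeff_sser : constCoeff sser = 1 := by
  simp [sser, constantCoeff_gu]

/-- The cubic relation between `a`, `g` and the Hauptmodul. -/
theorem aa_pow_three (hτ : 0 < τ.im) : aa τ ^ 3 = gg τ * xx τ := by
  have key : ∀ τ : ℂ, 0 < τ.im → aa τ ^ 3 / gg τ - xx τ = 0 := by
    intro τ hτ
    refine eq_zero_of_invariant (f := fun τ => aa τ ^ 3 / gg τ - xx τ) (fun τ hτ =>
      ((((differentiableAt_aa hτ).pow 3).div (differentiableAt_gg hτ) (gg_ne_zero hτ)).sub
      (differentiableAt_xx hτ))) (fun τ _ => by simp only [aa_T, gg_T, xx_T]) (fun τ hτ => ?_) ?_ hτ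
    · have := gg_ne_zero hτ
      have := ne_zero_of_im hτ
      simp only [aa_W hτ, gg_Wt hτ, xx_W hτ]
      field_simp
      ring
    · set ψ : PowerSeries ℤ := aser ^ 3 * wu * invOfUnit gu 1 -
        (1 + 27 * (PowerSeries.X * wu)) ^ 2 with hψ
      have h1 : PowerSeries.X ^ 2 ∣ ψ := by
        rw [PowerSeries.X_pow_dvd_iff]
        intro m hm
        have hs : ψ = aser * (aser * aser) * wu * invOfUnit gu 1 - (1 +
          PowerSeries.X * (54 * wu + PowerSeries.X * (729 * wu ^ 2))) := by rw [hψ]; ring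
        interval_cases m
        · rw [coeff_zero_eq_constantCoeff_apply, hs]
          simp [constantCoeff_aser, constantCoeff_wu]
        · rw [hs, map_sub, map_add, coeff_one_X_mul]
          simp only [coeff_one_mul, coeff_one_aser, map_mul, map_add, coeff_one_wu,
            constantCoeff_aser, constantCoeff_wu, constantCoeff_invOfUnit_one,
            coeff_one_invOfUnit constantCoeff_gu, coeff_one_gu, PowerSeries.coeff_one]
          simp [map_ofNat]
      obtain ⟨χ, hχ⟩ := h1
      have h2 : HasQ 1 (fun τ => ww τ * (aa τ ^ 3 / gg τ - xx τ))
          ((PowerSeries.X * (PowerSeries.X * χ)).map (ιℤ ℂ)) := by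
        rw [← mul_assoc, ← pow_two, ← hχ]
        have e1 : HasQ 1 (fun τ => aa τ ^ 3 * ww τ / gg τ)
            ((aser ^ 3 * wu).map (ιℤ ℂ) *
              (invOfUnit gu 1).map (ιℤ ℂ)) := by
          refine HasQ.div_unit (φ := (aser ^ 3 * wu).map (ιℤ ℂ)) constantCoeff_gu
            hasQ_gg ?_
          have := (hasQ_aa.pow 3).mul hasQ_ww
          rw [wser, map_mul, PowerSeries.map_X, mul_left_comm] at this
          rw [map_mul, map_pow]
          exact this
        have e2 := e1.sub ((HasQ.one.add (hasQ_ww.const_mul 27)).pow 2)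
        have e3 : ψ.map (ιℤ ℂ) = (aser ^ 3 * wu).map (ιℤ ℂ) *
          (invOfUnit gu 1).map (ιℤ ℂ) -
            (1 + PowerSeries.C 27 * wser.map (ιℤ ℂ)) ^ 2 := by
          rw [hψ, wser]; simp [map_ofNat]
        rw [e3]
        refine e2.congr ?_
        filter_upwards [eventually_im_pos] with τ hτ
        rw [mul_sub, xx_mul hτ]
        ring
      have h3 := (h2.div_ww (ιℤ ℂ)).tendsto one_ne_zero
      rw [constantCoeff_map] at h3
      simp only [map_mul, constantCoeff_X, zero_mul, map_zero] at h3
      refine h3.congr' ?_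
      filter_upwards [eventually_im_pos] with τ hτ
      exact mul_div_cancel_left₀ _ (ww_ne_zero hτ)
  have := key τ hτ
  have h2 := gg_ne_zero hτ
  grind

/-- The Riccati equation for `s`. -/
theorem td_sg (hτ : 0 < τ.im) : td sg τ = (sg τ ^ 2 - aa τ ^ 2) / 6 := by
  set b : ℂ → ℂ := fun τ => td sg τ - sg τ ^ 2 / 6 + aa τ ^ 2 / 6 with hb
  have hbd : ∀ τ : ℂ, 0 < τ.im → DifferentiableAt ℂ b τ := fun τ hτ =>
    ((differentiableAt_td (fun _ => differentiableAt_sg) hτ).sub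
      (((differentiableAt_sg hτ).pow 2).div_const 6)).add
      (((differentiableAt_aa hτ).pow 2).div_const 6)
  have hbW : ∀ τ : ℂ, 0 < τ.im → b (Wt τ) = 9 * τ ^ 4 * b τ := by
    intro τ hτ
    simp only [hb, td_sg_W hτ, sg_W hτ, aa_W hτ]
    field_simp
    ring
  have hbT : ∀ τ : ℂ, b (τ + 1) = b τ := fun τ => by
    simp only [hb, td_T sg_T, sg_T, aa_T]
  have key : b τ ^ 3 / gg τ ^ 2 = 0 := by
    refine eq_zero_of_invariant (f := fun τ => b τ ^ 3 / gg τ ^ 2) (fun τ hτ =>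
      (((hbd τ hτ).pow 3).div ((differentiableAt_gg hτ).pow 2) (pow_ne_zero _ (gg_ne_zero hτ))))
      (fun τ _ => by simp only [hbT, gg_T]) (fun τ hτ => ?_) ?_ hτ
    · have := gg_ne_zero hτ
      have := ne_zero_of_im hτ
      simp only [hbW τ hτ, gg_Wt hτ]
      field_simp
      ring
    · have h1 := (hasQ_sg.theta.sub ((hasQ_sg.pow 2).const_mul (1 / 6))).add
        ((hasQ_aa.pow 2).const_mul (1 / 6))
      have hX : ∃ χ, _ = PowerSeries.X * χ := PowerSeries.X_dvd_iff (φ := (PowerSeries.X *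
        PowerSeries.derivative ℂ (sser.map (ιℤ ℂ)) -
          PowerSeries.C (1 / 6) * sser.map (ιℤ ℂ) ^ 2 +
          PowerSeries.C (1 / 6) * aser.map (ιℤ ℂ) ^ 2)).2 (by
        have e1 : constCoeff (sser.map (ιℤ ℂ)) = 1 := by
          rw [constantCoeff_map, constantCoeff_sser, map_one]
        have e2 : constCoeff (aser.map (ιℤ ℂ)) = 1 := by
          rw [constantCoeff_map, constantCoeff_aser, map_one]
        simp [e1, e2])
      obtain ⟨χ, hχ⟩ := hX
      rw [hχ] at h1
      have h2 := HasQ.div_unit constantCoeff_gu hasQ_gg h1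
      have h3 := ((h2.pow 2).mul h1).tendsto one_ne_zero
      simp only [map_mul, constantCoeff_X, zero_mul, mul_zero] at h3
      refine h3.congr' ?_
      filter_upwards [eventually_im_pos] with τ hτ
      have := gg_ne_zero hτ
      simp only [hb, td]
      field_simp
  have h2 := gg_ne_zero hτ
  grind

theorem td_xx (hτ : 0 < τ.im) :
    ww τ * td xx τ = aa τ * ((27 * ww τ + 1) * (27 * ww τ - 1)) := by
  have hw := ww_ne_zero hτ
  have h1 := hasDerivAt_td (differentiableAt_ww hτ)
  have h2 := (((h1.const_mul 27).const_add 1).fun_pow 2).fun_div h1 hw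
  have h3 : td xx τ = _ := td_eq h2
  rw [h3, td_ww hτ]
  push_cast
  field_simp
  ring

theorem X_mul_derivative_wser : PowerSeries.X * PowerSeries.derivative ℤ wser = aser * wser := by
  rw [wser, X_mul_derivative_X_mul, aser, mul_assoc, mul_left_comm _ PowerSeries.X wu,
    mul_comm _ wu, mul_invOfUnit _ _ (by simp [constantCoeff_wu])]
  ring
theorem X_mul_derivative_gser : PowerSeries.X * PowerSeries.derivative ℤ gser = sser * gser := by
  rw [gser, X_mul_derivative_X_mul, sser, mul_assoc, mul_left_comm _ PowerSeries.X gu,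
    mul_comm _ gu, mul_invOfUnit _ _ (by simp [constantCoeff_gu])]
  ring

theorem map_intCast_injective :
    Function.Injective (PowerSeries.map (ιℤ ℂ)) :=
  PowerSeries.map_injective _ Int.cast_injective

theorem aser_pow_three : wser * aser ^ 3 = gser * (1 + 27 * wser) ^ 2 := by
  apply map_intCast_injective
  have h1 := hasQ_ww.mul (hasQ_aa.pow 3)
  have h2 := hasQ_gg.mul ((HasQ.one.add (hasQ_ww.const_mul 27)).pow 2)
  have := h1.unique one_ne_zero (h2.congr (by
    filter_upwards [eventually_im_pos] with τ hτ
    rw [aa_pow_three hτ, mul_left_comm, xx_mul hτ]))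
  simpa [map_ofNat] using this

theorem derivative_sser : 6 * (PowerSeries.X * PowerSeries.derivative ℤ sser) =
    sser ^ 2 - aser ^ 2 := by
  apply map_intCast_injective
  have h1 := hasQ_sg.theta.const_mul 6
  have h2 := (hasQ_sg.pow 2).sub (hasQ_aa.pow 2)
  have := h1.unique one_ne_zero (h2.congr (by
    filter_upwards [eventually_im_pos] with τ hτ
    have := td_sg hτ
    rw [td] at this
    rw [this]; ring))
  simpa [map_ofNat, map_derivative] using this

theorem abs_mul_im_le (c d : ℤ) (τ : ℂ) : |(c : ℝ)| * |τ.im| ≤ ‖(c * τ + d : ℂ)‖ := by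
  have h := abs_im_le_norm (c * τ + d : ℂ)
  simpa [abs_mul] using h

theorem bound_pair {c d : ℤ} {y R B : ℝ} (hy : 0 < y) (hτ : y ≤ τ.im) (hR : ‖τ‖ ≤ R)
    (hB : ‖(c * τ + d : ℂ)‖ ≤ B) : |(c : ℝ)| ≤ B / y ∧ |(d : ℝ)| ≤ B + B / y * R := by
  have h1 : |(c : ℝ)| ≤ B / y := by
    rw [le_div_iff₀ hy]
    have := abs_mul_im_le c d τ
    rw [abs_of_pos (hy.trans_le hτ)] at this
    exact (mul_le_mul_of_nonneg_left hτ (abs_nonneg _)).trans (this.trans hB)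
  refine ⟨h1, ?_⟩
  have e : (d : ℂ) = (c * τ + d) - c * τ := by ring
  have : ‖(d : ℂ)‖ ≤ ‖(c * τ + d : ℂ)‖ + ‖(c : ℂ)‖ * ‖τ‖ := by
    conv_lhs => rw [e]
    exact (norm_sub_le _ _).trans (by rw [norm_mul])
  rw [norm_intCast, norm_intCast] at this
  have h2 : |(c : ℝ)| * ‖τ‖ ≤ B / y * R :=
    mul_le_mul h1 hR (norm_nonneg _) ((abs_nonneg _).trans h1)
  linarith

theorem finite_bounded (B : ℝ) : {M : Mat | ∀ i j, |(M i j : ℝ)| ≤ B}.Finite := by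
  have h1 : {n : ℤ | |(n : ℝ)| ≤ B}.Finite := by
    refine (Set.finite_Icc (-⌊B⌋) ⌊B⌋).subset fun n hn => ?_
    have hn' : |(n : ℝ)| ≤ B := hn
    have := abs_le.1 hn'
    constructor
    · rw [neg_le, Int.le_floor]; push_cast; linarith
    · rw [Int.le_floor]; exact this.2
  have := Set.Finite.pi' (fun _ : Fin 2 => Set.Finite.pi' (fun _ : Fin 2 => h1))
  exact this

/-- The action of `Γ₀(3)` is properly discontinuous. -/
theorem eventually_not_E0 {τ₁ τ₂ : ℂ} (h1 : 0 < τ₁.im) (h2 : 0 < τ₂.im) (h : ¬ E0 τ₁ τ₂) :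
    ∀ᶠ s in 𝓝 τ₁ ×ˢ 𝓝 τ₂, ¬ E0 s.1 s.2 := by
  set y := min (τ₁.im / 2) (τ₂.im / 2)
  have hy0 : 0 < y := lt_min (by linarith) (by linarith)
  set R := max (‖τ₁‖ + 1) (‖τ₂‖ + 1)
  have hR0 : 0 ≤ R := le_max_of_le_left (by positivity)
  have n1 : ∀ᶠ s in 𝓝 τ₁, y ≤ s.im ∧ ‖s‖ ≤ R := by
    refine ((continuous_im.tendsto τ₁).eventually (le_mem_nhds ?_)).and
      ((continuous_norm.tendsto τ₁).eventually (ge_mem_nhds ?_))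
    · exact (min_le_left _ _).trans_lt (by linarith)
    grind
  have n2 : ∀ᶠ s in 𝓝 τ₂, y ≤ s.im ∧ ‖s‖ ≤ R := by
    refine ((continuous_im.tendsto τ₂).eventually (le_mem_nhds ?_)).and
      ((continuous_norm.tendsto τ₂).eventually (ge_mem_nhds ?_))
    · exact (min_le_right _ _).trans_lt (by linarith)
    grind
  set B := 1 + R / y
  set B' := R * B
  set C := B / y + (B + B / y * R) + (B' / y + (B' + B' / y * R)) with hC
  have hf := finite_bounded C
  have n3 : ∀ᶠ s in 𝓝 τ₁ ×ˢ 𝓝 τ₂, ∀ M ∈ {M : Mat | ∀ i j, |(M i j : ℝ)| ≤ C},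
      G0 M → mob M s.1 ≠ s.2 := by
    rw [Set.Finite.eventually_all hf]
    intro M _
    by_cases hM : G0 M
    · have hc : Tendsto (fun s : ℂ × ℂ => (mob M s.1, s.2)) (𝓝 τ₁ ×ˢ 𝓝 τ₂)
          (𝓝 (mob M τ₁) ×ˢ 𝓝 τ₂) :=
        ((continuousAt_mob hM.det_ne h1).tendsto.comp tendsto_fst).prodMk tendsto_snd
      have hne : mob M τ₁ ≠ τ₂ := fun e => h ⟨M, hM, e⟩
      have hne' : ∀ᶠ y : ℂ × ℂ in 𝓝 (mob M τ₁, τ₂), y.1 ≠ y.2 :=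
        (isOpen_ne_fun continuous_fst continuous_snd).mem_nhds
          (show (mob M τ₁, τ₂) ∈ {y : ℂ × ℂ | y.1 ≠ y.2} from hne)
      rw [nhds_prod_eq] at hne'
      have := hc.eventually hne'
      filter_upwards [this] with s hs _ using hs
    · exact Eventually.of_forall fun s hM' => absurd hM' hM
  filter_upwards [n3, n1.prod_mk n2] with s hs ⟨⟨a1, a2⟩, b1, b2⟩
  rintro ⟨M, hM, e⟩
  have p1 : 0 < s.1.im := hy0.trans_le a1
  refine hs M ?_ hM e
  have hj : ‖jf M s.1‖ ≤ B := by
    have h3 := im_mob (M := M) s.1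
    rw [e, hM.1] at h3
    have hpos := normSq_pos.2 (jf_ne_zero hM.det_ne p1)
    rw [eq_div_iff hpos.ne', normSq_eq_norm_sq] at h3
    have h4 : s.1.im ≤ R := (le_abs_self _).trans ((abs_im_le_norm _).trans a2)
    push_cast at h3
    have h5 : ‖jf M s.1‖ ^ 2 ≤ R / y := by
      rw [le_div_iff₀ hy0]
      nlinarith [sq_nonneg ‖jf M s.1‖]
    nlinarith [norm_nonneg (jf M s.1), sq_nonneg (‖jf M s.1‖ - 1)]
  have hn : ‖(M 0 0 * s.1 + M 0 1 : ℂ)‖ ≤ B' := by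
    rw [← mob_mul_jf hM.det_ne p1, norm_mul, e]
    exact mul_le_mul b2 hj (norm_nonneg _) hR0
  obtain ⟨c1, c2⟩ := bound_pair hy0 a1 a2 hj
  obtain ⟨c3, c4⟩ := bound_pair hy0 a1 a2 hn
  have k1 := (abs_nonneg _).trans c1
  have k2 := (abs_nonneg _).trans c2
  have k3 := (abs_nonneg _).trans c3
  have k4 := (abs_nonneg _).trans c4
  simp only [Fin.forall_fin_two, hC]
  refine ⟨⟨?_, ?_⟩, ?_, ?_⟩ <;> linarith

theorem eventually_not_EF {τ₁ τ₂ : ℂ} (h1 : 0 < τ₁.im) (h2 : 0 < τ₂.im) (h : ¬ EF τ₁ τ₂) :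
    ∀ᶠ s in 𝓝 τ₁ ×ˢ 𝓝 τ₂, ¬ EF s.1 s.2 := by
  rw [EF, not_or] at h
  have e1 := eventually_not_E0 h1 h2 h.1
  have e2 := eventually_not_E0 (im_Wt_pos h1) h2 h.2
  have hc : Tendsto (fun s : ℂ × ℂ => (Wt s.1, s.2)) (𝓝 τ₁ ×ˢ 𝓝 τ₂) (𝓝 (Wt τ₁) ×ˢ 𝓝 τ₂) :=
    ((hasDerivAt_Wt h1).continuousAt.tendsto.comp tendsto_fst).prodMk tendsto_snd
  filter_upwards [e1, hc.eventually e2] with s h3 h4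
  rw [EF, not_or]
  exact ⟨h3, h4⟩

theorem EF.xx_eq (hτ : 0 < τ.im) (h : EF τ σ) : xx τ = xx σ :=
  EF.inv (fun τ _ => xx_T τ) (fun _ => xx_W) hτ h

theorem E0.ww_eq (hτ : 0 < τ.im) (h : E0 τ σ) : ww τ = ww σ := by
  obtain ⟨M, hM, rfl⟩ := h
  refine (inv_G0 (fun τ _ => ww_T τ) (fun τ hτ => ?_) hM τ hτ).symm
  rw [ww_Wt hτ, ww_Wt (by simpa using hτ), ww_T]

/-- The Siegel domain. -/
def SD : Set ℂ := {τ | |τ.re| ≤ 1 / 2 ∧ 1 / 4 ≤ τ.im}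
theorem SD.im_pos (h : τ ∈ SD) : 0 < τ.im := lt_of_lt_of_le (by norm_num) h.2

/-- Truncated Siegel domain. -/
def SK (Y : ℝ) : Set ℂ := Set.Icc (-(1/2) : ℝ) (1/2) ×ℂ Set.Icc (1/4 : ℝ) Y
theorem isCompact_SK (Y : ℝ) : IsCompact (SK Y) := isCompact_Icc.reProdIm isCompact_Icc
theorem mem_SK {Y : ℝ} : τ ∈ SK Y ↔ τ ∈ SD ∧ τ.im ≤ Y := by
  rw [SK, mem_reProdIm, SD, Set.mem_ofPred_eq, abs_le, Set.mem_Icc, Set.mem_Icc]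
  tauto

theorem tendsto_ww : Tendsto ww (comap im atTop) (𝓝 0) := by
  have := hasQ_ww.tendsto one_ne_zero
  rw [constantCoeff_map] at this
  simpa [wser] using this

theorem exists_bound_xx (R : ℝ) : ∃ Y, ∀ τ : ℂ, 0 < τ.im → ‖xx τ‖ ≤ R → τ.im ≤ Y := by
  have h : Tendsto (fun τ => ww τ / (1 + 27 * ww τ) ^ 2) (comap im atTop) (𝓝 0) := by
    have := tendsto_ww.div (((tendsto_ww.const_mul 27).const_add 1).pow 2) (by simp)
    simp only [zero_div] at this
    exact this
  have hR : 0 < 1 / (|R| + 1) := by positivity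
  have h2 := h.norm.eventually (gt_mem_nhds (by rw [norm_zero]; exact hR))
  have h3 := (tendsto_ww.const_mul 27).const_add 1
  rw [mul_zero, add_zero] at h3
  obtain ⟨Y, hY⟩ := eventually_im_iff.1 (h2.and (h3.eventually_ne one_ne_zero))
  refine ⟨Y, fun τ hτ hx => ?_⟩
  by_contra hlt
  obtain ⟨h1, h4⟩ := hY τ (not_le.1 hlt)
  have hw := ww_ne_zero hτ
  have e : ww τ / (1 + 27 * ww τ) ^ 2 = (xx τ)⁻¹ := by rw [xx, inv_div]
  have hx0 : xx τ ≠ 0 := div_ne_zero (pow_ne_zero _ h4) hw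
  rw [e, norm_inv, ← one_div] at h1
  have h5 := (one_div_lt_one_div (norm_pos_iff.2 hx0) (by positivity)).1 h1
  have := le_abs_self R
  linarith

theorem exists_SD (hτ : 0 < τ.im) : ∃ σ ∈ SD, EF τ σ := by
  obtain ⟨σ, h1, h2, h3⟩ := exists_reduced hτ
  exact ⟨σ, ⟨h2, h3⟩, h1⟩

theorem continuousOn_xx : ContinuousOn xx HH := fun _ h =>
  (differentiableAt_xx h).continuousAt.continuousWithinAt

theorem SK_subset (Y : ℝ) : SK Y ⊆ HH := fun _ h => SD.im_pos (mem_SK.1 h).1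

theorem analyticOnNhd_xx : AnalyticOnNhd ℂ xx HH :=
  DifferentiableOn.analyticOnNhd (fun _ h => (differentiableAt_xx h).differentiableWithinAt)
    isOpen_HH

theorem nhds_le_map_xx (hτ : 0 < τ.im) : 𝓝 (xx τ) ≤ map xx (𝓝 τ) := by
  refine ((analyticOnNhd_xx τ hτ).eventually_constant_or_nhds_le_map_nhds).resolve_left fun h => ?_
  have h1 := analyticOnNhd_xx.eqOn_of_preconnected_of_eventuallyEq
    (g := fun _ => xx τ) (fun _ _ => analyticAt_const) isPreconnected_HH (mem_HH.2 hτ) h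
  obtain ⟨Y, hY⟩ := exists_bound_xx ‖xx τ‖
  have hm : (I * ((max Y 0 + 1 : ℝ) : ℂ)).im = max Y 0 + 1 := by simp
  have h0 : 0 < (I * ((max Y 0 + 1 : ℝ) : ℂ)).im := by
    rw [hm]; have := le_max_right Y 0; linarith
  have h2 := h1 (mem_HH.2 h0)
  grind

/-- The Hauptmodul is surjective. -/
theorem xx_surjective (c : ℂ) : ∃ τ, 0 < τ.im ∧ xx τ = c := by
  have hopen : IsOpen (xx '' HH) := by
    rw [isOpen_iff_mem_nhds]
    rintro _ ⟨τ, hτ, rfl⟩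
    exact nhds_le_map_xx hτ (image_mem_map (isOpen_HH.mem_nhds hτ))
  have hclosed : IsClosed (xx '' HH) := by
    rw [← closure_subset_iff_isClosed]
    intro z hz
    obtain ⟨Y, hY⟩ := exists_bound_xx (‖z‖ + 1)
    have hK : IsClosed (xx '' SK Y) := ((isCompact_SK Y).image_of_continuousOn
      (continuousOn_xx.mono (SK_subset Y))).isClosed
    have : z ∈ closure (xx '' SK Y) := by
      rw [mem_closure_iff_nhds] at hz ⊢
      intro t ht
      obtain ⟨u, ⟨hu1, hu2⟩, τ, hτ, rfl⟩ := hz _ (inter_mem ht (Metric.ball_mem_nhds z one_pos))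
      obtain ⟨σ, hσ, he⟩ := exists_SD hτ
      have e := he.xx_eq hτ
      refine ⟨xx τ, hu1, σ, mem_SK.2 ⟨hσ, hY σ (SD.im_pos hσ) ?_⟩, e.symm⟩
      rw [← e]
      rw [Metric.mem_ball, dist_eq_norm] at hu2
      have := norm_sub_norm_le (xx τ) z
      linarith
    rw [hK.closure_eq] at this
    exact Set.image_mono (SK_subset Y) this
  have hu := IsClopen.eq_univ ⟨hclosed, hopen⟩ ⟨xx I, I, by simp [mem_HH], rfl⟩
  have : c ∈ xx '' HH := by rw [hu]; trivial
  obtain ⟨τ, h1, h2⟩ := this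
  exact ⟨τ, h1, h2⟩

theorem exists_int_of_qq_eq (h : qq 1 τ = qq 1 σ) : ∃ n : ℤ, τ = σ + n := by
  rw [qq, qq, exp_eq_exp_iff_exists_int] at h
  obtain ⟨n, hn⟩ := h
  refine ⟨n, ?_⟩
  have := two_pi_I_ne
  grind

theorem ww_eq_or (hτ : 0 < τ.im) (hσ : 0 < σ.im) (h : xx τ = xx σ) :
    ww τ = ww σ ∨ ww τ * ww σ = 1 / 729 := by
  have h1 := ww_ne_zero hτ
  have h2 := ww_ne_zero hσ
  rw [xx, xx, div_eq_div_iff h1 h2] at h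
  grind

/-- The Hauptmodul is injective near infinity. -/
theorem exists_large : ∃ R : ℝ, ∀ τ σ : ℂ, 0 < τ.im → 0 < σ.im → R < ‖xx τ‖ → xx τ = xx σ →
    EF τ σ := by
  have hd : HasStrictDerivAt wz 1 0 := by
    have h1 := PS_wz.analyticAt.hasStrictDerivAt
    have h2 := PS_wz.coeff_eq 1
    rw [PowerSeries.coeff_map, wser, coeff_one_X_mul, constantCoeff_wu] at h2
    simp_all
  have hinj := hd.eventually_left_inverse one_ne_zero
  have e1 := (tendsto_qq (N := 1) one_ne_zero).eventually hinj
  have e2 := tendsto_ww.norm.eventually (gt_mem_nhds (show ‖(0:ℂ)‖ < 1 / 27 by simp))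
  obtain ⟨Y, hY⟩ := eventually_im_iff.1 (e1.and e2)
  obtain ⟨R, hR⟩ := ((isCompact_SK Y).image_of_continuousOn
    (continuousOn_xx.mono (SK_subset Y))).isBounded.exists_norm_le
  refine ⟨R, fun τ σ hτ hσ h1 h2 => ?_⟩
  obtain ⟨τ', t1, t2⟩ := exists_SD hτ
  obtain ⟨σ', s1, s2⟩ := exists_SD hσ
  have t3 := t2.xx_eq hτ
  have s3 := s2.xx_eq hσ
  have hlarge : ∀ ρ ∈ SD, R < ‖xx ρ‖ → Y < ρ.im := by
    intro ρ hρ hlt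
    by_contra hle
    exact (hR _ ⟨ρ, mem_SK.2 ⟨hρ, not_lt.1 hle⟩, rfl⟩).not_gt hlt
  obtain ⟨a1, a2⟩ := hY τ' (hlarge τ' t1 (by rw [← t3]; exact h1))
  obtain ⟨b1, b2⟩ := hY σ' (hlarge σ' s1 (by rw [← s3, ← h2]; exact h1))
  have hww : ww τ' = ww σ' := by
    refine (ww_eq_or (SD.im_pos t1) (SD.im_pos s1) (by rw [← t3, ← s3, h2])).resolve_right ?_
    intro e
    have := congrArg norm e
    rw [norm_mul] at this
    have h3 : ‖ww τ'‖ * ‖ww σ'‖ < 1 / 27 * (1 / 27) :=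
      mul_lt_mul'' a2 b2 (norm_nonneg _) (norm_nonneg _)
    rw [this] at h3
    norm_num at h3
  have hq : qq 1 τ' = qq 1 σ' := by
    rw [← a1, ← b1]
    exact congrArg _ hww
  obtain ⟨n, hn⟩ := exists_int_of_qq_eq hq
  have h5 : EF σ' τ' := by rw [hn]; exact EF_add_int _ _
  exact t2.trans hτ ((s2.trans hσ h5).symm hσ)

theorem td_xx_ne_zero (hτ : 0 < τ.im) (h0 : xx τ ≠ 0) (h1 : xx τ ≠ 108) :
    deriv xx τ ≠ 0 := by
  have ha : aa τ ≠ 0 := fun h => by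
    have := aa_pow_three hτ
    rw [h] at this
    simp [gg_ne_zero hτ, h0] at this
  have h2 := td_xx hτ
  intro h
  rw [td, h, zero_div, mul_zero] at h2
  rcases mul_eq_zero.1 h2.symm with h3 | h3
  · exact ha h3
  rcases mul_eq_zero.1 h3 with h3 | h3
  · apply h0; rw [xx, show 1 + 27 * ww τ = 0 by linear_combination h3]; simp
  · apply h1
    have : ww τ = 1 / 27 := by linear_combination h3 / 27
    rw [xx, this]; norm_num

/-- The values of the Hauptmodul taken on two different orbits. -/
def BadSet : Set ℂ :=
  {c | ∃ τ σ : ℂ, 0 < τ.im ∧ 0 < σ.im ∧ ¬ EF τ σ ∧ xx τ = c ∧ xx σ = c}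

theorem isOpen_BadSet : IsOpen BadSet := by
  rw [isOpen_iff_mem_nhds]
  rintro c ⟨τ, σ, hτ, hσ, h, h1, h2⟩
  obtain ⟨p, hp, q, hq, hpq⟩ := eventually_prod_iff.1 (eventually_not_EF hτ hσ h)
  have m1 := nhds_le_map_xx hτ (image_mem_map (hp.and (eventually_HH hτ)))
  have m2 := nhds_le_map_xx hσ (image_mem_map (hq.and (eventually_HH hσ)))
  rw [h1] at m1
  rw [h2] at m2
  filter_upwards [m1, m2] with z ⟨τ', ⟨a1, a2⟩, a3⟩ ⟨σ', ⟨b1, b2⟩, b3⟩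
  exact ⟨τ', σ', a2, b2, hpq a1 b1, a3, b3⟩

theorem not_mem_BadSet_nhds {c : ℂ} (hc : c ∉ BadSet) (h0 : c ≠ 0) (h1 : c ≠ 108) :
    ∀ᶠ z in 𝓝 c, z ∉ BadSet := by
  by_contra hcon
  have hcl : c ∈ closure BadSet := mem_closure_iff_frequently.2 (by
    rw [Filter.Frequently]; exact hcon)
  obtain ⟨z, hz, hlim⟩ := mem_closure_iff_seq_limit.1 hcl
  have hred : ∀ n, ∃ s : ℂ × ℂ, s.1 ∈ SD ∧ s.2 ∈ SD ∧ ¬ EF s.1 s.2 ∧ xx s.1 = z n ∧ xx s.2 = z n := by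
    intro n
    obtain ⟨τ, σ, hτ, hσ, h, h1, h2⟩ := hz n
    obtain ⟨τ', t1, t2⟩ := exists_SD hτ
    obtain ⟨σ', s1, s2⟩ := exists_SD hσ
    exact ⟨(τ', σ'), t1, s1, fun e => h ((t2.trans hτ e).trans hτ (s2.symm hσ)),
      by rw [← h1, ← t2.xx_eq hτ], by rw [← h2, ← s2.xx_eq hσ]⟩
  choose s s1 s2 s3 s4 s5 using hred
  obtain ⟨R, hR⟩ := hlim.norm.bddAbove_range
  obtain ⟨Y, hY⟩ := exists_bound_xx R
  have hb : ∀ n, ‖z n‖ ≤ R := fun n => hR ⟨n, rfl⟩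
  have hK : ∀ n, s n ∈ SK Y ×ˢ SK Y := fun n =>
    ⟨mem_SK.2 ⟨s1 n, hY _ (SD.im_pos (s1 n)) (by rw [s4]; exact hb n)⟩,
      mem_SK.2 ⟨s2 n, hY _ (SD.im_pos (s2 n)) (by rw [s5]; exact hb n)⟩⟩
  obtain ⟨⟨τ, σ⟩, ⟨kτ, kσ⟩, φ, hφ, hs⟩ := ((isCompact_SK Y).prod (isCompact_SK Y)).tendsto_subseq hK
  have hτ : 0 < τ.im := SK_subset Y kτ
  have hσ : 0 < σ.im := SK_subset Y kσ
  have lim1 : Tendsto (fun n => (s (φ n)).1) atTop (𝓝 τ) := (continuous_fst.tendsto _).comp hs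
  have lim2 : Tendsto (fun n => (s (φ n)).2) atTop (𝓝 σ) := (continuous_snd.tendsto _).comp hs
  have hz' := hlim.comp hφ.tendsto_atTop
  have e1 : xx τ = c := tendsto_nhds_unique
    (((differentiableAt_xx hτ).continuousAt.tendsto.comp lim1).congr fun n => s4 _) hz'
  have e2 : xx σ = c := tendsto_nhds_unique
    (((differentiableAt_xx hσ).continuousAt.tendsto.comp lim2).congr fun n => s5 _) hz'
  have hEF : EF τ σ := by
    by_contra h; exact hc ⟨τ, σ, hτ, hσ, h, e1, e2⟩
  have hinj := ((analyticOnNhd_xx σ hσ).hasStrictDerivAt).eventually_left_inverse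
    (td_xx_ne_zero hσ (by rwa [e2]) (by rwa [e2]))
  have main : ∀ m : ℂ → ℂ, ContinuousAt m τ → m τ = σ → (∀ ρ, 0 < ρ.im → EF ρ (m ρ)) → False := by
    intro m mc me mE
    have l3 : Tendsto (fun n => m (s (φ n)).1) atTop (𝓝 σ) := by
      rw [← me]; exact mc.tendsto.comp lim1
    obtain ⟨n, n1, n2⟩ := ((l3.eventually hinj).and (lim2.eventually hinj)).exists
    have hE := mE _ (SD.im_pos (s1 (φ n)))
    apply s3 (φ n)
    have : m (s (φ n)).1 = (s (φ n)).2 := by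
      rw [← n1, ← n2, ← hE.xx_eq (SD.im_pos (s1 (φ n))), s4, s5]
    rwa [this] at hE
  rcases hEF with ⟨M, hM, e⟩ | ⟨M, hM, e⟩
  · exact main (mob M) (continuousAt_mob hM.det_ne hτ) e fun ρ _ => Or.inl ⟨M, hM, rfl⟩
  · exact main (fun ρ => mob M (Wt ρ)) (ContinuousAt.comp
      (continuousAt_mob hM.det_ne (im_Wt_pos hτ)) (hasDerivAt_Wt hτ).continuousAt) e
      fun ρ _ => Or.inr ⟨M, hM, rfl⟩

/-- The Hauptmodul separates orbits of the Fricke group. -/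
theorem EF_of_xx_eq (hτ : 0 < τ.im) (hσ : 0 < σ.im) (h : xx τ = xx σ) : EF τ σ := by
  have hfin : ({0, 108} : Set ℂ).Finite := by simp
  have hconn : IsPreconnected (({0, 108} : Set ℂ)ᶜ) :=
    (hfin.countable.isPathConnected_compl_of_one_lt_rank (by
      rw [rank_real_complex]; norm_num)).isConnected.isPreconnected
  have hV : IsOpen {c : ℂ | c ∉ BadSet ∧ c ∈ ({0, 108} : Set ℂ)ᶜ} := by
    rw [isOpen_iff_mem_nhds]
    rintro c ⟨h1, h2⟩
    have h3 : c ≠ 0 ∧ c ≠ 108 := by simpa using h2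
    exact (not_mem_BadSet_nhds h1 h3.1 h3.2).and (hfin.isClosed.isOpen_compl.mem_nhds h2)
  have hsub : BadSet ⊆ {0, 108} := by
    obtain ⟨R, hR⟩ := exists_large
    have hb : ((max R 108 + 1 : ℝ) : ℂ) ∉ BadSet := by
      rintro ⟨τ, σ, hτ, hσ, h, h1, h2⟩
      refine h (hR τ σ hτ hσ ?_ (h1.trans h2.symm))
      rw [h1, norm_real, Real.norm_eq_abs]
      grind
    have hb2 : ((max R 108 + 1 : ℝ) : ℂ) ∈ ({0, 108} : Set ℂ)ᶜ := by
      have := le_max_right R 108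
      intro hh
      rcases hh with hh | hh
      · have : max R 108 + 1 = 0 := by exact_mod_cast hh
        linarith
      · have : max R 108 + 1 = 108 := by exact_mod_cast (Set.mem_singleton_iff.1 hh)
        linarith
    have := hconn.subset_right_of_subset_union isOpen_BadSet hV
      (Set.disjoint_left.2 fun c h1 h2 => h2.1 h1) (fun c hc => by
        grind) ⟨_, hb2, hb, hb2⟩
    intro c hc
    by_contra h
    exact (this h).1 hc
  by_contra hne
  have hmem : xx τ ∈ BadSet := ⟨τ, σ, hτ, hσ, hne, rfl, h.symm⟩
  exact (infinite_of_mem_nhds _ (isOpen_BadSet.mem_nhds hmem)) (hfin.subset hsub)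

/-- The elliptic point fixed by the Fricke involution. -/
def ptA : ℂ := I * (Real.sqrt 3 / 3 : ℝ)
/-- The elliptic point of order three. -/
def ptB : ℂ := -1 / 2 + I * (Real.sqrt 3 / 6 : ℝ)

theorem sqrt3_sq : Real.sqrt 3 ^ 2 = 3 := Real.sq_sqrt (by norm_num)
theorem csqrt3_sq : (Real.sqrt 3 : ℂ) ^ 2 = 3 := by exact_mod_cast sqrt3_sq
theorem sqrt3_pos : 0 < Real.sqrt 3 := Real.sqrt_pos.2 (by norm_num)

theorem ptA_im : ptA.im = Real.sqrt 3 / 3 := by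
  rw [ptA, I_mul_im, ofReal_re]
theorem ptB_im : ptB.im = Real.sqrt 3 / 6 := by
  rw [ptB, add_im, I_mul_im, ofReal_re]; norm_num
theorem ptA_im_pos : 0 < ptA.im := by rw [ptA_im]; positivity
theorem ptB_im_pos : 0 < ptB.im := by rw [ptB_im]; positivity

theorem ptA_sq : 3 * ptA ^ 2 + 1 = 0 := by
  rw [ptA]; push_cast
  linear_combination (Real.sqrt 3 : ℂ) ^ 2 / 3 * I_sq - csqrt3_sq / 3
theorem ptB_sq : 3 * ptB ^ 2 + 3 * ptB + 1 = 0 := by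
  rw [ptB]; push_cast
  linear_combination (Real.sqrt 3 : ℂ) ^ 2 / 12 * I_sq - csqrt3_sq / 12

theorem Wt_ptA : Wt ptA = ptA := by
  have := ne_zero_of_im ptA_im_pos
  rw [Wt, div_eq_iff (by simpa using this)]
  linear_combination -ptA_sq
theorem Wt_ptB : Wt ptB = ptB + 1 := by
  have := ne_zero_of_im ptB_im_pos
  rw [Wt, div_eq_iff (by simpa using this)]
  linear_combination -ptB_sq

theorem xx_ptB : xx ptB = 0 := by
  have h1 := aa_W ptB_im_pos
  rw [Wt_ptB, aa_T] at h1
  have h2 : (3 * ptB ^ 2 + 1) * aa ptB = 0 := by linear_combination h1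
  have h3 : aa ptB = 0 := by
    refine (mul_eq_zero.1 h2).resolve_left fun h => ?_
    have : ptB = 0 := by linear_combination (ptB_sq - h) / 3
    exact ne_zero_of_im ptB_im_pos this
  have h4 := aa_pow_three ptB_im_pos
  rw [h3] at h4
  simpa [gg_ne_zero ptB_im_pos] using h4.symm

theorem not_E0_ptA_ptB : ¬ E0 ptA ptB := by
  rintro ⟨M, hM, h⟩
  have h1 := im_mob (M := M) ptA
  rw [h, hM.1, ptA_im, ptB_im] at h1
  have hj := normSq_pos.2 (jf_ne_zero hM.det_ne ptA_im_pos)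
  rw [eq_div_iff hj.ne'] at h1
  have h2 : normSq (jf M ptA) = 2 := by
    push_cast at h1
    field_simp at h1
    linarith
  have hre : ptA.re = 0 := by simp [ptA]
  rw [jf, normSq_apply] at h2
  simp [hre, ptA_im] at h2
  obtain ⟨c, hc⟩ := hM.2
  rw [hc] at h2
  push_cast at h2
  have h3 : ((M 1 1 * M 1 1 + 3 * (c * c) : ℤ) : ℝ) = (2 : ℤ) := by
    grind
  have h4 : M 1 1 * M 1 1 + 3 * (c * c) = 2 := by exact_mod_cast h3
  have hc0 : c = 0 := by
    by_contra hne
    have : 0 < c * c := mul_self_pos.2 hne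
    have := mul_self_nonneg (M 1 1)
    omega
  rw [hc0] at h4
  have h5 : |M 1 1| < 2 := by
    rw [← sq_lt_sq₀ (abs_nonneg _) (by norm_num), sq_abs]; nlinarith
  rw [abs_lt] at h5
  obtain ⟨h5, h6⟩ := h5
  interval_cases M 1 1 <;> omega

theorem ww_ptA : ww ptA = 1 / 27 := by
  have h0 := ww_ne_zero ptA_im_pos
  have h1 := ww_Wt ptA_im_pos
  rw [Wt_ptA, eq_div_iff (by simpa using h0)] at h1
  have h2 : (27 * ww ptA - 1) * (27 * ww ptA + 1) = 0 := by linear_combination h1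
  rcases mul_eq_zero.1 h2 with h | h
  · linear_combination h / 27
  · exfalso
    have hx : xx ptA = 0 := by
      rw [xx, show 1 + 27 * ww ptA = 0 by linear_combination h]; simp
    rcases EF_of_xx_eq ptA_im_pos ptB_im_pos (hx.trans xx_ptB.symm) with h3 | h3
    · exact not_E0_ptA_ptB h3
    · rw [Wt_ptA] at h3; exact not_E0_ptA_ptB h3

theorem ww_ptB : ww ptB = -1 / 27 := by
  have h := xx_ptB
  rw [xx, div_eq_zero_iff, or_iff_left (ww_ne_zero ptB_im_pos)] at h
  grind

theorem E0_Wt_of_EF {τ P : ℂ} (hτ : 0 < τ.im) (hP : 0 < P.im) (h : E0 (Wt P) P) (h' : EF τ P) :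
    E0 (Wt τ) τ := by
  rcases h' with h1 | h1
  · exact (h1.Wt hτ).trans (im_Wt_pos hτ) (h.trans (im_Wt_pos hP) (h1.symm hτ))
  · have h2 := h1.Wt (im_Wt_pos hτ)
    rw [Wt_Wt hτ] at h2
    exact (h1.trans (im_Wt_pos hτ) (h.symm (im_Wt_pos hP))).trans (im_Wt_pos hτ) (h2.symm hτ)

/-- The function `w` separates the orbits of `Γ₀(3)`. -/
theorem E0_of_ww_eq (hτ : 0 < τ.im) (hσ : 0 < σ.im) (h : ww τ = ww σ) : E0 τ σ := by
  have hx : xx τ = xx σ := by rw [xx, xx, h]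
  rcases EF_of_xx_eq hτ hσ hx with h1 | h1
  · exact h1
  have hw := ww_ne_zero hτ
  have h2 := h1.ww_eq (im_Wt_pos hτ)
  rw [ww_Wt hτ, ← h, div_eq_iff (by simpa using hw)] at h2
  have h3 : (27 * ww τ - 1) * (27 * ww τ + 1) = 0 := by linear_combination -h2
  have hP : ∃ P : ℂ, 0 < P.im ∧ E0 (Wt P) P ∧ ww P = ww τ := by
    rcases mul_eq_zero.1 h3 with h | h
    · exact ⟨ptA, ptA_im_pos, by rw [Wt_ptA]; exact E0.refl _,
        by rw [ww_ptA]; linear_combination -h / 27⟩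
    · refine ⟨ptB, ptB_im_pos, ?_, by rw [ww_ptB]; linear_combination -h / 27⟩
      rw [Wt_ptB]
      exact ⟨Tn (-1), G0_Tn _, by rw [mob_Tn]; push_cast; ring⟩
  obtain ⟨P, p1, p2, p3⟩ := hP
  have h4 := E0_Wt_of_EF hτ p1 p2 (EF_of_xx_eq hτ p1 (by rw [xx, xx, p3]))
  exact (h4.symm (im_Wt_pos hτ)).trans hτ h1

theorem ww_surjective {c : ℂ} (hc : c ≠ 0) : ∃ τ, 0 < τ.im ∧ ww τ = c := by
  obtain ⟨τ, hτ, h⟩ := xx_surjective ((1 + 27 * c) ^ 2 / c)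
  have hw := ww_ne_zero hτ
  rw [xx, div_eq_div_iff hw hc] at h
  have h2 : (ww τ - c) * (729 * ww τ * c - 1) = 0 := by linear_combination h
  rcases mul_eq_zero.1 h2 with h3 | h3
  · exact ⟨τ, hτ, sub_eq_zero.1 h3⟩
  · refine ⟨Wt τ, im_Wt_pos hτ, ?_⟩
    rw [ww_Wt hτ, div_eq_iff (by simpa using hw)]
    linear_combination -h3

section Cosets
variable (p : ℕ) [Fact p.Prime]

/-- Representatives of the cosets of `Γ₀(3)` in the matrices of determinant `p`. -/
def crep : Option (ZMod p) → Mat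
  | none => !![(p : ℤ), 0; 0, 1]
  | some b => !![1, (b.val : ℤ); 0, (p : ℤ)]

/-- The permutation of the cosets induced by the translation. -/
def tI : Equiv.Perm (Option (ZMod p)) := Equiv.optionCongr (Equiv.addRight 1)

/-- The permutation of the cosets induced by the Fricke involution. -/
def wF : Option (ZMod p) → Option (ZMod p)
  | none => some 0
  | some b => if b = 0 then none else some (-(3 * b)⁻¹)

variable {p}

theorem p_pos : 0 < p := (Fact.out : p.Prime).pos

theorem natCast_ne_zero_of_lt {n : ℕ} (h0 : n ≠ 0) (hn : n < p) : (n : ZMod p) ≠ 0 := by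
  rw [Ne, ZMod.natCast_eq_zero_iff]
  exact fun h => absurd (Nat.le_of_dvd (Nat.pos_of_ne_zero h0) h) (by omega)

theorem three_ne_zero_zmod (hp : 5 ≤ p) : (3 : ZMod p) ≠ 0 := by
  exact_mod_cast natCast_ne_zero_of_lt (p := p) (n := 3) (by norm_num) (by omega)

theorem wF_wF (hp : 5 ≤ p) (i : Option (ZMod p)) : wF p (wF p i) = i := by
  have h3 := three_ne_zero_zmod hp
  rcases i with _ | b
  · simp [wF]
  · by_cases hb : b = 0
    · simp [wF, hb]
    · have : -(3 * b)⁻¹ ≠ 0 := neg_ne_zero.2 (inv_ne_zero (mul_ne_zero h3 hb))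
      simp only [wF, hb, if_false, this]
      congr 1
      field_simp

/-- The permutation of the cosets induced by the Fricke involution. -/
def wI (hp : 5 ≤ p) : Equiv.Perm (Option (ZMod p)) := Function.Involutive.toPerm (wF p) (wF_wF hp)

theorem wI_apply (hp : 5 ≤ p) (i : Option (ZMod p)) : wI hp i = wF p i := rfl

theorem det_cos (i : Option (ZMod p)) : (crep p i).det = p := by
  rcases i with _ | b <;> simp [crep, det_fin_two]

theorem det_cos_pos (i : Option (ZMod p)) : 0 < (crep p i).det := by
  rw [det_cos]; exact_mod_cast p_pos

theorem im_cos_pos (i : Option (ZMod p)) (hτ : 0 < τ.im) : 0 < (mob (crep p i) τ).im :=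
  im_mob_pos (det_cos_pos i) hτ

theorem cos_Tn (i : Option (ZMod p)) : ∃ γ, G0 γ ∧ crep p i * Tn 1 = γ * crep p (tI p i) := by
  rcases i with _ | b
  · refine ⟨Tn p, G0_Tn _, ?_⟩
    simp [crep, tI, Tn, Matrix.mul_fin_two]
  · have h : ((b.val + 1 - (b + 1 : ZMod p).val : ℤ) : ZMod p) = 0 := by simp
    rw [ZMod.intCast_zmod_eq_zero_iff_dvd] at h
    obtain ⟨k, hk⟩ := h
    refine ⟨Tn k, G0_Tn _, ?_⟩
    simp [crep, tI, Tn, -ZMod.natCast_val]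
    linarith

theorem cos_WM (hp : 5 ≤ p) (i : Option (ZMod p)) :
    ∃ γ, G0 γ ∧ crep p i * WM = γ * (WM * crep p (wI hp i)) := by
  rcases i with _ | b
  · refine ⟨1, G0_one, ?_⟩
    simp [crep, wI_apply, wF, WM, -ZMod.natCast_val]
  · by_cases hb : b = 0
    · refine ⟨1, G0_one, ?_⟩
      simp [crep, wI_apply, wF, WM, -ZMod.natCast_val, hb, mul_comm]
    · have h3 := three_ne_zero_zmod hp
      have h : ((3 * b.val * (-(3 * b)⁻¹ : ZMod p).val + 1 : ℤ) : ZMod p) = 0 := by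
        push_cast
        simp only [ZMod.natCast_val, ZMod.cast_id', id]
        field_simp
        ring
      rw [ZMod.intCast_zmod_eq_zero_iff_dvd] at h
      obtain ⟨k, hk⟩ := h
      have hw : wI hp (some b) = some (-(3 * b)⁻¹) := by rw [wI_apply, wF, if_neg hb]
      rw [hw]
      generalize -(3 * b)⁻¹ = b' at *
      refine ⟨!![k, (b.val : ℤ); 3 * (b'.val : ℤ), p],
        ⟨by rw [det_fin_two]; simp [-ZMod.natCast_val]; linarith, by simp⟩, ?_⟩
      ext i j
      fin_cases i <;> fin_cases j <;> simp [crep, WM, -ZMod.natCast_val] <;> linarith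

theorem exists_cos {N : Mat} (hd : N.det = p) (h3 : 3 ∣ N 1 0) (hp : 5 ≤ p) :
    ∃ i γ, G0 γ ∧ N = γ * crep p i := by
  obtain ⟨a, b, c, d, rfl⟩ : ∃ a b c d, N = !![a, b; c, d] := ⟨_, _, _, _, eta_fin_two N⟩
  rw [det_fin_two] at hd
  simp only [of_apply, cons_val', cons_val_zero, cons_val_one, cons_val_fin_one] at hd h3
  have hp0 : (p : ℤ) ≠ 0 := by exact_mod_cast p_pos.ne'
  by_cases h : (p : ℤ) ∣ a ∧ (p : ℤ) ∣ c
  · obtain ⟨⟨a', rfl⟩, ⟨c', rfl⟩⟩ := h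
    have hc : (3 : ℤ) ∣ c' := by
      refine (Int.isCoprime_iff_gcd_eq_one.2 ?_ : IsCoprime (3 : ℤ) p).dvd_of_dvd_mul_left h3
      have : Nat.Coprime 3 p := (Nat.coprime_primes Nat.prime_three Fact.out).2 (by omega)
      exact_mod_cast this
    refine ⟨none, !![a', b; c', d], ⟨?_, by simpa using hc⟩, ?_⟩
    · rw [det_fin_two]
      simp only [of_apply, cons_val', cons_val_zero, cons_val_one, cons_val_fin_one]
      apply mul_left_cancel₀ hp0
      linarith
    · simp [crep, Matrix.mul_fin_two, mul_comm]
  · have key : ∃ β : ZMod p, (b : ZMod p) = a * β ∧ (d : ZMod p) = c * β := by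
      have hd' : (a * d : ZMod p) = b * c := by
        have := congrArg (Int.cast : ℤ → ZMod p) hd
        push_cast at this
        rw [← sub_eq_zero]; simpa using this
      by_cases ha : (a : ZMod p) = 0
      · have hc : (c : ZMod p) ≠ 0 := by
          intro hc
          rw [ZMod.intCast_zmod_eq_zero_iff_dvd] at ha hc
          exact h ⟨ha, hc⟩
        refine ⟨d / c, ?_, by field_simp⟩
        grind
      · refine ⟨b / a, by field_simp, ?_⟩
        field_simp
        linear_combination hd'
    obtain ⟨β, hb, hd2⟩ := key
    have e1 : (p : ℤ) ∣ b - a * β.val := by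
      rw [← ZMod.intCast_zmod_eq_zero_iff_dvd]; push_cast; simp [hb]
    have e2 : (p : ℤ) ∣ d - c * β.val := by
      rw [← ZMod.intCast_zmod_eq_zero_iff_dvd]; push_cast; simp [hd2]
    obtain ⟨b', hb'⟩ := e1
    obtain ⟨d', hd'⟩ := e2
    refine ⟨some β, !![a, b'; c, d'], ⟨?_, by simpa using h3⟩, ?_⟩
    · rw [det_fin_two]
      simp only [of_apply, cons_val', cons_val_zero, cons_val_one, cons_val_fin_one]
      apply mul_left_cancel₀ hp0
      linear_combination hd - a * hd' + c * hb'
    · ext i j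
      fin_cases i <;> fin_cases j <;> simp [crep, -ZMod.natCast_val] <;> linarith

theorem cos_injective {i j : Option (ZMod p)} {γ : Mat} (hγ : G0 γ)
    (h : crep p i = γ * crep p j) : i = j := by
  obtain ⟨a, b, c, d, rfl⟩ : ∃ a b c d, γ = !![a, b; c, d] := ⟨_, _, _, _, eta_fin_two γ⟩
  have hp1 : (1 : ℤ) < p := by exact_mod_cast (Fact.out : p.Prime).one_lt
  have hd := hγ.1
  rw [det_fin_two] at hd
  simp only [of_apply, cons_val', cons_val_zero, cons_val_one, cons_val_fin_one] at hd
  have h00 := congrFun (congrFun h 0) 0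
  have h01 := congrFun (congrFun h 0) 1
  have h10 := congrFun (congrFun h 1) 0
  have h11 := congrFun (congrFun h 1) 1
  have notunit : ∀ x : ℤ, 1 ≠ (p : ℤ) * x := fun x hx => by
    have := Int.eq_one_of_dvd_one (by omega) ⟨x, hx⟩
    omega
  rcases i with _ | i <;> rcases j with _ | j <;>
    simp [crep, Matrix.mul_fin_two] at h00 h01 h10 h11
  · rfl
  · grind
  · exfalso
    refine notunit a ?_
    linarith
  · congr 1
    subst h10
    rw [← h00] at h01
    have := congrArg (Int.cast : ℤ → ZMod p) h01
    simpa using this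

end Cosets

theorem gg_mob {M : Mat} (hM : G0 M) : ∀ τ : ℂ, 0 < τ.im → gg (mob M τ) = jf M τ ^ 6 * gg τ := by
  refine G0_induction (P := fun M => ∀ τ : ℂ, 0 < τ.im → gg (mob M τ) = jf M τ ^ 6 * gg τ)
    ?_ ?_ ?_ ?_ M hM
  · intro τ _; rw [mob_one]; simp [jf]
  · intro M hM h τ hτ
    rw [mob_neg, h τ hτ]
    simp only [jf, Matrix.neg_apply]; push_cast; ring
  · intro M n hM h τ hτ
    have h1 : 0 < (τ + n : ℂ).im := by simpa using hτ
    rw [mob_mul hM.det_ne (G0_Tn n).det_pos hτ, jf_mul (G0_Tn n).det_ne hτ, mob_Tn, h _ h1,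
      inv_int_of_T (fun τ _ => gg_T τ) n τ hτ]
    simp [jf, Tn]
  · intro M n hM h τ hτ
    have h1 := im_mob_pos (G0_Vn n).det_pos hτ
    have h2 : 0 < (Wt τ + ((-n : ℤ) : ℂ)).im := by rw [im_add_int]; exact im_Wt_pos hτ
    have h0 := ne_zero_of_im hτ
    rw [mob_mul hM.det_ne (G0_Vn n).det_pos hτ, jf_mul (G0_Vn n).det_ne hτ, h _ h1, mul_pow,
      mul_assoc]
    congr 1
    rw [mob_Vn_eq hτ, gg_Wt h2, inv_int_of_T (fun τ _ => gg_T τ) _ _ (im_Wt_pos hτ), gg_Wt hτ]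
    simp only [jf, Vn, Wt, of_apply, cons_val', cons_val_zero, cons_val_one, cons_val_fin_one]
    push_cast
    field_simp
    ring

theorem ww_mob {M : Mat} (hM : G0 M) (hτ : 0 < τ.im) : ww (mob M τ) = ww τ :=
  (E0.ww_eq hτ ⟨M, hM, rfl⟩).symm

/-- The quotient `g|M / g`, a modular unit-like function. -/
def FM (M : Mat) (τ : ℂ) : ℂ := (M.det : ℂ) ^ 6 / jf M τ ^ 6 * gg (mob M τ) / gg τ

theorem FM_mul {M N : Mat} (hM : 0 < M.det) (hN : 0 < N.det) (hτ : 0 < τ.im) :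
    FM (M * N) τ = FM M (mob N τ) * FM N τ := by
  have h1 := im_mob_pos hN hτ
  have := gg_ne_zero h1
  have := gg_ne_zero hτ
  have := jf_ne_zero hN.ne' hτ
  have := jf_ne_zero hM.ne' h1
  rw [FM, FM, FM, jf_mul hN.ne' hτ, mob_mul hM.ne' hN hτ, Matrix.det_mul]
  push_cast
  field_simp

theorem FM_G0 {M : Mat} (hM : G0 M) (hτ : 0 < τ.im) : FM M τ = 1 := by
  have := gg_ne_zero hτ
  have := jf_ne_zero hM.det_ne hτ
  rw [FM, gg_mob hM τ hτ, hM.1]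
  push_cast
  field_simp

theorem FM_WM (hτ : 0 < τ.im) : FM WM τ = -27 := by
  have := gg_ne_zero hτ
  have := ne_zero_of_im hτ
  rw [FM, mob_WM, gg_Wt hτ, det_WM, jf_WM]
  push_cast
  field_simp

section Families
variable {p : ℕ} [Fact p.Prime]

theorem ww_cos_T (i : Option (ZMod p)) (hτ : 0 < τ.im) :
    ww (mob (crep p i) (τ + 1)) = ww (mob (crep p (tI p i)) τ) := by
  obtain ⟨γ, hγ, h⟩ := cos_Tn i
  have h1 : τ + 1 = mob (Tn 1) τ := by rw [mob_Tn]; simp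
  rw [h1, ← mob_mul (det_cos_pos i).ne' (G0_Tn 1).det_pos hτ, h,
    mob_mul hγ.det_ne (det_cos_pos _) hτ, ww_mob hγ (im_cos_pos _ hτ)]

theorem ww_cos_W (hp : 5 ≤ p) (i : Option (ZMod p)) (hτ : 0 < τ.im) :
    ww (mob (crep p i) (Wt τ)) = 1 / (729 * ww (mob (crep p (wI hp i)) τ)) := by
  obtain ⟨γ, hγ, h⟩ := cos_WM hp i
  have hW : 0 < WM.det := by rw [det_WM]; norm_num
  have h1 : 0 < (WM * crep p (wI hp i)).det := by
    rw [Matrix.det_mul]; exact mul_pos hW (det_cos_pos _)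
  rw [← mob_WM τ, ← mob_mul (det_cos_pos i).ne' hW hτ, h,
    mob_mul hγ.det_ne h1 hτ, ww_mob hγ (im_mob_pos h1 hτ),
    mob_mul hW.ne' (det_cos_pos _) hτ, mob_WM, ww_Wt (im_cos_pos _ hτ)]

theorem FM_cos_T (i : Option (ZMod p)) (hτ : 0 < τ.im) :
    FM (crep p i) (τ + 1) = FM (crep p (tI p i)) τ := by
  obtain ⟨γ, hγ, h⟩ := cos_Tn i
  have h1 : τ + 1 = mob (Tn 1) τ := by rw [mob_Tn]; simp
  have h2 := FM_mul (det_cos_pos i) (G0_Tn 1).det_pos hτ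
  rw [FM_G0 (G0_Tn 1) hτ, mul_one, h, FM_mul hγ.det_pos (det_cos_pos _) hτ,
    FM_G0 hγ (im_cos_pos _ hτ), one_mul] at h2
  rw [h1, h2]

theorem FM_cos_W (hp : 5 ≤ p) (i : Option (ZMod p)) (hτ : 0 < τ.im) :
    FM (crep p i) (Wt τ) = FM (crep p (wI hp i)) τ := by
  obtain ⟨γ, hγ, h⟩ := cos_WM hp i
  have hW : 0 < WM.det := by rw [det_WM]; norm_num
  have h1 : 0 < (WM * crep p (wI hp i)).det := by
    rw [Matrix.det_mul]; exact mul_pos hW (det_cos_pos _)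
  have h2 := FM_mul (det_cos_pos i) hW hτ
  rw [h, FM_mul hγ.det_pos h1 hτ, FM_G0 hγ (im_mob_pos h1 hτ), one_mul,
    FM_mul hW (det_cos_pos _) hτ, FM_WM hτ, FM_WM (im_cos_pos _ hτ), mob_WM] at h2
  linear_combination (1 / 27) * h2

/-- Symmetric functions of the `w ∘ α`, and of the `F_α`, are periodic. -/
theorem prod_T {M : Type*} [CommMonoid M] {f : Option (ZMod p) → ℂ → M}
    (h : ∀ i (τ : ℂ), 0 < τ.im → f i (τ + 1) = f (tI p i) τ) (hτ : 0 < τ.im) :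
    ∏ i, f i (τ + 1) = ∏ i, f i τ := by
  rw [prod_congr rfl fun i _ => h i τ hτ]
  exact Equiv.prod_comp (tI p) fun i => f i τ

theorem prod_W {M : Type*} [CommMonoid M] (hp : 5 ≤ p) {f : Option (ZMod p) → ℂ → M}
    (h : ∀ i (τ : ℂ), 0 < τ.im → f i (Wt τ) = f (wI hp i) τ) (hτ : 0 < τ.im) :
    ∏ i, f i (Wt τ) = ∏ i, f i τ := by
  rw [prod_congr rfl fun i _ => h i τ hτ]
  exact Equiv.prod_comp (wI hp) fun i => f i τ

end Families

theorem exists_valuationSubring (p : ℕ) [Fact p.Prime] :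
    ∃ V : ValuationSubring ℂ, (p : V) ∈ maximalIdeal V := by
  let A : Subring ℂ := (ιℤ ℂ).range
  have hI : Ideal.span {(p : A)} ≠ ⊤ := by
    rw [Ne, Ideal.span_singleton_eq_top]
    intro h
    obtain ⟨⟨y, ⟨n, rfl⟩⟩, hy⟩ := h.exists_right_inv
    have := congrArg Subtype.val hy
    simp only [Subring.coe_mul, Subring.coe_natCast, eq_intCast, Subring.coe_one] at this
    have h2 : (p : ℤ) * n = 1 := by exact_mod_cast this
    have h3 := Int.eq_one_of_mul_eq_one_right (by positivity) h2
    exact (Fact.out : p.Prime).ne_one (by exact_mod_cast h3)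
  obtain ⟨V, -, hV⟩ := Ideal.image_subset_nonunits_valuationSubring _ hI
  refine ⟨V, ?_⟩
  have := hV ⟨(p : A), Ideal.mem_span_singleton_self _, rfl⟩
  rw [← ValuationSubring.coe_mem_nonunits_iff]
  simpa using this

section Residue
variable {V : ValuationSubring ℂ}

theorem mem_of_root {P : V[X]} (hP : P.Monic) {z : ℂ} (hz : P.eval₂ V.subtype z = 0) : z ∈ V := by
  have : IsIntegral V z := ⟨P, hP, hz⟩
  obtain ⟨y, hy⟩ := IsIntegrallyClosed.isIntegral_iff.1 this
  rw [← hy]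
  exact y.2

instance : IsAlgClosed (ResidueField V) := by
  refine IsAlgClosed.of_exists_root _ fun P hP hirr => ?_
  obtain ⟨Q, hQ1, hQ2, hQ3⟩ := Polynomial.lifts_and_natDegree_eq_and_monic
    ((Polynomial.mem_lifts P).2 (Polynomial.map_surjective _ IsLocalRing.residue_surjective P)) hP
  have hd : (Q.map V.subtype).degree ≠ 0 := by
    rw [hQ3.degree_map]
    intro h0
    have : Q.natDegree = 0 := natDegree_eq_of_degree_eq_some h0
    rw [hQ2] at this
    exact hirr.natDegree_pos.ne' this
  obtain ⟨z, hz⟩ := IsAlgClosed.exists_root _ hd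
  rw [IsRoot, eval_map] at hz
  refine ⟨residue V ⟨z, mem_of_root hQ3 hz⟩, ?_⟩
  rw [← hQ1, eval_map, Polynomial.eval₂_hom]
  have : Q.eval ⟨z, mem_of_root hQ3 hz⟩ = 0 := by
    apply Subtype.coe_injective
    have h2 := Polynomial.hom_eval₂ Q (RingHom.id V) V.subtype ⟨z, mem_of_root hQ3 hz⟩
    simp only [RingHom.comp_id] at h2
    exact h2.trans hz
  rw [this, map_zero]

theorem charP_residue {p : ℕ} [Fact p.Prime] (hV : (p : V) ∈ maximalIdeal V) :
    CharP (ResidueField V) p := by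
  rw [CharP.charP_iff_prime_eq_zero Fact.out, ← map_natCast (residue V)]
  exact (residue_eq_zero_iff _).2 hV
end Residue

section Descend
variable {R : Type*} [CommRing R] {ι : R →+* ℂ} {N : ℕ}

theorem hasSum_subseq {a : ℕ → ℂ} (hN : N ≠ 0) (ha : ∀ n, ¬ N ∣ n → a n = 0) {u s : ℂ}
    (h : HasSum (fun n => a n * u ^ n) s) : HasSum (fun n => a (N * n) * (u ^ N) ^ n) s := by
  have hi : Function.Injective fun n : ℕ => N * n := fun x y h => Nat.eq_of_mul_eq_mul_left
    (Nat.pos_of_ne_zero hN) h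
  rw [← hi.hasSum_iff (f := fun n => a n * u ^ n)] at h
  · convert h using 2 with n
    simp [pow_mul]
  · intro n hn
    rw [ha n, zero_mul]
    rintro ⟨m, rfl⟩
    exact hn ⟨m, rfl⟩

theorem HasQ.dvd_of_coeff_ne_zero {f : ℂ → ℂ} {Φ : PowerSeries ℂ} (hN : N ≠ 0) (h : HasQ N f Φ)
    (hT : ∀ τ : ℂ, 0 < τ.im → f (τ + 1) = f τ) {n : ℕ} (hn : ¬ N ∣ n) :
    PowerSeries.coeff n Φ = 0 := by
  have h1 := h.comp_add 1
  have h2 : HasQ N f (rescale (qq N (1 : ℕ)) Φ) := h1.congr (by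
    filter_upwards [eventually_im_pos] with τ hτ
    rw [Nat.cast_one, hT τ hτ])
  have h3 := congrArg (PowerSeries.coeff n) (h.unique hN h2)
  rw [coeff_rescale] at h3
  have h4 : qq N (1 : ℕ) ^ n ≠ 1 := by
    have := Complex.isPrimitiveRoot_exp N hN
    rw [qq, Nat.cast_one, mul_one]
    exact fun h => hn (this.dvd_of_pow_eq_one n h)
  by_contra h5
  apply h4
  rw [eq_comm, mul_left_eq_self₀] at h3
  exact h3.resolve_right h5

/-- A periodic function with an expansion in a fractional power of the nome has an expansion in
the nome. -/
theorem HasQ.descend {f : ℂ → ℂ} {Ψ : PowerSeries R} (hN : N ≠ 0) (h : HasQ N f (Ψ.map ι))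
    (hT : ∀ τ : ℂ, 0 < τ.im → f (τ + 1) = f τ) :
    HasQ 1 f ((PowerSeries.mk fun n => PowerSeries.coeff (N * n) Ψ).map ι) := by
  have hd := fun n => h.dvd_of_coeff_ne_zero hN hT (n := n)
  obtain ⟨F, hF, hfF⟩ := h
  have key : ∀ᶠ u in 𝓝 (0 : ℂ), HasSum (fun n => ι (PowerSeries.coeff (N * n) Ψ) * (u ^ N) ^ n)
      (F u) := by
    filter_upwards [hF] with u hu
    have := hasSum_subseq hN hd hu
    simpa only [PowerSeries.coeff_map] using this
  refine ⟨fun z => ∑' n, ι (PowerSeries.coeff (N * n) Ψ) * z ^ n, ?_, ?_⟩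
  · rw [PS]
    obtain ⟨r, hr, h1⟩ := Metric.eventually_nhds_iff.1 key
    refine Metric.eventually_nhds_iff.2 ⟨r ^ N, pow_pos hr N, fun {z} hz => ?_⟩
    obtain ⟨u, hu⟩ := IsAlgClosed.exists_pow_nat_eq z (Nat.pos_of_ne_zero hN)
    have h2 : ‖u‖ < r := by
      rw [dist_zero_right, ← hu, norm_pow] at hz
      exact lt_of_pow_lt_pow_left₀ N hr.le hz
    have h3 := h1 (y := u) (by rwa [dist_zero_right])
    rw [hu] at h3
    simpa only [PowerSeries.coeff_map, coeff_mk] using h3.summable.hasSum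
  · filter_upwards [hfF, (tendsto_qq hN).eventually key] with τ h1 h2
    have h3 : qq N τ ^ N = qq 1 τ := by simpa using qq_mul_pow (M := 1) hN τ
    rw [h3] at h2
    rw [h1]
    exact h2.tsum_eq.symm

end Descend

section PolyQ

/-- Coefficientwise expansions of a polynomial valued function. -/
def HasQP (N : ℕ) (f : ℂ → ℂ[X]) (φ : (PowerSeries ℂ)[X]) : Prop :=
  ∀ j, HasQ N (fun τ => (f τ).coeff j) (φ.coeff j)

theorem HasQ.zero {N : ℕ} : HasQ N (fun _ => 0) 0 := by simpa using HasQ.const (N := N) 0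

theorem HasQP.mul {N : ℕ} {f g : ℂ → ℂ[X]} {φ ψ : (PowerSeries ℂ)[X]} (h : HasQP N f φ)
    (h' : HasQP N g ψ) : HasQP N (fun τ => f τ * g τ) (φ * ψ) := by
  intro j
  simp only [Polynomial.coeff_mul]
  exact HasQ.sum _ fun x _ => (h x.1).mul (h' x.2)

theorem HasQP.prod {N : ℕ} {ι : Type*} (s : Finset ι) {f : ι → ℂ → ℂ[X]}
    {φ : ι → (PowerSeries ℂ)[X]} (h : ∀ i, HasQP N (f i) (φ i)) :
    HasQP N (fun τ => ∏ i ∈ s, f i τ) (∏ i ∈ s, φ i) := by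
  classical
  induction s using Finset.induction_on with
  | empty =>
    intro j
    simp only [Finset.prod_empty, Polynomial.coeff_one]
    split_ifs
    · exact HasQ.one
    · exact HasQ.zero
  | insert a s ha ih =>
    simp only [prod_insert ha]
    exact (h a).mul ih

theorem HasQP.linear {N : ℕ} {u f : ℂ → ℂ} {υ φ : PowerSeries ℂ} (hu : HasQ N u υ)
    (hf : HasQ N f φ) : HasQP N (fun τ => C (u τ) * X - C (f τ)) (C υ * X - C φ) := by
  intro j
  rcases j with _ | _ | j
  · simpa using hf.neg
  · simpa using hu
  · simpa [Polynomial.coeff_X, Polynomial.coeff_C] using HasQ.zero (N := N)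

end PolyQ

section Hom
variable {R S : Type*} [CommRing R] [CommRing S]

/-- The polynomial `X ^ n * P ((1 + 27 X) ^ 2 / X)`. -/
def hom (n : ℕ) (P : R[X]) : R[X] :=
  ∑ i ∈ range (n + 1), C (P.coeff i) * (1 + C 27 * X) ^ (2 * i) * X ^ (n - i)

theorem eval₂_one_add (f : R →+* S) (w : S) : (1 + C 27 * X : R[X]).eval₂ f w = 1 + 27 * w := by
  have h : f 27 = 27 := map_ofNat f 27
  rw [eval₂_add, eval₂_one, eval₂_mul, eval₂_C, eval₂_X, h]

theorem hom_map (f : R →+* S) (n : ℕ) (P : R[X]) : (hom n P).map f = hom n (P.map f) := by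
  have h : f 27 = 27 := map_ofNat f 27
  simp [hom, Polynomial.map_sum, coeff_map, h]

theorem eval₂_hom_mul {K : Type*} [Field K] (f : R →+* K) {n : ℕ} {P : R[X]}
    (hP : P.natDegree ≤ n) {w x : K} (hw : w * x = (1 + 27 * w) ^ 2) :
    (hom n P).eval₂ f w = w ^ n * P.eval₂ f x := by
  rw [Polynomial.eval₂_eq_sum_range' f (Nat.lt_succ_of_le hP), hom, Finset.mul_sum,
    Polynomial.eval₂_finsetSum]
  refine sum_congr rfl fun i hi => ?_
  have hi' : i ≤ n := by simpa [Nat.lt_succ_iff] using hi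
  simp only [eval₂_mul, eval₂_C, eval₂_pow, eval₂_one_add, eval₂_X]
  rw [pow_mul, ← hw, ← Nat.sub_add_cancel hi', pow_add, Nat.sub_add_cancel hi', mul_pow]
  ring

theorem natDegree_one_add_le (m : ℕ) : ((1 + C 27 * X : R[X]) ^ m).natDegree ≤ m := by
  refine (natDegree_pow_le_of_le m (m := 1) ?_).trans (mul_one _).le
  rw [add_comm, ← C_1]
  exact natDegree_linear_le

theorem natDegree_hom (n : ℕ) (P : R[X]) : (hom n P).natDegree ≤ 2 * n := by
  refine natDegree_sum_le_of_forall_le _ _ fun i hi => ?_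
  have hi' : i ≤ n := by simpa [Nat.lt_succ_iff] using hi
  have h1 := natDegree_one_add_le (R := R) (2 * i)
  refine (natDegree_mul_le.trans (add_le_add (natDegree_mul_le.trans (add_le_add
    (natDegree_C _).le h1)) (natDegree_X_pow_le (n - i)))).trans ?_
  omega

theorem coeff_zero_hom (n : ℕ) (P : R[X]) : (hom n P).coeff 0 = P.coeff n := by
  rw [hom, coeff_zero_eq_eval_zero, eval_finsetSum, sum_eq_single n]
  · simp
  · intro i hi hn
    have : n - i ≠ 0 := by
      have : i < n + 1 := by simpa using hi
      omega
    simp [this]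
  · simp

theorem coeff_one_add_pow (m : ℕ) : ((1 + C 27 * X : R[X]) ^ m).coeff m = 27 ^ m := by
  have : (1 + C 27 * X : R[X]).natDegree ≤ 1 := by
    rw [add_comm, ← C_1]; exact natDegree_linear_le
  have h := coeff_pow_of_natDegree_le (m := m) this
  rw [mul_one] at h
  rw [h]
  simp [coeff_one]

theorem coeff_top_hom (n : ℕ) (P : R[X]) : (hom n P).coeff (2 * n) = P.coeff n * 27 ^ (2 * n) := by
  rw [hom, finsetSum_coeff, sum_eq_single n]
  · rw [Nat.sub_self, pow_zero, mul_one, coeff_C_mul, coeff_one_add_pow]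
  · intro i hi hn
    have hi' : i < n + 1 := by simpa using hi
    refine coeff_eq_zero_of_natDegree_lt ?_
    have h1 := natDegree_one_add_le (R := R) (2 * i)
    refine lt_of_le_of_lt (natDegree_mul_le.trans (add_le_add (natDegree_mul_le.trans (add_le_add
      (natDegree_C _).le h1)) (natDegree_X_pow_le (n - i)))) ?_
    omega
  · simp

/-- Substitution of a power series. -/
def pev (w : PowerSeries R) (P : R[X]) : PowerSeries R := P.eval₂ PowerSeries.C w

theorem map_pev (f : R →+* S) (w : PowerSeries R) (P : R[X]) :
    (pev w P).map f = pev (w.map f) (P.map f) := by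
  rw [pev, pev, hom_eval₂, eval₂_map]
  congr 1
  ext x : 1
  simp

theorem hasQ_pev {f : ℂ → ℂ} (ι : R →+* ℂ) {w : PowerSeries R} (h : HasQ 1 f (w.map ι)) (P : R[X]) :
    HasQ 1 (fun τ => P.eval₂ ι (f τ)) ((pev w P).map ι) := by
  rw [map_pev, pev, eval₂_map, eval₂_eq_sum_range]
  simp only [eval₂_eq_sum_range]
  exact HasQ.sum _ fun i _ => (h.pow i).const_mul _

theorem coeff_zero_pev {w : PowerSeries R} (hw : constCoeff w = 0) (P : R[X]) :
    constCoeff (pev w P) = P.coeff 0 := by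
  rw [pev, hom_eval₂, hw, eval₂_at_zero]
  simp

theorem pev_mul (w : PowerSeries R) (P Q : R[X]) : pev w (P * Q) = pev w P * pev w Q :=
  eval₂_mul _ _

theorem pev_X_pow (w : PowerSeries R) (n : ℕ) : pev w (X ^ n) = w ^ n := by
  rw [pev, eval₂_pow, eval₂_X]

theorem pev_injective [IsDomain R] {w : PowerSeries R} (hw : constCoeff w = 0)
    (hw0 : w ≠ 0) {P Q : R[X]} (h : pev w P = pev w Q) : P = Q := by
  rw [← sub_eq_zero] at h ⊢
  rw [pev, pev, ← eval₂_sub] at h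
  change pev w (P - Q) = 0 at h
  by_contra hne
  obtain ⟨G, hG1, hG2⟩ := exists_eq_pow_rootMultiplicity_mul_and_not_dvd (P - Q) hne 0
  rw [C_0, sub_zero] at hG1 hG2
  rw [hG1, pev_mul, pev_X_pow] at h
  have h2 := (mul_eq_zero.1 h).resolve_left (pow_ne_zero _ hw0)
  rw [X_dvd_iff] at hG2
  apply hG2
  rw [← coeff_zero_pev hw, h2, map_zero]

end Hom

section CharP
variable {k : Type*} [Field k] {p : ℕ} [Fact p.Prime] [CharP k p]

theorem expand_intCast (ψ : PowerSeries ℤ) (hp : p ≠ 0) :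
    PowerSeries.expand p hp (ψ.map (ιℤ k)) = ψ.map (ιℤ k) ^ p := by
  have : ExpChar k p := ExpChar.prime Fact.out
  rw [← MvPowerSeries.map_frobenius_expand p hp]
  have : (MvPowerSeries.map (frobenius k p)) (MvPowerSeries.expand p hp (ψ.map (ιℤ k)))
    = PowerSeries.map (frobenius k p) (PowerSeries.expand p hp (ψ.map (ιℤ k))) := rfl
  refine Eq.trans ?_ this.symm
  rw [map_expand]
  congr 1
  ext n
  simp [PowerSeries.coeff_map]

theorem expand_injective {R : Type*} [CommRing R] {n : ℕ} (hn : n ≠ 0) {φ ψ : PowerSeries R}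
    (h : PowerSeries.expand n hn φ = PowerSeries.expand n hn ψ) : φ = ψ := by
  ext m
  rw [← PowerSeries.coeff_expand_mul n hn, h, PowerSeries.coeff_expand_mul]

end CharP

section Conj
variable {R S : Type*} [CommRing R] [CommRing S] {p : ℕ} [Fact p.Prime]

theorem p_ne_zero : p ≠ 0 := (Fact.out : p.Prime).ne_zero

/-- The expansion of `F ∘ α` in a fractional power of the nome. -/
def serC (ζ : R) (ψ : PowerSeries R) : Option (ZMod p) → PowerSeries R
  | none => PowerSeries.expand p p_ne_zero (PowerSeries.expand p p_ne_zero ψ)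
  | some b => rescale (ζ ^ b.val) ψ

theorem map_serC (f : R →+* S) (ζ : R) (ψ : PowerSeries R) (i : Option (ZMod p)) :
    (serC ζ ψ i).map f = serC (f ζ) (ψ.map f) i := by
  rcases i with _ | b
  · rw [serC, serC, map_expand, map_expand]
  · rw [serC, serC]
    ext n
    simp [coeff_rescale]

theorem constantCoeff_serC (ζ : R) (ψ : PowerSeries R) (i : Option (ZMod p)) :
    constCoeff (serC ζ ψ i) = constCoeff ψ := by
  rcases i with _ | b
  · rw [serC, PowerSeries.constantCoeff_expand, PowerSeries.constantCoeff_expand]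
  · rw [serC, ← coeff_zero_eq_constantCoeff_apply, coeff_rescale]
    simp

theorem mob_none (τ : ℂ) : mob (crep p none) τ = p * τ := by simp [mob, jf, crep]
theorem mob_some (b : ZMod p) (τ : ℂ) : mob (crep p (some b)) τ = (τ + (b.val : ℕ)) / p := by
  simp [mob, jf, crep]
theorem jf_none (τ : ℂ) : jf (crep p none) τ = 1 := by simp [jf, crep]
theorem jf_some (b : ZMod p) (τ : ℂ) : jf (crep p (some b)) τ = p := by simp [jf, crep]

theorem qq_natCast (N b : ℕ) : qq N b = qq N 1 ^ b := by
  rw [qq, qq, ← exp_nat_mul]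
  congr 1; ring

theorem HasQ.cos {f : ℂ → ℂ} {φ : PowerSeries ℂ} (h : HasQ 1 f φ) (i : Option (ZMod p)) :
    HasQ p (fun τ => f (mob (crep p i) τ)) (serC (qq p 1) φ i) := by
  rcases i with _ | b
  · simp only [mob_none, serC]
    have := (h.comp_mul (p_ne_zero (p := p))).expand (N := p) p_ne_zero
    rwa [mul_one] at this
  · simp only [mob_some, serC, ← qq_natCast]
    exact h.comp_div p_ne_zero b.val

theorem sum_val_mul_two : ∑ b : ZMod p, b.val * 2 = p * (p - 1) := by
  obtain ⟨n, hn⟩ : ∃ n, p = n + 1 := ⟨p - 1, by have := p_pos (p := p); omega⟩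
  subst hn
  rw [← Finset.sum_range_id_mul_two, Finset.sum_mul]
  exact (Finset.sum_range fun i => i * 2).symm

theorem prod_qq_cos (hp : 5 ≤ p) (τ : ℂ) : ∏ i, qq 1 (mob (crep p i) τ) = qq 1 τ ^ (p + 1) := by
  have hp0 : (p : ℂ) ≠ 0 := by exact_mod_cast (p_ne_zero (p := p))
  have h2 : p ≠ 2 := by omega
  obtain ⟨m, hm⟩ := (Fact.out : p.Prime).odd_of_ne_two h2
  simp only [qq]
  rw [← exp_sum, Fintype.sum_option, mob_none]
  simp only [mob_some]
  have hs : ∑ b : ZMod p, (b.val : ℂ) = p * m := by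
    have := sum_val_mul_two (p := p)
    rw [← Finset.sum_mul, show p - 1 = 2 * m by omega] at this
    have h3 : ∑ b : ZMod p, b.val = p * m := by linarith
    exact_mod_cast congrArg (Nat.cast : ℕ → ℂ) h3
  have he : ∑ b : ZMod p, 2 * Real.pi * I * ((τ + (b.val : ℕ)) / p) / (1 : ℕ) =
      2 * Real.pi * I * τ + m * (2 * Real.pi * I) := by
    rw [← Finset.sum_div, ← Finset.mul_sum, ← Finset.sum_div, sum_add_distrib, hs]
    simp only [Finset.sum_const, card_univ, ZMod.card, nsmul_eq_mul]
    field_simp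
    push_cast; ring
  rw [he, ← add_assoc, exp_add, exp_nat_mul_two_pi_mul_I, mul_one, ← exp_nat_mul]
  congr 1
  push_cast; ring

/-- Comparison of the leading terms of the conjugates. -/
theorem tendsto_prod_cos (hp : 5 ≤ p) {f : ℂ → ℂ} {υ : PowerSeries ℂ}
    (hf : HasQ 1 f (PowerSeries.X * υ)) (hυ : constCoeff υ = 1) :
    Tendsto (fun τ => (∏ i, f (mob (crep p i) τ)) / f τ ^ (p + 1)) (comap im atTop) (𝓝 1) := by
  have h1 := hf.div_X
  have h2 := (HasQ.prod univ fun i _ => h1.cos (p := p) i).tendsto p_ne_zero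
  have h3 := (h1.pow (p + 1)).tendsto one_ne_zero
  rw [map_prod] at h2
  simp only [constantCoeff_serC, map_pow, hυ, one_pow, Finset.prod_const_one] at h2 h3
  have h4 := h2.div h3 one_ne_zero
  rw [div_one] at h4
  refine h4.congr fun τ => ?_
  simp only [Pi.div_apply]
  rw [prod_div_distrib, prod_qq_cos hp, div_pow, div_div_div_cancel_right₀]
  exact pow_ne_zero _ (qq_ne_zero 1 τ)

theorem differentiableAt_comp_cos {f : ℂ → ℂ} (hf : ∀ τ, 0 < τ.im → DifferentiableAt ℂ f τ)
    (i : Option (ZMod p)) (hτ : 0 < τ.im) :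
    DifferentiableAt ℂ (fun τ => f (mob (crep p i) τ)) τ :=
  (hf _ (im_cos_pos i hτ)).comp τ (differentiableAt_mob (det_cos_pos i).ne' hτ)

theorem constantCoeff_map_intCast {υ : PowerSeries ℤ} (h : constCoeff υ = 1) :
    constCoeff (υ.map (ιℤ R)) = 1 := by
  rw [constantCoeff_map, h, map_one]

theorem prod_ww_cos (hp : 5 ≤ p) (hτ : 0 < τ.im) :
    ∏ i, ww (mob (crep p i) τ) = ww τ ^ (p + 1) := by
  set r : ℂ → ℂ := fun τ => (∏ i, ww (mob (crep p i) τ)) / ww τ ^ (p + 1) with hr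
  have hne : ∀ τ : ℂ, 0 < τ.im → r τ ≠ 0 := fun τ hτ => div_ne_zero
    (Finset.prod_ne_zero_iff.2 fun i _ => ww_ne_zero (im_cos_pos i hτ))
    (pow_ne_zero _ (ww_ne_zero hτ))
  have hd : ∀ τ : ℂ, 0 < τ.im → DifferentiableAt ℂ r τ := fun τ hτ => DifferentiableAt.div
    (DifferentiableAt.fun_finsetProd fun i _ =>
      differentiableAt_comp_cos (fun _ => differentiableAt_ww) i hτ)
    ((differentiableAt_ww hτ).pow _) (pow_ne_zero _ (ww_ne_zero hτ))
  have hT : ∀ τ : ℂ, 0 < τ.im → r (τ + 1) = r τ := fun τ hτ => by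
    simp only [hr, ww_T]
    rw [prod_T (f := fun i τ => ww (mob (crep p i) τ)) (fun i τ => ww_cos_T i) hτ]
  have hW : ∀ τ : ℂ, 0 < τ.im → r (Wt τ) = (r τ)⁻¹ := fun τ hτ => by
    simp only [hr]
    have h1 : ∏ i, ww (mob (crep p i) (Wt τ)) =
        (729 ^ (p + 1) * ∏ i, ww (mob (crep p i) τ))⁻¹ := by
      rw [prod_congr rfl fun i _ => ww_cos_W hp i hτ,
        Equiv.prod_comp (wI hp) fun i => 1 / (729 * ww (mob (crep p i) τ))]
      simp [prod_mul_distrib, mul_comm]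
    rw [h1, ww_Wt hτ, inv_div, div_pow, mul_pow, one_pow]
    field_simp
  have h0 := tendsto_prod_cos hp (by simpa [wser] using hasQ_ww)
    (constantCoeff_map_intCast constantCoeff_wu)
  have key := eq_zero_of_invariant (f := fun τ => r τ + (r τ)⁻¹ - 2)
    (fun τ hτ => ((hd τ hτ).add ((hd τ hτ).inv (hne τ hτ))).sub_const 2)
    (fun τ hτ => by simp only [hT τ hτ])
    (fun τ hτ => by simp only [hW τ hτ, inv_inv]; ring)
    (by have := (h0.add (h0.inv₀ one_ne_zero)).sub_const 2
        convert this using 2; norm_num) hτ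
  have h1 := hne τ hτ
  have h2 : (r τ - 1) ^ 2 = 0 := by
    have : (r τ - 1) ^ 2 = r τ * (r τ + (r τ)⁻¹ - 2) := by field_simp; ring
    rw [this, key, mul_zero]
  have h3 : r τ = 1 := sub_eq_zero.1 (pow_eq_zero_iff two_ne_zero |>.1 h2)
  exact (div_eq_one_iff_eq (pow_ne_zero _ (ww_ne_zero hτ))).1 h3

theorem FM_none (τ : ℂ) : FM (crep p none) τ = p ^ 6 * gg (mob (crep p none) τ) / gg τ := by
  rw [FM, det_cos, jf_none]; simp
theorem FM_some (b : ZMod p) (τ : ℂ) :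
    FM (crep p (some b)) τ = gg (mob (crep p (some b)) τ) / gg τ := by
  have : (p : ℂ) ≠ 0 := by exact_mod_cast (p_ne_zero (p := p))
  rw [FM, det_cos, jf_some, Int.cast_natCast, div_self (pow_ne_zero _ this), one_mul]

theorem differentiableAt_FM (i : Option (ZMod p)) (hτ : 0 < τ.im) :
    DifferentiableAt ℂ (FM (crep p i)) τ := by
  have h := differentiableAt_comp_cos (fun _ => differentiableAt_gg) i hτ
  have h2 := differentiableAt_gg hτ
  rcases i with _ | b
  · rw [show FM (crep p none) = _ from funext FM_none]
    exact (h.const_mul _).fun_div h2 (gg_ne_zero hτ)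
  · rw [show FM (crep p (some b)) = _ from funext (FM_some b)]
    exact h.fun_div h2 (gg_ne_zero hτ)

theorem prod_FM_cos (hp : 5 ≤ p) (hτ : 0 < τ.im) :
    ∏ i, FM (crep p i) τ = p ^ 6 := by
  have h0 := tendsto_prod_cos hp (by simpa [gser] using hasQ_gg)
    (constantCoeff_map_intCast constantCoeff_gu)
  have h1 : ∀ τ : ℂ, ∏ i, FM (crep p i) τ =
      p ^ 6 * ((∏ i, gg (mob (crep p i) τ)) / gg τ ^ (p + 1)) := fun τ => by
    rw [Fintype.prod_option, Fintype.prod_option, FM_none]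
    simp only [FM_some, prod_div_distrib, prod_const, card_univ, ZMod.card]
    rw [pow_succ' _ p, mul_div_assoc, mul_assoc, div_mul_div_comm]
  rw [← sub_eq_zero]
  refine eq_zero_of_invariant (f := fun τ => ∏ i, FM (crep p i) τ - p ^ 6)
    (fun τ hτ => (DifferentiableAt.fun_finsetProd fun i _ => differentiableAt_FM i hτ).sub_const _)
    (fun τ hτ => by rw [prod_T (f := fun i τ => FM (crep p i) τ) (fun i τ => FM_cos_T i) hτ])
    (fun τ hτ => by rw [prod_W hp (f := fun i τ => FM (crep p i) τ) (fun i τ => FM_cos_W hp i) hτ])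
    ?_ hτ
  simp only [h1]
  have := (h0.const_mul ((p : ℂ) ^ 6)).sub_const ((p : ℂ) ^ 6)
  rwa [mul_one, sub_self] at this

end Conj

section Descent
variable {R : Type*} [CommRing R] {ι : R →+* ℂ} {p : ℕ} [Fact p.Prime]

/-- An invariant function with a pole of bounded order, as a polynomial in the Hauptmodul whose
expansion is known. -/
theorem exists_poly_expand (hι : Function.Injective ι) (n : ℕ) {f : ℂ → ℂ} {Ψ : PowerSeries R}
    (hd : ∀ τ, 0 < τ.im → DifferentiableAt ℂ f τ)
    (hT : ∀ τ : ℂ, 0 < τ.im → f (τ + 1) = f τ) (hW : ∀ τ : ℂ, 0 < τ.im → f (Wt τ) = f τ)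
    (h : HasQ p (fun τ => ww τ ^ n * f τ) (Ψ.map ι)) :
    ∃ P : R[X], P.natDegree ≤ n ∧ P.coeff n = constCoeff Ψ ∧
      (∀ τ : ℂ, 0 < τ.im → f τ = P.eval₂ ι (xx τ)) ∧
      PowerSeries.expand p p_ne_zero (pev (wser.map (ιℤ R)) (hom n P)) = Ψ := by
  have h1 := h.descend p_ne_zero fun τ hτ => by rw [hT τ hτ, ww_T]
  obtain ⟨P, hP1, hP2, hP3⟩ := exists_poly ι n hd hT hW h1
  refine ⟨P, hP1, ?_, hP3, ?_⟩
  · rw [hP2, ← coeff_zero_eq_constantCoeff_apply, coeff_mk, mul_zero,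
      coeff_zero_eq_constantCoeff_apply]
  · have h2 := hasQ_pev ι (w := wser.map (ιℤ R)) (by rw [map_intCast]; exact hasQ_ww)
      (hom n P)
    have h3 : HasQ 1 (fun τ => ww τ ^ n * f τ)
        ((pev (wser.map (ιℤ R)) (hom n P)).map ι) := h2.congr (by
      filter_upwards [eventually_im_pos] with τ hτ
      rw [eval₂_hom_mul ι hP1 (xx_mul hτ), hP3 τ hτ])
    have h4 := h3.expand (N := p) p_ne_zero
    rw [mul_one] at h4
    have h5 := h4.unique p_ne_zero h
    rw [← map_expand] at h5
    exact PowerSeries.map_injective _ hι h5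

end Descent

section HomLemmas
variable {R : Type*} [CommRing R]

theorem hom_succ {n : ℕ} {P : R[X]} (h : P.natDegree ≤ n) : hom (n + 1) P = X * hom n P := by
  rw [hom, sum_range_succ, coeff_eq_zero_of_natDegree_lt (Nat.lt_succ_of_le h), C_0,
    zero_mul, zero_mul, add_zero, hom, Finset.mul_sum]
  refine sum_congr rfl fun i hi => ?_
  have : i < n + 1 := by simpa using hi
  rw [show n + 1 - i = (n - i) + 1 by omega, pow_succ]
  ring

theorem natDegree_le_of_X_pow_mul_hom [IsDomain R] {n m : ℕ} {P Q : R[X]} (h : P.natDegree ≤ n)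
    (hm : m ≤ n) (hP : hom n P = X ^ m * Q) : P.natDegree ≤ n - m := by
  induction m generalizing n with
  | zero => simpa using h
  | succ m ih =>
    obtain ⟨n, rfl⟩ : ∃ k, n = k + 1 := ⟨n - 1, by omega⟩
    have h0 : P.coeff (n + 1) = 0 := by
      rw [← coeff_zero_hom, hP, pow_succ', mul_assoc, coeff_X_mul_zero]
    have h1 : P.natDegree ≤ n := by
      rw [natDegree_le_iff_coeff_eq_zero] at h ⊢
      intro j hj
      rcases Nat.lt_or_ge (n + 1) j with h2 | h2
      · exact h j h2
      · rwa [show j = n + 1 by omega]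
    rw [hom_succ h1, pow_succ', mul_assoc] at hP
    have := ih h1 (by omega) (mul_left_cancel₀ X_ne_zero hP)
    omega

end HomLemmas

section Residue
variable {V : ValuationSubring ℂ} {p : ℕ} [Fact p.Prime]

theorem qq_one_mem : qq p 1 ∈ V := by
  refine mem_of_root (P := X ^ p - 1) (monic_X_pow_sub_C 1 p_ne_zero) ?_
  have := qq_mul_pow (N := p) (M := 1) p_ne_zero 1
  rw [mul_one] at this
  rw [eval₂_sub, eval₂_X_pow, eval₂_one, this, qq]
  simp [exp_two_pi_mul_I]

variable (V p) in
/-- A primitive root of unity in the valuation ring. -/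
def zet : V := ⟨qq p 1, qq_one_mem⟩

theorem residue_zet [CharP (ResidueField V) p] :
    residue V (zet V p) = 1 := by
  have h : zet V p ^ p = 1 := by
    apply Subtype.coe_injective
    have := qq_mul_pow (N := p) (M := 1) p_ne_zero 1
    rw [mul_one] at this
    push_cast
    rw [zet, this, qq]
    simp [exp_two_pi_mul_I]
  have h2 := congrArg (residue V) h
  rw [map_pow, map_one] at h2
  have h3 : (residue V (zet V p) - 1) ^ p = 0 := by
    rw [sub_pow_char, h2, one_pow, sub_self]
  exact sub_eq_zero.1 ((pow_eq_zero_iff p_ne_zero).1 h3)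

/-- The expansion of `w` over a ring. -/
abbrev wR (R : Type*) [CommRing R] : PowerSeries R := wser.map (ιℤ R)
/-- The expansion of `g` over a ring. -/
abbrev gR (R : Type*) [CommRing R] : PowerSeries R := gser.map (ιℤ R)
/-- The expansion of `w / g`. -/
def wgser : PowerSeries ℤ := wu * invOfUnit gu 1
/-- The expansion of `w / g` over a ring. -/
abbrev wgR (R : Type*) [CommRing R] : PowerSeries R := wgser.map (ιℤ R)

theorem wgR_mul (R : Type*) [CommRing R] : wgR R * gR R = wR R := by
  rw [← map_mul]
  congr 1
  rw [wgser, gser, wser, mul_assoc, mul_left_comm _ PowerSeries.X gu, mul_comm _ gu,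
    mul_invOfUnit _ _ (by simp [constantCoeff_gu]), mul_one, mul_comm]

theorem map_intCast' {R S : Type*} [CommRing R] [CommRing S] (f : R →+* S) (φ : PowerSeries ℤ) :
    (φ.map (ιℤ R)).map f = φ.map (ιℤ S) := by
  ext n; simp

theorem constantCoeff_wR (R : Type*) [CommRing R] : constCoeff (wR R) = 0 := by
  rw [wR, wser, map_mul, PowerSeries.map_X, map_mul, constantCoeff_X, zero_mul]

theorem wR_ne_zero (R : Type*) [CommRing R] [Nontrivial R] : wR R ≠ 0 := by
  intro h
  have := congrArg (PowerSeries.coeff 1) h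
  rw [wR, wser, map_mul, PowerSeries.map_X, ← zero_add 1, PowerSeries.coeff_succ_X_mul, map_zero,
    coeff_zero_eq_constantCoeff_apply, constantCoeff_map_intCast constantCoeff_wu] at this
  exact one_ne_zero this

theorem gR_ne_zero (R : Type*) [CommRing R] [Nontrivial R] : gR R ≠ 0 := by
  intro h
  apply wR_ne_zero R
  rw [← wgR_mul, h, mul_zero]

theorem HasQ.serV {f : ℂ → ℂ} {ψ : PowerSeries ℤ} (h : HasQ 1 f (ψ.map (ιℤ ℂ)))
    (i : Option (ZMod p)) : HasQ p (fun τ => f (mob (crep p i) τ))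
      ((serC (zet V p) (ψ.map (ιℤ V)) i).map V.subtype) := by
  rw [map_serC, map_intCast]
  exact h.cos i

theorem HasQ.expV {f : ℂ → ℂ} {ψ : PowerSeries ℤ} (h : HasQ 1 f (ψ.map (ιℤ ℂ))) :
    HasQ p f ((PowerSeries.expand p p_ne_zero (ψ.map (ιℤ V))).map V.subtype) := by
  rw [map_expand, map_intCast]
  have := h.expand (N := p) p_ne_zero
  rwa [mul_one] at this

theorem map_serC_residue [CharP (ResidueField V) p] (ψ : PowerSeries ℤ)
    (i : Option (ZMod p)) :
    (serC (zet V p) (ψ.map (ιℤ V)) i).map (residue V) =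
      if i = none then (ψ.map (ιℤ (ResidueField V)) ^ p) ^ p
      else ψ.map (ιℤ (ResidueField V)) := by
  rw [map_serC, map_intCast', residue_zet]
  rcases i with _ | b
  · rw [if_pos rfl, serC, expand_intCast, map_pow, expand_intCast]
  · rw [if_neg (by simp), serC, one_pow, PowerSeries.rescale_one]
    rfl

instance charP_powerSeries {k : Type*} [Field k] [CharP k p] : CharP (PowerSeries k) p :=
  charP_of_injective_ringHom (f := PowerSeries.C) PowerSeries.C_injective p

theorem intCast_pow_char {k : Type*} [Field k] [CharP k p] (n : ℤ) : (n : k) ^ p = n := by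
  have : ExpChar k p := ExpChar.prime Fact.out
  exact _root_.map_intCast (frobenius k p) n

/-- The polynomial whose roots are the values of `w` at the fixed points of the Fricke
involution composed with a correspondence of degree `p`. -/
theorem exists_ramification_poly (hp : 5 ≤ p) [CharP (ResidueField V) p] :
    ∃ P : V[X], P.natDegree ≤ 2 * (p + 1) ∧ P.coeff (2 * (p + 1)) = 27 ^ (2 * (p + 1)) ∧
      P.coeff 0 = 1 ∧
      (∀ τ : ℂ, 0 < τ.im → P.eval₂ V.subtype (ww τ) =
        ∏ i, (1 - 729 * ww τ * ww (mob (crep p i) τ))) ∧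
      P.map (residue V) = (1 - 729 * X ^ (p + 1)) ^ 2 := by
  obtain ⟨m, hm⟩ := (Fact.out : p.Prime).odd_of_ne_two (by omega)
  set k := ResidueField V
  set f : ℂ → ℂ := fun τ => ∏ i : Option (ZMod p), (1 / ww τ - 729 * ww (mob (crep p i) τ)) with hf
  set Ψ : PowerSeries V := ∏ i : Option (ZMod p), (1 - 729 * PowerSeries.expand p p_ne_zero (wR V) *
    serC (zet V p) (wR V) i) with hΨ
  have hmul : ∀ τ : ℂ, 0 < τ.im →
      ww τ ^ (p + 1) * f τ = ∏ i : Option (ZMod p), (1 - 729 * ww τ * ww (mob (crep p i) τ)) := by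
    intro τ hτ
    have hc : p + 1 = (univ : Finset (Option (ZMod p))).card := by simp
    rw [hf, hc, ← prod_const, ← prod_mul_distrib]
    refine prod_congr rfl fun i _ => ?_
    rw [mul_sub, mul_one_div_cancel (ww_ne_zero hτ)]; ring
  have hd : ∀ τ, 0 < τ.im → DifferentiableAt ℂ f τ := fun τ hτ =>
    DifferentiableAt.fun_finsetProd fun i _ =>
      ((differentiableAt_const 1).fun_div (differentiableAt_ww hτ) (ww_ne_zero hτ)).fun_sub
        ((differentiableAt_comp_cos (fun _ => differentiableAt_ww) i hτ).const_mul _)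
  have hT : ∀ τ : ℂ, 0 < τ.im → f (τ + 1) = f τ := fun τ hτ =>
    prod_T (f := fun i τ => 1 / ww τ - 729 * ww (mob (crep p i) τ))
      (fun i τ hτ => by simp only [ww_T, ww_cos_T i hτ]) hτ
  have hW : ∀ τ : ℂ, 0 < τ.im → f (Wt τ) = f τ := by
    intro τ hτ
    have h1 : f (Wt τ) = ∏ i, (1 / ww τ - 729 * ww (mob (crep p i) τ)) *
        (-ww τ / ww (mob (crep p i) τ)) := by
      rw [← Equiv.prod_comp (wI hp)]
      refine prod_congr rfl fun i _ => ?_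
      rw [ww_cos_W hp i hτ, ww_Wt hτ]
      have h1 := ww_ne_zero hτ
      have h2 := ww_ne_zero (im_cos_pos (wI hp i) hτ)
      field_simp
      ring
    have he : Even (p + 1) := ⟨m + 1, by omega⟩
    rw [h1, prod_mul_distrib, prod_div_distrib, prod_ww_cos hp hτ, prod_const]
    simp only [card_univ, Fintype.card_option, ZMod.card]
    rw [he.neg_pow, div_self (pow_ne_zero _ (ww_ne_zero hτ)), mul_one]
  have hQ : HasQ p (fun τ => ww τ ^ (p + 1) * f τ) (Ψ.map V.subtype) := by
    refine HasQ.congr (f := fun τ => ∏ i, (1 - 729 * ww τ * ww (mob (crep p i) τ))) ?_ ?_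
    · rw [hΨ, map_prod]
      refine HasQ.prod _ fun i _ => ?_
      simp only [map_sub, map_one, map_mul, map_ofNat]
      refine HasQ.one.sub (HasQ.mul ?_ (HasQ.serV hasQ_ww i))
      have := (hasQ_ww.expV (p := p) (V := V)).const_mul 729
      rwa [map_ofNat] at this
    · filter_upwards [eventually_im_pos] with τ hτ
      exact (hmul τ hτ).symm
  obtain ⟨P, hP1, hP2, hP3, hP4⟩ := exists_poly_expand V.subtype_injective (p + 1) hd hT hW hQ
  have hc1 : P.coeff (p + 1) = 1 := by
    rw [hP2, hΨ, map_prod]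
    refine Finset.prod_eq_one fun i _ => ?_
    rw [map_sub, map_mul, constantCoeff_serC, constantCoeff_wR, mul_zero, map_one, sub_zero]
  refine ⟨hom (p + 1) P, natDegree_hom _ _, ?_, ?_, fun τ hτ => ?_, ?_⟩
  · rw [coeff_top_hom, hc1, one_mul]
  · rw [coeff_zero_hom, hc1]
  · rw [eval₂_hom_mul _ hP1 (xx_mul hτ), ← hP3 τ hτ, hmul τ hτ]
  · refine pev_injective (constantCoeff_wR k) (wR_ne_zero k) (expand_injective (p_ne_zero (p := p)) ?_)
    have h1 := congrArg (PowerSeries.map (residue V)) hP4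
    rw [map_expand, map_pev, map_intCast'] at h1
    rw [h1, hΨ, map_prod, Fintype.prod_option]
    simp only [map_sub, map_one, map_mul, map_ofNat, map_serC_residue, map_expand, map_intCast',
      expand_intCast, if_true, reduceCtorEq, if_false, prod_const, card_univ,
      ZMod.card]
    have h729 : (729 : PowerSeries k) ^ p = 729 := by
      have : (PowerSeries.C ((729 : ℤ) : k)) ^ p = PowerSeries.C ((729 : ℤ) : k) := by
        rw [← map_pow, intCast_pow_char]
      have e : PowerSeries.C ((729 : ℤ) : k) = (729 : PowerSeries k) := by
        rw [Int.cast_ofNat, map_ofNat]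
      rwa [e] at this
    rw [sub_pow_char, one_pow, mul_pow, mul_pow, h729]
    have h2 : pev (wR k) ((1 - 729 * X ^ (p + 1)) ^ 2) = (1 - 729 * wR k ^ (p + 1)) ^ 2 := by
      rw [pev, eval₂_pow, eval₂_sub, eval₂_mul, eval₂_X_pow, eval₂_one, eval₂_ofNat]
    rw [h2, map_pow, map_sub, map_mul, map_pow, expand_intCast, map_ofNat, map_one]
    ring

end Residue

section Residue
variable {V : ValuationSubring ℂ} {p : ℕ} [Fact p.Prime]

theorem hasQ_wg : HasQ 1 (fun τ => ww τ / gg τ) (wgR ℂ) := by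
  rw [wgR, wgser, map_mul]
  refine HasQ.div_unit constantCoeff_gu hasQ_gg ?_
  have := hasQ_ww
  rwa [wser, map_mul, PowerSeries.map_X] at this

/-- The expansion of `w F_α`. -/
def serF (V : ValuationSubring ℂ) (i : Option (ZMod p)) : PowerSeries V :=
  PowerSeries.C (if i = none then (p : V) ^ 6 else 1) *
    (PowerSeries.expand p p_ne_zero (wgR V) * serC (zet V p) (gR V) i)

theorem hasQ_serF (i : Option (ZMod p)) :
    HasQ p (fun τ => ww τ * FM (crep p i) τ) ((serF V i).map V.subtype) := by
  have h := ((hasQ_wg.expV (p := p) (V := V)).mul (hasQ_gg.serV (V := V) i)).const_mul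
    (V.subtype (if i = none then (p : V) ^ 6 else 1))
  have h2 : (serF V i).map V.subtype =
    PowerSeries.C (V.subtype (if i = none then (p : V) ^ 6 else 1)) *
    ((PowerSeries.expand p p_ne_zero (wgR V)).map V.subtype *
      (serC (zet V p) (gR V) i).map V.subtype) := by
    rw [serF, map_mul, map_mul, PowerSeries.map_C]
  rw [h2]
  refine h.congr (Eventually.of_forall fun τ => ?_)
  rcases i with _ | b
  · rw [FM_none, if_pos rfl, map_pow, map_natCast]; ring
  · rw [FM_some, if_neg (by simp), map_one]; ring

/-- Generating polynomial of the expansions. -/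
def polF (V : ValuationSubring ℂ) (p : ℕ) [Fact p.Prime] : (PowerSeries V)[X] :=
  ∏ i : Option (ZMod p), (C (PowerSeries.expand p p_ne_zero (wR V)) * X - C (serF V i))

theorem hasQ_polF (j : ℕ) : HasQ p
    (fun τ => ww τ ^ (p + 1) * (∏ i, (X - C (FM (crep p i) τ))).coeff j)
    (((polF V p).coeff j).map V.subtype) := by
  have h := HasQP.prod (univ : Finset (Option (ZMod p))) fun i =>
    HasQP.linear (hasQ_ww.expV (p := p) (V := V)) (hasQ_serF (V := V) i)
  have h2 := h j
  have e : ((polF V p).coeff j).map V.subtype = (∏ i : Option (ZMod p),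
      (C ((PowerSeries.expand p p_ne_zero (wR V)).map V.subtype) * X -
        C ((serF V i).map V.subtype))).coeff j := by
    rw [← coeff_map, polF, Polynomial.map_prod]
    simp
  rw [e]
  refine h2.congr (Eventually.of_forall fun τ => ?_)
  have hc : p + 1 = (univ : Finset (Option (ZMod p))).card := by simp
  rw [← coeff_C_mul, C_pow, hc, ← prod_const, ← prod_mul_distrib]
  simp only [mul_sub, C_mul]

variable [CharP (ResidueField V) p]

theorem map_polF : (polF V p).map (PowerSeries.map (residue V)) =
    C (wR (ResidueField V) ^ p) ^ (p + 1) * X ^ (p + 1) -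
    C (wR (ResidueField V) ^ p *
      (wgR (ResidueField V) ^ p * gR (ResidueField V)) ^ p) * X := by
  set k := ResidueField V
  have hp0 : (p : k) = 0 := CharP.cast_eq_zero k p
  rw [polF, Polynomial.map_prod, Fintype.prod_option]
  have h1 : (serF (p := p) V none).map (residue V) = 0 := by
    rw [serF, map_mul, PowerSeries.map_C, if_pos rfl, map_pow, map_natCast, hp0,
      zero_pow (by norm_num), map_zero, zero_mul]
  have h2 : ∀ b : ZMod p, (serF V (some b)).map (residue V) = wgR k ^ p * gR k := by
    intro b
    rw [serF, map_mul, PowerSeries.map_C, if_neg (by simp), map_one, map_one, one_mul, map_mul,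
      map_expand, map_intCast', expand_intCast, map_serC_residue, if_neg (by simp)]
  simp only [Polynomial.map_sub, Polynomial.map_mul, map_C, map_X, h1, h2, map_expand, map_intCast',
    expand_intCast, map_zero, sub_zero, prod_const, card_univ, ZMod.card]
  rw [sub_pow_char, mul_pow]
  simp only [C_mul, C_pow]
  ring

theorem coeff_map_polF (j : ℕ) : ((polF V p).coeff j).map (residue V) =
    (if j = p + 1 then (wR (ResidueField V) ^ p) ^ (p + 1) else 0) -
    if j = 1 then wR (ResidueField V) ^ p *
      (wgR (ResidueField V) ^ p * gR (ResidueField V)) ^ p else 0 := by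
  have h := congrArg (fun P => P.coeff j) (map_polF (V := V) (p := p))
  simp only [coeff_map, coeff_sub] at h
  rw [h, ← C_pow, coeff_C_mul, coeff_C_mul, coeff_X_pow, coeff_X, mul_ite, mul_one, mul_zero,
    mul_ite, mul_one, mul_zero]
  simp only [eq_comm (a := 1)]

theorem exists_ne_zero_root {k : Type*} [Field k] [IsAlgClosed k] (h27 : (27 : k) ≠ 0) (x : k) :
    ∃ w : k, w ≠ 0 ∧ w * x = (1 + 27 * w) ^ 2 := by
  have hd : (C (27 ^ 2) * X ^ 2 + C (54 - x) * X + C 1 : k[X]).degree = 2 :=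
    degree_quadratic (pow_ne_zero 2 h27)
  obtain ⟨w, hw⟩ := IsAlgClosed.exists_root (C (27 ^ 2) * X ^ 2 + C (54 - x) * X + C 1 : k[X])
    (by rw [hd]; norm_num)
  simp only [IsRoot, eval_add, eval_mul, eval_C, eval_pow, eval_X] at hw
  refine ⟨w, ?_, by linear_combination -hw⟩
  rintro rfl
  simp at hw

theorem coe_ne_zero_of_char {k : Type*} [Field k] (hp : 5 ≤ p) [CharP k p] : (3 : k) ≠ 0 := by
  have : ((3 : ℕ) : k) ≠ 0 := by
    rw [Ne, CharP.cast_eq_zero_iff k p]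
    exact fun h => absurd (Nat.le_of_dvd (by norm_num) h) (by omega)
  simpa using this

theorem differentiableAt_coeff_prod {ι : Type*} (s : Finset ι) {f : ι → ℂ → ℂ}
    (h : ∀ i ∈ s, DifferentiableAt ℂ (f i) τ) (j : ℕ) :
    DifferentiableAt ℂ (fun τ => (∏ i ∈ s, (X - C (f i τ))).coeff j) τ := by
  classical
  induction s using Finset.induction_on generalizing j with
  | empty => simp
  | insert a s ha ih =>
    have h1 := fun j => ih (fun i hi => h i (Finset.mem_insert_of_mem hi)) j
    have h2 := h a (Finset.mem_insert_self _ _)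
    simp only [prod_insert ha, sub_mul, coeff_sub, coeff_C_mul]
    refine .fun_sub ?_ (h2.fun_mul (h1 j))
    rcases j with _ | j
    · simp
    · simpa only [coeff_X_mul] using h1 j

end Residue

section Residue
variable {V : ValuationSubring ℂ} {p : ℕ} [Fact p.Prime]

theorem exists_coeff_poly (hp : 5 ≤ p) (j : ℕ) : ∃ Q : V[X], Q.natDegree ≤ p + 1 ∧
    (∀ τ : ℂ, 0 < τ.im →
      (∏ i, (X - C (FM (crep p i) τ))).coeff j = Q.eval₂ V.subtype (xx τ)) ∧
    PowerSeries.expand p p_ne_zero (pev (wR V) (hom (p + 1) Q)) = (polF V p).coeff j := by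
  obtain ⟨Q, h1, _, h2, h3⟩ := exists_poly_expand (p := p) V.subtype_injective (p + 1)
    (f := fun τ => (∏ i, (X - C (FM (crep p i) τ))).coeff j) (Ψ := (polF V p).coeff j)
    (fun τ hτ => differentiableAt_coeff_prod _ (fun i _ => differentiableAt_FM i hτ) j)
    (fun τ hτ => congrArg (fun P => P.coeff j)
      (prod_T (f := fun i τ => X - C (FM (crep p i) τ))
        (fun i τ hτ => by simp only [FM_cos_T i hτ]) hτ))
    (fun τ hτ => congrArg (fun P => P.coeff j)
      (prod_W hp (f := fun i τ => X - C (FM (crep p i) τ))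
        (fun i τ hτ => by simp only [FM_cos_W hp i hτ]) hτ))
    (hasQ_polF j)
  exact ⟨Q, h1, h2, h3⟩

theorem X_sq_dvd_hom {k : Type*} [Field k] {S : k[X]}
    (h : pev (wR k) (hom (p + 1) S) = wR k * (wgR k ^ p * gR k)) :
    ∃ Q, hom (p + 1) S = X ^ 2 * Q := by
  have hw := constantCoeff_wR k
  have hg : constCoeff (gR k) = 0 := by
    rw [gR, gser, map_mul, PowerSeries.map_X, map_mul, constantCoeff_X, zero_mul]
  have h0 : (hom (p + 1) S).coeff 0 = 0 := by
    rw [← coeff_zero_pev hw, h, map_mul, hw, zero_mul]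
  obtain ⟨Q, hQ⟩ := X_dvd_iff.2 h0
  have h1 : pev (wR k) Q = wgR k ^ p * gR k := by
    rw [hQ, pev_mul, ← pow_one X, pev_X_pow, pow_one] at h
    exact mul_left_cancel₀ (wR_ne_zero k) h
  have h2 : Q.coeff 0 = 0 := by rw [← coeff_zero_pev hw, h1, map_mul, hg, mul_zero]
  obtain ⟨Q', hQ'⟩ := X_dvd_iff.2 h2
  exact ⟨Q', by rw [hQ, hQ']; ring⟩

/-- The mod `p` reduction of the symmetric functions of the `F_α`. -/
theorem exists_S (hp : 5 ≤ p) [CharP (ResidueField V) p] :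
    ∃ S : (ResidueField V)[X], S ≠ 0 ∧ S.natDegree ≤ p - 1 ∧
      gR (ResidueField V) ^ (p - 1) *
        pev (wR (ResidueField V)) (hom (p + 1) S) =
          wR (ResidueField V) ^ (p + 1) ∧
      ∀ (τ : ℂ) (x : V), 0 < τ.im → (x : ℂ) = xx τ → ∃ F : Option (ZMod p) → V,
        (∀ i, (F i : ℂ) = FM (crep p i) τ) ∧
        ∏ i, (X - C (residue V (F i))) =
          X ^ (p + 1) - C (S.eval (residue V x)) * X := by
  set k := ResidueField V
  choose Q hQ1 hQ2 hQ3 using exists_coeff_poly (V := V) (p := p) hp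
  have hred : ∀ j, PowerSeries.expand p p_ne_zero
      (pev (wR k) (hom (p + 1) ((Q j).map (residue V)))) =
      ((polF V p).coeff j).map (residue V) := by
    intro j
    rw [← hQ3 j, map_expand, map_pev, map_intCast', hom_map]
  set S := -((Q 1).map (residue V)) with hS
  have hpS : pev (wR k) (hom (p + 1) S) = wR k * (wgR k ^ p * gR k) := by
    refine expand_injective (p_ne_zero (p := p)) ?_
    have h1 := hred 1
    rw [coeff_map_polF, if_neg (by omega), if_pos rfl, zero_sub] at h1
    have h2 : hom (p + 1) S = -hom (p + 1) ((Q 1).map (residue V)) := by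
      simp [hS, hom]
    have h3 : pev (wR k) (-hom (p + 1) ((Q 1).map (residue V))) =
        -pev (wR k) (hom (p + 1) ((Q 1).map (residue V))) := eval₂_neg _
    rw [h2, h3, map_neg, h1, neg_neg, map_mul, map_mul, map_pow, expand_intCast, expand_intCast,
      expand_intCast, mul_pow]
  have hSd : S.natDegree ≤ p + 1 := by
    rw [hS, natDegree_neg]
    exact natDegree_map_le.trans (hQ1 1)
  have hS0 : S ≠ 0 := by
    intro h0
    have h1 : wgR k ≠ 0 := by
      intro h
      apply wR_ne_zero k
      rw [← wgR_mul, h, zero_mul]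
    have h2 : pev (wR k) (hom (p + 1) S) = 0 := by simp [h0, hom, pev]
    rw [hpS] at h2
    exact mul_ne_zero (wR_ne_zero k) (mul_ne_zero (pow_ne_zero _ h1) (gR_ne_zero k)) h2
  obtain ⟨H, hH⟩ := X_sq_dvd_hom hpS
  refine ⟨S, hS0, ?_, ?_, fun τ x hτ hx => ?_⟩
  · have := natDegree_le_of_X_pow_mul_hom hSd (by omega) hH
    omega
  · obtain ⟨m, rfl⟩ : ∃ m, p = m + 1 := ⟨p - 1, by omega⟩
    rw [hpS, Nat.add_sub_cancel, ← wgR_mul k]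
    ring
  set P : ℂ[X] := ∏ i, (X - C (FM (crep p i) τ)) with hP
  have hPm : P.Monic := monic_prod_of_monic _ _ fun i _ => monic_X_sub_C _
  have hPj : ∀ j, P.coeff j = V.subtype ((Q j).eval x) := by
    intro j
    rw [hP, hQ2 j τ hτ, ← hx]
    exact Polynomial.eval₂_at_apply V.subtype x
  obtain ⟨R, hR1, hR2, hR3⟩ := lifts_and_natDegree_eq_and_monic (f := V.subtype)
    ((lifts_iff_coeff_lifts P).2 fun j => ⟨_, (hPj j).symm⟩) hPm
  have hmem : ∀ i, FM (crep p i) τ ∈ V := by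
    intro i
    refine mem_of_root hR3 ?_
    rw [← eval_map, hR1, hP, eval_prod]
    exact prod_eq_zero (mem_univ i) (by simp)
  refine ⟨fun i => ⟨_, hmem i⟩, fun i => rfl, ?_⟩
  have hR4 : R = ∏ i, (X - C (⟨_, hmem i⟩ : V)) := by
    refine map_injective V.subtype V.subtype_injective ?_
    rw [hR1, hP, Polynomial.map_prod]
    refine prod_congr rfl fun i _ => ?_
    rw [Polynomial.map_sub, map_X, map_C]
    rfl
  have h5 : ∏ i, (X - C (residue V (⟨_, hmem i⟩ : V))) =
      R.map (residue V) := by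
    rw [hR4, Polynomial.map_prod]
    refine prod_congr rfl fun i _ => ?_
    rw [Polynomial.map_sub, map_X, map_C]
  rw [h5]
  ext j
  have hRj : R.coeff j = (Q j).eval x := by
    apply V.subtype_injective
    rw [← hPj j, ← hR1, coeff_map]
  have h3 := coe_ne_zero_of_char (p := p) (k := k) hp
  have h27 : (27 : k) ≠ 0 := by
    have : (27 : k) = 3 ^ 3 := by norm_num
    rw [this]; exact pow_ne_zero 3 h3
  obtain ⟨w, hw0, hw⟩ := exists_ne_zero_root h27 (residue V x)
  have hkey : ∀ (A : k[X]) (hA : A.natDegree ≤ p + 1), hom (p + 1) A = 0 →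
      A.eval (residue V x) = 0 := by
    intro A hA h
    have := eval₂_hom_mul (RingHom.id k) hA hw
    rw [h, eval₂_zero] at this
    exact (mul_eq_zero.1 this.symm).resolve_left (pow_ne_zero _ hw0)
  have hres : residue V ((Q j).eval x) =
      ((Q j).map (residue V)).eval (residue V x) := by
    rw [eval_map, Polynomial.eval₂_at_apply]
  rw [coeff_map, hRj, hres, coeff_sub, coeff_C_mul, coeff_X_pow, coeff_X]
  have hpi := fun A B => pev_injective (constantCoeff_wR k) (wR_ne_zero k) (P := A) (Q := B)
  by_cases hj1 : j = 1
  · subst hj1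
    rw [if_neg (by omega), if_pos rfl, hS]
    simp
  rw [if_neg (show ¬(1 = j) from Ne.symm hj1), mul_zero, sub_zero]
  by_cases hjp : j = p + 1
  · rw [if_pos hjp]
    have hd : ((Q j).map (residue V) - 1).natDegree ≤ p + 1 :=
      (natDegree_sub_le _ _).trans (max_le (natDegree_map_le.trans (hQ1 j)) (by simp))
    have := hkey _ hd ?_
    · rw [eval_sub, eval_one, sub_eq_zero] at this
      exact this
    have e1 : hom (p + 1) ((Q j).map (residue V) - 1) =
        hom (p + 1) ((Q j).map (residue V)) - X ^ (p + 1) := by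
      have : (X : k[X]) ^ (p + 1) = hom (p + 1) 1 := by
        rw [hom, sum_eq_single 0]
        · simp
        · intro i _ hi; simp [coeff_one, hi]
        · simp
      rw [this]
      simp only [hom, coeff_sub, C_sub, sub_mul, Finset.sum_sub_distrib]
    rw [e1, sub_eq_zero]
    refine hpi _ _ (expand_injective (p_ne_zero (p := p)) ?_)
    rw [hred, coeff_map_polF, if_pos hjp, if_neg hj1, sub_zero, pev_X_pow, map_pow, expand_intCast]
  · rw [if_neg hjp]
    refine hkey _ (natDegree_map_le.trans (hQ1 j)) ?_
    refine hpi _ _ (expand_injective (p_ne_zero (p := p)) ?_)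
    rw [hred, coeff_map_polF, if_neg hjp, if_neg hj1, sub_zero, pev, eval₂_zero, map_zero]

end Residue

section Hyp
variable {p : ℕ} [Fact p.Prime]

/-- Coefficients of the truncated hypergeometric series with parameters `-m, β; 1`. -/
def hypC (p : ℕ) [Fact p.Prime] (m : ℕ) (β c : ZMod p) (n : ℕ) : ZMod p :=
  poch p (-(m : ZMod p)) n * poch p β n / ((n.factorial : ZMod p)) ^ 2 * c ^ n

/-- The reversed truncated hypergeometric polynomial. -/
def hypP (p : ℕ) [Fact p.Prime] (m : ℕ) (β c : ZMod p) : (ZMod p)[X] :=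
  ∑ n ∈ range (m + 1), C (hypC p m β c n) * X ^ (m - n)

theorem poch_succ (x : ZMod p) (n : ℕ) : poch p x (n + 1) = poch p x n * (x + n) := by
  rw [poch, poch, ascPochhammer_succ_right, eval_mul]
  simp

theorem hypC_zero (m : ℕ) (β c : ZMod p) : hypC p m β c 0 = 1 := by
  simp [hypC, poch]

theorem hypC_succ {m n : ℕ} (hn : n + 1 < p) (β c : ZMod p) :
    hypC p m β c (n + 1) * ((n : ZMod p) + 1) ^ 2 =
      c * ((n : ZMod p) - m) * (β + n) * hypC p m β c n := by
  have h1 : (((n + 1 : ℕ)) : ZMod p) ≠ 0 := by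
    rw [Ne, ZMod.natCast_eq_zero_iff]
    exact fun h => absurd (Nat.le_of_dvd (by omega) h) (by omega)
  have h2 : ((n.factorial : ℕ) : ZMod p) ≠ 0 := by
    rw [Ne, ZMod.natCast_eq_zero_iff, (Fact.out : p.Prime).dvd_factorial]
    omega
  rw [hypC, hypC, poch_succ, poch_succ, Nat.factorial_succ]
  push_cast at h1 ⊢
  field_simp
  ring

theorem coeff_hypP (m : ℕ) (β c : ZMod p) (j : ℕ) :
    (hypP p m β c).coeff j = if j ≤ m then hypC p m β c (m - j) else 0 := by
  rw [hypP, finsetSum_coeff]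
  simp only [coeff_C_mul, coeff_X_pow, mul_ite, mul_one, mul_zero]
  split_ifs with h
  · rw [sum_eq_single (m - j)]
    · rw [if_pos (by omega)]
    · intro n hn hne
      have : n ≤ m := by simpa [Nat.lt_succ_iff] using hn
      rw [if_neg (by omega)]
    · intro hn
      exact absurd (mem_range.2 (by omega)) hn
  · refine Finset.sum_eq_zero fun n _ => if_neg (by omega)

theorem natDegree_hypP_le (m : ℕ) (β c : ZMod p) : (hypP p m β c).natDegree ≤ m := by
  refine natDegree_le_iff_coeff_eq_zero.2 fun n hn => ?_
  rw [coeff_hypP, if_neg (by omega)]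

theorem coeff_top_hypP (m : ℕ) (β c : ZMod p) : (hypP p m β c).coeff m = 1 := by
  rw [coeff_hypP, if_pos le_rfl, Nat.sub_self, hypC_zero]

theorem hypP_ne_zero (m : ℕ) (β c : ZMod p) : hypP p m β c ≠ 0 := by
  intro h
  have := coeff_top_hypP m β c
  rw [h, coeff_zero] at this
  exact zero_ne_one this

/-- The Euler operator. -/
def Eu {R : Type*} [CommRing R] (P : R[X]) : R[X] := X * derivative P

theorem coeff_Eu {R : Type*} [CommRing R] (P : R[X]) (j : ℕ) : (Eu P).coeff j = j * P.coeff j := by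
  rcases j with _ | j
  · simp [Eu]
  · rw [Eu, coeff_X_mul, coeff_derivative]; push_cast; ring

theorem map_Eu {R S : Type*} [CommRing R] [CommRing S] (f : R →+* S) (P : R[X]) :
    (Eu P).map f = Eu (P.map f) := by
  simp [Eu, derivative_map]

theorem natDegree_Eu {R : Type*} [CommRing R] {P : R[X]} {n : ℕ} (h : P.natDegree ≤ n) :
    (Eu P).natDegree ≤ n := by
  refine natDegree_le_iff_coeff_eq_zero.2 fun j hj => ?_
  rw [coeff_Eu, coeff_eq_zero_of_natDegree_lt (by omega), mul_zero]

theorem hypP_ode {m : ℕ} (hm : m < p) (β c : ZMod p) :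
    X * (Eu (Eu (hypP p m β c)) - C (2 * (m : ZMod p)) * Eu (hypP p m β c) +
      C ((m : ZMod p) ^ 2) * hypP p m β c) =
    C c * (Eu (Eu (hypP p m β c)) - C (m + β) * Eu (hypP p m β c)) := by
  ext j
  rcases j with _ | j
  · simp [coeff_Eu]
  simp only [coeff_X_mul, coeff_add, coeff_sub, coeff_C_mul, coeff_Eu, coeff_hypP]
  rcases lt_trichotomy j m with h | h | h
  · obtain ⟨n, rfl⟩ : ∃ n, m = j + 1 + n := ⟨m - (j + 1), by omega⟩
    rw [if_pos (by omega), if_pos (by omega), show j + 1 + n - j = n + 1 by omega,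
      show j + 1 + n - (j + 1) = n by omega]
    have h := hypC_succ (p := p) (m := j + 1 + n) (n := n) (by omega) β c
    push_cast at h ⊢
    linear_combination h
  · subst h
    rw [if_pos le_rfl, if_neg (by omega)]
    ring
  · rw [if_neg (by omega), if_neg (by omega)]; ring

end Hyp

section HomLemmas
variable {R : Type*} [CommRing R]

theorem hom_add (n : ℕ) (P Q : R[X]) : hom n (P + Q) = hom n P + hom n Q := by
  simp only [hom, coeff_add, C_add, add_mul, sum_add_distrib]
theorem hom_neg (n : ℕ) (P : R[X]) : hom n (-P) = -hom n P := by
  simp only [hom, coeff_neg, C_neg, neg_mul, Finset.sum_neg_distrib]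
theorem hom_sub (n : ℕ) (P Q : R[X]) : hom n (P - Q) = hom n P - hom n Q := by
  rw [sub_eq_add_neg, hom_add, hom_neg, sub_eq_add_neg]
theorem hom_C_mul (n : ℕ) (c : R) (P : R[X]) : hom n (C c * P) = C c * hom n P := by
  simp only [hom, coeff_C_mul, C_mul, Finset.mul_sum, mul_assoc]

theorem X_mul_derivative_hom (n : ℕ) (P : R[X]) :
    (1 + C 27 * X) * (X * derivative (hom n P)) =
      (n : R[X]) * (1 + C 27 * X) * hom n P + (C 27 * X - 1) * hom n (Eu P) := by
  have h27 : (C (27 : R) : R[X]) = 27 := map_ofNat C 27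
  simp only [hom, derivative_sum, Finset.mul_sum, coeff_Eu, ← sum_add_distrib]
  refine sum_congr rfl fun i hi => ?_
  obtain ⟨j, rfl⟩ : ∃ j, n = i + j := ⟨n - i, by have := mem_range.1 hi; omega⟩
  rw [Nat.add_sub_cancel_left, h27]
  have e : ∀ (j : ℕ), (X : R[X]) * derivative (X ^ j) = (j : R[X]) * X ^ j := by
    intro j
    rcases j with _ | j
    · simp
    · rw [derivative_X_pow]; push_cast; simp; ring
  have e2 : (1 + 27 * X : R[X]) * derivative ((1 + 27 * X) ^ (2 * i)) =
      54 * (i : R[X]) * (1 + 27 * X) ^ (2 * i) := by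
    rcases i with _ | i
    · simp
    · rw [derivative_pow]
      have : derivative (1 + 27 * X : R[X]) = 27 := by
        rw [← h27]; simp
      rw [this, show 2 * (i + 1) = 2 * i + 1 + 1 by ring]
      simp only [Nat.add_sub_cancel, map_natCast]
      push_cast
      ring
  simp only [derivative_mul, derivative_C, C_mul, map_natCast]
  push_cast
  linear_combination (C (P.coeff i) * (1 + 27 * X) * (1 + 27 * X) ^ (2 * i)) * e j +
    C (P.coeff i) * X * X ^ j * e2

theorem hom_X_mul (n : ℕ) (P : R[X]) : hom (n + 1) (X * P) = (1 + C 27 * X) ^ 2 * hom n P := by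
  rw [hom, hom, Finset.sum_range_succ', Finset.mul_sum]
  simp only [coeff_X_mul, coeff_X_mul_zero, C_0, zero_mul, add_zero]
  refine sum_congr rfl fun i _ => ?_
  rw [Nat.add_sub_add_right]
  ring

theorem hom_succ' {n : ℕ} {P : R[X]} (h : P.natDegree ≤ n) : hom (n + 1) P = X * hom n P := by
  rw [hom, hom, sum_range_succ, coeff_eq_zero_of_natDegree_lt (by omega), Finset.mul_sum]
  simp only [C_0, zero_mul, add_zero]
  refine sum_congr rfl fun i hi => ?_
  rw [show n + 1 - i = (n - i) + 1 by have := mem_range.1 hi; omega]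
  ring

end HomLemmas

section HomField
variable {k : Type*} [Field k] [IsAlgClosed k]

theorem hom_mul_hom {n m : ℕ} {P Q : k[X]} (hP : P.natDegree ≤ n) (hQ : Q.natDegree ≤ m) :
    hom n P * hom m Q = hom (n + m) (P * Q) := by
  have hf := IsAlgClosed.instInfinite (K := k)
  refine Polynomial.eq_of_infinite_eval_eq _ _ ((Set.finite_singleton (0 : k)).infinite_compl.mono ?_)
  intro w hw
  have hw : w ≠ 0 := hw
  have hx : w * ((1 + 27 * w) ^ 2 / w) = (1 + 27 * w) ^ 2 := mul_div_cancel₀ _ hw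
  have h1 := eval₂_hom_mul (RingHom.id k) hP hx
  have h2 := eval₂_hom_mul (RingHom.id k) hQ hx
  have h3 := eval₂_hom_mul (RingHom.id k) (natDegree_mul_le.trans (add_le_add hP hQ)) hx
  simp only [eval₂_id] at h1 h2 h3
  change eval w _ = eval w _
  rw [eval_mul, h1, h2, h3, eval_mul, pow_add]
  ring

theorem hom_injective (h27 : (27 : k) ≠ 0) {n : ℕ} {P : k[X]} (hP : P.natDegree ≤ n)
    (h : hom n P = 0) : P = 0 := by
  have hf := IsAlgClosed.instInfinite (K := k)
  refine Polynomial.eq_zero_of_infinite_isRoot _ (Set.infinite_univ.mono fun x _ => ?_)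
  obtain ⟨w, hw0, hw⟩ := exists_ne_zero_root h27 x
  have := eval₂_hom_mul (RingHom.id k) hP hw
  rw [h, eval₂_zero, eval₂_id] at this
  exact (mul_eq_zero.1 this.symm).resolve_left (pow_ne_zero _ hw0)

end HomField

section Theta
variable {k : Type*} [Field k]

/-- The derivation `q d/dq`. -/
def Th (k : Type*) [Field k] : Derivation k (PowerSeries k) (PowerSeries k) :=
  (PowerSeries.X : PowerSeries k) • PowerSeries.derivative k

theorem Th_apply (φ : PowerSeries k) : Th k φ = PowerSeries.X * PowerSeries.derivative k φ := rfl

theorem coeff_Th (φ : PowerSeries k) (n : ℕ) :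
    PowerSeries.coeff n (Th k φ) = n * PowerSeries.coeff n φ := by
  rw [Th_apply]
  rcases n with _ | n
  · simp
  · rw [PowerSeries.coeff_succ_X_mul, PowerSeries.coeff_derivative]; push_cast; ring

theorem Th_mul (φ ψ : PowerSeries k) : Th k (φ * ψ) = φ * Th k ψ + ψ * Th k φ := by
  rw [Derivation.leibniz, smul_eq_mul, smul_eq_mul]

/-- The expansion of `a` over a field. -/
abbrev aR (k : Type*) [Field k] : PowerSeries k := aser.map (ιℤ k)
/-- The expansion of `s` over a field. -/
abbrev sR (k : Type*) [Field k] : PowerSeries k := sser.map (ιℤ k)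

theorem Th_w : Th k (wR k) = aR k * wR k := by
  have := congrArg (PowerSeries.map (ιℤ k)) X_mul_derivative_wser
  rwa [map_mul, map_mul, PowerSeries.map_X, map_derivative] at this
theorem Th_g : Th k (gR k) = sR k * gR k := by
  have := congrArg (PowerSeries.map (ιℤ k)) X_mul_derivative_gser
  rwa [map_mul, map_mul, PowerSeries.map_X, map_derivative] at this
theorem Th_s : 6 * Th k (sR k) = sR k ^ 2 - aR k ^ 2 := by
  have := congrArg (PowerSeries.map (ιℤ k)) derivative_sser
  rwa [map_mul, map_mul, map_sub, map_pow, map_pow, PowerSeries.map_X, map_derivative,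
    map_ofNat] at this
theorem aR_pow_three : wR k * aR k ^ 3 = gR k * (1 + 27 * wR k) ^ 2 := by
  have := congrArg (PowerSeries.map (ιℤ k)) aser_pow_three
  rwa [map_mul, map_mul, map_pow, map_pow, map_add, map_one, map_mul, map_ofNat] at this
theorem aR_ne_zero : aR k ≠ 0 := by
  intro h
  have := congrArg constCoeff h
  rw [aR, constantCoeff_map_intCast constantCoeff_aser, map_zero] at this
  exact one_ne_zero this

theorem Th_pow (φ : PowerSeries k) (n : ℕ) : Th k (φ ^ n) = n * φ ^ (n - 1) * Th k φ := by
  rw [Derivation.leibniz_pow, nsmul_eq_mul, smul_eq_mul, mul_assoc]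

theorem Th_one_add : Th k (1 + 27 * wR k) = 27 * aR k * wR k := by
  have h : Th k (27 : PowerSeries k) = 0 := by
    have := (Th k).map_natCast 27
    exact_mod_cast this
  rw [map_add, Derivation.map_one_eq_zero, Th_mul, h, Th_w]
  ring

theorem Th_a : 3 * Th k (aR k) * (1 + 27 * wR k) =
    aR k * (sR k * (1 + 27 * wR k) + aR k * (27 * wR k - 1)) := by
  have h := congrArg (Th k) (aR_pow_three (k := k))
  rw [Th_mul, Th_mul, Th_pow, Th_pow, Th_w, Th_g, Th_one_add] at h
  push_cast at h
  simp only [Nat.add_one_sub_one, Nat.reduceSub, pow_one] at h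
  refine mul_left_cancel₀ (mul_ne_zero (wR_ne_zero k) (pow_ne_zero 2 aR_ne_zero)) ?_
  linear_combination (1 + 27 * wR k) * h -
    (sR k * (1 + 27 * wR k) + 54 * aR k * wR k) * aR_pow_three (k := k)

theorem Th_pev (P : k[X]) : Th k (pev (wR k) P) = aR k * pev (wR k) (X * derivative P) := by
  induction P using Polynomial.induction_on' with
  | add P Q hP hQ =>
    have e : ∀ A B : k[X], pev (wR k) (A + B) = pev (wR k) A + pev (wR k) B := fun A B => eval₂_add _ _
    rw [e, map_add, hP, hQ, derivative_add, mul_add, e, mul_add]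
  | monomial n c =>
    rw [← C_mul_X_pow_eq_monomial]
    have hC : Th k (PowerSeries.C c) = 0 := by
      rw [Th_apply, PowerSeries.derivative_C, mul_zero]
    simp only [pev, eval₂_mul, eval₂_C, eval₂_pow, eval₂_X, derivative_C_mul, derivative_X_pow,
      Th_mul, Th_pow, hC, Th_w, map_natCast, eval₂_natCast]
    rcases n with _ | n
    · simp
    · rw [Nat.add_sub_cancel]; ring

theorem Th_pev_hom (n : ℕ) (P : k[X]) : (1 + 27 * wR k) * Th k (pev (wR k) (hom n P)) =
    aR k * (n * (1 + 27 * wR k) * pev (wR k) (hom n P) +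
      (27 * wR k - 1) * pev (wR k) (hom n (Eu P))) := by
  have h := congrArg (pev (wR k)) (X_mul_derivative_hom n P)
  have e : PowerSeries.C (27 : k) = 27 := map_ofNat _ 27
  rw [Th_pev]
  simp only [pev, eval₂_mul, eval₂_add, eval₂_sub, eval₂_one, eval₂_X, eval₂_C, eval₂_natCast,
    e] at h ⊢
  linear_combination aR k * h

theorem eq_zero_of_Th {p : ℕ} [Fact p.Prime] [CharP k p] {d : PowerSeries k}
    (h : 6 * Th k d = d ^ 2) : d = 0 := by
  have hp := (Fact.out : p.Prime).two_le
  have : ExpChar k p := ExpChar.prime Fact.out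
  have hp0 : (p : PowerSeries k) = 0 := CharP.cast_eq_zero _ p
  have h1 : -d ^ p = 6 * Th k (d ^ (p - 1)) := by
    rw [Th_pow, Nat.cast_sub (by omega), hp0]
    obtain ⟨m, rfl⟩ : ∃ m, p = m + 2 := ⟨p - 2, by omega⟩
    simp only [show m + 2 - 1 - 1 = m by omega]
    push_cast
    linear_combination d ^ m * h
  ext m
  have h2 := congrArg (PowerSeries.coeff (p * m)) h1
  have h3 : PowerSeries.coeff (p * m) (d ^ p) = PowerSeries.coeff m d ^ p := by
    have e : d ^ p = PowerSeries.map (frobenius k p) (PowerSeries.expand p p_ne_zero d) :=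
      (MvPowerSeries.map_frobenius_expand p p_ne_zero).symm
    rw [e, PowerSeries.coeff_map, PowerSeries.coeff_expand_mul]
    rfl
  have h6 : (6 : PowerSeries k) = PowerSeries.C 6 := (map_ofNat _ 6).symm
  rw [map_neg, h3, h6, PowerSeries.coeff_C_mul, coeff_Th, Nat.cast_mul, CharP.cast_eq_zero k p,
    zero_mul, zero_mul, mul_zero, neg_eq_zero] at h2
  rw [map_zero]
  exact pow_eq_zero_iff (p_ne_zero) |>.1 h2

/-- The inverse of `1 + 27 w`. -/
def uR (k : Type*) [Field k] : PowerSeries k := invOfUnit (1 + 27 * wR k) 1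
/-- The square root of `(x - 108) / x`. -/
def yR (k : Type*) [Field k] : PowerSeries k := (27 * wR k - 1) * uR k

theorem one_add_mul_uR : (1 + 27 * wR k) * uR k = 1 := by
  refine mul_invOfUnit _ _ ?_
  rw [map_add, map_mul, constantCoeff_wR, mul_zero, add_zero, map_one, Units.val_one]

theorem one_add_mul_yR : (1 + 27 * wR k) * yR k = 27 * wR k - 1 := by
  rw [yR]; linear_combination (27 * wR k - 1) * one_add_mul_uR (k := k)

theorem one_sub_yR_sq : 1 - yR k ^ 2 = 108 * wR k * uR k ^ 2 := by
  rw [yR]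
  linear_combination -((1 + 27 * wR k) * uR k + 1) * one_add_mul_uR (k := k)

theorem three_Th_a : 3 * Th k (aR k) = aR k * (sR k + aR k * yR k) := by
  rw [yR]
  linear_combination uR k * Th_a (k := k) -
    (3 * Th k (aR k) - aR k * sR k) * one_add_mul_uR (k := k)

theorem two_Th_y : 2 * Th k (yR k) = aR k * (1 - yR k ^ 2) := by
  have h := congrArg (Th k) (one_add_mul_yR (k := k))
  have h1 : Th k (27 * wR k - 1) = 27 * aR k * wR k := by
    rw [← Th_one_add, show 27 * wR k - 1 = 1 + 27 * wR k - 2 by ring, map_sub]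
    have : Th k (2 : PowerSeries k) = 0 := by
      have := (Th k).map_natCast 2
      exact_mod_cast this
    rw [this, sub_zero]
  rw [Th_mul, Th_one_add, h1] at h
  have h2 := one_add_mul_yR (k := k)
  have h3 := one_add_mul_uR (k := k)
  have e : ∀ A : PowerSeries k, A = (1 + 27 * wR k) ^ 2 * A * uR k ^ 2 := fun A => by
    linear_combination -A * ((1 + 27 * wR k) * uR k + 1) * h3
  rw [e (2 * _), e (aR k * _)]
  congr 1
  linear_combination 2 * (1 + 27 * wR k) * h +
    (-54 * aR k * wR k + aR k * (1 + 27 * wR k) * yR k + aR k * (27 * wR k - 1)) * h2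

theorem Th_pev_hom' (n : ℕ) (P : k[X]) : Th k (pev (wR k) (hom n P)) =
    aR k * (n * pev (wR k) (hom n P) + yR k * pev (wR k) (hom n (Eu P))) := by
  have h := Th_pev_hom n P
  have h3 := one_add_mul_uR (k := k)
  rw [yR]
  linear_combination uR k * h + (aR k * n * pev (wR k) (hom n P) - Th k (pev (wR k) (hom n P))) * h3

variable {T : k[X]} {m : ℕ}

/-- The logarithmic derivative of `T(x)`, up to normalization. -/
def vT (T : k[X]) (m : ℕ) : PowerSeries k :=
  pev (wR k) (hom m (Eu T)) * invOfUnit (pev (wR k) (hom m T)) 1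

theorem vT_mul (hm : T.coeff m = 1) : pev (wR k) (hom m T) * vT T m =
    pev (wR k) (hom m (Eu T)) := by
  have h : pev (wR k) (hom m T) * invOfUnit (pev (wR k) (hom m T)) 1 = 1 := by
    refine mul_invOfUnit _ _ ?_
    rw [coeff_zero_pev (constantCoeff_wR k), coeff_zero_hom, hm, Units.val_one]
  rw [vT]
  linear_combination pev (wR k) (hom m (Eu T)) * h

theorem Th_vT (hm : T.coeff m = 1) (hT : T.natDegree ≤ m) {b : k}
    (hode : X * (Eu (Eu T) - C (2 * (m : k)) * Eu T + C ((m : k) ^ 2) * T) =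
      C 108 * (Eu (Eu T) - C b * Eu T)) :
    yR k * Th k (vT T m) = aR k * ((2 * (m : PowerSeries k) - (1 - yR k ^ 2) * PowerSeries.C b) * vT T m -
      (m : PowerSeries k) ^ 2 - yR k ^ 2 * vT T m ^ 2) := by
  have h0 : pev (wR k) (hom m T) ≠ 0 := by
    intro h
    have := coeff_zero_pev (constantCoeff_wR k) (hom m T)
    rw [coeff_zero_hom, hm, h, map_zero] at this
    exact zero_ne_one this
  have hv := vT_mul hm
  have h1 := congrArg (Th k) hv
  rw [Th_mul, Th_pev_hom', Th_pev_hom'] at h1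
  have h2 := congrArg (fun P => pev (wR k) (hom (m + 1) P)) hode
  have hE : (Eu (Eu T) - C b * Eu T).natDegree ≤ m :=
    (natDegree_sub_le _ _).trans (max_le (natDegree_Eu (natDegree_Eu hT))
      ((natDegree_C_mul_le _ _).trans (natDegree_Eu hT)))
  simp only [hom_X_mul, hom_C_mul, hom_succ' hE, hom_add, hom_sub, pev_mul] at h2
  simp only [pev, eval₂_mul, eval₂_add, eval₂_sub, eval₂_one, eval₂_X, eval₂_C, eval₂_pow,
    map_pow, map_mul, map_natCast, map_ofNat, eval₂_ofNat, eval₂_natCast] at h2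
  have h3 := one_add_mul_uR (k := k)
  have h4 := one_sub_yR_sq (k := k)
  refine mul_left_cancel₀ h0 ?_
  simp only [pev] at h1 hv ⊢
  set t0 := eval₂ PowerSeries.C (wR k) (hom m T)
  set t1 := eval₂ PowerSeries.C (wR k) (hom m (Eu T))
  set t2 := eval₂ PowerSeries.C (wR k) (hom m (Eu (Eu T)))
  have h5 : t2 - 2 * m * t1 + (m : PowerSeries k) ^ 2 * t0 =
      (1 - yR k ^ 2) * (t2 - PowerSeries.C b * t1) := by
    rw [h4]
    linear_combination uR k ^ 2 * h2 -
      (t2 - 2 * m * t1 + (m : PowerSeries k) ^ 2 * t0) * ((1 + 27 * wR k) * uR k + 1) * h3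
  linear_combination yR k * h1 + aR k * h5 - (aR k * yR k * m) * hv -
    aR k * (2 * (m : PowerSeries k) - (1 - yR k ^ 2) * PowerSeries.C b - yR k ^ 2 * vT T m) * hv

end Theta

section Theta
variable {k : Type*} [Field k]

theorem sR_eq_of_one (p : ℕ) [Fact p.Prime] [CharP k p] {T : k[X]} {m : ℕ} {b : k} (hm : T.coeff m = 1) (hT : T.natDegree ≤ m)
    (hode : X * (Eu (Eu T) - C (2 * (m : k)) * Eu T + C ((m : k) ^ 2) * T) =
      C 108 * (Eu (Eu T) - C b * Eu T)) (h6 : 6 * (m : k) = -1) (hb : 6 * b = 1) :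
    sR k = 6 * aR k * yR k * vT T m := by
  have hV := Th_vT hm hT hode
  have hA := three_Th_a (k := k)
  have hY := two_Th_y (k := k)
  have hS := Th_s (k := k)
  have h6' : 6 * (m : PowerSeries k) = -1 := by
    have := congrArg (PowerSeries.C (R := k)) h6
    simpa only [map_mul, map_ofNat, map_natCast, map_neg, map_one] using this
  have hb' : 6 * PowerSeries.C b = 1 := by
    have := congrArg (PowerSeries.C (R := k)) hb
    simpa only [map_mul, map_ofNat, map_one] using this
  rw [← sub_eq_zero]
  refine eq_zero_of_Th (p := p) ?_
  have e6 : (6 : PowerSeries k) * aR k * yR k * vT T m = ((6 : ℕ) : PowerSeries k) *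
    (aR k * yR k * vT T m) := by push_cast; ring
  rw [map_sub, e6, Th_mul, (Th k).map_natCast, Th_mul, Th_mul]
  push_cast
  generalize Th k (aR k) = ta at *
  generalize Th k (yR k) = ty at *
  generalize Th k (sR k) = ts at *
  generalize Th k (vT T m) = tv at *
  generalize PowerSeries.C b = B at *
  generalize (m : PowerSeries k) = M at *
  linear_combination hS - 12 * yR k * vT T m * hA - 18 * aR k * vT T m * hY - 36 * aR k * hV +
    (6 * M - 1 - 12 * vT T m) * aR k ^ 2 * h6' + 6 * aR k ^ 2 * (1 - yR k ^ 2) * vT T m * hb'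

/-- The inverse of `yR`. -/
def zR (k : Type*) [Field k] : PowerSeries k :=
  (1 + 27 * wR k) * invOfUnit (27 * wR k - 1) (-1)

theorem yR_mul_zR : yR k * zR k = 1 := by
  have h : (27 * wR k - 1) * invOfUnit (27 * wR k - 1) (-1) = 1 := by
    refine mul_invOfUnit _ _ ?_
    rw [map_sub, map_mul, constantCoeff_wR, mul_zero, zero_sub, map_one, Units.val_neg,
      Units.val_one]
  rw [yR, zR]
  linear_combination h + (27 * wR k - 1) * invOfUnit (27 * wR k - 1) (-1) *
    one_add_mul_uR (k := k)

theorem sR_eq_of_two (p : ℕ) [Fact p.Prime] [CharP k p] {T : k[X]} {m : ℕ} {b : k}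
    (hm : T.coeff m = 1) (hT : T.natDegree ≤ m)
    (hode : X * (Eu (Eu T) - C (2 * (m : k)) * Eu T + C ((m : k) ^ 2) * T) =
      C 108 * (Eu (Eu T) - C b * Eu T)) (h6 : 6 * (m : k) = -5) (hb : 6 * b = -1) :
    sR k = 6 * aR k * yR k * vT T m + aR k * yR k + 3 * aR k * zR k := by
  have hV := Th_vT hm hT hode
  have hA := three_Th_a (k := k)
  have hY := two_Th_y (k := k)
  have hS := Th_s (k := k)
  have hyz := yR_mul_zR (k := k)
  have hZ : 2 * Th k (zR k) = -aR k * (zR k ^ 2 - 1) := by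
    have h := congrArg (Th k) hyz
    rw [Th_mul, Derivation.map_one_eq_zero] at h
    linear_combination 2 * zR k * h - zR k ^ 2 * hY +
      (-2 * Th k (zR k) + aR k * (yR k * zR k + 1)) * hyz
  have h6' : 6 * (m : PowerSeries k) = -5 := by
    have := congrArg (PowerSeries.C (R := k)) h6
    simpa only [map_mul, map_ofNat, map_natCast, map_neg, map_one] using this
  have hb' : 6 * PowerSeries.C b = -1 := by
    have := congrArg (PowerSeries.C (R := k)) hb
    simpa only [map_mul, map_ofNat, map_one, map_neg] using this
  rw [← sub_eq_zero]
  refine eq_zero_of_Th (p := p) ?_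
  have e6 : (6 : PowerSeries k) * aR k * yR k * vT T m = ((6 : ℕ) : PowerSeries k) *
    (aR k * yR k * vT T m) := by push_cast; ring
  have e3 : (3 : PowerSeries k) * aR k * zR k = ((3 : ℕ) : PowerSeries k) *
    (aR k * zR k) := by push_cast; ring
  rw [map_sub, map_add, map_add, e6, e3]
  simp only [Th_mul, (Th k).map_natCast]
  push_cast
  generalize Th k (aR k) = ta at *
  generalize Th k (yR k) = ty at *
  generalize Th k (sR k) = ts at *
  generalize Th k (zR k) = tz at *
  generalize Th k (vT T m) = tv at *
  generalize PowerSeries.C b = B at *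
  generalize (m : PowerSeries k) = M at *
  linear_combination hS - (12 * yR k * vT T m + 2 * yR k + 6 * zR k) * hA -
    (18 * aR k * vT T m + 3 * aR k) * hY - 9 * aR k * hZ - 36 * aR k * hV +
    (6 * M - 5 - 12 * vT T m) * aR k ^ 2 * h6' + 6 * aR k ^ 2 * (1 - yR k ^ 2) * vT T m * hb' -
    (36 * vT T m + 12) * aR k ^ 2 * hyz

end Theta

section Roots
variable {k : Type*} [Field k]

theorem rootMultiplicity_sub {A B : k[X]} (hA : A ≠ 0) (hB : B ≠ 0)
    (h : derivative A * B = A * derivative B) (r : k) :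
    (A.rootMultiplicity r : k) = B.rootMultiplicity r := by
  obtain ⟨A0, hA1, hA2⟩ := exists_eq_pow_rootMultiplicity_mul_and_not_dvd A hA r
  obtain ⟨B0, hB1, hB2⟩ := exists_eq_pow_rootMultiplicity_mul_and_not_dvd B hB r
  set a := A.rootMultiplicity r
  set b := B.rootMultiplicity r
  rw [dvd_iff_isRoot, IsRoot] at hA2 hB2
  have hl : (X - C r : k[X]) ≠ 0 := X_sub_C_ne_zero r
  have e : ∀ n : ℕ, (X - C r) * derivative ((X - C r) ^ n) = (n : k[X]) * (X - C r) ^ n := by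
    intro n
    rcases n with _ | n
    · simp
    · rw [derivative_X_sub_C_pow, map_natCast, Nat.add_sub_cancel]; ring
  have key : ((a : k[X]) * A0 + (X - C r) * derivative A0) * B0 =
      A0 * ((b : k[X]) * B0 + (X - C r) * derivative B0) := by
    refine mul_left_cancel₀ (mul_ne_zero (pow_ne_zero a hl) (pow_ne_zero b hl)) ?_
    have h' := h
    rw [hA1, hB1, derivative_mul, derivative_mul] at h'
    linear_combination (X - C r) * h' - A0 * (X - C r) ^ b * B0 * e a +
      B0 * A0 * (X - C r) ^ a * e b
  have := congrArg (eval r) key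
  simp only [eval_mul, eval_add, eval_natCast, eval_sub, eval_X, eval_C, sub_self, zero_mul,
    add_zero] at this
  refine mul_right_cancel₀ (mul_ne_zero hA2 hB2) ?_
  linear_combination this

theorem isRoot_iff_of_derivative {p : ℕ} [Fact p.Prime] [CharP k p] {A B : k[X]} (hA : A ≠ 0)
    (hB : B ≠ 0) (hAd : A.natDegree < p) (hBd : B.natDegree < p)
    (h : derivative A * B = A * derivative B) (r : k) : A.eval r = 0 ↔ B.eval r = 0 := by
  have h1 := rootMultiplicity_sub hA hB h r
  have h2 := (CharP.natCast_eq_natCast k p).1 h1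
  have h3 : A.rootMultiplicity r < p := lt_of_le_of_lt
    ((rootMultiplicity_le_iff hA r _).2 fun hd => by
      have := natDegree_le_of_dvd hd hA
      rw [natDegree_pow, natDegree_X_sub_C] at this
      omega) hAd
  have h4 : B.rootMultiplicity r < p := lt_of_le_of_lt
    ((rootMultiplicity_le_iff hB r _).2 fun hd => by
      have := natDegree_le_of_dvd hd hB
      rw [natDegree_pow, natDegree_X_sub_C] at this
      omega) hBd
  have h5 := Nat.ModEq.eq_of_lt_of_lt h2 h3 h4
  have h6 := rootMultiplicity_pos hA (x := r)
  have h7 := rootMultiplicity_pos hB (x := r)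
  rw [h5] at h6
  exact h6.symm.trans h7

end Roots

section Del
variable {p : ℕ} [Fact p.Prime]

theorem legendreSym_three_one : legendreSym 3 1 = 1 ∧ legendreSym 3 2 = -1 := by decide

theorem legendreSym_neg_three (hp : 5 ≤ p) : legendreSym p (-3) = if p % 3 = 1 then 1 else -1 := by
  have hp2 : p ≠ 2 := by omega
  have hodd := (Fact.out : p.Prime).eq_two_or_odd.resolve_left hp2
  have h1 : legendreSym p (-3) = legendreSym p (-1) * legendreSym p (3 : ℕ) := by
    rw [← legendreSym.mul]; norm_num
  have h2 : legendreSym 3 p = if p % 3 = 1 then 1 else -1 := by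
    have hne : p % 3 ≠ 0 := by
      intro h
      have := (Nat.prime_dvd_prime_iff_eq Nat.prime_three (Fact.out : p.Prime)).1
        (Nat.dvd_of_mod_eq_zero h)
      omega
    rw [legendreSym.mod]
    have : p % 3 = 1 ∨ p % 3 = 2 := by omega
    rcases this with h | h
    · rw [if_pos h, show ((p : ℤ) % (3 : ℕ)) = 1 by omega]; exact legendreSym_three_one.1
    · rw [if_neg (by omega), show ((p : ℤ) % (3 : ℕ)) = 2 by omega]; exact legendreSym_three_one.2
  have h4 := legendreSym.quadratic_reciprocity' (p := 3) (q := p) (by norm_num) hp2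
  rw [h1, h4, h2, legendreSym.at_neg_one hp2, ZMod.χ₄_eq_neg_one_pow hodd]
  rw [← mul_assoc, ← pow_add]
  simp

theorem del_eq_zero (hp : 5 ≤ p) (h : p % 3 = 1) : del p = 0 := by
  rw [del, legendreSym_neg_three hp, if_pos h]; rfl
theorem del_eq_one (hp : 5 ≤ p) (h : p % 3 ≠ 1) : del p = 1 := by
  rw [del, legendreSym_neg_three hp, if_neg h]; rfl

/-- The hypergeometric factor of the supersingular polynomial of level 3. -/
def tri (p : ℕ) [Fact p.Prime] : (ZMod p)[X] :=
  hypP p (p / 6) ((1 : ZMod p) / 3 + (del p : ZMod p) / 3) 108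

theorem ss3Star_eq : ss3Star p = (X - C 108) ^ del p * (X ^ del p * tri p) := by
  rw [ss3Star, tri, hypP, Finset.mul_sum (a := X ^ del p)]
  congr 1
  refine sum_congr rfl fun n hn => ?_
  have : n ≤ p / 6 := by have := mem_range.1 hn; omega
  rw [hypC, mul_left_comm, ← pow_add, show del p + (p / 6 - n) = p / 6 + del p - n by omega]

end Del

section Supp
variable {k : Type*} [Field k] [IsAlgClosed k] {p : ℕ} [Fact p.Prime] [CharP k p]

theorem sR_mul {S : k[X]} (hS : gR k ^ (p - 1) * pev (wR k) (hom (p + 1) S) = wR k ^ (p + 1)) :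
    sR k * pev (wR k) (hom (p + 1) S) = aR k * yR k * pev (wR k) (hom (p + 1) (Eu S)) := by
  have hp := (Fact.out : p.Prime).two_le
  have hp0 : (p : PowerSeries k) = 0 := CharP.cast_eq_zero _ p
  have h := congrArg (Th k) hS
  rw [Th_mul, Th_pow, Th_pow, Th_pev_hom', Th_g, Th_w, Nat.cast_sub (by omega), hp0] at h
  push_cast at h
  rw [hp0] at h
  refine mul_left_cancel₀ (pow_ne_zero (p - 1) (gR_ne_zero k)) ?_
  have e1 : gR k ^ (p - 1 - 1) * gR k = gR k ^ (p - 1) := by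
    rw [← pow_succ]; congr 1; omega
  grind

theorem yR_ne_zero : yR k ≠ 0 := left_ne_zero_of_mul_eq_one yR_mul_zR

theorem relation_of_pev (h27 : (27 : k) ≠ 0) {n : ℕ} {A B D : k[X]} (hA : A.natDegree ≤ n)
    (hB : B.natDegree ≤ n) (hD : D.natDegree ≤ n)
    (h : (27 * wR k - 1) ^ 2 * (pev (wR k) (hom n D) - 6 * pev (wR k) (hom n A) -
      pev (wR k) (hom n B)) = 3 * (1 + 27 * wR k) ^ 2 * pev (wR k) (hom n B)) :
    6 * ((X - C 108) * A) + (4 * X - C 108) * B = (X - C 108) * D := by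
  have h6 : (6 : k[X]) = C 6 := (map_ofNat C 6).symm
  have h4 : (4 : k[X]) = C 4 := (map_ofNat C 4).symm
  have hE1 : (C 6 * A + C 4 * B - D).natDegree ≤ n :=
    (natDegree_sub_le _ _).trans (max_le ((natDegree_add_le _ _).trans (max_le
      ((natDegree_C_mul_le _ _).trans hA) ((natDegree_C_mul_le _ _).trans hB))) hD)
  have hE2 : (C 6 * A + B - D).natDegree ≤ n :=
    (natDegree_sub_le _ _).trans (max_le ((natDegree_add_le _ _).trans (max_le
      ((natDegree_C_mul_le _ _).trans hA) hB)) hD)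
  have e : X * (C 6 * A + C 4 * B - D) - C 108 * (C 6 * A + B - D) = 0 := by
    refine hom_injective h27 (n := n + 1) ((natDegree_sub_le _ _).trans (max_le ?_ ?_)) ?_
    · exact natDegree_mul_le.trans (by rw [natDegree_X]; omega)
    · exact (natDegree_C_mul_le _ _).trans (hE2.trans (Nat.le_succ n))
    · rw [hom_sub, hom_X_mul, hom_C_mul, hom_succ' hE2]
      refine pev_injective (constantCoeff_wR k) (wR_ne_zero k) ?_
      simp only [hom_sub, hom_add, hom_C_mul]
      simp only [pev, eval₂_sub, eval₂_mul, eval₂_add, eval₂_pow, eval₂_X, eval₂_one, map_ofNat,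
        eval₂_ofNat, eval₂_zero] at h ⊢
      linear_combination -h
  rw [h6, h4]
  linear_combination e

theorem natCast_hyp (hp : 5 ≤ p) : (3 : k) ≠ 0 ∧ (6 : k) ≠ 0 ∧ (27 : k) ≠ 0 := by
  have h3 := coe_ne_zero_of_char (p := p) (k := k) hp
  have h2 : ((2 : ℕ) : k) ≠ 0 := by
    rw [Ne, CharP.cast_eq_zero_iff k p]
    exact fun h => absurd (Nat.le_of_dvd (by norm_num) h) (by omega)
  push_cast at h2
  refine ⟨h3, ?_, ?_⟩
  · rw [show (6 : k) = 2 * 3 by norm_num]; exact mul_ne_zero h2 h3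
  · rw [show (27 : k) = 3 ^ 3 by norm_num]; exact pow_ne_zero 3 h3

theorem map_hyp_ode {m : ℕ} (hm : m < p) (β : ZMod p) (f : ZMod p →+* k) :
    X * (Eu (Eu ((hypP p m β 108).map f)) - C (2 * (m : k)) * Eu ((hypP p m β 108).map f) +
      C ((m : k) ^ 2) * (hypP p m β 108).map f) =
    C 108 * (Eu (Eu ((hypP p m β 108).map f)) - C (f (m + β)) * Eu ((hypP p m β 108).map f)) := by
  have h := congrArg (Polynomial.map f) (hypP_ode hm β 108)
  have e : f 108 = 108 := map_ofNat f 108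
  have e2 : f 2 = 2 := map_ofNat f 2
  simp only [Polynomial.map_mul, map_X, Polynomial.map_add, Polynomial.map_sub, map_Eu, map_C,
    f.map_mul, f.map_pow, map_natCast f, e, e2] at h
  exact h

theorem derivative_relation_of_one (hp : 5 ≤ p) {S T : k[X]} (hSd : S.natDegree ≤ p + 1)
    (hsm : sR k * pev (wR k) (hom (p + 1) S) = aR k * yR k * pev (wR k) (hom (p + 1) (Eu S)))
    {m : ℕ} (hTd : T.natDegree ≤ m) (hTc : T.coeff m = 1)
    (hs : sR k = 6 * aR k * yR k * vT T m) :
    derivative S * T ^ 6 = S * derivative (T ^ 6) := by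
  obtain ⟨h3, h6, h27⟩ := natCast_hyp (k := k) hp
  have hv := vT_mul hTc
  have hay : aR k * yR k ≠ 0 := mul_ne_zero aR_ne_zero yR_ne_zero
  have key : 6 * Eu T * S = T * Eu S := by
    rw [← sub_eq_zero]
    have hdeg : (6 * Eu T * S - T * Eu S).natDegree ≤ m + (p + 1) := by
      refine (natDegree_sub_le _ _).trans (max_le ?_ ?_)
      · rw [mul_assoc, show (6 : k[X]) = C 6 from (map_ofNat C 6).symm]
        exact (natDegree_C_mul_le _ _).trans
          (natDegree_mul_le.trans (add_le_add (natDegree_Eu hTd) hSd))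
      · exact natDegree_mul_le.trans (add_le_add hTd (natDegree_Eu hSd))
    refine hom_injective h27 hdeg ?_
    rw [hom_sub, mul_assoc, show (6 : k[X]) = C 6 from (map_ofNat C 6).symm, hom_C_mul,
      ← hom_mul_hom (natDegree_Eu hTd) hSd, ← hom_mul_hom hTd (natDegree_Eu hSd), sub_eq_zero]
    refine pev_injective (constantCoeff_wR k) (wR_ne_zero k) (mul_left_cancel₀ hay ?_)
    have e6 : pev (wR k) (C 6) = 6 := by rw [pev, eval₂_C]; exact map_ofNat _ 6
    rw [pev_mul, pev_mul, pev_mul, e6]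
    grind
  refine mul_left_cancel₀ X_ne_zero ?_
  rw [Eu, Eu] at key
  rw [derivative_pow]
  simp only [map_natCast]
  push_cast
  linear_combination -T ^ 5 * key

theorem derivative_relation_of_two (hp : 5 ≤ p) {S T : k[X]} (hSd : S.natDegree ≤ p + 1)
    (hsm : sR k * pev (wR k) (hom (p + 1) S) = aR k * yR k * pev (wR k) (hom (p + 1) (Eu S)))
    {m : ℕ} (hTd : T.natDegree ≤ m) (hTc : T.coeff m = 1)
    (hs : sR k = 6 * aR k * yR k * vT T m + aR k * yR k + 3 * aR k * zR k) :
    derivative S * (X * (X - C 108) ^ 3 * T ^ 6) =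
      S * derivative (X * (X - C 108) ^ 3 * T ^ 6) := by
  obtain ⟨h3, h6, h27⟩ := natCast_hyp (k := k) hp
  have hv := vT_mul hTc
  have hyz := yR_mul_zR (k := k)
  have hy1 := one_add_mul_yR (k := k)
  have hA : (Eu T * S).natDegree ≤ m + (p + 1) :=
    natDegree_mul_le.trans (add_le_add (natDegree_Eu hTd) hSd)
  have hB : (T * S).natDegree ≤ m + (p + 1) := natDegree_mul_le.trans (add_le_add hTd hSd)
  have hD : (T * Eu S).natDegree ≤ m + (p + 1) :=
    natDegree_mul_le.trans (add_le_add hTd (natDegree_Eu hSd))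
  have key := relation_of_pev h27 hA hB hD (by
    rw [← hom_mul_hom (natDegree_Eu hTd) hSd, ← hom_mul_hom hTd hSd,
      ← hom_mul_hom hTd (natDegree_Eu hSd), pev_mul, pev_mul, pev_mul]
    generalize pev (wR k) (hom m T) = t0 at *
    generalize pev (wR k) (hom m (Eu T)) = t1 at *
    generalize pev (wR k) (hom (p + 1) S) = u0 at *
    generalize pev (wR k) (hom (p + 1) (Eu S)) = u1 at *
    generalize vT T m = v at *
    generalize zR k = z at *
    have h2 : yR k ^ 2 * (t0 * u1 - 6 * (t1 * u0) - t0 * u0) = 3 * (t0 * u0) := by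
      refine mul_left_cancel₀ (aR_ne_zero (k := k)) ?_
      linear_combination yR k * t0 * (u0 * hs - hsm) + 6 * aR k * yR k ^ 2 * u0 * hv +
        3 * aR k * t0 * u0 * hyz
    generalize yR k = y at *
    generalize wR k = w at *
    linear_combination (1 + 27 * w) ^ 2 * h2 - ((1 + 27 * w) * y + 27 * w - 1) *
      (t0 * u1 - 6 * (t1 * u0) - t0 * u0) * hy1)
  refine mul_left_cancel₀ X_ne_zero ?_
  rw [Eu, Eu] at key
  rw [derivative_mul, derivative_mul, derivative_pow, derivative_pow, derivative_X_sub_C]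
  simp only [map_natCast, derivative_X]
  grind

theorem S_root_iff (hp : 5 ≤ p) {S : k[X]} (hS0 : S ≠ 0) (hSd : S.natDegree ≤ p - 1)
    (hS : gR k ^ (p - 1) * pev (wR k) (hom (p + 1) S) = wR k ^ (p + 1)) (f : ZMod p →+* k) (r : k) :
    S.eval r = 0 ↔ ((ss3Star p).map f).eval r = 0 := by
  obtain ⟨h3, h6, h27⟩ := natCast_hyp (k := k) hp
  have hsm := sR_mul hS
  have hSd' : S.natDegree ≤ p + 1 := by omega
  have hTd : ((tri p).map f).natDegree ≤ p / 6 := natDegree_map_le.trans (natDegree_hypP_le _ _ _)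
  have hTc : ((tri p).map f).coeff (p / 6) = 1 := by
    rw [coeff_map, tri, coeff_top_hypP, map_one]
  have hT0 : (tri p).map f ≠ 0 :=
    (Polynomial.map_ne_zero_iff f.injective).2 (hypP_ne_zero _ _ _)
  have hode := map_hyp_ode (k := k) (m := p / 6) (by omega)
    ((1 : ZMod p) / 3 + (del p : ZMod p) / 3) f
  rw [← tri] at hode
  have hp0 : (p : k) = 0 := CharP.cast_eq_zero k p
  have hbeta : f (((p / 6 : ℕ) : ZMod p) + ((1 : ZMod p) / 3 + (del p : ZMod p) / 3)) =
      ((p / 6 : ℕ) : k) + (1 + del p) / 3 := by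
    rw [map_add, map_add, map_div₀, map_div₀, map_natCast, map_natCast, map_one, map_ofNat]
    ring
  rw [hbeta] at hode
  rw [ss3Star_eq, Polynomial.map_mul, Polynomial.map_mul]
  generalize (tri p).map f = T at *
  have hmod : p % 6 = 1 ∨ p % 6 = 5 := by
    have h2 := (Fact.out : p.Prime).eq_two_or_odd.resolve_left (by omega)
    have h3 : p % 3 ≠ 0 := fun h => by
      have := (Nat.prime_dvd_prime_iff_eq Nat.prime_three (Fact.out : p.Prime)).1
        (Nat.dvd_of_mod_eq_zero h)
      omega
    omega
  have hm := congrArg (Nat.cast (R := k)) (Nat.div_add_mod p 6)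
  rw [hp0] at hm
  rcases hmod with hmod | hmod
  · have hd := del_eq_zero hp (by omega)
    rw [hmod] at hm
    push_cast at hm
    have hs := sR_eq_of_one p hTc hTd hode (by linear_combination hm) (by
      rw [hd]; push_cast; field_simp; linear_combination 3 * hm)
    have key2 := derivative_relation_of_one hp hSd' hsm hTd hTc hs
    have hlt : (T ^ 6).natDegree < p := (natDegree_pow_le_of_le 6 hTd).trans_lt (by omega)
    rw [isRoot_iff_of_derivative hS0 (pow_ne_zero 6 hT0) (by omega) hlt key2 r, hd]
    simp
  · have hd := del_eq_one hp (by omega)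
    rw [hmod] at hm
    push_cast at hm
    have hs := sR_eq_of_two p hTc hTd hode (by linear_combination hm) (by
      rw [hd]; push_cast; field_simp; linear_combination 3 * hm)
    have key2 := derivative_relation_of_two hp hSd' hsm hTd hTc hs
    have hlt : (X * (X - C 108) ^ 3 * T ^ 6).natDegree < p := by
      refine (natDegree_mul_le.trans (add_le_add (natDegree_mul_le.trans
        (add_le_add natDegree_X_le (natDegree_pow_le_of_le 3 (natDegree_X_sub_C_le 108))))
        (natDegree_pow_le_of_le 6 hTd))).trans_lt (by omega)
    have e : f 108 = 108 := map_ofNat f 108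
    rw [isRoot_iff_of_derivative hS0 (mul_ne_zero (mul_ne_zero X_ne_zero
      (pow_ne_zero 3 (X_sub_C_ne_zero _))) (pow_ne_zero 6 hT0)) (by omega) hlt key2 r, hd]
    simp only [eval_mul, eval_pow, eval_X, eval_sub, eval_C, pow_one, Polynomial.map_mul,
      Polynomial.map_sub, map_X, map_C, e, mul_eq_zero, pow_eq_zero_iff, Ne, OfNat.ofNat_ne_zero,
      not_false_eq_true]
    tauto

end Supp

section CM
variable {p : ℕ} [Fact p.Prime]

/-- `τ` is a fixed point of a trace-zero element of determinant `3p` of the normaliser of `Γ₀(3)`. -/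
def TZ (p : ℕ) (τ : ℂ) : Prop :=
  ∃ A B D : ℤ, A * D - 3 * B ^ 2 = p ∧ 3 * A * τ ^ 2 + 6 * B * τ + D = 0

theorem mob_eq_Wt_iff {A B C D : ℤ} (hd : A * D - 3 * (B * C) = p) (hτ : 0 < τ.im) :
    mob !![A, B; 3 * C, D] τ = Wt τ ↔ (3 * A * τ ^ 2 + 3 * (B + C) * τ + D : ℂ) = 0 := by
  have h0 := ne_zero_of_im hτ
  have hdet : (!![A, B; 3 * C, D] : Mat).det ≠ 0 := by
    rw [det_fin_two_of, show A * D - B * (3 * C) = p by linarith]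
    exact_mod_cast p_pos.ne'
  have hj := jf_ne_zero hdet hτ
  rw [mob, Wt, div_eq_div_iff hj (mul_ne_zero three_ne_zero h0)]
  simp only [jf, of_apply, cons_val', cons_val_zero, cons_val_one, cons_val_fin_one]
  grind

theorem mul_of_quad {A B C D : ℤ} (hd : A * D - 3 * (B * C) = p)
    (h : (3 * A * τ ^ 2 + 3 * (B + C) * τ + D : ℂ) = 0) :
    3 * ((A * τ + B) * (A * τ + C)) = -(p : ℂ) := by
  have hd' : (A * D - 3 * (B * C) : ℂ) = p := by exact_mod_cast hd
  linear_combination A * h - hd'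

theorem FM_of_quad {A B C D : ℤ} (hd : A * D - 3 * (B * C) = p) (hτ : 0 < τ.im)
    (h : (3 * A * τ ^ 2 + 3 * (B + C) * τ + D : ℂ) = 0) :
    FM !![A, B; 3 * C, D] τ = -27 * (A * τ + C) ^ 6 := by
  have h0 := ne_zero_of_im hτ
  have hdet : (!![A, B; 3 * C, D] : Mat).det = p := by
    rw [det_fin_two_of]; linarith
  have hp0 : (p : ℤ) ≠ 0 := by exact_mod_cast p_pos.ne'
  have hj := jf_ne_zero (M := !![A, B; 3 * C, D]) (by rw [hdet]; exact hp0) hτ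
  have hg := gg_ne_zero hτ
  rw [FM, (mob_eq_Wt_iff hd hτ).2 h, gg_Wt hτ, hdet]
  have e : jf !![A, B; 3 * C, D] τ = -3 * τ * (A * τ + B) := by
    simp only [jf, of_apply, cons_val', cons_val_zero, cons_val_one, cons_val_fin_one]
    push_cast
    linear_combination h
  rw [e] at hj ⊢
  have hm := mul_of_quad hd h
  have h1 : (A * τ + B : ℂ) ≠ 0 := right_ne_zero_of_mul hj
  push_cast
  have : (p : ℂ) = -(3 * ((A * τ + B) * (A * τ + C))) := by rw [hm]; ring
  rw [this]
  field_simp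

theorem exists_quad_of_ww_eq {i : Option (ZMod p)} (hτ : 0 < τ.im)
    (h : 1 - 729 * ww τ * ww (mob (crep p i) τ) = 0) :
    ∃ A B C D : ℤ, A * D - 3 * (B * C) = p ∧ (3 * A * τ ^ 2 + 3 * (B + C) * τ + D : ℂ) = 0 ∧
      ∃ γ, G0 γ ∧ γ * crep p i = !![A, B; 3 * C, D] := by
  have hw := ww_ne_zero hτ
  have h1 : ww (mob (crep p i) τ) = ww (Wt τ) := by
    rw [ww_Wt hτ, eq_div_iff (mul_ne_zero (by norm_num) hw)]; linear_combination -h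
  obtain ⟨γ, hγ, h2⟩ := E0_of_ww_eq (im_cos_pos i hτ) (im_Wt_pos hτ) h1
  rw [← mob_mul hγ.det_ne (det_cos_pos i) hτ] at h2
  have hdet : (γ * crep p i).det = p := by rw [det_mul, hγ.1, det_cos, one_mul]
  have h3 : 3 ∣ (γ * crep p i) 1 0 := by
    obtain ⟨c, hc⟩ := hγ.2
    rcases i with _ | b <;>
    simp [crep, Matrix.mul_apply, Fin.sum_univ_two, hc, mul_assoc]
  obtain ⟨C, hC⟩ := h3
  have e : γ * crep p i = !![(γ * crep p i) 0 0, (γ * crep p i) 0 1; 3 * C,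
      (γ * crep p i) 1 1] := by
    rw [← hC]; exact eta_fin_two _
  generalize (γ * crep p i) 0 0 = A at e
  generalize (γ * crep p i) 0 1 = B at e
  generalize (γ * crep p i) 1 1 = D at e
  have hd : A * D - 3 * (B * C) = p := by
    rw [e, det_fin_two_of] at hdet; linarith
  exact ⟨A, B, C, D, hd, (mob_eq_Wt_iff hd hτ).1 (by rw [← e]; exact h2), γ, hγ, e⟩

theorem exists_index_of_quad (hp : 5 ≤ p) {A B C D : ℤ} (hd : A * D - 3 * (B * C) = p)
    (hτ : 0 < τ.im) (h : (3 * A * τ ^ 2 + 3 * (B + C) * τ + D : ℂ) = 0) :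
    ∃ i γ, G0 γ ∧ !![A, B; 3 * C, D] = γ * crep p i ∧
      FM (crep p i) τ = -27 * (A * τ + C) ^ 6 := by
  obtain ⟨i, γ, hγ, e⟩ := exists_cos (p := p) (N := !![A, B; 3 * C, D])
    (by rw [det_fin_two_of]; linarith) (by simp) hp
  refine ⟨i, γ, hγ, e, ?_⟩
  rw [← FM_of_quad hd hτ h, e, FM_mul hγ.det_pos (det_cos_pos i) hτ, FM_G0 hγ (im_cos_pos i hτ),
    one_mul]

theorem ww_mul_of_index {M : Mat} {i : Option (ZMod p)} {γ : Mat} (hγ : G0 γ)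
    (e : M = γ * crep p i) (hτ : 0 < τ.im) :
    ww (mob (crep p i) τ) = ww (mob M τ) := by
  rw [e, mob_mul hγ.det_ne (det_cos_pos i) hτ, ww_mob hγ (im_cos_pos i hτ)]

/-- Integral quadratic equations with a common root in the upper half-plane are proportional. -/
theorem quad_proportional {a b c a' b' c' : ℤ} (hτ : 0 < τ.im)
    (h : (a * τ ^ 2 + b * τ + c : ℂ) = 0) (h' : (a' * τ ^ 2 + b' * τ + c' : ℂ) = 0) :
    a * b' = a' * b ∧ a * c' = a' * c := by
  have h1 : ((a * b' - a' * b : ℤ) : ℂ) * τ + ((a * c' - a' * c : ℤ) : ℂ) = 0 := by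
    push_cast; linear_combination a * h' - a' * h
  have h2 := congrArg im h1
  simp only [add_im, mul_im, intCast_im, intCast_re, zero_mul, add_zero, zero_im] at h2
  have h3 : a * b' - a' * b = 0 := by
    have := (mul_eq_zero.1 h2).resolve_right hτ.ne'
    exact_mod_cast this
  rw [h3, Int.cast_zero, zero_mul, zero_add] at h1
  have h4 : a * c' - a' * c = 0 := by exact_mod_cast h1
  omega

theorem quad_disc_neg {a b c : ℤ} (hτ : 0 < τ.im) (ha : a ≠ 0)
    (h : (a * τ ^ 2 + b * τ + c : ℂ) = 0) : b ^ 2 < 4 * a * c := by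
  have h1 : (2 * a * τ + b) ^ 2 = ((b ^ 2 - 4 * a * c : ℤ) : ℂ) := by
    push_cast; linear_combination 4 * a * h
  have h2 := congrArg im h1
  have h3 := congrArg re h1
  rw [intCast_im] at h2
  rw [intCast_re] at h3
  have e1 : (2 * a * τ + b : ℂ).im = 2 * a * τ.im := by simp
  have ha' : (a : ℝ) ≠ 0 := by exact_mod_cast ha
  have hi : (2 * a * τ + b : ℂ).im ≠ 0 := by
    grind
  generalize (2 * a * τ + b : ℂ) = z at *
  rw [sq, mul_im] at h2
  rw [sq, mul_re] at h3
  have h4 : z.re = 0 := by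
    grind
  rw [h4] at h3
  have h5 := pow_pos (abs_pos.2 hi) 2
  rw [sq_abs] at h5
  have h6 : ((b ^ 2 - 4 * a * c : ℤ) : ℝ) < 0 := by rw [← h3]; nlinarith
  have : b ^ 2 - 4 * a * c < 0 := by exact_mod_cast h6
  linarith

theorem quad_ne_zero (hp : 5 ≤ p) {A B C D : ℤ} (hd : A * D - 3 * (B * C) = p) : A ≠ 0 := by
  rintro rfl
  have : (3 : ℤ) ∣ p := ⟨-(B * C), by linarith⟩
  have h6 : 3 ∣ p := by exact_mod_cast this
  have h7 := (Nat.prime_dvd_prime_iff_eq Nat.prime_three (Fact.out : p.Prime)).1 h6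
  omega

theorem sq_sub_lt (hp : 5 ≤ p) {A B C D : ℤ} (hd : A * D - 3 * (B * C) = p) (hτ : 0 < τ.im)
    (h : (3 * A * τ ^ 2 + 3 * (B + C) * τ + D : ℂ) = 0) : 3 * (B - C) ^ 2 < 4 * p := by
  have hA := quad_ne_zero hp hd
  have := quad_disc_neg (a := 3 * A) (b := 3 * (B + C)) (c := D) hτ (by omega)
    (by push_cast; exact h)
  nlinarith

theorem eq_zero_of_dvd_of_lt (hp : 5 ≤ p) {d : ℤ} (hd : (p : ℤ) ∣ d) (h : 3 * d ^ 2 ≤ 4 * p) : d = 0 := by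
  obtain ⟨e, rfl⟩ := hd
  by_contra hne
  have he : e ≠ 0 := right_ne_zero_of_mul hne
  have h1 : 1 ≤ e ^ 2 := by have := sq_pos_of_ne_zero he; omega
  have h2 : 3 * (p : ℤ) ^ 2 * 1 ≤ 3 * (p : ℤ) ^ 2 * e ^ 2 := by gcongr
  nlinarith

/-- All elements of determinant `3p` fixing a trace-zero point agree up to sign. -/
theorem eq_of_quad_of_TZ (hp : 5 ≤ p) {A B D : ℤ} (hτ : 0 < τ.im)
    (hd : A * D - 3 * B ^ 2 = p) (h : (3 * A * τ ^ 2 + 6 * B * τ + D : ℂ) = 0)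
    {A' B' C' D' : ℤ} (hd' : A' * D' - 3 * (B' * C') = p)
    (h' : (3 * A' * τ ^ 2 + 3 * (B' + C') * τ + D' : ℂ) = 0) :
    (A' = A ∧ B' = B ∧ C' = B ∧ D' = D) ∨ (A' = -A ∧ B' = -B ∧ C' = -B ∧ D' = -D) := by
  have hA := quad_ne_zero hp (A := A) (B := B) (C := B) (D := D) (by rw [← hd]; ring)
  obtain ⟨h1, h2⟩ := quad_proportional (a := 3 * A) (b := 6 * B) (c := D) (a' := 3 * A')
    (b' := 3 * (B' + C')) (c' := D') hτ (by push_cast; exact h) (by push_cast; exact h')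
  have h1 : A * (B' + C') = 2 * (A' * B) := by linarith
  have h2 : A * D' = A' * D := by linarith
  have h3 : 3 * ((B' - C') * A) ^ 2 = 4 * p * (A ^ 2 - A' ^ 2) := by
    grind
  have h4 : D * (B' + C') = 2 * (D' * B) := by
    refine mul_left_cancel₀ hA ?_
    linear_combination D * h1 - 2 * B * h2
  have h5 : 3 * ((B' - C') * D) ^ 2 = 4 * p * (D ^ 2 - D' ^ 2) := by
    grind
  have hpp : Prime (p : ℤ) := Nat.prime_iff_prime_int.1 Fact.out
  have hp3 : ∀ x : ℤ, (p : ℤ) ∣ 3 * x ^ 2 → (p : ℤ) ∣ x := fun x hx => by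
    rcases hpp.dvd_mul.1 hx with h | h
    · have := Int.le_of_dvd (by norm_num) h; omega
    · exact hpp.dvd_of_dvd_pow h
  have h6 := hp3 _ ⟨_, h3.trans (by ring : _ = (p : ℤ) * (4 * (A ^ 2 - A' ^ 2)))⟩
  have h7 := hp3 _ ⟨_, h5.trans (by ring : _ = (p : ℤ) * (4 * (D ^ 2 - D' ^ 2)))⟩
  have h8 : (p : ℤ) ∣ B' - C' := by
    rcases hpp.dvd_mul.1 h6 with h | ⟨a, ha⟩
    · exact h
    rcases hpp.dvd_mul.1 h7 with h | ⟨d, hdd⟩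
    · exact h
    obtain ⟨b, hb⟩ := hp3 B ⟨p * (a * d) - 1, by rw [ha, hdd] at hd; linear_combination -hd⟩
    exfalso
    have : (p : ℤ) * (p * (a * d - 3 * b ^ 2)) = p * 1 := by
      rw [ha, hb, hdd] at hd; linear_combination hd
    have := mul_left_cancel₀ hpp.ne_zero this
    exact hpp.not_isUnit (IsUnit.of_mul_eq_one _ this)
  have h9 := eq_zero_of_dvd_of_lt hp h8 (sq_sub_lt hp hd' hτ h').le
  have h10 : A' ^ 2 = A ^ 2 := by
    rw [h9] at h3
    have : 4 * (p : ℤ) * (A ^ 2 - A' ^ 2) = 4 * p * 0 := by linear_combination -h3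
    have := mul_left_cancel₀ (mul_ne_zero four_ne_zero hpp.ne_zero) this
    omega
  have hC : C' = B' := by omega
  subst hC
  rcases sq_eq_sq_iff_eq_or_eq_neg.1 h10 with rfl | rfl
  · left
    have e1 := mul_left_cancel₀ hA (show A' * C' = A' * B by linarith)
    exact ⟨rfl, e1, e1, mul_left_cancel₀ hA h2⟩
  · right
    have e1 := mul_left_cancel₀ hA (show A * C' = A * -B by linarith)
    exact ⟨rfl, e1, e1, mul_left_cancel₀ hA (by linarith)⟩

theorem aa_ne_zero_of_TZ (hp : 5 ≤ p) (hτ : 0 < τ.im) (h : TZ p τ) : aa τ ≠ 0 := by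
  obtain ⟨A, B, D, hd, hq⟩ := h
  intro h0
  have h1 := aa_pow_three hτ
  rw [h0, zero_pow three_ne_zero] at h1
  have h2 : xx τ = 0 := (mul_eq_zero.1 h1.symm).resolve_left (gg_ne_zero hτ)
  have h3 := xx_mul hτ
  rw [h2, mul_zero] at h3
  have h4 : ww τ = ww ptB := by
    rw [ww_ptB]
    grind
  obtain ⟨M, hM, hM2⟩ := E0_of_ww_eq hτ ptB_im_pos h4
  obtain ⟨a, b, c, d, rfl⟩ : ∃ a b c d, M = !![a, b; c, d] := ⟨_, _, _, _, eta_fin_two M⟩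
  have hdet := hM.1
  rw [det_fin_two_of] at hdet
  have hb := ptB_sq
  have hm := mob_mul_jf hM.det_ne hτ
  rw [hM2] at hm
  simp only [jf, of_apply, cons_val', cons_val_zero, cons_val_one, cons_val_fin_one] at hm
  generalize ptB = m at *
  have hA := quad_ne_zero hp (A := A) (B := B) (C := B) (D := D) (by rw [← hd]; ring)
  obtain ⟨h5, h6⟩ := quad_proportional (a := 3 * A) (b := 6 * B) (c := D)
    (a' := 3 * a ^ 2 + 3 * a * c + c ^ 2) (b' := 6 * a * b + 3 * a * d + 3 * b * c + 2 * c * d)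
    (c' := 3 * b ^ 2 + 3 * b * d + d ^ 2) hτ (by push_cast; exact hq)
    (by
      grind)
  have h7 : (p : ℤ) * (2 * (3 * a ^ 2 + 3 * a * c + c ^ 2)) ^ 2 = (3 * A) ^ 2 := by
    have hdisc : 4 * (3 * a ^ 2 + 3 * a * c + c ^ 2) * (3 * b ^ 2 + 3 * b * d + d ^ 2) -
        (6 * a * b + 3 * a * d + 3 * b * c + 2 * c * d) ^ 2 = 3 := by
      linear_combination 3 * (a * d - b * c + 1) * hdet
    generalize 3 * a ^ 2 + 3 * a * c + c ^ 2 = x at *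
    grind
  have h8 : ¬ IsSquare (p : ℚ) := by
    rw [Rat.isSquare_natCast_iff]
    exact (Fact.out : p.Prime).prime.not_isSquare
  have h9 : (2 * (3 * a ^ 2 + 3 * a * c + c ^ 2) : ℚ) ≠ 0 := by
    intro h
    have : (2 * (3 * a ^ 2 + 3 * a * c + c ^ 2) : ℤ) = 0 := by exact_mod_cast h
    grind
  refine h8 ⟨3 * A / (2 * (3 * a ^ 2 + 3 * a * c + c ^ 2)), ?_⟩
  rw [div_mul_div_comm, eq_div_iff (mul_ne_zero h9 h9), ← sq, ← sq]
  exact_mod_cast h7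

end CM

section Simple
variable {p : ℕ} [Fact p.Prime]

theorem TZ_index_unique (hp : 5 ≤ p) {A B D : ℤ} (hτ : 0 < τ.im)
    (hd : A * D - 3 * B ^ 2 = p) (h : (3 * A * τ ^ 2 + 6 * B * τ + D : ℂ) = 0)
    {i j : Option (ZMod p)} {γ : Mat} (hγ : G0 γ) (e : !![A, B; 3 * B, D] = γ * crep p i)
    (hj : 1 - 729 * ww τ * ww (mob (crep p j) τ) = 0) : j = i := by
  obtain ⟨A', B', C', D', hd', hq', γ', hγ', e'⟩ := exists_quad_of_ww_eq hτ hj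
  rcases eq_of_quad_of_TZ hp hτ hd h hd' hq' with ⟨rfl, rfl, rfl, rfl⟩ | ⟨rfl, rfl, rfl, rfl⟩
  · refine cos_injective (hγ'.adj.mul hγ) ?_
    rw [Matrix.mul_assoc, ← e, ← e', ← Matrix.mul_assoc, hγ'.adj_mul, Matrix.one_mul]
  · refine cos_injective (hγ'.adj.mul hγ.neg) ?_
    have e2 : (-γ) * crep p i = γ' * crep p j := by
      rw [e', Matrix.neg_mul, ← e]
      ext a b; fin_cases a <;> fin_cases b <;> simp
    rw [Matrix.mul_assoc, e2, ← Matrix.mul_assoc, hγ'.adj_mul, Matrix.one_mul]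

theorem hasDerivAt_ww (hτ : 0 < τ.im) :
    HasDerivAt ww (2 * Real.pi * I * (aa τ * ww τ)) τ := by
  rw [← td_ww hτ]; exact hasDerivAt_td (differentiableAt_ww hτ)

theorem TZ_simple (hp : 5 ≤ p) {V : ValuationSubring ℂ} {P : V[X]}
    (hP : ∀ τ : ℂ, 0 < τ.im → P.eval₂ V.subtype (ww τ) =
        ∏ i, (1 - 729 * ww τ * ww (mob (crep p i) τ)))
    (hτ : 0 < τ.im) (h : TZ p τ) :
    (P.map V.subtype).eval (ww τ) = 0 ∧ (derivative (P.map V.subtype)).eval (ww τ) ≠ 0 := by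
  have haa := aa_ne_zero_of_TZ hp hτ h
  obtain ⟨A, B, D, hd, hq⟩ := h
  have hd2 : A * D - 3 * (B * B) = p := by rw [← hd]; ring
  have hq2 : (3 * A * τ ^ 2 + 3 * (B + B) * τ + D : ℂ) = 0 := by rw [← hq]; ring
  obtain ⟨i, γ, hγ, e, -⟩ := exists_index_of_quad hp hd2 hτ hq2
  have hw := ww_ne_zero hτ
  have hdetN : (!![A, B; 3 * B, D] : Mat).det = p := by rw [det_fin_two_of]; linarith
  have hpos : (0 : ℤ) < p := by exact_mod_cast p_pos
  have hdetN' : 0 < (!![A, B; 3 * B, D] : Mat).det := by rw [hdetN]; exact hpos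
  set M : Mat := WM * !![A, B; 3 * B, D] with hM
  have hMd : M.det = 3 * p := by rw [hM, det_mul, det_WM, hdetN]
  have hMd0 : M.det ≠ 0 := by rw [hMd]; positivity
  have hWM : WM.det ≠ 0 := by rw [det_WM]; norm_num
  have hWp := (mob_eq_Wt_iff hd2 hτ).2 hq2
  have hMτ : mob M τ = τ := by
    rw [hM, mob_mul hWM hdetN' hτ, mob_WM, hWp, Wt_Wt hτ]
  have hf : ∀ σ : ℂ, 0 < σ.im → 1 - 729 * ww σ * ww (mob (crep p i) σ) =
      1 - ww σ / ww (mob M σ) := by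
    intro σ hσ
    rw [ww_mul_of_index hγ e hσ, hM, mob_mul hWM hdetN' hσ, mob_WM, ww_Wt (im_mob_pos hdetN' hσ)]
    field_simp
  have hP0 : ∀ Q : V[X], (Q.map V.subtype).eval (ww τ) = Q.eval₂ V.subtype (ww τ) :=
    fun Q => eval_map _ _
  have hi0 : 1 - 729 * ww τ * ww (mob (crep p i) τ) = 0 := by
    rw [hf τ hτ, hMτ, div_self hw, sub_self]
  refine ⟨by rw [hP0, hP τ hτ]; exact prod_eq_zero (mem_univ i) hi0, fun hder => ?_⟩
  set G : ℂ → ℂ := fun σ => ∏ j ∈ univ.erase i,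
    (1 - 729 * ww σ * ww (mob (crep p j) σ))
  have hGd : DifferentiableAt ℂ G τ := by
    refine DifferentiableAt.fun_finsetProd fun j _ => ?_
    exact ((differentiableAt_const _).sub (((differentiableAt_const _).mul
      (differentiableAt_ww hτ)).mul (differentiableAt_comp_cos (fun _ => differentiableAt_ww) j hτ)))
  have hG0 : G τ ≠ 0 := by
    refine Finset.prod_ne_zero_iff.2 fun j hj h0 => ?_
    exact (Finset.mem_erase.1 hj).1 (TZ_index_unique hp hτ hd hq hγ e h0)
  have hw' := hasDerivAt_ww hτ
  have hmob := hasDerivAt_mob hMd0 hτ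
  have hcomp : HasDerivAt (fun σ => ww (mob M σ))
      (2 * Real.pi * I * (aa τ * ww τ) * (M.det / jf M τ ^ 2)) τ := by
    have hw2 : HasDerivAt ww (2 * Real.pi * I * (aa τ * ww τ)) (mob M τ) := by
      rw [hMτ]; exact hw'
    exact hw2.comp τ hmob
  have hmult : (M.det / jf M τ ^ 2 : ℂ) = -1 := by
    have hm := mul_of_quad hd2 hq2
    have hj := jf_ne_zero hMd0 hτ
    rw [div_eq_iff (pow_ne_zero 2 hj), hMd]
    have : jf M τ = 3 * (A * τ + B) := by
      simp [jf, hM, WM]; ring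
    rw [this]
    push_cast
    linear_combination 3 * hm
  rw [hmult] at hcomp
  have hdiv := (hw'.fun_div hcomp (by rw [hMτ]; exact hw)).const_sub 1
  have hprod := hdiv.mul hGd.hasDerivAt
  have hL : HasDerivAt (fun σ => (P.map V.subtype).eval (ww σ))
      ((derivative (P.map V.subtype)).eval (ww τ) * (2 * Real.pi * I * (aa τ * ww τ))) τ :=
    (Polynomial.hasDerivAt _ _).comp τ hw'
  have hev : (fun σ => (P.map V.subtype).eval (ww σ)) =ᶠ[𝓝 τ]
      (fun σ => 1 - ww σ / ww (mob M σ)) * G := by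
    filter_upwards [(isOpen_lt continuous_const Complex.continuous_im).mem_nhds hτ] with σ (hσ : 0 < σ.im)
    rw [eval_map, hP σ hσ, ← mul_prod_erase _ _ (mem_univ i), hf σ hσ]
    rfl
  have huniq := hL.unique (hprod.congr_of_eventuallyEq hev)
  rw [hder, zero_mul, hMτ, div_self hw, sub_self, zero_mul, add_zero] at huniq
  have h2 := (mul_eq_zero.1 huniq.symm).resolve_right hG0
  rw [neg_eq_zero, div_eq_zero_iff, or_iff_left (pow_ne_zero 2 hw)] at h2
  have h3 : 2 * (2 * Real.pi * I) * aa τ * ww τ ^ 2 = 0 := by linear_combination h2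
  simp [hw, haa] at h3

end Simple

section Dichotomy
variable {p : ℕ} [Fact p.Prime] {V : ValuationSubring ℂ}

theorem eval_S_eq_zero_iff (hp : 5 ≤ p) [CharP (ResidueField V) p]
    {s : ResidueField V} (hτ : 0 < τ.im) {F : Option (ZMod p) → V}
    (hF : ∀ i, (F i : ℂ) = FM (crep p i) τ)
    (hs : ∏ i, (X - C (residue V (F i))) = X ^ (p + 1) - C s * X)
    {i : Option (ZMod p)} (hi : 1 - 729 * ww τ * ww (mob (crep p i) τ) = 0) :
    s = 0 ↔ TZ p τ := by
  have hp0 : residue V (p : V) = 0 := by rw [map_natCast, CharP.cast_eq_zero]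
  constructor
  · intro h0
    obtain ⟨A, B, C', D, hd, hq, -⟩ := exists_quad_of_ww_eq hτ hi
    have hroot : ∀ j, residue V (F j) = 0 := by
      intro j
      have := congrArg (eval (residue V (F j))) hs
      rw [h0, C_0, zero_mul, sub_zero, eval_pow, eval_X, eval_prod,
        prod_eq_zero (mem_univ j) (by simp)] at this
      exact pow_eq_zero_iff (by omega) |>.1 this.symm
    by_cases hBC : B = C'
    · subst hBC
      exact ⟨A, B, D, by rw [← hd]; ring, by rw [← hq]; ring⟩
    exfalso
    have hint : ∀ x y : ℤ, A * D - 3 * (x * y) = p →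
        (3 * A * τ ^ 2 + 3 * (x + y) * τ + D : ℂ) = 0 →
        ∃ z : V, (z : ℂ) = 3 * (A * τ + y) ∧ residue V z = 0 := by
      intro x y hd hq
      have hz : (3 * (A * τ + y) : ℂ) ∈ V := by
        refine mem_of_root (P := X ^ 2 + (C ((3 * (x - y) : ℤ) : V) * X + C ((3 * p : ℤ) : V))) ?_ ?_
        · refine monic_X_pow_add ((degree_linear_le).trans_lt (by norm_num))
        · have hd' : (A * D - 3 * (x * y) : ℂ) = p := by exact_mod_cast hd
          rw [eval₂_add, eval₂_add, eval₂_mul, eval₂_pow, eval₂_X, eval₂_C, eval₂_C,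
            _root_.map_intCast, _root_.map_intCast]
          push_cast
          linear_combination 3 * A * hq - 3 * hd'
      refine ⟨⟨_, hz⟩, rfl, ?_⟩
      obtain ⟨j, γ, hγ, -, hj⟩ := exists_index_of_quad hp hd hτ hq
      have h1 : 27 * F j = -(⟨_, hz⟩ : V) ^ 6 := by
        apply Subtype.ext
        change (27 : ℂ) * F j = -(3 * (A * τ + y) : ℂ) ^ 6
        rw [hF, hj]; ring
      have h2 := congrArg (residue V) h1
      rw [map_mul, hroot, mul_zero, map_neg, map_pow] at h2
      exact pow_eq_zero_iff (by norm_num : 6 ≠ 0) |>.1 (neg_eq_zero.1 h2.symm)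
    obtain ⟨z1, hz1, hr1⟩ := hint B C' hd hq
    obtain ⟨z2, hz2, hr2⟩ := hint C' B (by rw [← hd]; ring) (by rw [← hq]; ring)
    have h3 : z2 - z1 = ((3 * (B - C') : ℤ) : V) := by
      apply Subtype.ext
      change (z2 : ℂ) - z1 = _
      rw [hz1, hz2]
      have : ((((3 * (B - C') : ℤ) : V)) : ℂ) = ((3 * (B - C') : ℤ) : ℂ) :=
        _root_.map_intCast V.subtype _
      rw [this]
      push_cast
      ring
    have h4 := congrArg (residue V) h3
    rw [map_sub, hr1, hr2, sub_zero, _root_.map_intCast, eq_comm,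
      CharP.intCast_eq_zero_iff _ p] at h4
    have hpp : Prime (p : ℤ) := Nat.prime_iff_prime_int.1 Fact.out
    rcases hpp.dvd_mul.1 h4 with h5 | h5
    · have := Int.le_of_dvd (by norm_num) h5; omega
    · have := eq_zero_of_dvd_of_lt hp h5 (sq_sub_lt hp hd hτ hq).le
      omega
  · rintro ⟨A, B, D, hd, hq⟩
    have hd2 : A * D - 3 * (B * B) = p := by rw [← hd]; ring
    have hq2 : (3 * A * τ ^ 2 + 3 * (B + B) * τ + D : ℂ) = 0 := by rw [← hq]; ring
    obtain ⟨i, γ, hγ, e, hFi⟩ := exists_index_of_quad hp hd2 hτ hq2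
    have hm := mul_of_quad hd2 hq2
    have hFp : F i = (p : V) ^ 3 := by
      apply Subtype.ext
      have : ((p : V) ^ 3 : V) = ((p : ℂ) ^ 3) := by push_cast; rfl
      rw [hF, hFi, this]
      linear_combination -(9 * (A * τ + B) ^ 4 - 3 * p * (A * τ + B) ^ 2 + p ^ 2) * hm
    have hprod : ∏ j ∈ univ.erase i, F j = (p : V) ^ 3 := by
      have hpc : (p : V) ^ 3 ≠ 0 := by
        refine pow_ne_zero 3 fun h => ?_
        have := congrArg (fun v : V => (v : ℂ)) h
        exact (p_ne_zero (p := p)) (by exact_mod_cast this)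
      refine mul_left_cancel₀ hpc ?_
      rw [← hFp, mul_prod_erase _ _ (mem_univ i)]
      apply Subtype.ext
      have h1 := prod_FM_cos hp hτ
      rw [← prod_congr rfl fun j _ => hF j] at h1
      have h2 : ((∏ j, F j : V) : ℂ) = ∏ j, (F j : ℂ) := map_prod V.subtype _ _
      rw [h2, h1, hFp]
      push_cast
      ring
    have h0 : ∃ j ∈ univ.erase i, residue V (F j) = 0 := by
      have := congrArg (residue V) hprod
      rw [map_prod, map_pow, hp0, zero_pow three_ne_zero] at this
      exact Finset.prod_eq_zero_iff.1 this
    obtain ⟨j, hj, hj0⟩ := h0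
    have hi0 : residue V (F i) = 0 := by rw [hFp, map_pow, hp0, zero_pow three_ne_zero]
    rw [← mul_prod_erase _ _ (mem_univ i), ← mul_prod_erase _ _ hj, hj0, hi0,
      C_0, sub_zero, ← mul_assoc] at hs
    have := congrArg (fun Q => coeff Q 1) hs
    simp only [coeff_sub, coeff_C_mul, coeff_X_one, mul_one, coeff_X_pow] at this
    rw [if_neg (by omega), ← sq, coeff_X_pow_mul', if_neg (by norm_num)] at this
    simpa using this.symm

end Dichotomy

section Count
variable {p : ℕ} [Fact p.Prime] {V : ValuationSubring ℂ}

local notation "k" => ResidueField V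

theorem count_filter_roots {K : Type*} [Field K] [IsAlgClosed K] {T : K[X]} (hT : T.Separable)
    (q : K → Prop) [DecidablePred q] :
    Multiset.card ((T ^ 2).roots.filter q) = 2 * Set.ncard {r | T.eval r = 0 ∧ q r} := by
  classical
  have hT0 : T ≠ 0 := hT.ne_zero
  rw [roots_pow, Multiset.filter_nsmul, Multiset.card_nsmul]
  congr 1
  have hn : (T.roots.filter q).Nodup := (nodup_roots hT).filter q
  rw [← Multiset.toFinset_card_of_nodup (m := T.roots.filter q) hn, ← Set.ncard_coe_finset]
  congr 1
  ext r
  simp [hT0]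

theorem isUnit_natCast_of_lt (hp : 5 ≤ p) [CharP k p] : IsUnit (27 : V) := by
  have h3 : (3 : k) ≠ 0 := by
    intro h
    have := (CharP.cast_eq_zero_iff k p 3).1 (by exact_mod_cast h)
    have := Nat.le_of_dvd (by norm_num) this
    omega
  have : residue V 27 ≠ 0 := by
    rw [map_ofNat, show (27 : k) = 3 ^ 3 by norm_num]
    exact pow_ne_zero 3 h3
  exact not_not.1 fun h => this ((residue_eq_zero_iff _).2 h)

theorem separable_aux [CharP k p] : (1 - 729 * X ^ (p + 1) : k[X]).Separable := by
  refine ⟨1, C (1 : k) * -X, ?_⟩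
  have e : derivative (1 - 729 * X ^ (p + 1) : k[X]) = -(729 * X ^ p) := by
    rw [derivative_sub, derivative_one, derivative_mul, derivative_X_pow, derivative_ofNat]
    have : ((p + 1 : ℕ) : k) = 1 := by push_cast; rw [CharP.cast_eq_zero, zero_add]
    rw [this]; simp
  rw [e, C_1]
  ring

/-- The values of the Hauptmodul at the points fixed by an element of determinant `p`
are the zeros of the ramification polynomial reducing to supersingular points. -/
theorem ncard_TZ (hp : 5 ≤ p) [CharP k p] (f : ZMod p →+* k) :
    Set.ncard {w : ℂ | ∃ τ : ℂ, 0 < τ.im ∧ TZ p τ ∧ w = ww τ} =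
      2 * Set.ncard {r : k | 729 * r ^ (p + 1) = 1 ∧
        ((ss3Star p).map f).eval ((1 + 27 * r) ^ 2 / r) = 0} := by
  classical
  obtain ⟨P, hPd, hPc, hP0, hP, hPr⟩ := exists_ramification_poly (V := V) hp
  obtain ⟨S, hS0, hSd, hS, hSF⟩ := exists_S (V := V) hp
  obtain ⟨u, hu⟩ := isUnit_natCast_of_lt (V := V) hp
  set N := 2 * (p + 1)
  have hinj : Function.Injective V.subtype := Subtype.val_injective
  set Q := P.map V.subtype with hQ
  have hlc : P.leadingCoeff = ((u ^ N : Vˣ) : V) := by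
    rw [leadingCoeff, natDegree_eq_of_le_of_coeff_ne_zero hPd, hPc, Units.val_pow_eq_pow_val, hu]
    rw [hPc, ← hu]; exact pow_ne_zero _ u.ne_zero
  have hQlc : Q.leadingCoeff = V.subtype ((u ^ N : Vˣ) : V) := by
    rw [hQ, leadingCoeff_map_of_injective hinj, hlc]
  have hP00 : P ≠ 0 := by
    rintro rfl
    simp at hP0
  have hQ0 : Q ≠ 0 := (Polynomial.map_ne_zero_iff hinj).2 hP00
  have hmem : ∀ z ∈ Q.roots, z ∈ V := by
    intro z hz
    have hz0 : P.eval₂ V.subtype z = 0 := by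
      rw [← eval_map]; exact (mem_roots hQ0).1 hz
    refine mem_of_root (P := C (((u ^ N)⁻¹ : Vˣ) : V) * P) ?_ ?_
    · rw [Monic, leadingCoeff_mul, leadingCoeff_C, hlc, Units.inv_mul]
    · rw [eval₂_mul, hz0, mul_zero]
  obtain ⟨M, hM⟩ : ∃ M : Multiset V, M.map V.subtype = Q.roots := by
    refine ⟨Q.roots.pmap (fun z hz => ⟨z, hz⟩) hmem, ?_⟩
    rw [Multiset.map_pmap]
    exact (Multiset.pmap_eq_map _ _ _ _).trans (Multiset.map_id _)
  have hPM : P = C ((u ^ N : Vˣ) : V) * (M.map fun a => X - C a).prod := by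
    apply Polynomial.map_injective _ hinj
    rw [← hQ, (IsAlgClosed.splits Q).eq_prod_roots, hQlc, ← hM, Polynomial.map_mul, map_C,
      Polynomial.map_multiset_prod, Multiset.map_map, Multiset.map_map]
    simp
  have hMr : M.map (residue V) = ((1 - 729 * X ^ (p + 1) : k[X]) ^ 2).roots := by
    rw [← hPr, hPM, Polynomial.map_mul, map_C, roots_C_mul _
      ((u ^ N).isUnit.map (residue V)).ne_zero, Polynomial.map_multiset_prod,
      Multiset.map_map]
    have : ((fun x => Polynomial.map (residue V) x) ∘ fun a => X - C a) =
      (fun a => X - C a) ∘ residue V := by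
      funext a; simp
    rw [this, ← Multiset.map_map, roots_multiset_prod_X_sub_C]
  set q : k → Prop := fun r => ((ss3Star p).map f).eval ((1 + 27 * r) ^ 2 / r) = 0 with hq
  have hM0 : ∀ w : V, w ∈ M ↔ P.eval₂ V.subtype w = 0 := by
    intro w
    rw [← eval_map, ← hQ]
    have : w ∈ M ↔ (w : ℂ) ∈ Q.roots := by
      rw [← hM]; exact (Multiset.mem_map_of_injective hinj).symm
    rw [this, mem_roots hQ0]; rfl
  have hkey : ∀ (w : V) (τ : ℂ), 0 < τ.im → (w : ℂ) = ww τ → w ∈ M →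
      (q (residue V w) ↔ TZ p τ) := by
    intro w τ hτ hwτ hw
    have hprod := (hM0 w).1 hw
    rw [hwτ, hP τ hτ] at hprod
    obtain ⟨i, -, hi⟩ := Finset.prod_eq_zero_iff.1 hprod
    have hr : residue V w ∈ ((1 - 729 * X ^ (p + 1) : k[X]) ^ 2).roots := by
      rw [← hMr]; exact Multiset.mem_map_of_mem _ hw
    have hr0 : residue V w ≠ 0 := by
      intro h0
      rw [h0] at hr
      have := isRoot_of_mem_roots hr
      simp at this
    have hwu : IsUnit w := not_not.1 fun h => hr0 ((residue_eq_zero_iff _).2 h)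
    obtain ⟨v, hv⟩ := hwu
    have hx : (((1 + 27 * w) ^ 2 * (v⁻¹ : Vˣ) : V) : ℂ) = xx τ := by
      have h1 : ((v : V) * ((1 + 27 * w) ^ 2 * (v⁻¹ : Vˣ)) : V) = (1 + 27 * w) ^ 2 := by
        rw [mul_left_comm, Units.mul_inv, mul_one]
      have h2 := congrArg (fun a : V => (a : ℂ)) h1
      rw [hv] at h2
      change (w : ℂ) * _ = (1 + 27 * (w : ℂ)) ^ 2 at h2
      rw [hwτ, ← xx_mul hτ] at h2
      exact mul_left_cancel₀ (ww_ne_zero hτ) h2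
    obtain ⟨F, hF, hFs⟩ := hSF τ _ hτ hx
    rw [← eval_S_eq_zero_iff hp hτ hF hFs hi, S_root_iff hp hS0 hSd hS f]
    have : residue V ((1 + 27 * w) ^ 2 * (v⁻¹ : Vˣ)) =
        (1 + 27 * residue V w) ^ 2 / residue V w := by
      rw [eq_div_iff hr0, ← map_mul, mul_assoc, ← hv, Units.inv_mul]
      rw [mul_one, map_pow, map_add, map_mul, map_one, map_ofNat]
    rw [this]
  have hnd : (M.filter fun w => q (residue V w)).Nodup := by
    rw [Multiset.nodup_iff_count_le_one]
    intro w
    by_cases hwq : q (residue V w)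
    swap
    · rw [Multiset.count_filter_of_neg (p := fun w => q (residue V w)) hwq]; exact zero_le_one
    rw [Multiset.count_filter_of_pos (p := fun w => q (residue V w)) hwq]
    by_cases hw : w ∈ M
    swap
    · rw [Multiset.count_eq_zero_of_notMem hw]; exact zero_le_one
    have hw0 : (w : ℂ) ≠ 0 := by
      intro h
      have := (hM0 w).1 hw
      rw [h, eval₂_at_zero, hP0, map_one] at this
      exact one_ne_zero this
    obtain ⟨τ, hτ, hwτ⟩ := ww_surjective hw0
    have hTZ := (hkey w τ hτ hwτ.symm hw).1 hwq
    have hs := TZ_simple hp hP hτ hTZ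
    rw [← Multiset.count_map_eq_count' V.subtype M hinj, hM, count_roots]
    by_contra hcon
    have := (one_lt_rootMultiplicity_iff_isRoot hQ0).1 (not_le.1 hcon)
    have h2 := this.2
    change Q.derivative.eval (w : ℂ) = 0 at h2
    rw [← hwτ] at h2
    exact hs.2 h2
  have hset : {w : ℂ | ∃ τ : ℂ, 0 < τ.im ∧ TZ p τ ∧ w = ww τ} =
      V.subtype '' ((M.filter fun w => q (residue V w)).toFinset : Set V) := by
    ext z
    simp only [Set.mem_image, Finset.mem_coe, Multiset.mem_toFinset, Multiset.mem_filter]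
    constructor
    · rintro ⟨τ, hτ, hTZ, rfl⟩
      have h0 := (TZ_simple hp hP hτ hTZ).1
      have hz : ww τ ∈ Q.roots := (mem_roots hQ0).2 h0
      have hwM : (⟨ww τ, hmem _ hz⟩ : V) ∈ M := by
        rw [hM0]; rw [← eval_map]; exact h0
      exact ⟨_, ⟨hwM, (hkey _ τ hτ rfl hwM).2 hTZ⟩, rfl⟩
    · rintro ⟨w, ⟨hw, hwq⟩, rfl⟩
      have hw0 : (w : ℂ) ≠ 0 := by
        intro h
        have := (hM0 w).1 hw
        rw [h, eval₂_at_zero, hP0, map_one] at this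
        exact one_ne_zero this
      obtain ⟨τ, hτ, hwτ⟩ := ww_surjective hw0
      exact ⟨τ, hτ, (hkey w τ hτ hwτ.symm hw).1 hwq, hwτ.symm⟩
  rw [hset, Set.ncard_image_of_injective _ hinj, Set.ncard_coe_finset,
    Multiset.toFinset_card_of_nodup hnd]
  have hc := count_filter_roots (separable_aux (V := V)) q
  rw [← hMr, Multiset.filter_map, Multiset.card_map] at hc
  rw [show (M.filter fun w => q (residue V w)) =
    M.filter (q ∘ residue V) from rfl, hc]
  congr 2
  ext r
  simp only [Set.mem_ofPred_eq, hq, eval_sub, eval_one, eval_mul, eval_pow, eval_X, eval_ofNat]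
  rw [sub_eq_zero, eq_comm]

end Count

open NumberField

section Field
variable (p : ℕ)

/-- The square root of `-3p` in the upper half plane. -/
def lam : ℂ := Complex.I * Real.sqrt (3 * p : ℕ)

/-- The field `ℚ(√-3p)` as a subfield of `ℂ`. -/
abbrev KK : IntermediateField ℚ ℂ := IntermediateField.adjoin ℚ {(Complex.I * Real.sqrt (3 * p : ℕ) : ℂ)}

/-- A generator of the ring of integers of `ℚ(√-3p)`. -/
def om : ℂ := if p % 4 = 1 then (1 + lam p) / 2 else lam p

variable {p}

theorem lam_sq : lam p ^ 2 = -(3 * p) := by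
  rw [lam, mul_pow, Complex.I_sq, ← Complex.ofReal_pow, Real.sq_sqrt (Nat.cast_nonneg _)]
  push_cast
  ring

theorem lam_re : (lam p).re = 0 := by simp [lam]

theorem lam_im_pos (hp : 0 < p) : 0 < (lam p).im := by
  have : 0 < Real.sqrt (3 * p : ℕ) := Real.sqrt_pos.2 (by exact_mod_cast (by omega : 0 < 3 * p))
  simpa [lam] using this

theorem mem_KK {z : ℂ} (hz : z ∈ KK p) : ∃ u v : ℚ, z = u + v * lam p := by
  have hint : IsIntegral ℚ (lam p) :=
    ⟨X ^ 2 + C (3 * p : ℚ), monic_X_pow_add_C _ two_ne_zero, by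
      rw [← aeval_def]; simp [lam_sq]⟩
  have h1 : z ∈ (KK p).toSubalgebra := hz
  rw [show (KK p).toSubalgebra = Algebra.adjoin ℚ {lam p} from
    IntermediateField.adjoin_simple_toSubalgebra_of_isAlgebraic hint.isAlgebraic] at h1
  clear hz
  induction h1 using Algebra.adjoin_induction with
  | mem x hx => rw [Set.mem_singleton_iff.1 hx]; exact ⟨0, 1, by simp⟩
  | algebraMap r => exact ⟨r, 0, by simp⟩
  | add x y _ _ hx hy =>
    obtain ⟨u, v, rfl⟩ := hx
    obtain ⟨u', v', rfl⟩ := hy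
    exact ⟨u + u', v + v', by push_cast; ring⟩
  | mul x y _ _ hx hy =>
    obtain ⟨u, v, rfl⟩ := hx
    obtain ⟨u', v', rfl⟩ := hy
    refine ⟨u * u' - 3 * p * (v * v'), u * v' + u' * v, ?_⟩
    push_cast
    linear_combination (v * v' : ℂ) * lam_sq (p := p)

theorem lam_mem : lam p ∈ KK p := IntermediateField.mem_adjoin_simple_self ℚ _

theorem om_mem : om p ∈ KK p := by
  rw [om]
  split_ifs
  · exact div_mem (add_mem (one_mem _) lam_mem) (ofNat_mem _ 2)
  · exact lam_mem

theorem isIntegral_lam : IsIntegral ℤ (lam p) :=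
  ⟨X ^ 2 + C (3 * p : ℤ), monic_X_pow_add_C _ two_ne_zero, by
    rw [eval₂_add, eval₂_pow, eval₂_X, eval₂_C, lam_sq]; simp⟩

theorem isIntegral_om : IsIntegral ℤ (om p) := by
  rw [om]
  split_ifs with h
  · refine ⟨X ^ 2 + (C (-1) * X + C ((1 + 3 * p) / 4 : ℤ)), ?_, ?_⟩
    · exact monic_X_pow_add ((degree_linear_le).trans_lt (by norm_num))
    · have h4 : (((1 + 3 * p) / 4 : ℤ) : ℂ) * 4 = 1 + 3 * p := by
        have : ((1 + 3 * p) / 4 : ℤ) * 4 = 1 + 3 * p := by omega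
        exact_mod_cast this
      rw [eval₂_add, eval₂_add, eval₂_mul, eval₂_pow, eval₂_X, eval₂_C, eval₂_C, algebraMap_int_eq,
        eq_intCast, eq_intCast]
      push_cast
      linear_combination lam_sq (p := p) / 4 + h4 / 4
  · exact isIntegral_lam

/-- The embedding of the ring of integers in `ℂ`. -/
def emb : 𝓞 (KK p) →+* ℂ := (algebraMap (KK p) ℂ).comp (algebraMap (𝓞 (KK p)) (KK p))

theorem emb_injective : Function.Injective (emb (p := p)) :=
  (algebraMap (KK p) ℂ).injective.comp RingOfIntegers.coe_injective

theorem exists_emb {z : ℂ} (hz : z ∈ KK p) (hi : IsIntegral ℤ z) : ∃ a, emb (p := p) a = z := by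
  have : IsIntegral ℤ (⟨z, hz⟩ : KK p) :=
    (isIntegral_algebraMap_iff (algebraMap (KK p) ℂ).injective).1 hi
  exact ⟨⟨_, this⟩, rfl⟩

theorem isIntegral_emb (a : 𝓞 (KK p)) : IsIntegral ℤ (emb a) :=
  (RingOfIntegers.isIntegral_coe a).map (algebraMap (KK p) ℂ).toIntAlgHom

theorem emb_mem (a : 𝓞 (KK p)) : emb a ∈ KK p := (a : KK p).2

theorem exists_int_of_isIntegral {q : ℚ} (h : IsIntegral ℤ (q : ℂ)) : ∃ n : ℤ, q = n := by
  have h1 : IsIntegral ℤ q :=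
    (isIntegral_algebraMap_iff (algebraMap ℚ ℂ).injective).1 (by simpa using h)
  obtain ⟨n, hn⟩ := IsIntegrallyClosed.isIntegral_iff.1 h1
  exact ⟨n, by simpa using hn.symm⟩

theorem int_of_three_mul_sq [Fact p.Prime] (hp : 5 ≤ p) {s : ℚ} {m : ℤ} (h : 3 * p * s ^ 2 = m) :
    ∃ n : ℤ, s = n := by
  have hpp : p.Prime := Fact.out
  have hsq : Squarefree (3 * p) :=
    (Nat.squarefree_mul ((Nat.coprime_primes Nat.prime_three hpp).2 (by omega))).2
      ⟨Nat.prime_three.squarefree, hpp.squarefree⟩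
  refine ⟨s.num, ?_⟩
  have hd : s.den = 1 := by
    have h1 : (3 * p : ℤ) * s.num ^ 2 = m * s.den ^ 2 := by
      have hden : (s.den : ℚ) ≠ 0 := Nat.cast_ne_zero.2 s.den_nz
      have : (3 * p : ℚ) * (s.num : ℚ) ^ 2 = m * (s.den : ℚ) ^ 2 := by
        rw [← h]
        nth_rewrite 2 [← Rat.num_div_den s]
        field_simp
      exact_mod_cast this
    have hc : IsCoprime ((s.den : ℤ) ^ 2) (s.num ^ 2) := by
      refine IsCoprime.pow ?_
      rw [Int.isCoprime_iff_gcd_eq_one, Int.gcd_comm]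
      exact s.reduced
    have h2 : ((s.den : ℤ) ^ 2) ∣ 3 * p := hc.dvd_of_dvd_mul_right ⟨m, by rw [h1]; ring⟩
    have h3 : s.den * s.den ∣ 3 * p := by
      rw [← sq]; exact_mod_cast h2
    exact Nat.isUnit_iff.1 (hsq _ h3)
  rw [← Rat.num_div_den s, hd]
  simp

theorem emb_eq [Fact p.Prime] (hp : 5 ≤ p) (a : 𝓞 (KK p)) :
    ∃ x y : ℤ, emb a = x + y * om p := by
  obtain ⟨u, v, huv⟩ := mem_KK (emb_mem a)
  have hi := isIntegral_emb a
  have hc : IsIntegral ℤ ((starRingEnd ℂ) (emb a)) := hi.map (starRingEnd ℂ).toIntAlgHom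
  have hlc : (starRingEnd ℂ) (lam p) = -lam p := by
    apply Complex.ext
    · simp [lam_re]
    · simp
  have hcv : (starRingEnd ℂ) (emb a) = u - v * lam p := by
    rw [huv, map_add, map_mul, hlc, map_ratCast, map_ratCast]
    ring
  obtain ⟨t, ht⟩ := exists_int_of_isIntegral (q := 2 * u) (by
    have := hi.add hc
    rw [hcv, huv] at this
    have e : (((2 * u : ℚ)) : ℂ) = u + v * lam p + (u - v * lam p) := by push_cast; ring
    rw [e]; exact this)
  obtain ⟨n, hn⟩ := exists_int_of_isIntegral (q := u ^ 2 + 3 * p * v ^ 2) (by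
    have := hi.mul hc
    rw [hcv, huv] at this
    have e : (((u ^ 2 + 3 * p * v ^ 2 : ℚ)) : ℂ) = (u + v * lam p) * (u - v * lam p) := by
      push_cast
      linear_combination (v ^ 2 : ℂ) * lam_sq (p := p)
    rw [e]; exact this)
  obtain ⟨s, hs⟩ := int_of_three_mul_sq hp (s := 2 * v) (m := 4 * n - t ^ 2) (by
    push_cast
    rw [← hn, ← ht]; ring)
  have hrel : t ^ 2 + 3 * p * s ^ 2 = 4 * n := by
    have : (t : ℚ) ^ 2 + 3 * p * s ^ 2 = 4 * n := by rw [← hn, ← ht, ← hs]; ring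
    exact_mod_cast this
  have h2 : (2 : ℂ) * emb a = t + s * lam p := by
    have ht' : (2 * u : ℂ) = t := by exact_mod_cast congrArg (fun q : ℚ => (q : ℂ)) ht
    have hs' : (2 * v : ℂ) = s := by exact_mod_cast congrArg (fun q : ℚ => (q : ℂ)) hs
    rw [huv, ← ht', ← hs']; ring
  have hmod : (t ^ 2 + 3 * (p * s ^ 2)) % 4 = 0 := by rw [← mul_assoc, hrel]; omega
  have hpodd := (Fact.out : p.Prime).eq_two_or_odd
  rw [om]
  split_ifs with h4
  · have h4' : (p : ℤ) % 4 = 1 := by omega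
    have : (t - s) % 2 = 0 := by
      have h1 : t % 4 = 0 ∨ t % 4 = 1 ∨ t % 4 = 2 ∨ t % 4 = 3 := by omega
      have h2 : s % 4 = 0 ∨ s % 4 = 1 ∨ s % 4 = 2 ∨ s % 4 = 3 := by omega
      rcases h1 with h1 | h1 | h1 | h1 <;> rcases h2 with h2 | h2 | h2 | h2 <;>
        simp [Int.add_emod, Int.mul_emod, pow_two, h1, h2, h4'] at hmod <;> omega
    obtain ⟨m, hm⟩ : (2 : ℤ) ∣ t - s := Int.dvd_of_emod_eq_zero this
    refine ⟨m, s, ?_⟩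
    have hm' : (t - s : ℂ) = 2 * m := by exact_mod_cast hm
    linear_combination h2 / 2 + hm' / 2
  · have h4' : (p : ℤ) % 4 = 3 := by omega
    have : t % 2 = 0 ∧ s % 2 = 0 := by
      have h1 : t % 4 = 0 ∨ t % 4 = 1 ∨ t % 4 = 2 ∨ t % 4 = 3 := by omega
      have h2 : s % 4 = 0 ∨ s % 4 = 1 ∨ s % 4 = 2 ∨ s % 4 = 3 := by omega
      rcases h1 with h1 | h1 | h1 | h1 <;> rcases h2 with h2 | h2 | h2 | h2 <;>
        simp [Int.add_emod, Int.mul_emod, pow_two, h1, h2, h4'] at hmod <;> omega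
    obtain ⟨m, hm⟩ : (2 : ℤ) ∣ t := Int.dvd_of_emod_eq_zero this.1
    obtain ⟨l, hl⟩ : (2 : ℤ) ∣ s := Int.dvd_of_emod_eq_zero this.2
    refine ⟨m, l, ?_⟩
    have hm' : (t : ℂ) = 2 * m := by exact_mod_cast hm
    have hl' : (s : ℂ) = 2 * l := by exact_mod_cast hl
    linear_combination h2 / 2 + hm' / 2 + lam p * hl' / 2

end Field

section Lattice
variable {p : ℕ}

instance numberField_KK : NumberField (KK p) where
  to_finiteDimensional := IntermediateField.adjoin.finiteDimensional
    (isIntegral_lam (p := p)).tower_top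

/-- Membership in the lattice `ℤτ + ℤ`. -/
def lat (τ z : ℂ) : Prop := ∃ x y : ℤ, z = x * τ + y

/-- The points of `TZ` whose lattice is stable under the ring of integers. -/
def TZ0 (p : ℕ) (τ : ℂ) : Prop :=
  ∃ A B D : ℤ, A * D - 3 * B ^ 2 = p ∧ (3 * A * τ ^ 2 + 6 * B * τ + D : ℂ) = 0 ∧
    (p % 4 = 1 → 2 ∣ A ∧ 2 ∣ D)

theorem lin_indep (hτ : 0 < τ.im) {x y x' y' : ℤ} (h : (x * τ + y : ℂ) = x' * τ + y') :
    x = x' ∧ y = y' := by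
  have h1 := congrArg Complex.im h
  simp only [add_im, mul_im, intCast_re, intCast_im, zero_mul, add_zero] at h1
  have hx : (x : ℝ) = x' := mul_right_cancel₀ hτ.ne' h1
  simp_all

theorem TZ0.normalize (h : TZ0 p τ) :
    ∃ A B D : ℤ, A * D - 3 * B ^ 2 = p ∧ (3 * A * τ ^ 2 + 6 * B * τ + D : ℂ) = 0 ∧
      (p % 4 = 1 → 2 ∣ A ∧ 2 ∣ D) ∧ 3 * (A * τ + B : ℂ) = lam p := by
  obtain ⟨A, B, D, hd, hq, h4⟩ := h
  have hd' : (A * D - 3 * B ^ 2 : ℂ) = p := by exact_mod_cast hd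
  have : (3 * (A * τ + B) : ℂ) ^ 2 = lam p ^ 2 := by
    rw [lam_sq]
    linear_combination 3 * A * hq - 3 * hd'
  rcases sq_eq_sq_iff_eq_or_eq_neg.1 this with h | h
  · exact ⟨A, B, D, hd, hq, h4, h⟩
  · refine ⟨-A, -B, -D, by rw [← hd]; ring, ?_, fun h1 => ?_, ?_⟩
    · push_cast; linear_combination -hq
    · omega
    · push_cast; linear_combination -h

theorem lat_om_mul [Fact p.Prime] (hp : 5 ≤ p) {A B D : ℤ} (hd : A * D - 3 * B ^ 2 = p)
    (hq : (3 * A * τ ^ 2 + 6 * B * τ + D : ℂ) = 0) (h4 : p % 4 = 1 → 2 ∣ A ∧ 2 ∣ D)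
    (hl : 3 * (A * τ + B : ℂ) = lam p) {z : ℂ} (hz : lat τ z) : lat τ (om p * z) := by
  obtain ⟨x, y, rfl⟩ := hz
  rw [om]
  split_ifs with h
  · obtain ⟨⟨a, rfl⟩, ⟨d, rfl⟩⟩ := h4 h
    obtain ⟨b, hb | hb⟩ := Int.even_or_odd' B
    · exfalso
      have : (p : ℤ) = 2 * (2 * (a * d) - 6 * b ^ 2) := by rw [← hd, hb]; ring
      omega
    · subst hb
      refine ⟨x * (-3 * b - 1) + y * (3 * a), -x * d + y * (3 * b + 2), ?_⟩
      grind
  · refine ⟨-3 * x * B + 3 * y * A, -x * D + 3 * y * B, ?_⟩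
    grind

theorem lat_add {τ z w : ℂ} (hz : lat τ z) (hw : lat τ w) : lat τ (z + w) := by
  obtain ⟨x, y, rfl⟩ := hz
  obtain ⟨x', y', rfl⟩ := hw
  exact ⟨x + x', y + y', by push_cast; ring⟩

theorem lat_int_mul {τ z : ℂ} (n : ℤ) (hz : lat τ z) : lat τ (n * z) := by
  obtain ⟨x, y, rfl⟩ := hz
  exact ⟨n * x, n * y, by push_cast; ring⟩

theorem lat_emb_mul [Fact p.Prime] (hp : 5 ≤ p) (h : TZ0 p τ) {z : ℂ} (hz : lat τ z)
    (a : 𝓞 (KK p)) : lat τ (emb a * z) := by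
  obtain ⟨A, B, D, hd, hq, h4, hl⟩ := h.normalize
  obtain ⟨x, y, e⟩ := emb_eq hp a
  rw [e, add_mul, mul_assoc]
  exact lat_add (lat_int_mul x hz) (lat_int_mul y (lat_om_mul hp hd hq h4 hl hz))

/-- The lattice `ℤτ + ℤ` is homothetic to an ideal in the class `c`. -/
def Rel (p : ℕ) (τ : ℂ) (c : ClassGroup (𝓞 (KK p))) : Prop :=
  ∃ I : nonZeroDivisors (Ideal (𝓞 (KK p))), ClassGroup.mk0 I = c ∧ ∃ μ : ℂ, μ ≠ 0 ∧
    ∀ z, (∃ a ∈ (I : Ideal (𝓞 (KK p))), emb a = z) ↔ ∃ w, lat τ w ∧ z = μ * w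

theorem TZ0.exists_rel [Fact p.Prime] (hp : 5 ≤ p) (h : TZ0 p τ) :
    ∃ c, Rel p τ c := by
  obtain ⟨A, B, D, hd, hq, h4, hl⟩ := h.normalize
  have hA : (3 * A : ℂ) ≠ 0 := by
    intro h0
    have h1 : lam p = ((3 * B : ℤ) : ℂ) := by
      rw [← hl]; push_cast; linear_combination τ * h0
    have h2 := lam_im_pos (p := p) (by omega)
    simp_all
  obtain ⟨l, hll⟩ := exists_emb (lam_mem (p := p)) isIntegral_lam
  set I : Ideal (𝓞 (KK p)) :=
    { carrier := {a | ∃ w, lat τ w ∧ emb a = 3 * A * w}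
      zero_mem' := ⟨0, ⟨0, 0, by simp⟩, by simp⟩
      add_mem' := by
        rintro a b ⟨w, hw, ha⟩ ⟨w', hw', hb⟩
        exact ⟨w + w', lat_add hw hw', by rw [map_add, ha, hb]; ring⟩
      smul_mem' := by
        rintro a b ⟨w, hw, hb⟩
        exact ⟨emb a * w, lat_emb_mul hp ⟨A, B, D, hd, hq, h4⟩ hw a, by
          rw [smul_eq_mul, map_mul, hb]; ring⟩ }
  have hmem : ∀ a, a ∈ I ↔ ∃ w, lat τ w ∧ emb a = 3 * A * w := fun a => Iff.rfl
  have hI0 : I ≠ ⊥ := by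
    intro h0
    have : ((3 * A : ℤ) : 𝓞 (KK p)) ∈ I :=
      (hmem _).2 ⟨1, ⟨0, 1, by simp⟩, by rw [_root_.map_intCast]; push_cast; ring⟩
    rw [h0, Ideal.mem_bot] at this
    have h1 := congrArg (emb (p := p)) this
    rw [_root_.map_intCast, map_zero] at h1
    exact hA (by exact_mod_cast h1)
  refine ⟨_, ⟨I, mem_nonZeroDivisors_of_ne_zero hI0⟩, rfl, 3 * A, hA, fun z => ⟨?_, ?_⟩⟩
  · rintro ⟨a, ha, rfl⟩
    exact ha
  · rintro ⟨w, ⟨x, y, hw⟩, hz⟩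
    have : emb ((x : 𝓞 (KK p)) * (l - ((3 * B : ℤ) : 𝓞 (KK p))) + ((3 * A * y : ℤ) : 𝓞 (KK p))) =
        3 * A * w := by
      rw [map_add, map_mul, map_sub, _root_.map_intCast, _root_.map_intCast, _root_.map_intCast,
        hll, ← hl, hw]
      push_cast
      ring
    exact ⟨_, (hmem _).2 ⟨w, ⟨x, y, hw⟩, this⟩, by rw [this, hz]⟩

theorem Rel.exists_scale {τ τ' : ℂ} {c : ClassGroup (𝓞 (KK p))} (h : Rel p τ c) (h' : Rel p τ' c) :
    ∃ ν : ℂ, ν ≠ 0 ∧ (∀ z, lat τ z → lat τ' (ν * z)) ∧ ∀ w, lat τ' w → lat τ (ν⁻¹ * w) := by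
  obtain ⟨I, hI, μ, hμ, hL⟩ := h
  obtain ⟨J, hJ, μ', hμ', hL'⟩ := h'
  obtain ⟨x, y, hx, hy, hxy⟩ := ClassGroup.mk0_eq_mk0_iff.1 (hI.trans hJ.symm)
  have hx' : emb x ≠ 0 := (map_ne_zero_iff _ emb_injective).2 hx
  have hy' : emb y ≠ 0 := (map_ne_zero_iff _ emb_injective).2 hy
  refine ⟨(emb x * μ) / (emb y * μ'), by positivity, fun z hz => ?_, fun w hw => ?_⟩
  · obtain ⟨a, ha, e⟩ := (hL (μ * z)).2 ⟨z, hz, rfl⟩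
    have : x * a ∈ Ideal.span {x} * (I : Ideal (𝓞 (KK p))) :=
      Ideal.mem_span_singleton_mul.2 ⟨a, ha, rfl⟩
    rw [hxy] at this
    obtain ⟨b, hb, e'⟩ := Ideal.mem_span_singleton_mul.1 this
    obtain ⟨w, hw, e2⟩ := (hL' (emb b)).1 ⟨b, hb, rfl⟩
    have h1 := congrArg emb e'
    grind
  · obtain ⟨b, hb, e⟩ := (hL' (μ' * w)).2 ⟨w, hw, rfl⟩
    have : y * b ∈ Ideal.span {y} * (J : Ideal (𝓞 (KK p))) :=
      Ideal.mem_span_singleton_mul.2 ⟨b, hb, rfl⟩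
    rw [← hxy] at this
    obtain ⟨a, ha, e'⟩ := Ideal.mem_span_singleton_mul.1 this
    obtain ⟨z, hz, e2⟩ := (hL (emb a)).1 ⟨a, ha, rfl⟩
    have h1 := congrArg emb e'
    grind

theorem Rel.unique {τ τ' ν : ℂ} {c c' : ClassGroup (𝓞 (KK p))} (h : Rel p τ c) (h' : Rel p τ' c')
    (hν : ν ≠ 0) (h1 : ∀ z, lat τ z → lat τ' (ν * z)) (h2 : ∀ w, lat τ' w → lat τ (ν⁻¹ * w)) :
    c = c' := by
  obtain ⟨I, rfl, μ, hμ, hL⟩ := h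
  obtain ⟨J, rfl, μ', hμ', hL'⟩ := h'
  obtain ⟨a, ha, e⟩ := (hL μ).2 ⟨1, ⟨0, 1, by simp⟩, by simp⟩
  obtain ⟨b, hb, e'⟩ := (hL' (μ' * ν)).2 ⟨ν, by simpa using h1 1 ⟨0, 1, by simp⟩, rfl⟩
  have ha0 : a ≠ 0 := by rintro rfl; rw [map_zero] at e; exact hμ e.symm
  have hb0 : b ≠ 0 := by
    grind
  rw [ClassGroup.mk0_eq_mk0_iff]
  refine ⟨b, a, hb0, ha0, ?_⟩
  ext t
  rw [Ideal.mem_span_singleton_mul, Ideal.mem_span_singleton_mul]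
  constructor
  · rintro ⟨i, hi, rfl⟩
    obtain ⟨z, hz, ez⟩ := (hL (emb i)).1 ⟨i, hi, rfl⟩
    obtain ⟨j, hj, ej⟩ := (hL' (μ' * (ν * z))).2 ⟨ν * z, h1 z hz, rfl⟩
    refine ⟨j, hj, emb_injective ?_⟩
    rw [map_mul, map_mul, e, e', ej, ez]; ring
  · rintro ⟨j, hj, rfl⟩
    obtain ⟨w, hw, ew⟩ := (hL' (emb j)).1 ⟨j, hj, rfl⟩
    obtain ⟨i, hi, ei⟩ := (hL (μ * (ν⁻¹ * w))).2 ⟨ν⁻¹ * w, h2 w hw, rfl⟩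
    refine ⟨i, hi, emb_injective ?_⟩
    grind

theorem E0_of_scale [Fact p.Prime] (hp : 5 ≤ p) {τ τ' ν : ℂ} (hτ : 0 < τ.im) (hτ' : 0 < τ'.im)
    (h : TZ0 p τ) (h' : TZ0 p τ') (hν : ν ≠ 0) (h1 : ∀ z, lat τ z → lat τ' (ν * z))
    (h2 : ∀ w, lat τ' w → lat τ (ν⁻¹ * w)) : E0 τ' τ := by
  obtain ⟨a, b, e1⟩ := h1 τ ⟨1, 0, by simp⟩
  obtain ⟨c, d, e2⟩ := h1 1 ⟨0, 1, by simp⟩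
  obtain ⟨a', b', e3⟩ := h2 τ' ⟨1, 0, by simp⟩
  obtain ⟨c', d', e4⟩ := h2 1 ⟨0, 1, by simp⟩
  rw [inv_mul_eq_iff_eq_mul₀ hν] at e3 e4
  rw [mul_one] at e2
  have i1 : ((1 : ℤ) * τ' + (0 : ℤ) : ℂ) = (a' * a + b' * c : ℤ) * τ' + (a' * b + b' * d : ℤ) := by
    grind
  have i2 : ((0 : ℤ) * τ' + (1 : ℤ) : ℂ) = (c' * a + d' * c : ℤ) * τ' + (c' * b + d' * d : ℤ) := by
    grind
  obtain ⟨j1, j2⟩ := lin_indep hτ' i1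
  obtain ⟨j3, j4⟩ := lin_indep hτ' i2
  have hdet : (a' * d' - b' * c') * (a * d - b * c) = 1 := by
    grind
  have hM : (!![a, b; c, d] : Mat).det = a * d - b * c := Matrix.det_fin_two_of ..
  have hmob : mob !![a, b; c, d] τ' = τ := by
    change (a * τ' + b : ℂ) / (c * τ' + d) = τ
    rw [← e1, ← e2, mul_div_cancel_left₀ _ hν]
  refine ⟨!![a, b; c, d], ⟨?_, ?_⟩, hmob⟩
  · rw [hM]
    rcases Int.eq_one_or_neg_one_of_mul_eq_one' hdet with ⟨-, h⟩ | ⟨-, h⟩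
    · exact h
    · exfalso
      have := im_mob (M := !![a, b; c, d]) τ'
      rw [hmob, hM, h] at this
      have h3 : 0 ≤ τ'.im / normSq (jf !![a, b; c, d] τ') := div_nonneg hτ'.le (normSq_nonneg _)
      grind
  · change 3 ∣ c
    obtain ⟨A, B, D, -, -, -, hl⟩ := h.normalize
    obtain ⟨A', B', D', hd', hq', -, hl'⟩ := h'.normalize
    have i3 : ((-3 * c * B' + 3 * d * A' : ℤ) * τ' + (-c * D' + 3 * d * B' : ℤ) : ℂ) =
        (3 * A * a + 3 * B * c : ℤ) * τ' + (3 * A * b + 3 * B * d : ℤ) := by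
      grind
    obtain ⟨-, j5⟩ := lin_indep hτ' i3
    have h3 : (3 : ℤ) ∣ c * D' := ⟨d * B' - A * b - B * d, by linarith⟩
    refine (Int.prime_three.dvd_mul.1 h3).resolve_right ?_
    rintro ⟨t, rfl⟩
    have : (3 : ℤ) ∣ (p : ℤ) := ⟨A' * t - B' ^ 2, by rw [← hd']; ring⟩
    have := (Nat.prime_dvd_prime_iff_eq Nat.prime_three Fact.out).1 (Int.natCast_dvd_natCast.1 this)
    omega

theorem scale_of_E0 {τ τ' : ℂ} (hτ : 0 < τ.im) (h : E0 τ τ') :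
    ∃ ν : ℂ, ν ≠ 0 ∧ (∀ z, lat τ z → lat τ' (ν * z)) ∧ ∀ w, lat τ' w → lat τ (ν⁻¹ * w) := by
  obtain ⟨M, hM, rfl⟩ := h
  have hj := jf_ne_zero hM.det_ne hτ
  have hdet : (M 0 0 * M 1 1 - M 0 1 * M 1 0 : ℂ) = 1 := by
    have := hM.1
    rw [Matrix.det_fin_two] at this
    exact_mod_cast this
  have hm : jf M τ * mob M τ = M 0 0 * τ + M 0 1 := by rw [mob, mul_div_cancel₀ _ hj]
  refine ⟨(jf M τ)⁻¹, inv_ne_zero hj, ?_, ?_⟩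
  · rintro z ⟨x, y, rfl⟩
    refine ⟨x * M 1 1 - y * M 1 0, -x * M 0 1 + y * M 0 0, ?_⟩
    rw [inv_mul_eq_iff_eq_mul₀ hj]
    push_cast
    have e : jf M τ = M 1 0 * τ + M 1 1 := rfl
    grind
  · rintro w ⟨x, y, rfl⟩
    refine ⟨x * M 0 0 + y * M 1 0, x * M 0 1 + y * M 1 1, ?_⟩
    rw [inv_inv]
    push_cast
    have e : jf M τ = M 1 0 * τ + M 1 1 := rfl
    linear_combination (x : ℂ) * hm + (y : ℂ) * e

end Lattice

section Existence
variable {p : ℕ} [Fact p.Prime]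

theorem exists_basis (hp : 5 ≤ p) : Nonempty (Module.Basis (Fin 2) ℤ (𝓞 (KK p))) := by
  obtain ⟨o, ho⟩ := exists_emb (om_mem (p := p)) isIntegral_om
  have him : (0 : ℝ) < (om p).im := by
    have := lam_im_pos (p := p) (by omega)
    rw [om]
    split_ifs
    · rw [show ((1 + lam p) / 2 : ℂ) = (1 + lam p) / (2 : ℝ) by simp, div_ofReal_im]
      simp only [add_im, one_im]
      linarith
    · exact this
  refine ⟨Module.Basis.mk (v := ![o, 1]) ?_ ?_⟩
  · rw [LinearIndependent.pair_iff]
    intro s t h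
    have h1 := congrArg emb h
    rw [map_add, zsmul_eq_mul, zsmul_eq_mul, map_mul, map_mul, _root_.map_intCast,
      _root_.map_intCast, ho, map_one, map_zero, mul_one] at h1
    exact lin_indep him (x' := 0) (y' := 0) (by rw [h1]; simp)
  · rintro a -
    obtain ⟨x, y, h⟩ := emb_eq hp a
    have : a = y • o + x • (1 : 𝓞 (KK p)) := by
      apply emb_injective
      rw [map_add, zsmul_eq_mul, zsmul_eq_mul, map_mul, map_mul, _root_.map_intCast,
        _root_.map_intCast, ho, map_one, h]
      ring
    rw [this]
    refine add_mem (Submodule.smul_mem _ _ (Submodule.subset_span ⟨0, rfl⟩))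
      (Submodule.smul_mem _ _ (Submodule.subset_span ⟨1, rfl⟩))

/-- Every nonzero ideal is homothetic to the lattice of a point of `TZ0`. -/
theorem exists_lat (hp : 5 ≤ p) {I : Ideal (𝓞 (KK p))} (hI : I ≠ ⊥) :
    ∃ τ μ : ℂ, 0 < τ.im ∧ μ ≠ 0 ∧ (∀ z, (∃ a ∈ I, emb a = z) ↔ ∃ w, lat τ w ∧ z = μ * w) := by
  obtain ⟨b⟩ := exists_basis hp
  have e := I.selfBasis b hI
  set w0 : ℂ := emb (e 0 : 𝓞 (KK p)) with hw0
  set w1 : ℂ := emb (e 1 : 𝓞 (KK p)) with hw1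
  have hspan : ∀ z, (∃ a ∈ I, emb a = z) ↔ ∃ x y : ℤ, z = x * w0 + y * w1 := by
    intro z
    constructor
    · rintro ⟨a, ha, rfl⟩
      refine ⟨e.repr ⟨a, ha⟩ 0, e.repr ⟨a, ha⟩ 1, ?_⟩
      have h := congrArg (fun t : I => emb (t : 𝓞 (KK p))) (e.sum_repr ⟨a, ha⟩)
      simp only [Fin.sum_univ_two] at h
      rw [← h]
      simp [hw0, hw1]
    · rintro ⟨x, y, rfl⟩
      refine ⟨x * (e 0 : 𝓞 (KK p)) + y * (e 1 : 𝓞 (KK p)), ?_, by simp [hw0, hw1]⟩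
      exact add_mem (I.mul_mem_left _ (e 0).2) (I.mul_mem_left _ (e 1).2)
  have hw1' : w1 ≠ 0 := by
    rw [hw1]
    refine (map_ne_zero_iff _ emb_injective).2 fun h => e.ne_zero 1 ?_
    exact Subtype.ext h
  obtain ⟨l, hl⟩ := exists_emb (lam_mem (p := p)) isIntegral_lam
  obtain ⟨r, s, hrs⟩ := (hspan (lam p * w1)).1
    ⟨l * (e 1 : 𝓞 (KK p)), I.mul_mem_left _ (e 1).2, by rw [map_mul, hl]⟩
  have him : (w0 / w1).im ≠ 0 := by
    intro h0
    have h1 : lam p = r * (w0 / w1) + s := by field_simp; linear_combination hrs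
    have h2 := lam_im_pos (p := p) (by omega)
    rw [h1] at h2
    simp [h0] at h2
  rcases lt_or_gt_of_ne him with h | h
  · refine ⟨-(w0 / w1), w1, by simpa using h, hw1', fun z => (hspan z).trans ⟨?_, ?_⟩⟩
    · rintro ⟨x, y, rfl⟩
      exact ⟨_, ⟨-x, y, rfl⟩, by push_cast; field_simp⟩
    · rintro ⟨w, ⟨x, y, rfl⟩, rfl⟩
      exact ⟨-x, y, by push_cast; field_simp⟩
  · refine ⟨w0 / w1, w1, h, hw1', fun z => (hspan z).trans ⟨?_, ?_⟩⟩
    · rintro ⟨x, y, rfl⟩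
      exact ⟨_, ⟨x, y, rfl⟩, by field_simp⟩
    · rintro ⟨w, ⟨x, y, rfl⟩, rfl⟩
      exact ⟨x, y, by field_simp⟩

theorem exists_quad_of_stable (hτ : 0 < τ.im)
    (h : ∀ z, lat τ z → lat τ (lam p * z)) :
    ∃ r s n : ℤ, lam p = r * τ + s ∧ lam p * τ = -s * τ + n ∧ r * n + s ^ 2 = -(3 * p) := by
  obtain ⟨r, s, h1⟩ := h 1 ⟨0, 1, by simp⟩
  obtain ⟨m, n, h2⟩ := h τ ⟨1, 0, by simp⟩
  rw [mul_one] at h1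
  have h3 : ((r * (m + s) : ℤ) * τ + (r * n + s ^ 2 : ℤ) : ℂ) = (0 : ℤ) * τ + (-(3 * p) : ℤ) := by
    push_cast
    linear_combination lam_sq (p := p) - r * h2 - (lam p + s) * h1
  obtain ⟨h4, h5⟩ := lin_indep hτ h3
  have hr : r ≠ 0 := by
    rintro rfl
    have h2 := lam_im_pos (p := p) (Nat.Prime.pos Fact.out)
    rw [h1] at h2
    simp at h2
  have : m = -s := by
    have := (mul_eq_zero.1 h4).resolve_left hr
    linarith
  subst this
  exact ⟨r, s, n, h1, by rw [h2]; push_cast; ring, h5⟩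

theorem exists_TZ_scale (hp : 5 ≤ p) (hτ : 0 < τ.im)
    (h : ∀ z, lat τ z → lat τ (lam p * z)) :
    ∃ σ ν : ℂ, 0 < σ.im ∧ ν ≠ 0 ∧ (∀ z, lat σ z ↔ lat τ (ν * z)) ∧
      ∃ A B D : ℤ, A * D - 3 * B ^ 2 = p ∧ (3 * A * σ ^ 2 + 6 * B * σ + D : ℂ) = 0 ∧
        lam p = 3 * (A * σ + B) := by
  obtain ⟨r, s, n, h1, h2, h3⟩ := exists_quad_of_stable hτ h
  have hfin : ∀ (A B D : ℤ) (σ : ℂ), 0 < σ.im → lam p = 3 * (A * σ + B) →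
      lam p * σ = -3 * B * σ - D →
      A * D - 3 * B ^ 2 = p ∧ (3 * A * σ ^ 2 + 6 * B * σ + D : ℂ) = 0 := by
    intro A B D σ hσ e1 e2
    have hq : (3 * A * σ ^ 2 + 6 * B * σ + D : ℂ) = 0 := by linear_combination e2 - σ * e1
    refine ⟨?_, hq⟩
    have : (3 * (A * D - 3 * B ^ 2) : ℂ) = 3 * p := by
      linear_combination 3 * A * hq - lam_sq (p := p) + (lam p + 3 * (A * σ + B)) * e1
    have : (3 * (A * D - 3 * B ^ 2) : ℤ) = 3 * p := by exact_mod_cast this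
    linarith
  by_cases hr : (3 : ℤ) ∣ r
  · obtain ⟨A, rfl⟩ := hr
    have hs : (3 : ℤ) ∣ s :=
      Int.prime_three.dvd_of_dvd_pow (n := 2) ⟨-p - A * n, by linarith⟩
    obtain ⟨B, rfl⟩ := hs
    have e1 : lam p = 3 * (A * τ + B) := by rw [h1]; push_cast; ring
    obtain ⟨h4, h5⟩ := hfin A B (-n) τ hτ e1 (by rw [h2]; push_cast; ring)
    exact ⟨τ, 1, hτ, one_ne_zero, fun z => by rw [one_mul], A, B, -n, h4, h5, e1⟩
  · obtain ⟨y, k, hy⟩ : ∃ y k : ℤ, y * r - s = 3 * k := by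
      have hc : IsCoprime r 3 := ((Int.prime_three.coprime_iff_not_dvd).2 hr).symm
      obtain ⟨a, b, hab⟩ := hc
      exact ⟨a * s, -b * s, by linear_combination s * hab⟩
    have hny : (3 : ℤ) ∣ n + y * s := by
      have : (3 : ℤ) ∣ r * (n + y * s) := ⟨-p + k * s, by linear_combination h3 + s * hy⟩
      exact (Int.prime_three.dvd_mul.1 this).resolve_left hr
    obtain ⟨t, ht⟩ := hny
    have hty : τ + y ≠ 0 := by
      intro h0
      have := congrArg Complex.im h0
      simp at this
      exact hτ.ne' this
    have hσ : 0 < (-1 / (τ + y)).im := by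
      rw [neg_div, one_div, neg_im, inv_im, neg_div, neg_neg]
      refine div_pos (by simpa using hτ) (normSq_pos.2 hty)
    have hk : (y * r - s : ℂ) = 3 * k := by exact_mod_cast hy
    have htc : (n + y * s : ℂ) = 3 * t := by exact_mod_cast ht
    have e1 : lam p = 3 * ((-(t - k * y) : ℤ) * (-1 / (τ + y)) + (k : ℤ)) := by
      field_simp
      push_cast
      linear_combination h2 + y * h1 + (τ - y) * hk + 2 * y * hk + htc - y * hk
    have e2 : lam p * (-1 / (τ + y)) = -3 * (k : ℤ) * (-1 / (τ + y)) - (r : ℤ) := by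
      field_simp
      linear_combination -h1 + hk
    obtain ⟨h4, h5⟩ := hfin _ _ _ _ hσ e1 e2
    refine ⟨_, τ + y, hσ, hty, fun z => ⟨?_, ?_⟩, _, _, _, h4, h5, e1⟩
    · rintro ⟨x, x', rfl⟩
      exact ⟨x', x' * y - x, by push_cast; field_simp; ring⟩
    · rintro ⟨x, x', e⟩
      refine ⟨x * y - x', x, ?_⟩
      push_cast
      field_simp
      linear_combination e

theorem Rel.exists_TZ0 (hp : 5 ≤ p) (c : ClassGroup (𝓞 (KK p))) :
    ∃ τ, 0 < τ.im ∧ TZ0 p τ ∧ Rel p τ c := by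
  obtain ⟨I, rfl⟩ := ClassGroup.mk0_surjective c
  obtain ⟨τ, μ, hτ, hμ, hL⟩ := exists_lat hp (nonZeroDivisors.ne_zero I.2)
  have hst : ∀ (a : 𝓞 (KK p)) z, lat τ z → lat τ (emb a * z) := by
    intro a z hz
    obtain ⟨b, hb, e⟩ := (hL (μ * z)).2 ⟨z, hz, rfl⟩
    obtain ⟨w, hw, e'⟩ := (hL (emb (a * b))).1 ⟨_, Ideal.mul_mem_left _ a hb, rfl⟩
    have : emb a * z = w := by
      refine mul_left_cancel₀ hμ ?_
      rw [← e', map_mul, e]; ring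
    rw [this]; exact hw
  obtain ⟨l, hl⟩ := exists_emb (lam_mem (p := p)) isIntegral_lam
  obtain ⟨σ, ν, hσ, hν, hσL, A, B, D, hd, hq, hlam⟩ :=
    exists_TZ_scale hp hτ fun z hz => by rw [← hl]; exact hst l z hz
  refine ⟨σ, hσ, ⟨A, B, D, hd, hq, fun h4 => ?_⟩, I, rfl, μ * ν, mul_ne_zero hμ hν, fun z => ?_⟩
  · obtain ⟨o, ho⟩ := exists_emb (om_mem (p := p)) isIntegral_om
    have hsto : ∀ z, lat σ z → lat σ (om p * z) := by
      intro z hz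
      rw [hσL, ← ho, mul_left_comm]
      exact hst o _ ((hσL z).1 hz)
    obtain ⟨x, y, e1⟩ := hsto 1 ⟨0, 1, by simp⟩
    obtain ⟨x', y', e2⟩ := hsto σ ⟨1, 0, by simp⟩
    rw [om, if_pos h4, hlam] at e1 e2
    have i1 : ((3 * A : ℤ) * σ + (1 + 3 * B : ℤ) : ℂ) = (2 * x : ℤ) * σ + (2 * y : ℤ) := by
      push_cast; linear_combination 2 * e1
    have i2 : ((1 - 3 * B : ℤ) * σ + (-D : ℤ) : ℂ) = (2 * x' : ℤ) * σ + (2 * y' : ℤ) := by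
      push_cast; linear_combination 2 * e2 - hq
    have j1 := (lin_indep hσ i1).1
    have j2 := (lin_indep hσ i2).2
    omega
  · rw [hL]
    constructor
    · rintro ⟨w, hw, rfl⟩
      refine ⟨ν⁻¹ * w, (hσL _).2 (by rwa [mul_inv_cancel_left₀ hν]), by field_simp⟩
    · rintro ⟨w, hw, rfl⟩
      exact ⟨ν * w, (hσL _).1 hw, by ring⟩

end Existence

section
variable {p : ℕ} [Fact p.Prime]

/-- Representatives of the integral matrices of determinant two. -/
def NN : Fin 3 → Mat := ![!![2, 0; 0, 1], !![1, 0; 0, 2], !![1, 1; 0, 2]]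

theorem det_NN (i : Fin 3) : (NN i).det = 2 := by
  fin_cases i <;> simp [NN, det_fin_two]

theorem det_NN_pos (i : Fin 3) : 0 < (NN i).det := by rw [det_NN]; norm_num

theorem det_adj_NN (i : Fin 3) : (NN i).adjugate.det = 2 := by
  rw [det_adjugate, det_NN]; rfl

theorem exists_NN {M : Mat} (hM : M.det = 2) (h3 : 3 ∣ M 1 0) :
    ∃ i γ, G0 γ ∧ M = γ * NN i := by
  obtain ⟨a, b, c, d, rfl⟩ : ∃ a b c d : ℤ, M = !![a, b; c, d] := ⟨_, _, _, _, eta_fin_two M⟩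
  rw [det_fin_two_of] at hM
  replace h3 : 3 ∣ c := h3
  have key : ∀ a b c d : ZMod 2, a * d - b * c = 0 →
      (a = 0 ∧ c = 0) ∨ (b = 0 ∧ d = 0) ∨ (b - a = 0 ∧ d - c = 0) := by decide
  have h2 : ((a * d - b * c : ℤ) : ZMod 2) = 0 := by rw [hM]; rfl
  have := key a b c d (by exact_mod_cast h2)
  simp only [← Int.cast_sub, ZMod.intCast_zmod_eq_zero_iff_dvd, Nat.cast_ofNat] at this
  rcases this with ⟨⟨x, rfl⟩, y, rfl⟩ | ⟨⟨x, rfl⟩, y, rfl⟩ | ⟨⟨x, hx⟩, y, hy⟩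
  · refine ⟨0, !![x, b; y, d], ⟨?_, ?_⟩, ?_⟩
    · rw [det_fin_two_of]; linarith
    · change 3 ∣ y; omega
    · ext i j; fin_cases i <;> fin_cases j <;> simp [NN, Matrix.mul_apply, mul_comm]
  · refine ⟨1, !![a, x; c, y], ⟨?_, ?_⟩, ?_⟩
    · rw [det_fin_two_of]; linarith
    · exact h3
    · ext i j; fin_cases i <;> fin_cases j <;> simp [NN, Matrix.mul_apply, mul_comm]
  · obtain rfl : b = a + 2 * x := by linarith
    obtain rfl : d = c + 2 * y := by linarith
    refine ⟨2, !![a, x; c, y], ⟨?_, ?_⟩, ?_⟩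
    · rw [det_fin_two_of]; linarith
    · exact h3
    · ext i j; fin_cases i <;> fin_cases j <;> simp [NN, Matrix.mul_apply, mul_comm]

theorem NN_inj {γ : Mat} {i j : Fin 3} (h : γ * NN i = NN j ∨ γ * NN i = -NN j) : i = j := by
  obtain ⟨a, b, c, d, rfl⟩ : ∃ a b c d : ℤ, γ = !![a, b; c, d] := ⟨_, _, _, _, eta_fin_two γ⟩
  have h00 := h.imp (fun e => congrFun (congrFun e 0) 0) (fun e => congrFun (congrFun e 0) 0)
  have h01 := h.imp (fun e => congrFun (congrFun e 0) 1) (fun e => congrFun (congrFun e 0) 1)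
  have h11 := h.imp (fun e => congrFun (congrFun e 1) 1) (fun e => congrFun (congrFun e 1) 1)
  have h10 := h.imp (fun e => congrFun (congrFun e 1) 0) (fun e => congrFun (congrFun e 1) 0)
  fin_cases i <;> fin_cases j <;> simp [NN, Matrix.mul_apply] at h00 h01 h10 h11 ⊢ <;> omega

/-- A triple of coefficients of the quadratic equation of a point of `TZ`. -/
def Tri (p : ℕ) (τ : ℂ) (A B D : ℤ) : Prop :=
  A * D - 3 * B ^ 2 = p ∧ (3 * A * τ ^ 2 + 6 * B * τ + D : ℂ) = 0

theorem Tri.unique (hp : 5 ≤ p) (hτ : 0 < τ.im) {A B D A' B' D' : ℤ}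
    (h : Tri p τ A B D) (h' : Tri p τ A' B' D') :
    (A' = A ∧ B' = B ∧ D' = D) ∨ (A' = -A ∧ B' = -B ∧ D' = -D) := by
  have := eq_of_quad_of_TZ hp hτ h.1 h.2 (A' := A') (B' := B') (C' := B') (D' := D')
    (by linarith [h'.1]) (by linear_combination h'.2)
  omega

theorem Tri.TZ0_iff (hp : 5 ≤ p) (hτ : 0 < τ.im) {A B D : ℤ}
    (h : Tri p τ A B D) : TZ0 p τ ↔ (p % 4 = 1 → 2 ∣ A ∧ 2 ∣ D) := by
  constructor
  · rintro ⟨A', B', D', h1, h2, h3⟩ h4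
    have := h3 h4
    have := h.unique hp hτ ⟨h1, h2⟩
    omega
  · exact fun h4 => ⟨A, B, D, h.1, h.2, h4⟩

theorem TZ0.TZ (h : TZ0 p τ) : TZ p τ := by
  obtain ⟨A, B, D, h1, h2, -⟩ := h
  exact ⟨A, B, D, h1, h2⟩

theorem Tri.of_E0 (hτ : 0 < τ.im) (hE : E0 τ σ) {A B D : ℤ} (h : Tri p τ A B D) :
    ∃ A' B' D', Tri p σ A' B' D' ∧ (2 ∣ A ∧ 2 ∣ D → 2 ∣ A' ∧ 2 ∣ D') := by
  obtain ⟨M, hM, rfl⟩ := hE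
  have hj := jf_ne_zero hM.det_ne hτ
  have hdet := hM.1
  obtain ⟨c, hc⟩ := hM.2
  obtain ⟨hd, hq⟩ := h
  rw [det_fin_two, hc] at hdet
  rw [jf, hc] at hj
  generalize ha : M 0 0 = a at *
  generalize hb : M 0 1 = b at *
  generalize hd' : M 1 1 = d at *
  refine ⟨A * d ^ 2 - 6 * B * c * d + 3 * D * c ^ 2, -A * b * d + B * (a * d + 3 * b * c) - D * a * c,
    3 * A * b ^ 2 - 6 * B * a * b + D * a ^ 2, ⟨?_, ?_⟩, ?_⟩
  · linear_combination (a * d - b * (3 * c)) ^ 2 * hd + p * (a * d - b * (3 * c) + 1) * hdet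
  · rw [mob, jf, ha, hb, hc, hd']
    push_cast at hj ⊢
    field_simp
    linear_combination (a * d - b * (3 * c)) ^ 2 * hq
  · rintro ⟨⟨x, rfl⟩, y, rfl⟩
    exact ⟨⟨x * d ^ 2 - 3 * B * c * d + 3 * y * c ^ 2, by ring⟩,
      3 * x * b ^ 2 - 3 * B * a * b + y * a ^ 2, by ring⟩

theorem TZ0.of_E0 (hτ : 0 < τ.im) (hE : E0 τ σ) (h : TZ0 p τ) : TZ0 p σ := by
  obtain ⟨A, B, D, h1, h2, h3⟩ := h
  obtain ⟨A', B', D', h', h4⟩ := Tri.of_E0 hτ hE ⟨h1, h2⟩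
  exact ⟨A', B', D', h'.1, h'.2, fun h => h4 (h3 h)⟩

theorem mob_NN0 (τ : ℂ) : mob (NN 0) τ = 2 * τ := by simp [mob, jf, NN]
theorem mob_NN1 (τ : ℂ) : mob (NN 1) τ = τ / 2 := by simp [mob, jf, NN]
theorem mob_NN2 (τ : ℂ) : mob (NN 2) τ = (τ + 1) / 2 := by
  change (((1 : ℤ) : ℂ) * τ + ((1 : ℤ) : ℂ)) / (((0 : ℤ) : ℂ) * τ + ((2 : ℤ) : ℂ)) = _
  simp

theorem Tri.NN0 {A B D : ℤ} : Tri p τ (2 * A) B D ↔ Tri p (mob (NN 0) τ) A B (2 * D) := by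
  rw [mob_NN0, Tri, Tri]
  push_cast
  refine and_congr (by ring_nf) ⟨fun h => ?_, fun h => ?_⟩
  · linear_combination 2 * h
  · linear_combination h / 2

theorem Tri.NN1 {A B D : ℤ} : Tri p τ A B (2 * D) ↔ Tri p (mob (NN 1) τ) (2 * A) B D := by
  rw [mob_NN1, Tri, Tri]
  push_cast
  refine and_congr (by ring_nf) ⟨fun h => ?_, fun h => ?_⟩
  · linear_combination h / 2
  · linear_combination 2 * h

theorem Tri.NN2 {A B D E : ℤ} (hE : 3 * A - 6 * B + D = 2 * E) :
    Tri p τ A B D ↔ Tri p (mob (NN 2) τ) (2 * A) (B - A) E := by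
  obtain rfl : D = 2 * E + 6 * B - 3 * A := by linarith
  rw [mob_NN2, Tri, Tri]
  push_cast
  refine and_congr (by ring_nf) ⟨fun h => ?_, fun h => ?_⟩
  · linear_combination h / 2
  · linear_combination 2 * h

end

section
variable {p : ℕ} [Fact p.Prime]

theorem im_NN_pos (i : Fin 3) (hτ : 0 < τ.im) : 0 < (mob (NN i) τ).im :=
  im_mob_pos (det_NN_pos i) hτ

/-- The condition for `NN i` to map a point with coefficients `(2a, B, 2d)` outside `TZ0`. -/
def OC (a d : ℤ) : Fin 3 → Prop := ![¬ 2 ∣ a, ¬ 2 ∣ d, 2 ∣ a + d]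

/-- The condition for `NN i` to map a point with coefficients `(A, B, D)` into `TZ0`. -/
def QC (A B D : ℤ) : Fin 3 → Prop := ![4 ∣ A, 4 ∣ D, 4 ∣ 3 * A - 6 * B + D]

theorem Tri.not_TZ0_iff (hp : 5 ≤ p) (h4 : p % 4 = 1) (hτ : 0 < τ.im) {a B d : ℤ}
    (h : Tri p τ (2 * a) B (2 * d)) (i : Fin 3) :
    TZ p (mob (NN i) τ) ∧ (¬ TZ0 p (mob (NN i) τ) ↔ OC a d i) := by
  have hB : ¬ 2 ∣ B := by
    rintro ⟨b, rfl⟩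
    have := h.1
    grind
  fin_cases i
  · have h' := NN0.1 h
    refine ⟨⟨_, _, _, h'⟩, ?_⟩
    change (¬ TZ0 p (mob (NN 0) τ) ↔ ¬ 2 ∣ a)
    rw [h'.TZ0_iff hp (im_NN_pos 0 hτ)]
    omega
  · have h' := NN1.1 h
    refine ⟨⟨_, _, _, h'⟩, ?_⟩
    change (¬ TZ0 p (mob (NN 1) τ) ↔ ¬ 2 ∣ d)
    rw [h'.TZ0_iff hp (im_NN_pos 1 hτ)]
    omega
  · have h' := (NN2 (E := 3 * a - 3 * B + d) (by ring)).1 h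
    refine ⟨⟨_, _, _, h'⟩, ?_⟩
    change (¬ TZ0 p (mob (NN 2) τ) ↔ 2 ∣ a + d)
    rw [h'.TZ0_iff hp (im_NN_pos 2 hτ)]
    omega

theorem TZ0.exists_tri (h4 : p % 4 = 1) (h : TZ0 p τ) :
    ∃ a B d, Tri p τ (2 * a) B (2 * d) := by
  obtain ⟨A, B, D, h1, h2, h3⟩ := h
  obtain ⟨⟨a, rfl⟩, d, rfl⟩ := h3 h4
  exact ⟨a, B, d, h1, h2⟩

theorem Tri.QC_of_TZ0 (hp : 5 ≤ p) (h4 : p % 4 = 1) {σ : ℂ} (hσ : 0 < σ.im) {A B D : ℤ}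
    (h : Tri p σ A B D) {i : Fin 3} (hi : TZ0 p (mob (NN i) σ)) : QC A B D i := by
  obtain ⟨a, b, d, h'⟩ := hi.exists_tri h4
  fin_cases i
  · have h2 := NN0.2 h'
    have := h.unique hp hσ h2
    change 4 ∣ A
    omega
  · have h2 := NN1.2 h'
    have := h.unique hp hσ h2
    change 4 ∣ D
    omega
  · have h2 : Tri p σ a (b + a) (4 * d + 6 * b + 3 * a) :=
      (NN2 (E := 2 * d) (by ring)).2 (by rwa [add_sub_cancel_right])
    have := h.unique hp hσ h2
    change 4 ∣ 3 * A - 6 * B + D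
    omega

theorem QC_unique {A B D : ℤ} (h : ¬ (2 ∣ A ∧ 2 ∣ D)) {i j : Fin 3}
    (hi : QC A B D i) (hj : QC A B D j) : i = j := by
  fin_cases i <;> fin_cases j <;> simp [QC] at hi hj ⊢ <;> omega

theorem Tri.exists_TZ0 (hp : 5 ≤ p) (h4 : p % 4 = 1) {σ : ℂ} (hσ : 0 < σ.im) {A B D : ℤ}
    (h : Tri p σ A B D) (hn : ¬ (2 ∣ A ∧ 2 ∣ D)) : ∃ i, TZ0 p (mob (NN i) σ) := by
  have key : ∀ A B D : ZMod 4, A * D - 3 * B ^ 2 = 1 →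
      A = 0 ∨ D = 0 ∨ 3 * A - 6 * B + D = 0 ∨ (2 * A = 0 ∧ 2 * D = 0) := by decide
  have h1 : ((A * D - 3 * B ^ 2 : ℤ) : ZMod 4) = 1 := by
    rw [h.1, Int.cast_natCast, ← Nat.mod_add_div p 4, h4]
    grind
  have h2 := key A B D (by exact_mod_cast h1)
  have e1 : ((3 * A - 6 * B + D : ℤ) : ZMod 4) = 3 * A - 6 * B + D := by push_cast; rfl
  have e2 : ((2 * A : ℤ) : ZMod 4) = 2 * A := by push_cast; rfl
  have e3 : ((2 * D : ℤ) : ZMod 4) = 2 * D := by push_cast; rfl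
  rw [← e1, ← e2, ← e3] at h2
  simp only [ZMod.intCast_zmod_eq_zero_iff_dvd, Nat.cast_ofNat] at h2
  rcases h2 with ⟨x, rfl⟩ | ⟨x, rfl⟩ | ⟨x, hx⟩ | h2
  · have h' : Tri p (mob (NN 0) σ) (2 * x) B (2 * D) :=
      NN0.1 (by rwa [← mul_assoc])
    exact ⟨0, (h'.TZ0_iff hp (im_NN_pos 0 hσ)).2 fun _ => ⟨⟨x, rfl⟩, D, rfl⟩⟩
  · have h' : Tri p (mob (NN 1) σ) (2 * A) B (2 * x) :=
      NN1.1 (by rwa [← mul_assoc])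
    exact ⟨1, (h'.TZ0_iff hp (im_NN_pos 1 hσ)).2 fun _ => ⟨⟨A, rfl⟩, x, rfl⟩⟩
  · have h' := (NN2 (E := 2 * x) (by rw [hx]; ring)).1 h
    exact ⟨2, (h'.TZ0_iff hp (im_NN_pos 2 hσ)).2 fun _ => ⟨⟨A, rfl⟩, x, rfl⟩⟩
  · exact absurd (by omega) hn

theorem mob_adj_NN (i : Fin 3) (hτ : 0 < τ.im) : mob (NN i).adjugate (mob (NN i) τ) = τ := by
  rw [← mob_mul (by rw [det_adj_NN]; norm_num) (det_NN_pos i) hτ, adjugate_mul, det_NN,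
    mob_smul two_ne_zero, mob_one]

theorem three_dvd_adj_NN (i : Fin 3) : 3 ∣ (NN i).adjugate 1 0 := by
  rw [adjugate_fin_two]; fin_cases i <;> simp [NN]

/-- The inverse of a degree two move is again a degree two move, up to equivalence. -/
theorem exists_NN_E0 (i : Fin 3) (hτ : 0 < τ.im) (h : E0 τ σ) :
    ∃ j, E0 (mob (NN j) τ) (mob (NN i).adjugate σ) := by
  obtain ⟨γ, hγ, rfl⟩ := h
  obtain ⟨j, γ', hγ', e⟩ := exists_NN (M := (NN i).adjugate * γ)
    (by rw [det_mul, det_adj_NN, hγ.1, mul_one])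
    (by
      rw [Matrix.mul_apply, Fin.sum_univ_two]
      exact dvd_add ((three_dvd_adj_NN i).mul_right _) (hγ.2.mul_left _))
  refine ⟨j, γ', hγ', ?_⟩
  rw [← mob_mul hγ'.det_ne (det_NN_pos j) hτ, ← e,
    mob_mul (by rw [det_adj_NN]; norm_num) hγ.det_pos hτ]

/-- Two points of `TZ0` with a common neighbour outside `TZ0` are equivalent. -/
theorem E0_of_common (hp : 5 ≤ p) (h4 : p % 4 = 1) {τ τ' : ℂ} (hτ : 0 < τ.im) (hτ' : 0 < τ'.im)
    (h : TZ0 p τ) (h' : TZ0 p τ') {i j : Fin 3} (hE : E0 (mob (NN i) τ) (mob (NN j) τ'))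
    (hn : ¬ TZ0 p (mob (NN i) τ)) : E0 τ τ' := by
  have hσ := im_NN_pos i hτ
  obtain ⟨a, b, d, ht⟩ := h.exists_tri h4
  obtain ⟨A, B, D, hT⟩ := (ht.not_TZ0_iff hp h4 hτ i).1
  have hn' : ¬ (2 ∣ A ∧ 2 ∣ D) := fun hd => hn ((Tri.TZ0_iff hp hσ hT).2 fun _ => hd)
  obtain ⟨k, hk⟩ := exists_NN_E0 i hσ (E0.refl _)
  obtain ⟨l, hl⟩ := exists_NN_E0 j hσ hE
  rw [mob_adj_NN i hτ] at hk
  rw [mob_adj_NN j hτ'] at hl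
  have hkσ := im_NN_pos k hσ
  have hlσ := im_NN_pos l hσ
  have h1 := Tri.QC_of_TZ0 hp h4 hσ hT (h.of_E0 hτ (hk.symm hkσ))
  have h2 := Tri.QC_of_TZ0 hp h4 hσ hT (h'.of_E0 hτ' (hl.symm hlσ))
  obtain rfl := QC_unique hn' h1 h2
  exact (hk.symm hkσ).trans hτ hl

theorem Tri.dvd_of_dvd (hp : 5 ≤ p) {a B d r : ℤ} (h : Tri p τ (2 * a) B (2 * d))
    (h1 : a ∣ 3 * r * B) (h2 : a ∣ r * d) : a ∣ r := by
  have hpr := (Fact.out : p.Prime)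
  have hd : 4 * a * d - 3 * B ^ 2 = p := by rw [← h.1]; ring
  set g := Int.gcd a (Int.gcd (3 * B) d) with hg
  have g1 : (g : ℤ) ∣ a := Int.gcd_dvd_left _ _
  have g0 : (g : ℤ) ∣ Int.gcd (3 * B) d := Int.gcd_dvd_right _ _
  have g2 : (g : ℤ) ∣ 3 * B := g0.trans (Int.gcd_dvd_left _ _)
  have g3 : (g : ℤ) ∣ d := g0.trans (Int.gcd_dvd_right _ _)
  have gp : (g : ℤ) ∣ p := by
    rw [← hd, show 4 * a * d - 3 * B ^ 2 = a * (4 * d) - 3 * B * B by ring]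
    exact dvd_sub (g1.mul_right _) (g2.mul_right _)
  rcases (Nat.dvd_prime hpr).1 (by exact_mod_cast gp) with h' | h'
  · have e1 := Int.gcd_eq_gcd_ab a (Int.gcd (3 * B) d)
    rw [← hg, h', Int.gcd_eq_gcd_ab (3 * B) d] at e1
    generalize Int.gcdA a _ = x at e1
    generalize Int.gcdB a _ = y at e1
    have : r = a * (r * x) + (3 * r * B) * (Int.gcdA (3 * B) d * y) +
        r * d * (Int.gcdB (3 * B) d * y) := by
      push_cast at e1
      linear_combination r * e1
    rw [this]
    exact dvd_add (dvd_add (dvd_mul_right _ _) (h1.mul_right _)) (h2.mul_right _)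
  · exfalso
    rw [h'] at g1 g2 g3
    obtain ⟨x, hx⟩ := g1
    obtain ⟨y, hy⟩ := g2
    obtain ⟨z, hz⟩ := g3
    have hp0 : (p : ℤ) ≠ 0 := by exact_mod_cast hpr.ne_zero
    have : (p : ℤ) * (3 - p * (12 * x * z - y ^ 2)) = 0 := by
      grind
    have h3 := (mul_eq_zero.1 this).resolve_left hp0
    have : (p : ℤ) ∣ 3 := ⟨12 * x * z - y ^ 2, by linarith⟩
    have h5 : p ∣ 3 := by exact_mod_cast this
    have := Nat.le_of_dvd (by norm_num) h5
    omega

/-- The stabilizer of a point of `TZ0` among matrices of determinant four is trivial. -/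
theorem Tri.fix (h17 : 17 ≤ p) (hτ : 0 < τ.im) {a B d : ℤ}
    (h : Tri p τ (2 * a) B (2 * d)) {M : Mat} (hM : M.det = 4) (h3 : 3 ∣ M 1 0)
    (hf : mob M τ = τ) : M = (2 : ℤ) • (1 : Mat) ∨ M = -((2 : ℤ) • (1 : Mat)) := by
  have hj := mob_mul_jf (N := M) (by rw [hM]; norm_num) hτ
  rw [hf, jf] at hj
  obtain ⟨r, hr⟩ := h3
  obtain ⟨m, n, c, s, rfl⟩ : ∃ a b c d : ℤ, M = !![a, b; c, d] := ⟨_, _, _, _, eta_fin_two M⟩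
  rw [det_fin_two_of] at hM
  obtain rfl : c = 3 * r := hr
  simp only [Matrix.of_apply, Matrix.cons_val', Matrix.cons_val_zero, Matrix.cons_val_one,
    Matrix.cons_val_fin_one] at hj
  obtain ⟨hd, hq⟩ := h
  have ha : a ≠ 0 := by
    have := quad_ne_zero (p := p) (by omega) (A := 2 * a) (B := B) (C := B) (D := 2 * d)
      (by linarith)
    omega
  obtain ⟨e1, e2⟩ := quad_proportional (a := 3 * a) (b := 3 * B) (c := d) (a' := 3 * r)
    (b' := s - m) (c' := -n) hτ (by push_cast at hq ⊢; linear_combination hq / 2)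
    (by push_cast at hj ⊢; linear_combination hj)
  obtain ⟨y, rfl⟩ := Tri.dvd_of_dvd (by omega) (a := a) (r := r) ⟨hd, hq⟩ ⟨s - m, by linarith⟩ ⟨-n, by linarith⟩
  have hn : n = -(d * y) := by
    refine mul_left_cancel₀ ha (by linarith)
  have hs : s = m + 3 * B * y := by
    refine mul_left_cancel₀ ha (by linarith)
  subst hn hs
  have hsq : (2 * m + 3 * B * y) ^ 2 = 16 - 3 * p * y ^ 2 := by
    rw [← hd]; linear_combination 4 * hM
  have hy : y = 0 := by
    by_contra hy
    have : 0 < y ^ 2 := by positivity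
    nlinarith [sq_nonneg (2 * m + 3 * B * y)]
  subst hy
  have hm : m = 2 ∨ m = -2 := by
    have : (m - 2) * (m + 2) = 0 := by linarith
    rcases mul_eq_zero.1 this with h | h
    · left; linarith
    · right; linarith
  rcases hm with rfl | rfl
  · left; rw [Matrix.one_fin_two]; ext i j; fin_cases i <;> fin_cases j <;> simp
  · right; rw [Matrix.one_fin_two]; ext i j; fin_cases i <;> fin_cases j <;> simp

theorem NN_eq_of_E0 (h17 : 17 ≤ p) (hτ : 0 < τ.im) {a B d : ℤ}
    (h : Tri p τ (2 * a) B (2 * d)) {i j : Fin 3} (hE : E0 (mob (NN i) τ) (mob (NN j) τ)) : i = j := by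
  obtain ⟨γ, hγ, e⟩ := hE
  have hd : ((NN j).adjugate * (γ * NN i)).det = 4 := by
    rw [det_mul, det_mul, det_adj_NN, det_NN, hγ.1]; norm_num
  have hg : (γ * NN i).det = 2 := by rw [det_mul, det_NN, hγ.1]; norm_num
  have := h.fix h17 hτ hd (by
      have h0 : NN i 1 0 = 0 := by fin_cases i <;> simp [NN]
      simp only [Matrix.mul_apply, Fin.sum_univ_two, h0, mul_zero, add_zero]
      exact dvd_add ((three_dvd_adj_NN j).mul_right _) ((hγ.2.mul_right _).mul_left _))
    (by
      rw [mob_mul (by rw [det_adj_NN]; norm_num) (by rw [hg]; norm_num) hτ,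
        mob_mul hγ.det_ne (det_NN_pos i) hτ, e, mob_adj_NN j hτ])
  refine NN_inj (γ := γ) ?_
  have h2 : (2 : ℤ) • (γ * NN i) = NN j * ((NN j).adjugate * (γ * NN i)) := by
    rw [← Matrix.mul_assoc, mul_adjugate, det_NN, Matrix.smul_mul, Matrix.one_mul]
  have hinj : ∀ M N : Mat, (2 : ℤ) • M = (2 : ℤ) • N → M = N := fun M N e =>
    smul_right_injective _ (two_ne_zero : (2 : ℤ) ≠ 0) e
  rcases this with e' | e' <;> rw [e'] at h2
  · left
    refine hinj _ _ (h2.trans ?_)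
    rw [Matrix.mul_smul, Matrix.mul_one]
  · right
    refine hinj _ _ (h2.trans ?_)
    grind

end

section
variable {p : ℕ} [Fact p.Prime]

theorem classNumberSqrtNeg_eq : classNumberSqrtNeg (3 * p) = Nat.card (ClassGroup (𝓞 (KK p))) := by
  rw [Nat.card_eq_fintype_card]
  rfl

theorem Tri.prod_parity {a B d : ℤ} (h4 : p % 4 = 1) (h : Tri p τ (2 * a) B (2 * d)) :
    ∃ k : ℤ, 4 * (a * d) = p + 3 + 24 * k := by
  have hd := h.1
  obtain ⟨b, rfl | rfl⟩ := Int.even_or_odd' B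
  · have : (p : ℤ) = 2 * (2 * (a * d - 3 * b ^ 2)) := by linarith
    omega
  · obtain ⟨k, hk⟩ := Int.even_mul_succ_self b
    exact ⟨k, by linear_combination hd + 12 * hk⟩

theorem OC_of_mod_eight {a B d : ℤ} (h8 : p % 8 = 1) (h : Tri p τ (2 * a) B (2 * d))
    (i : Fin 3) : OC a d i := by
  obtain ⟨k, hk⟩ := h.prod_parity (by omega)
  have : Odd (a * d) := by
    rw [Int.odd_iff]; generalize a * d = x at hk; omega
  obtain ⟨⟨x, rfl⟩, y, rfl⟩ := Int.odd_mul.1 this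
  fin_cases i <;> simp [OC] <;> omega

theorem exists_OC_of_mod_eight {a B d : ℤ} (h8 : p % 8 = 5)
    (h : Tri p τ (2 * a) B (2 * d)) : ∃ s, ∀ i, OC a d i ↔ i = s := by
  obtain ⟨k, hk⟩ := h.prod_parity (by omega)
  have : Even (a * d) := by
    rw [Int.even_iff]; generalize a * d = x at hk; omega
  rw [Int.even_mul, even_iff_two_dvd, even_iff_two_dvd] at this
  by_cases ha : 2 ∣ a
  · by_cases hd : 2 ∣ d
    · refine ⟨2, fun i => ?_⟩
      fin_cases i <;> simp [OC] <;> omega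
    · refine ⟨1, fun i => ?_⟩
      fin_cases i <;> simp [OC] <;> omega
  · refine ⟨0, fun i => ?_⟩
    fin_cases i <;> simp [OC] <;> omega

/-- The number of values of `ww` on the points of `TZ` as a multiple of the class number. -/
theorem ncard_TZ_eq (hp : 5 ≤ p) :
    Set.ncard {w : ℂ | ∃ τ : ℂ, 0 < τ.im ∧ TZ p τ ∧ w = ww τ} =
      (if p % 4 = 1 then if p % 8 = 1 then 4 else 2 else 1) * classNumberSqrtNeg (3 * p) := by
  rw [classNumberSqrtNeg_eq]
  have hfin : Finite (ClassGroup (𝓞 (KK p))) := inferInstance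
  choose t ht ht0 hrel using Rel.exists_TZ0 (p := p) hp
  have hE : ∀ c c', E0 (t c) (t c') → c = c' := by
    intro c c' h
    obtain ⟨ν, hν, h1, h2⟩ := scale_of_E0 (ht c) h
    exact (hrel c).unique (hrel c') hν h1 h2
  have hcov : ∀ τ : ℂ, 0 < τ.im → TZ0 p τ → ∃ c, E0 (t c) τ := by
    intro τ hτ h
    obtain ⟨c, hc⟩ := h.exists_rel hp
    obtain ⟨ν, hν, h1, h2⟩ := hc.exists_scale (hrel c)
    exact ⟨c, E0_of_scale hp hτ (ht c) h (ht0 c) hν h1 h2⟩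
  set W0 := Set.range (fun c => ww (t c)) with hW0
  have c0 : W0.ncard = Nat.card (ClassGroup (𝓞 (KK p))) := by
    rw [hW0, ← Set.image_univ, Set.ncard_image_of_injective, Set.ncard_univ]
    exact fun c c' h => hE _ _ (E0_of_ww_eq (ht c) (ht c') h)
  by_cases h4 : p % 4 = 1
  swap
  · rw [if_neg h4, one_mul, ← c0]
    congr 1
    ext w
    constructor
    · rintro ⟨τ, hτ, ⟨A, B, D, h1, h2⟩, rfl⟩
      obtain ⟨c, hc⟩ := hcov τ hτ ⟨A, B, D, h1, h2, fun h => absurd h h4⟩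
      exact ⟨c, hc.ww_eq (ht c)⟩
    · rintro ⟨c, rfl⟩
      exact ⟨t c, ht c, (ht0 c).TZ, rfl⟩
  rw [if_pos h4]
  choose a B d hT using fun c => (ht0 c).exists_tri h4
  set F : ClassGroup (𝓞 (KK p)) × Fin 3 → ℂ := fun x => ww (mob (NN x.2) (t x.1))
  set P : Set (ClassGroup (𝓞 (KK p)) × Fin 3) := {x | OC (a x.1) (d x.1) x.2}
  have hP' : ∀ c i, (c, i) ∈ P ↔ ¬ TZ0 p (mob (NN i) (t c)) := fun c i =>
    ((hT c).not_TZ0_iff hp h4 (ht c) i).2.symm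
  have himg : {w : ℂ | ∃ τ : ℂ, 0 < τ.im ∧ TZ p τ ∧ w = ww τ} = W0 ∪ F '' P := by
    ext w
    constructor
    · rintro ⟨τ, hτ, h, rfl⟩
      by_cases h0 : TZ0 p τ
      · obtain ⟨c, hc⟩ := hcov τ hτ h0
        exact Or.inl ⟨c, hc.ww_eq (ht c)⟩
      · right
        obtain ⟨A, B', D, hd⟩ := h
        obtain ⟨i, hi⟩ := Tri.exists_TZ0 hp h4 hτ hd
          fun hd' => h0 ((Tri.TZ0_iff hp hτ hd).2 fun _ => hd')
        obtain ⟨c, hc⟩ := hcov _ (im_NN_pos i hτ) hi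
        obtain ⟨j, hj⟩ := exists_NN_E0 i (ht c) hc
        rw [mob_adj_NN i hτ] at hj
        refine ⟨(c, j), (hP' c j).2 fun h' => h0 (h'.of_E0 (im_NN_pos j (ht c)) hj), ?_⟩
        exact hj.ww_eq (im_NN_pos j (ht c))
    · rintro (⟨c, rfl⟩ | ⟨⟨c, i⟩, -, rfl⟩)
      · exact ⟨t c, ht c, (ht0 c).TZ, rfl⟩
      · exact ⟨_, im_NN_pos i (ht c), ((hT c).not_TZ0_iff hp h4 (ht c) i).1, rfl⟩
  have hdisj : Disjoint W0 (F '' P) := by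
    rw [Set.disjoint_left]
    rintro _ ⟨c, rfl⟩ ⟨⟨c', i⟩, hi, h⟩
    exact (hP' c' i).1 hi
      ((ht0 c).of_E0 (ht c) (E0_of_ww_eq (ht c) (im_NN_pos i (ht c')) h.symm))
  have hinj : ∀ c c' i j, (c, i) ∈ P → F (c, i) = F (c', j) →
      c = c' ∧ E0 (mob (NN i) (t c)) (mob (NN j) (t c')) := by
    intro c c' i j hi h
    have h1 := E0_of_ww_eq (im_NN_pos i (ht c)) (im_NN_pos j (ht c')) h
    exact ⟨hE _ _ (E0_of_common hp h4 (ht c) (ht c') (ht0 c) (ht0 c') h1 ((hP' c i).1 hi)), h1⟩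
  rw [himg, Set.ncard_union_eq hdisj (Set.finite_range _) (Set.toFinite _), c0]
  by_cases h8 : p % 8 = 1
  · have h17 : 17 ≤ p := by
      by_contra hlt
      have h9 : p = 9 := by omega
      have hpr := (Fact.out : p.Prime)
      rw [h9] at hpr
      norm_num at hpr
    have hF : Set.InjOn F P := by
      rintro ⟨c, i⟩ hi ⟨c', j⟩ hj h
      obtain ⟨rfl, h1⟩ := hinj c c' i j hi h
      rw [NN_eq_of_E0 h17 (ht c) (hT c) h1]
    rw [if_pos h8, hF.ncard_image, show P = Set.univ from
      Set.eq_univ_of_forall fun x => OC_of_mod_eight h8 (hT x.1) x.2, Set.ncard_univ, Nat.card_prod]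
    simp; ring
  · choose s hs using fun c => exists_OC_of_mod_eight (by omega) (hT c)
    have hF : Set.InjOn F P := by
      rintro ⟨c, i⟩ hi ⟨c', j⟩ hj h
      obtain ⟨rfl, h1⟩ := hinj c c' i j hi h
      rw [(hs c i).1 hi, (hs c j).1 hj]
    rw [if_neg h8, hF.ncard_image, show P = Set.range (fun c => (c, s c)) from ?_,
      ← Set.image_univ, Set.ncard_image_of_injective, Set.ncard_univ]
    · ring
    · exact fun c c' h => congrArg Prod.fst h
    · ext ⟨c, i⟩
      refine (hs c i).trans ⟨fun h => ⟨c, by rw [h]⟩, ?_⟩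
      rintro ⟨c', h⟩
      obtain ⟨rfl, rfl⟩ := Prod.ext_iff.1 h
      rfl

end

section PicardFuchs
variable {p : ℕ} [Fact p.Prime]

theorem Eu_mul {R : Type*} [CommRing R] (P Q : R[X]) : Eu (P * Q) = Eu P * Q + P * Eu Q := by
  simp only [Eu, derivative_mul]; ring

theorem Eu_add {R : Type*} [CommRing R] (P Q : R[X]) : Eu (P + Q) = Eu P + Eu Q := by
  simp only [Eu, derivative_add]; ring

theorem Eu_C_mul {R : Type*} [CommRing R] (c : R) (P : R[X]) : Eu (C c * P) = C c * Eu P := by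
  simp only [Eu, derivative_C_mul]; ring

theorem Eu_pow {R : Type*} [CommRing R] (P : R[X]) (n : ℕ) {D L : R[X]} (h : D * Eu P = L * P) :
    D * Eu (P ^ n) = (n : R[X]) * L * P ^ n := by
  induction n with
  | zero => simp [Eu]
  | succ n ih =>
    rw [pow_succ, Eu_mul]
    push_cast
    linear_combination P * ih + P ^ n * h

/-- The Picard-Fuchs operator of the universal curve with a point of order three. -/
def PF (P : (ZMod p)[X]) : (ZMod p)[X] :=
  Eu (Eu P) - X * (27 * Eu (Eu P) + 27 * Eu P + 6 * P)

theorem PF_add (P Q : (ZMod p)[X]) : PF (P + Q) = PF P + PF Q := by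
  simp only [PF, Eu_add]; ring

theorem PF_C_mul (c : ZMod p) (P : (ZMod p)[X]) : PF (C c * P) = C c * PF P := by
  simp only [PF, Eu_C_mul]; ring

theorem coeff_PF_succ (P : (ZMod p)[X]) (j : ℕ) : (PF P).coeff (j + 1) =
    (j + 1) ^ 2 * P.coeff (j + 1) - 3 * (3 * j + 1) * (3 * j + 2) * P.coeff j := by
  have e27 : (27 : (ZMod p)[X]) = C 27 := (map_ofNat C 27).symm
  have e6 : (6 : (ZMod p)[X]) = C 6 := (map_ofNat C 6).symm
  rw [PF, coeff_sub, coeff_X_mul, e27, e6]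
  simp only [coeff_add, coeff_C_mul, coeff_Eu]
  push_cast; ring

theorem coeff_PF_zero (P : (ZMod p)[X]) : (PF P).coeff 0 = 0 := by
  rw [PF, coeff_sub, coeff_X_mul_zero, coeff_Eu]; simp

theorem natCast_succ_ne_zero {j : ℕ} (h : j + 1 < p) : (j + 1 : ZMod p) ≠ 0 := by
  have : ((j + 1 : ℕ) : ZMod p) ≠ 0 := by
    rw [Ne, ZMod.natCast_eq_zero_iff]
    exact fun hd => absurd (Nat.le_of_dvd (by omega) hd) (by omega)
  exact_mod_cast this

theorem eq_zero_of_PF {P : (ZMod p)[X]} (hP : PF P = 0) (hd : P.natDegree < p)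
    (h0 : P.coeff 0 = 0) : P = 0 := by
  ext j
  rw [coeff_zero]
  by_cases hj : p ≤ j
  · exact coeff_eq_zero_of_natDegree_lt (by omega)
  induction j with
  | zero => exact h0
  | succ j ih =>
    have h := coeff_PF_succ P j
    rw [hP, coeff_zero, ih (by omega), mul_zero, sub_zero] at h
    exact (mul_eq_zero.1 h.symm).resolve_left (pow_ne_zero _ (natCast_succ_ne_zero (by omega)))

theorem PF_unique {P Q : (ZMod p)[X]} (hP : PF P = 0) (hQ : PF Q = 0) (hPd : P.natDegree < p)
    (hQd : Q.natDegree < p) : C (Q.coeff 0) * P = C (P.coeff 0) * Q := by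
  have : C (Q.coeff 0) * P + C (-P.coeff 0) * Q = 0 := by
    refine eq_zero_of_PF (by rw [PF_add, PF_C_mul, PF_C_mul, hP, hQ]; simp)
      (lt_of_le_of_lt (natDegree_add_le _ _) (max_lt ?_ ?_)) ?_
    · exact lt_of_le_of_lt (natDegree_C_mul_le _ _) hPd
    · exact lt_of_le_of_lt (natDegree_C_mul_le _ _) hQd
    · rw [coeff_add, coeff_C_mul, coeff_C_mul]; ring
  rw [C_neg] at this
  linear_combination this

/-- Solutions of the Picard-Fuchs equation from pullbacks of hypergeometric polynomials. -/
theorem PF_sum {m : ℕ} (hm : m < p) (β : ZMod p) {T M : ℕ → (ZMod p)[X]} {D : (ZMod p)[X]}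
    (hD : D ≠ 0) (h : ∀ n, n < m → D * PF (T n) = C ((n : ZMod p) ^ 2) * M n -
      C (((n : ZMod p) - m) * (β + n)) * M (n + 1))
    (hlast : D * PF (T m) = C ((m : ZMod p) ^ 2) * M m) :
    PF (∑ n ∈ range (m + 1), C (hypC p m β 1 n) * T n) = 0 := by
  refine (mul_eq_zero.1 ?_).resolve_left hD
  have key : ∀ l, l ≤ m → D * PF (∑ n ∈ range l, C (hypC p m β 1 n) * T n) +
      C ((l : ZMod p) ^ 2 * hypC p m β 1 l) * M l = 0 := by
    intro l hl
    induction l with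
    | zero => simp [PF, Eu]
    | succ l ih =>
      have h1 := ih (by omega)
      have h2 := hypC_succ (p := p) (m := m) (n := l) (by omega) β 1
      rw [sum_range_succ, PF_add, PF_C_mul]
      have h3 := h l (by omega)
      have h4 : C (((l + 1 : ℕ) : ZMod p) ^ 2 * hypC p m β 1 (l + 1)) =
          C (((l : ZMod p) - m) * (β + l)) * C (hypC p m β 1 l) := by
        rw [← C_mul]; congr 1; push_cast; linear_combination h2
      rw [h4]
      rw [C_mul] at h1
      linear_combination h1 + C (hypC p m β 1 l) * h3
  have h1 := key m le_rfl
  rw [sum_range_succ, PF_add, PF_C_mul]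
  rw [C_mul] at h1
  linear_combination h1 + C (hypC p m β 1 m) * hlast

/-- The coefficients of the Hasse invariant of the curve `y² + xy + uy = x³`. -/
def gC (p : ℕ) (j : ℕ) : ZMod p :=
  ((p / 2).choose j * (p - 1 - 2 * j).choose j * 4 ^ j : ℕ)

/-- The Hasse invariant of the curve `y² + xy + uy = x³`. -/
def gP (p : ℕ) [Fact p.Prime] : (ZMod p)[X] := ∑ j ∈ range p, C (gC p j) * X ^ j

theorem gC_eq_zero {j : ℕ} (h : p ≤ 3 * j) : gC p j = 0 := by
  have := (Fact.out : p.Prime).pos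
  rw [gC, Nat.choose_eq_zero_of_lt (n := p - 1 - 2 * j) (by omega)]; simp

theorem coeff_gP (j : ℕ) : (gP p).coeff j = gC p j := by
  rw [gP, finsetSum_coeff]
  simp only [coeff_C_mul, coeff_X_pow, mul_ite, mul_one, mul_zero]
  rw [Finset.sum_ite_eq]
  split_ifs with h
  · rfl
  · exact (gC_eq_zero (by have := mem_range.not.1 h; omega)).symm

theorem natDegree_gP : (gP p).natDegree < p := by
  have := (Fact.out : p.Prime).pos
  refine lt_of_le_of_lt (natDegree_le_iff_coeff_eq_zero.2 fun N hN => ?_) (Nat.sub_one_lt this.ne')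
  rw [coeff_gP, gC_eq_zero (by omega)]

theorem two_mul_half (hp : 5 ≤ p) : (2 * (p / 2 : ℕ) : ZMod p) = -1 := by
  have h := (Fact.out : p.Prime).eq_two_or_odd.resolve_left (by omega)
  have : ((2 * (p / 2) + 1 : ℕ) : ZMod p) = 0 := by
    rw [show 2 * (p / 2) + 1 = p by omega, ZMod.natCast_self]
  push_cast at this
  linear_combination this

theorem gC_succ (hp : 5 ≤ p) (j : ℕ) :
    ((j : ZMod p) + 1) ^ 2 * gC p (j + 1) = 3 * (3 * j + 1) * (3 * j + 2) * gC p j := by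
  have hpr := (Fact.out : p.Prime)
  by_cases h1 : p ≤ 3 * j
  · rw [gC_eq_zero h1, gC_eq_zero (by omega)]; ring
  by_cases h2 : p ≤ 3 * j + 3
  · rw [gC_eq_zero (j := j + 1) (by omega)]
    have h3 : p ≠ 3 * j + 3 := by
      intro e
      have : 3 ∣ p := ⟨j + 1, by omega⟩
      exact absurd ((Nat.prime_dvd_prime_iff_eq Nat.prime_three hpr).1 this) (by omega)
    have h4 : (3 * j + 1) * (3 * j + 2) = (0 : ZMod p) := by
      have h5 : p = 3 * j + 1 ∨ p = 3 * j + 2 := by omega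
      rcases h5 with h5 | h5
      · have : ((3 * j + 1 : ℕ) : ZMod p) = 0 := by rw [← h5, ZMod.natCast_self]
        push_cast at this
        rw [this, zero_mul]
      · have : ((3 * j + 2 : ℕ) : ZMod p) = 0 := by rw [← h5, ZMod.natCast_self]
        push_cast at this
        rw [this, mul_zero]
    linear_combination (-3) * gC p j * h4
  · obtain ⟨l, hl⟩ : ∃ l, p = 3 * j + 4 + l := ⟨p - (3 * j + 4), by omega⟩
    set M := j + 1 + l
    have hn := two_mul_half hp
    set n := p / 2 with hn'
    have hnj : j ≤ n := by omega
    have hMp : (M : ZMod p) = -3 - 2 * j := by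
      have : ((M + 3 + 2 * j : ℕ) : ZMod p) = 0 := by
        rw [show M + 3 + 2 * j = p by omega, ZMod.natCast_self]
      push_cast at this
      linear_combination this
    have c1 := congrArg (Nat.cast : ℕ → ZMod p) (Nat.choose_succ_right_eq M j)
    have c2 := congrArg (Nat.cast : ℕ → ZMod p) (Nat.choose_mul_succ_eq M j)
    have c3 := congrArg (Nat.cast : ℕ → ZMod p) (Nat.choose_mul_succ_eq (M + 1) j)
    have c4 := congrArg (Nat.cast : ℕ → ZMod p) (Nat.choose_succ_right_eq n j)
    simp only [Nat.cast_mul, Nat.cast_sub (show j ≤ M by omega), Nat.cast_sub hnj,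
      Nat.cast_sub (show j ≤ M + 1 by omega), Nat.cast_sub (show j ≤ M + 1 + 1 by omega),
      Nat.cast_add, Nat.cast_one, hMp] at c1 c2 c3 c4
    rw [gC, gC, ← hn', show p - 1 - 2 * (j + 1) = M by omega,
      show p - 1 - 2 * j = M + 1 + 1 by omega]
    have hj := natCast_succ_ne_zero (p := p) (j := j) (by omega)
    have c1' : (M.choose (j + 1) : ZMod p) = -3 * M.choose j := by
      refine mul_right_cancel₀ hj ?_
      linear_combination c1
    push_cast
    rw [c1', pow_succ (4 : ZMod p) j]
    generalize (4 : ZMod p) ^ j = f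
    generalize (M.choose j : ZMod p) = C0 at *
    generalize ((M + 1).choose j : ZMod p) = Ca at *
    generalize ((M + 1 + 1).choose j : ZMod p) = Cb at *
    generalize (n.choose j : ZMod p) = Cn at *
    generalize (n.choose (j + 1) : ZMod p) = Cm at *
    linear_combination (-12) * f * C0 * (j + 1) * c4 - 6 * f * C0 * (j + 1) * Cn * hn -
      3 * f * Cn * (2 * j + 1) * c2 - 3 * f * Cn * (3 * j + 2) * c3

theorem PF_gP (hp : 5 ≤ p) : PF (gP p) = 0 := by
  ext j
  rcases j with _ | j
  · rw [coeff_PF_zero, coeff_zero]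
  · rw [coeff_PF_succ, coeff_gP, coeff_gP, gC_succ hp, coeff_zero, sub_self]

theorem coeff_gP_zero : (gP p).coeff 0 = 1 := by rw [coeff_gP, gC]; simp

end PicardFuchs

section Transform
variable {p : ℕ} [Fact p.Prime]

theorem Eu_pow_succ {R : Type*} [CommRing R] (P : R[X]) (n : ℕ) :
    Eu (P ^ (n + 1)) = ((n : R[X]) + 1) * P ^ n * Eu P := by
  rw [Eu, derivative_pow_succ, map_add, map_natCast, map_one, Eu]; ring

/-- The homogeneous form of the hypergeometric polynomial. -/
def hypH (p : ℕ) [Fact p.Prime] (m : ℕ) (β : ZMod p) (a b : (ZMod p)[X]) : (ZMod p)[X] :=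
  ∑ n ∈ range (m + 1), C (hypC p m β 1 n) * (a ^ (m - n) * b ^ n)

/-- The derivation for which the Picard-Fuchs operator is in normal form. -/
def Tt (P : (ZMod p)[X]) : (ZMod p)[X] := (1 - 27 * X) * Eu P

theorem Tt_mul (P Q : (ZMod p)[X]) : Tt (P * Q) = Tt P * Q + P * Tt Q := by
  rw [Tt, Tt, Tt, Eu_mul]; ring

theorem Tt_pow_succ (P : (ZMod p)[X]) (n : ℕ) :
    Tt (P ^ (n + 1)) = ((n : (ZMod p)[X]) + 1) * P ^ n * Tt P := by
  rw [Tt, Tt, Eu_pow_succ]; ring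

theorem Tt_pow {P L : (ZMod p)[X]} (h : Tt P = L * P) (n : ℕ) :
    Tt (P ^ n) = (n : (ZMod p)[X]) * L * P ^ n := Eu_pow P n h

theorem Tt_natCast (n : ℕ) : Tt (n : (ZMod p)[X]) = 0 := by simp [Tt, Eu]

theorem Tt_add (P Q : (ZMod p)[X]) : Tt (P + Q) = Tt P + Tt Q := by
  rw [Tt, Tt, Tt, Eu_add]; ring

theorem mul_PF (P : (ZMod p)[X]) : (1 - 27 * X) * PF P =
    Tt (Tt P) - 6 * X * (1 - 27 * X) * P := by
  have : Eu (1 - 27 * X : (ZMod p)[X]) = -27 * X := by simp [Eu]; ring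
  rw [Tt, Tt, Eu_mul, this, PF]; ring

/-- The discriminant parameter of level three. -/
def yP (p : ℕ) [Fact p.Prime] : (ZMod p)[X] := 108 * X * (1 - 27 * X)

theorem Tt_yP : Tt (yP p) = (1 - 54 * X) * yP p := by
  simp [Tt, Eu, yP]; ring

theorem Tt_s : Tt (1 - 54 * X : (ZMod p)[X]) = -54 * X * (1 - 27 * X) := by simp [Tt, Eu]; ring

theorem one_sub_ne_zero : (1 - 27 * X : (ZMod p)[X]) ≠ 0 := by
  intro h
  have := congrArg (eval 0) h
  simp at this

theorem natCast_ne_zero_of_dvd (hp : 5 ≤ p) {n : ℕ} (h : n ∣ 2592 ^ 4) :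
    ((n : ℕ) : (ZMod p)[X]) ≠ 0 := by
  rw [← C_eq_natCast, Ne, C_eq_zero, ZMod.natCast_eq_zero_iff]
  intro hd
  have hpr := (Fact.out : p.Prime)
  have h1 := hpr.dvd_of_dvd_pow (hd.trans h)
  rw [show 2592 = 2 ^ 5 * 3 ^ 4 by norm_num, hpr.dvd_mul] at h1
  rcases h1 with h1 | h1
  · exact absurd (Nat.le_of_dvd (by norm_num) (hpr.dvd_of_dvd_pow h1)) (by omega)
  · exact absurd (Nat.le_of_dvd (by norm_num) (hpr.dvd_of_dvd_pow h1)) (by omega)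

/-- The supersingular polynomial of level three on the curve with a point of order three. -/
def KP (p : ℕ) [Fact p.Prime] : (ZMod p)[X] :=
  (1 - 54 * X) ^ del p * hypH p (p / 6) ((1 : ZMod p) / 3 + (del p : ZMod p) / 3) 1 (yP p)

theorem mod_six (hp : 5 ≤ p) : p % 6 = 1 ∨ p % 6 = 5 := by
  have hpr := (Fact.out : p.Prime)
  have h2 := hpr.eq_two_or_odd.resolve_left (by omega)
  have h3 : p % 3 ≠ 0 := fun h => by
    have := (Nat.prime_dvd_prime_iff_eq Nat.prime_three hpr).1 (Nat.dvd_of_mod_eq_zero h)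
    omega
  omega

theorem mul_PF_pow_yP (n : ℕ) : 18 * ((1 - 27 * X) * PF (yP p ^ n)) =
    (n : (ZMod p)[X]) ^ 2 * (18 * yP p ^ n) -
      (6 * (n : (ZMod p)[X]) + 1) * (3 * (n : (ZMod p)[X]) + 1) * yP p ^ (n + 1) := by
  have e3 : yP p = 108 * X * (1 - 27 * X) := rfl
  rw [mul_PF, Tt_pow Tt_yP, Tt_mul, Tt_mul, Tt_natCast, Tt_s, Tt_pow Tt_yP, pow_succ]
  linear_combination ((18 : (ZMod p)[X]) * n ^ 2 + 9 * n + 1) * yP p ^ n * e3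

theorem mul_PF_mul_pow_yP (n : ℕ) : 18 * ((1 - 27 * X) * PF ((1 - 54 * X) * yP p ^ n)) =
    (n : (ZMod p)[X]) ^ 2 * (18 * (1 - 54 * X) * yP p ^ n) -
      (6 * (n : (ZMod p)[X]) + 5) * (3 * (n : (ZMod p)[X]) + 2) * (1 - 54 * X) * yP p ^ (n + 1) := by
  have e3 : yP p = 108 * X * (1 - 27 * X) := rfl
  have e1 : Tt ((1 - 54 * X) * yP p ^ n) =
      ((n : (ZMod p)[X]) - 54 * ((2 * n + 1 : ℕ) : (ZMod p)[X]) * X * (1 - 27 * X)) * yP p ^ n := by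
    rw [Tt_mul, Tt_s, Tt_pow Tt_yP]; push_cast; ring
  have e2 : Tt ((n : (ZMod p)[X]) - 54 * ((2 * n + 1 : ℕ) : (ZMod p)[X]) * X * (1 - 27 * X)) =
      -54 * (2 * (n : (ZMod p)[X]) + 1) * X * (1 - 54 * X) * (1 - 27 * X) := by
    simp [Tt, Eu]; ring
  rw [mul_PF, e1, Tt_mul, e2, Tt_pow Tt_yP, pow_succ]
  push_cast
  linear_combination (18 * (n : (ZMod p)[X]) ^ 2 + 27 * n + 10) * (1 - 54 * X) * yP p ^ n * e3

theorem PF_KP (hp : 5 ≤ p) : PF (KP p) = 0 := by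
  have hD : (18 * (1 - 27 * X) : (ZMod p)[X]) ≠ 0 :=
    mul_ne_zero (by exact_mod_cast natCast_ne_zero_of_dvd hp (n := 18) (by norm_num)) one_sub_ne_zero
  have h3 : (3 : ZMod p) ≠ 0 := (natCast_hyp (k := AlgebraicClosure (ZMod p)) hp).1 |> fun h e => h (by
    rw [← map_ofNat (algebraMap (ZMod p) (AlgebraicClosure (ZMod p))) 3, e, map_zero])
  obtain ⟨d, hd, hpd, hd1⟩ : ∃ d, del p = d ∧ p % 6 = 1 + 4 * d ∧ (d = 0 ∨ d = 1) := by
    rcases mod_six hp with h | h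
    · exact ⟨0, del_eq_zero hp (by omega), by omega, .inl rfl⟩
    · exact ⟨1, del_eq_one hp (by omega), by omega, .inr rfl⟩
  have hm := congrArg (Nat.cast (R := ZMod p)) (Nat.div_add_mod p 6)
  rw [ZMod.natCast_self, hpd] at hm
  push_cast at hm
  rw [KP, hypH, Finset.mul_sum, hd]
  simp only [one_pow, one_mul, mul_left_comm _ (C _)]
  have key (n : ℕ) : 18 * (1 - 27 * X) * PF ((1 - 54 * X) ^ d * yP p ^ n) =
      C ((n : ZMod p) ^ 2) * (18 * (1 - 54 * X) ^ d * yP p ^ n) -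
        C (((n : ZMod p) - (p / 6 : ℕ)) * ((1 : ZMod p) / 3 + (d : ZMod p) / 3 + n)) *
          (18 * (1 - 54 * X) ^ d * yP p ^ (n + 1)) := by
    have hc : ((n : ZMod p) - (p / 6 : ℕ)) * ((1 : ZMod p) / 3 + (d : ZMod p) / 3 + n) * 18 =
        (6 * n + 1 + 4 * d) * (3 * n + 1 + d) := by
      field_simp
      linear_combination (-3 - 3 * (d : ZMod p) - 9 * (n : ZMod p)) * hm
    have hc := congrArg C hc
    rw [C_mul (b := 18)] at hc
    generalize C (((n : ZMod p) - (p / 6 : ℕ)) * ((1 : ZMod p) / 3 + (d : ZMod p) / 3 + n)) = c at *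
    simp only [C_pow, map_natCast, map_mul, map_add, map_ofNat, map_one] at hc ⊢
    rcases hd1 with rfl | rfl
    · have := mul_PF_pow_yP (p := p) n
      push_cast at hc
      simp only [pow_zero, one_mul]
      linear_combination this + yP p ^ (n + 1) * hc
    · have := mul_PF_mul_pow_yP (p := p) n
      push_cast at hc
      simp only [pow_one]
      linear_combination this + (1 - 54 * X) * yP p ^ (n + 1) * hc
  refine PF_sum (by omega) _ hD (M := fun n => 18 * (1 - 54 * X) ^ d * yP p ^ n)
    (fun n hn => key n) ?_
  have := key (p / 6)
  rwa [sub_self, zero_mul, C_0, zero_mul, sub_zero] at this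

end Transform

section Psi
variable {p : ℕ} [Fact p.Prime]

theorem eps_eq (hp : 5 ≤ p) : p % 4 = 1 + 2 * eps p ∧ (eps p = 0 ∨ eps p = 1) := by
  have hp2 : p ≠ 2 := by omega
  have h2 := (Fact.out : p.Prime).eq_two_or_odd.resolve_left hp2
  have : p % 4 = 1 ∨ p % 4 = 3 := by omega
  rw [eps, legendreSym.at_neg_one hp2]
  rcases this with h | h
  · rw [ZMod.χ₄_nat_one_mod_four h, h]; exact ⟨rfl, .inl rfl⟩
  · rw [ZMod.χ₄_nat_three_mod_four h, h]; exact ⟨rfl, .inr rfl⟩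

theorem del_spec (hp : 5 ≤ p) : p % 6 = 1 + 4 * del p ∧ (del p = 0 ∨ del p = 1) := by
  rcases mod_six hp with h | h
  · rw [del_eq_zero hp (by omega)]; omega
  · rw [del_eq_one hp (by omega)]; omega

theorem mod_twelve (hp : 5 ≤ p) : p = 12 * (p / 12) + 1 + 4 * del p + 6 * eps p := by
  obtain ⟨h1, h2⟩ := del_spec hp
  obtain ⟨h3, h4⟩ := eps_eq hp
  omega

/-- The Eisenstein series of weight four on the universal curve with a point of order three. -/
def AP (p : ℕ) [Fact p.Prime] : (ZMod p)[X] := 1 - 24 * X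

/-- The Eisenstein series of weight six. -/
def EP (p : ℕ) [Fact p.Prime] : (ZMod p)[X] := 1 - 36 * X + 216 * X ^ 2

/-- The discriminant. -/
def BP (p : ℕ) [Fact p.Prime] : (ZMod p)[X] := 1728 * X ^ 3 * (1 - 27 * X)

theorem EP_sq : EP p ^ 2 = AP p ^ 3 - BP p := by rw [EP, AP, BP]; ring

theorem Tt_AP : Tt (AP p) = AP p * (1 - 36 * X) - EP p := by
  simp [Tt, Eu, AP, EP]; ring

theorem Tt_EP : 2 * Tt (EP p) = 3 * (EP p * (1 - 36 * X) - AP p ^ 2) := by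
  simp [Tt, Eu, AP, EP]; ring

theorem Tt_BP : Tt (BP p) = (3 * (1 - 36 * X)) * BP p := by
  have : (C 2 : (ZMod p)[X]) = 2 := map_ofNat C 2
  simp [Tt, Eu, BP, this]; ring

theorem Tt_P : Tt (1 - 36 * X : (ZMod p)[X]) = -36 * X * (1 - 27 * X) := by
  simp [Tt, Eu]; ring

theorem Tt_C_mul (c : ZMod p) (P : (ZMod p)[X]) : Tt (C c * P) = C c * Tt P := by
  rw [Tt, Eu_C_mul, Tt]; ring

theorem Tt_two_mul (P : (ZMod p)[X]) : Tt (2 * P) = 2 * Tt P := by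
  rw [← map_ofNat C 2, Tt_C_mul]

theorem mul_PF_of_weight {G G1 G2 W : (ZMod p)[X]} (n : ℕ)
    (h1 : 2 * Tt G = W * (1 - 36 * X) * G + G1) (h2 : 2 * Tt G1 = (W + 1) * (1 - 36 * X) * G1 + G2)
    (h : 2 * W + 12 * (n : (ZMod p)[X]) + 1 = 0) :
    16 * ((1 - 27 * X) * PF (G * BP p ^ n)) = (4 * G2 + AP p * G) * BP p ^ n := by
  have hA : AP p = 1 - 24 * X := rfl
  have e1 : 4 * Tt (G * BP p ^ n) = (2 * G1 - (1 - 36 * X) * G) * BP p ^ n := by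
    rw [Tt_mul, Tt_pow Tt_BP]
    linear_combination 2 * BP p ^ n * h1 + (1 - 36 * X) * G * BP p ^ n * h
  have e2 : Tt (4 * Tt (G * BP p ^ n)) = 4 * Tt (Tt (G * BP p ^ n)) := by
    rw [← map_ofNat C 4, Tt_C_mul]
  rw [e1, Tt_mul, Tt_pow Tt_BP, show 2 * G1 - (1 - 36 * X) * G = 2 * G1 + C (-1) * ((1 - 36 * X) * G) by
    simp; ring, Tt_add, Tt_two_mul, Tt_C_mul, Tt_mul, Tt_P] at e2
  rw [mul_PF]
  simp only [C_neg, C_1] at e2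
  linear_combination (-4) * e2 + 4 * BP p ^ n * h2 - 2 * (1 - 36 * X) * BP p ^ n * h1 +
    (1 - 36 * X) * (2 * G1 - (1 - 36 * X) * G) * BP p ^ n * h - G * BP p ^ n * hA

/-- The supersingular polynomial of level one on the curve with a point of order three. -/
def PsiP (p : ℕ) [Fact p.Prime] : (ZMod p)[X] :=
  AP p ^ del p * EP p ^ eps p * hypH p (p / 12)
    ((5 : ZMod p) / 12 - (((2 * (del p : ℤ) - 3 * (eps p : ℤ)) : ℤ) : ZMod p) / 6) (AP p ^ 3) (BP p)

theorem mul_PF_A (n a : ℕ) (h : 4 * (a : (ZMod p)[X]) + 12 * n + 13 = 0) :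
    16 * ((1 - 27 * X) * PF (AP p ^ (a + 3) * BP p ^ n)) =
      (144 * (n : (ZMod p)[X]) ^ 2 * AP p ^ (a + 4) - (12 * (n : (ZMod p)[X]) + 1) *
        (12 * (n : (ZMod p)[X]) + 5) * AP p ^ (a + 1) * BP p) * BP p ^ n := by
  rw [mul_PF_of_weight (G1 := C (-2) * (((a + 3 : ℕ) : (ZMod p)[X]) * (AP p ^ (a + 2) * EP p)))
    (G2 := ((a : (ZMod p)[X]) + 3) * (4 * ((a : (ZMod p)[X]) + 2) * AP p ^ (a + 1) * EP p ^ 2 + 6 * AP p ^ (a + 4)))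
    (W := 2 * ((a : (ZMod p)[X]) + 3)) n]
  · rw [EP_sq]
    grind
  · rw [Tt_pow_succ, Tt_AP]; push_cast; simp only [C_neg, map_ofNat]; ring
  · rw [Tt_C_mul, Tt_mul, Tt_natCast, Tt_mul, Tt_pow_succ, Tt_AP]
    push_cast; simp only [C_neg, map_ofNat]
    linear_combination (-2 * (a + 3) * AP p ^ (a + 2)) * Tt_EP (p := p)
  · linear_combination h

theorem mul_PF_AE (n a : ℕ) (h : 4 * (a : (ZMod p)[X]) + 12 * n + 19 = 0) :
    16 * ((1 - 27 * X) * PF (AP p ^ (a + 3) * EP p * BP p ^ n)) =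
      (144 * (n : (ZMod p)[X]) ^ 2 * AP p ^ (a + 4) - (12 * (n : (ZMod p)[X]) + 7) *
        (12 * (n : (ZMod p)[X]) + 11) * AP p ^ (a + 1) * BP p) * EP p * BP p ^ n := by
  have hE := EP_sq (p := p)
  rw [mul_PF_of_weight (G1 := C (-1) * (((2 * a + 9 : ℕ) : (ZMod p)[X]) * AP p ^ (a + 5)) +
      C 2 * (((a + 3 : ℕ) : (ZMod p)[X]) * (AP p ^ (a + 2) * BP p)))
    (G2 := 2 * (2 * (a : (ZMod p)[X]) + 9) * ((a : (ZMod p)[X]) + 5) * AP p ^ (a + 4) * EP p -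
      4 * ((a : (ZMod p)[X]) + 3) * ((a : (ZMod p)[X]) + 2) * AP p ^ (a + 1) * EP p * BP p)
    (W := 2 * (a : (ZMod p)[X]) + 9) n]
  · grind
  · rw [Tt_mul, Tt_pow_succ, Tt_AP]; push_cast; simp only [C_neg, map_ofNat, C_1]
    linear_combination (AP p ^ (a + 3)) * Tt_EP (p := p) -
      2 * (a + 3) * AP p ^ (a + 2) * hE
  · rw [Tt_add, Tt_C_mul, Tt_C_mul, Tt_mul, Tt_natCast, Tt_mul, Tt_natCast, Tt_mul, Tt_pow_succ,
      Tt_pow_succ, Tt_AP, Tt_BP]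
    push_cast; simp only [C_neg, map_ofNat, C_1]
    ring
  · linear_combination h

theorem mul_PF_last (n d e : ℕ) (hd : d = 0 ∨ d = 1) (he : e = 0 ∨ e = 1)
    (h : 12 * (n : (ZMod p)[X]) + 1 + 4 * d + 6 * e = 0) :
    16 * ((1 - 27 * X) * PF (AP p ^ d * EP p ^ e * BP p ^ n)) =
      144 * (n : (ZMod p)[X]) ^ 2 * (AP p ^ (d + 1) * EP p ^ e * BP p ^ n) := by
  have hE := EP_sq (p := p)
  have hA' := Tt_AP (p := p)
  have hE' := Tt_EP (p := p)
  have h1 : Tt (1 : (ZMod p)[X]) = 0 := by simp [Tt, Eu]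
  rcases hd with rfl | rfl <;> rcases he with rfl | rfl
  · rw [mul_PF_of_weight (G1 := 0) (G2 := 0) (W := 0) n]
    · grind
    · simp [h1]
    · simp [Tt, Eu]
    · push_cast at h; linear_combination h
  · rw [mul_PF_of_weight (G1 := C (-3) * AP p ^ 2) (G2 := 12 * AP p * EP p) (W := 3) n]
    · grind
    · simp only [pow_zero, pow_one, one_mul, C_neg, map_ofNat]; linear_combination hE'
    · rw [Tt_C_mul, Tt_pow_succ, hA']; simp only [C_neg, map_ofNat]; push_cast; ring
    · push_cast at h; linear_combination h
  · rw [mul_PF_of_weight (G1 := C (-2) * EP p) (G2 := 6 * AP p ^ 2) (W := 2) n]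
    · grind
    · simp only [pow_zero, pow_one, mul_one, C_neg, map_ofNat]; linear_combination 2 * hA'
    · rw [Tt_C_mul]; simp only [C_neg, map_ofNat]; linear_combination (-2) * hE'
    · push_cast at h; linear_combination h
  · rw [mul_PF_of_weight (G1 := C (-5) * AP p ^ 3 + C 2 * BP p) (G2 := 30 * AP p ^ 2 * EP p)
      (W := 5) n]
    · grind
    · rw [pow_one, pow_one, Tt_mul, hA']; simp only [C_neg, map_ofNat]
      linear_combination AP p * hE' - 2 * hE
    · rw [Tt_add, Tt_C_mul, Tt_C_mul, Tt_pow_succ, hA', Tt_BP]; simp only [C_neg, map_ofNat]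
      push_cast; ring
    · push_cast at h; linear_combination h

theorem PF_PsiP (hp : 5 ≤ p) : PF (PsiP p) = 0 := by
  have hD : (16 * (1 - 27 * X) : (ZMod p)[X]) ≠ 0 :=
    mul_ne_zero (by exact_mod_cast natCast_ne_zero_of_dvd hp (n := 16) (by norm_num)) one_sub_ne_zero
  have h12 : ((12 : ℕ) : ZMod p) ≠ 0 := by
    rw [Ne, ← C_eq_zero, C_eq_natCast]; exact natCast_ne_zero_of_dvd hp (by norm_num)
  have h6 : ((6 : ℕ) : ZMod p) ≠ 0 := by
    grind
  push_cast at h12 h6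
  have hm := mod_twelve hp
  obtain ⟨-, hd⟩ := del_spec hp
  obtain ⟨-, he⟩ := eps_eq hp
  rw [PsiP, hypH, Finset.mul_sum]
  simp only [mul_left_comm _ (C _)]
  have hlt : p / 12 < p := by omega
  generalize p / 12 = m at hm hlt ⊢
  generalize del p = d at hm hd ⊢
  generalize eps p = e at hm he ⊢
  have hX := congrArg (Nat.cast (R := (ZMod p)[X])) hm
  have hm := congrArg (Nat.cast (R := ZMod p)) hm
  rw [CharP.cast_eq_zero] at hm hX
  push_cast at hm hX
  refine PF_sum hlt _ hD (M := fun n => 144 * (AP p ^ (3 * (m - n) + d + 1) * EP p ^ e * BP p ^ n))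
    (fun n hn => ?_) ?_
  · have hc : ((n : ZMod p) - m) * ((5 : ZMod p) / 12 - ((2 * (d : ℤ) - 3 * (e : ℤ) : ℤ) : ZMod p) / 6
        + n) * 144 = (12 * n + 1 + 4 * d + 6 * e) * (12 * n + 5 - 4 * d + 6 * e) := by
      push_cast
      grind
    replace hc := congrArg C hc
    rw [C_mul (b := 144)] at hc
    generalize C (((n : ZMod p) - m) * ((5 : ZMod p) / 12 -
      ((2 * (d : ℤ) - 3 * (e : ℤ) : ℤ) : ZMod p) / 6 + n)) = c at *
    simp only [C_pow, map_natCast, map_mul, map_add, map_sub, map_ofNat, map_one] at hc ⊢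
    obtain ⟨i, rfl⟩ := Nat.exists_eq_add_of_lt hn
    rw [show n + i + 1 - n = i + 1 by omega, show n + i + 1 - (n + 1) = i by omega]
    push_cast at hX
    rcases he with rfl | rfl
    · have := mul_PF_A (p := p) n (3 * i + d) (by push_cast at hX ⊢; linear_combination -hX)
      rw [show AP p ^ d * EP p ^ 0 * ((AP p ^ 3) ^ (i + 1) * BP p ^ n) =
        AP p ^ (3 * i + d + 3) * BP p ^ n by ring]
      have hc' : c * 144 = (12 * (n : (ZMod p)[X]) + 1) * (12 * (n : (ZMod p)[X]) + 5) := by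
        rcases hd with rfl | rfl <;> push_cast at hc <;> linear_combination hc
      grind
    · have := mul_PF_AE (p := p) n (3 * i + d) (by push_cast at hX ⊢; linear_combination -hX)
      rw [show AP p ^ d * EP p ^ 1 * ((AP p ^ 3) ^ (i + 1) * BP p ^ n) =
        AP p ^ (3 * i + d + 3) * EP p * BP p ^ n by ring]
      have hc' : c * 144 = (12 * (n : (ZMod p)[X]) + 7) * (12 * (n : (ZMod p)[X]) + 11) := by
        rcases hd with rfl | rfl <;> push_cast at hc <;> linear_combination hc
      grind
  · have := mul_PF_last (p := p) m d e hd he (by linear_combination -hX)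
    simp only [C_pow, map_natCast, Nat.sub_self, pow_zero, mul_zero, one_mul, zero_add]
    linear_combination this

theorem natDegree_hypH_le {a b : (ZMod p)[X]} {i j : ℕ} (m : ℕ) (β : ZMod p)
    (ha : a.natDegree ≤ i) (hb : b.natDegree ≤ j) (hij : i ≤ j) :
    (hypH p m β a b).natDegree ≤ m * j := by
  refine natDegree_sum_le_of_forall_le _ _ fun n hn => natDegree_C_mul_le _ _ |>.trans ?_
  refine natDegree_mul_le.trans ((add_le_add (natDegree_pow_le_of_le _ ha)
    (natDegree_pow_le_of_le _ hb)).trans ?_)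
  have hn := mem_range_succ_iff.1 hn
  calc (m - n) * i + n * j ≤ (m - n) * j + n * j := by gcongr
    _ = m * j := by rw [← add_mul, Nat.sub_add_cancel hn]

theorem hypH_eval_zero {a b : (ZMod p)[X]} (m : ℕ) (β : ZMod p) (ha : a.eval 0 = 1)
    (hb : b.eval 0 = 0) : (hypH p m β a b).eval 0 = 1 := by
  rw [hypH, eval_finsetSum, sum_eq_single 0]
  · simp [ha, hypC_zero]
  · intro n _ hn; simp [hb, hn]
  · simp

theorem gP_eq_of_PF (hp : 5 ≤ p) {P : (ZMod p)[X]} (hP : PF P = 0) (hd : P.natDegree < p)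
    (h1 : P.eval 0 = 1) : gP p = P := by
  have := PF_unique (PF_gP hp) hP (natDegree_gP) hd
  rwa [coeff_gP_zero, coeff_zero_eq_eval_zero, h1, C_1, one_mul, one_mul] at this

theorem gP_eq_KP (hp : 5 ≤ p) : gP p = KP p := by
  refine gP_eq_of_PF hp (PF_KP hp) ?_ ?_
  · have h1 : (1 - 54 * X : (ZMod p)[X]).natDegree ≤ 1 := by compute_degree
    have h2 : (yP p).natDegree ≤ 2 := by rw [yP]; compute_degree
    have := natDegree_mul_le.trans (add_le_add (natDegree_pow_le_of_le (del p) h1)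
      (natDegree_hypH_le (p / 6) ((1 : ZMod p) / 3 + (del p : ZMod p) / 3)
        (natDegree_one.le.trans (Nat.zero_le 0)) h2 (Nat.zero_le 2)))
    refine this.trans_lt ?_
    have := del_spec hp
    omega
  · rw [KP, eval_mul, hypH_eval_zero] <;> simp [yP]

theorem gP_eq_PsiP (hp : 5 ≤ p) : gP p = PsiP p := by
  refine gP_eq_of_PF hp (PF_PsiP hp) ?_ ?_
  · have h1 : (AP p).natDegree ≤ 1 := by rw [AP]; compute_degree
    have h2 : (EP p).natDegree ≤ 2 := by rw [EP]; compute_degree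
    have h3 : (BP p).natDegree ≤ 4 := by rw [BP]; compute_degree
    have := natDegree_mul_le.trans (add_le_add (natDegree_mul_le.trans
      (add_le_add (natDegree_pow_le_of_le (del p) h1) (natDegree_pow_le_of_le (eps p) h2)))
      (natDegree_hypH_le (p / 12) ((5 : ZMod p) / 12 -
        (((2 * (del p : ℤ) - 3 * (eps p : ℤ)) : ℤ) : ZMod p) / 6)
        (natDegree_pow_le_of_le 3 h1) h3 (by norm_num)))
    refine this.trans_lt ?_
    have := mod_twelve hp
    omega
  · rw [PsiP, eval_mul, hypH_eval_zero] <;> simp [AP, EP, BP]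

end Psi

section Evl
variable {p : ℕ} [Fact p.Prime] {K : Type*} [Field K] [Algebra (ZMod p) K]

theorem ofNat_ne_zero_of_dvd {K : Type*} [Field K] [Algebra (ZMod p) K] (hp : 5 ≤ p) {n : ℕ}
    [n.AtLeastTwo] (h : n ∣ 2592 ^ 4) : (OfNat.ofNat n : K) ≠ 0 := by
  rw [← Nat.cast_ofNat, ← map_natCast (algebraMap (ZMod p) K), Ne, map_eq_zero, ← C_eq_zero, C_eq_natCast]
  exact natCast_ne_zero_of_dvd hp h

theorem aeval_hypP_mul (m : ℕ) (β c : ZMod p) {a b : (ZMod p)[X]} {u x : K}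
    (h : x * aeval u b = algebraMap (ZMod p) K c * aeval u a) :
    aeval u b ^ m * aeval x (hypP p m β c) =
      algebraMap (ZMod p) K c ^ m * aeval u (hypH p m β a b) := by
  rw [hypP, hypH, map_sum, map_sum, Finset.mul_sum, Finset.mul_sum]
  refine sum_congr rfl fun n hn => ?_
  obtain ⟨i, rfl⟩ := Nat.exists_eq_add_of_le (mem_range_succ_iff.1 hn)
  have h' := congrArg (· ^ i) h
  simp only [mul_pow] at h'
  simp only [map_mul, map_pow, aeval_C, aeval_X, Nat.add_sub_cancel_left, hypC, one_pow, mul_one]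
  grind

theorem ssPoly_eq : ssPoly p = (X - C 1728) ^ eps p * (X ^ del p * hypP p (p / 12)
    ((5 : ZMod p) / 12 - (((2 * (del p : ℤ) - 3 * (eps p : ℤ)) : ℤ) : ZMod p) / 6) 1728) := by
  rw [ssPoly, hypP, Finset.mul_sum (a := X ^ del p)]
  congr 1
  refine sum_congr rfl fun n hn => ?_
  have : n ≤ p / 12 := by have := mem_range.1 hn; omega
  rw [hypC, mul_left_comm, ← pow_add, show del p + (p / 12 - n) = p / 12 + del p - n by omega]

theorem eq_zero_iff_of_mul_eq {x y c d : K} (h : c * x = d * y) (hc : c ≠ 0) (hd : d ≠ 0) :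
    x = 0 ↔ y = 0 := by
  grind

theorem mul_pow_eq_zero_iff {x y c d : K} (h : x * c = y * d) (hc : c ≠ 0) (hd : d ≠ 0) (n : ℕ) :
    x ^ n = 0 ↔ y ^ n = 0 := by
  rw [← mul_eq_zero_iff_right (pow_ne_zero n hc), ← mul_pow, h, mul_pow,
    mul_eq_zero_iff_right (pow_ne_zero n hd)]

theorem aeval_ssPoly_iff (hp : 5 ≤ p) {u j : K} (hu : u ≠ 0) (hu' : 1 - 27 * u ≠ 0)
    (hj : j * (u ^ 3 * (1 - 27 * u)) = (1 - 24 * u) ^ 3) :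
    aeval j (ssPoly p) = 0 ↔ aeval u (gP p) = 0 := by
  have hc : (1728 : K) ≠ 0 := ofNat_ne_zero_of_dvd hp (by norm_num)
  have hB : aeval u (BP p) = 1728 * u ^ 3 * (1 - 27 * u) := by simp [BP, map_ofNat]
  have hA : aeval u (AP p) = 1 - 24 * u := by simp [AP, map_ofNat]
  have hE : aeval u (EP p) = 1 - 36 * u + 216 * u ^ 2 := by simp [EP, map_ofNat]
  have hB0 : aeval u (BP p) ≠ 0 := by
    grind
  have h := aeval_hypP_mul (p / 12) ((5 : ZMod p) / 12 - (((2 * (del p : ℤ) - 3 * (eps p : ℤ)) : ℤ) :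
    ZMod p) / 6) 1728 (a := AP p ^ 3) (b := BP p) (u := u) (x := j)
    (by rw [map_ofNat, map_pow, hB, hA]; linear_combination 1728 * hj)
  rw [map_ofNat] at h
  have hX := mul_pow_eq_zero_iff (x := j) (y := (1 - 24 * u) ^ 3) (c := u ^ 3 * (1 - 27 * u))
    (by rw [hj, mul_one]) (mul_ne_zero (pow_ne_zero 3 hu) hu') one_ne_zero (del p)
  have hY := mul_pow_eq_zero_iff (x := j - 1728) (y := (1 - 36 * u + 216 * u ^ 2) ^ 2)
    (c := u ^ 3 * (1 - 27 * u)) (by linear_combination hj)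
    (mul_ne_zero (pow_ne_zero 3 hu) hu') one_ne_zero (eps p)
  have hH := eq_zero_iff_of_mul_eq h (pow_ne_zero _ hB0) (pow_ne_zero (p / 12) hc)
  rw [gP_eq_PsiP hp, ssPoly_eq, PsiP]
  rw [← pow_mul, mul_comm 3, pow_mul, pow_eq_zero_iff three_ne_zero] at hX
  rw [← pow_mul, mul_comm 2, pow_mul, pow_eq_zero_iff two_ne_zero] at hY
  simp only [map_mul, map_pow, map_sub, aeval_X, aeval_C, map_ofNat, mul_eq_zero, hA, hE, hX, hY, hH]
  tauto

theorem aeval_ss3Star_iff (hp : 5 ≤ p) {r : K} (hr : r ≠ 0) (hr' : 1 + 27 * r ≠ 0) :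
    aeval ((1 + 27 * r) ^ 2 / r) (ss3Star p) = 0 ↔ aeval (r / (1 + 27 * r)) (gP p) = 0 := by
  have hc : (108 : K) ≠ 0 := ofNat_ne_zero_of_dvd hp (by norm_num)
  have hy : aeval (r / (1 + 27 * r)) (yP p) = 108 * r / (1 + 27 * r) ^ 2 := by
    have : 1 - 27 * (r / (1 + 27 * r)) = 1 / (1 + 27 * r) := by field_simp; ring
    rw [yP, map_mul, map_mul, map_sub, map_mul, map_one, aeval_X, map_ofNat, map_ofNat, this]
    field_simp
  have hy0 : aeval (r / (1 + 27 * r)) (yP p) ≠ 0 := by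
    rw [hy]; exact div_ne_zero (mul_ne_zero hc hr) (pow_ne_zero 2 hr')
  have h := aeval_hypP_mul (p / 6) ((1 : ZMod p) / 3 + (del p : ZMod p) / 3) 108
    (a := 1) (b := yP p) (u := r / (1 + 27 * r)) (x := (1 + 27 * r) ^ 2 / r)
    (by rw [map_ofNat, map_one, hy]; field_simp)
  rw [map_ofNat] at h
  have hY := mul_pow_eq_zero_iff (x := (1 + 27 * r) ^ 2 / r - 108)
    (y := (1 - 54 * (r / (1 + 27 * r))) ^ 2) (c := r) (d := (1 + 27 * r) ^ 2)
    (by field_simp; ring) hr (pow_ne_zero 2 hr') (del p)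
  have hH := eq_zero_iff_of_mul_eq h (pow_ne_zero _ hy0) (pow_ne_zero (p / 6) hc)
  rw [gP_eq_KP hp, ss3Star_eq, KP, tri]
  have hX : ((1 + 27 * r) ^ 2 / r) ^ del p ≠ 0 :=
    pow_ne_zero _ (div_ne_zero (pow_ne_zero 2 hr') hr)
  simp only [map_mul, map_pow, map_sub, map_one, aeval_X, aeval_C, map_ofNat, mul_eq_zero, hY, hH, hX,
    false_or]
  simp

theorem hypC_ne_zero {m : ℕ} {β c : ZMod p} (hc : c ≠ 0) (hm : m < p)
    (hβ : ∀ n < m, β + n ≠ 0) : hypC p m β c m ≠ 0 := by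
  have (n : ℕ) (hn : n ≤ m) : hypC p m β c n ≠ 0 := by
    induction n with
    | zero => rw [hypC_zero]; exact one_ne_zero
    | succ n ih =>
      refine left_ne_zero_of_mul (b := ((n : ZMod p) + 1) ^ 2) ?_
      rw [hypC_succ (by omega)]
      refine mul_ne_zero (mul_ne_zero (mul_ne_zero hc ?_) (hβ n (by omega))) (ih (by omega))
      obtain ⟨i, rfl⟩ := Nat.exists_eq_add_of_lt (show n < m by omega)
      have := natCast_succ_ne_zero (p := p) (j := i) (by omega)
      grind
  exact this m le_rfl

theorem eval_zero_ss3Star (hp : 5 ≤ p) : (ss3Star p).eval 0 = 0 ↔ del p = 1 := by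
  obtain ⟨h1, h | h⟩ := del_spec hp
  · rw [ss3Star_eq, h]
    simp only [pow_zero, one_mul, zero_ne_one, iff_false]
    rw [tri, ← coeff_zero_eq_eval_zero, coeff_hypP, if_pos (Nat.zero_le _), Nat.sub_zero]
    refine hypC_ne_zero ?_ (by omega) fun n hn => ?_
    · exact ofNat_ne_zero_of_dvd hp (by norm_num)
    · have h3 : (3 : ZMod p) ≠ 0 := ofNat_ne_zero_of_dvd hp (by norm_num)
      have := natCast_succ_ne_zero (p := p) (j := 3 * n) (by omega)
      refine right_ne_zero_of_mul (a := 3) ?_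
      convert this using 1
      push_cast [h]
      field_simp
      ring
  · rw [ss3Star_eq, h]; simp

end Evl

section HasseCoeff
variable {p : ℕ} [Fact p.Prime] {K : Type*} [Field K]

theorem coeff_taylor_eq [CharP K p] {f : K[X]} (hf : f.natDegree < 2 * p - 1) (x : K) :
    (taylor x f).coeff (p - 1) = f.coeff (p - 1) := by
  have hp := (Fact.out : p.Prime).two_le
  have : hasseDeriv (p - 1) f = C (f.coeff (p - 1)) := by
    ext i
    rw [hasseDeriv_coeff, coeff_C]
    split_ifs with hi
    · rw [hi, zero_add, Nat.choose_self, Nat.cast_one, one_mul]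
    · by_cases h : i < p
      · rw [add_comm, (CharP.cast_eq_zero_iff K p _).2
          ((Fact.out : p.Prime).dvd_choose_add (by omega) h (by omega)), zero_mul]
      · rw [coeff_eq_zero_of_natDegree_lt (by omega), mul_zero]
  rw [taylor_coeff, this, eval_C]

theorem coeff_flex [Algebra (ZMod p) K] (hp : 5 ≤ p) {l y : K} (hl : l ≠ 0) :
    ((X ^ 3 + (C l * X + C y) ^ 2) ^ (p / 2)).coeff (p - 1) =
      l ^ (p - 1) * aeval (y / (4 * l ^ 3)) (gP p) := by
  have h4 : (4 : K) ≠ 0 := ofNat_ne_zero_of_dvd hp (by norm_num)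
  have hodd : p = 2 * (p / 2) + 1 := by
    have := (Fact.out : p.Prime).eq_two_or_odd; omega
  rw [gP, map_sum, add_pow, finsetSum_coeff, Finset.mul_sum, ← Finset.sum_subset
    (Finset.range_mono (show p / 2 + 1 ≤ p by omega))]
  · refine sum_congr rfl fun j hj => ?_
    have hj := mem_range_succ_iff.1 hj
    rw [← pow_mul, ← pow_mul, mul_assoc, coeff_X_pow_mul', map_mul, map_pow, aeval_C, aeval_X]
    split_ifs with h
    · have e : (C l * X + C y) ^ (2 * (p / 2 - j)) = ((X + C y).comp (C l * X)) ^ (2 * (p / 2 - j)) := by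
        simp
      rw [← C_eq_natCast, coeff_mul_C, e, ← pow_comp, comp_C_mul_X_coeff, coeff_X_add_C_pow, gC,
        show 2 * (p / 2 - j) - (p - 1 - 3 * j) = j by omega,
        show 2 * (p / 2 - j) = p - 1 - 2 * j by omega,
        ← Nat.choose_symm (show j ≤ p - 1 - 2 * j by omega),
        show p - 1 - 2 * j - j = p - 1 - 3 * j by omega]
      obtain ⟨i, hi⟩ := Nat.exists_eq_add_of_le h
      rw [hi, Nat.add_sub_cancel_left, pow_add, pow_mul]
      push_cast
      simp only [map_mul, map_natCast, map_pow, map_ofNat, div_pow, mul_pow]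
      field_simp
    · rw [gC_eq_zero (by omega)]; simp
  · intro j _ hj
    rw [gC, Nat.choose_eq_zero_of_lt (by simpa using hj)]; simp

theorem coeff_of_flex [Algebra (ZMod p) K] (hp : 5 ≤ p) {f : K[X]} (hf : f.natDegree ≤ 3)
    {l x y : K} (hl : l ≠ 0) (h : taylor x f = X ^ 3 + (C l * X + C y) ^ 2) :
    (f ^ (p / 2)).coeff (p - 1) = 0 ↔ aeval (y / (4 * l ^ 3)) (gP p) = 0 := by
  have : CharP K p := charP_of_injective_algebraMap (algebraMap (ZMod p) K).injective p
  rw [← coeff_taylor_eq (p := p) _ x, taylor_pow, h, coeff_flex hp hl,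
    mul_eq_zero_iff_left (pow_ne_zero _ hl)]
  have := natDegree_pow_le_of_le (p / 2) hf
  omega

theorem sum_eval_eq_zero {F : (ZMod p)[X]} (hp : 5 ≤ p) (hF : F.natDegree < 2 * (p - 1))
    (h : F.coeff (p - 1) = 0) : ∑ x, F.eval x = 0 := by
  simp_rw [eval_eq_sum_range]
  rw [Finset.sum_comm]
  refine Finset.sum_eq_zero fun i hi => ?_
  rw [← Finset.mul_sum]
  have hi := mem_range_succ_iff.1 hi
  have hcard : Fintype.card (ZMod p) = p := ZMod.card p
  rcases lt_trichotomy i (p - 1) with h1 | h1 | h1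
  · rw [FiniteField.sum_pow_lt_card_sub_one, mul_zero]; rwa [hcard]
  · rw [h1, h, zero_mul]
  · obtain ⟨s, rfl⟩ := Nat.exists_eq_add_of_lt h1
    have (x : ZMod p) : x ^ (p - 1 + s + 1) = x ^ (s + 1) := by
      rw [show p - 1 + s + 1 = p + s by omega, pow_add, ZMod.pow_card, pow_succ']
    simp_rw [this]
    rw [FiniteField.sum_pow_lt_card_sub_one, mul_zero]
    omega

end HasseCoeff

section Pts
variable {p : ℕ} [Fact p.Prime]

theorem dvd_of_eval_eq_zero {F : (ZMod p)[X]} (h : ∀ x, F.eval x = 0) : X ^ p - X ∣ F := by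
  have hp := (Fact.out : p.Prime).one_lt
  have hm : (X ^ p - X : (ZMod p)[X]).Monic := by
    refine monic_X_pow_sub ?_
    rw [degree_X]; exact_mod_cast hp
  rw [← modByMonic_eq_zero_iff_dvd hm]
  have hq : (X ^ p - X : (ZMod p)[X]) ≠ 1 := fun h1 => by
    simpa [(Fact.out : p.Prime).ne_zero] using congrArg (eval 0) h1
  refine eq_zero_of_natDegree_lt_card_of_eval_eq_zero' _ univ (fun x _ => ?_) ?_
  · have := congrArg (eval x) (modByMonic_add_div F (X ^ p - X))
    simpa [h] using this
  · rw [card_univ, ZMod.card]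
    have := natDegree_modByMonic_lt F hm hq
    rwa [FiniteField.X_pow_card_sub_X_natDegree_eq _ hp] at this

theorem not_forall_eval_pow (hp : 5 ≤ p) {f : (ZMod p)[X]} (hf : f.natDegree = 3) {c : ZMod p}
    (hc : c ≠ 0) : ¬∀ x, f.eval x ^ (p / 2) = c := by
  intro h
  have hf0 : f ≠ 0 := by rintro rfl; simp at hf
  obtain ⟨g, hg⟩ := dvd_of_eval_eq_zero (F := f ^ (p / 2) - C c) (by simp [h])
  have hodd : p = 2 * (p / 2) + 1 := by
    have := (Fact.out : p.Prime).eq_two_or_odd; omega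
  obtain ⟨n, hn⟩ : ∃ n, p / 2 = n + 1 := ⟨p / 2 - 1, by omega⟩
  have hp0 : (p : (ZMod p)[X]) = 0 := CharP.cast_eq_zero _ p
  have hd := congrArg derivative hg
  have hdeg : g.natDegree + p ≤ 3 * (p / 2) := by
    by_cases hg0 : g = 0
    · rw [hg0, natDegree_zero]; omega
    have h1 := congrArg natDegree hg
    rw [natDegree_sub_C, natDegree_pow, hf, natDegree_mul _ hg0,
      FiniteField.X_pow_card_sub_X_natDegree_eq _ (by omega)] at h1
    · omega
    · exact FiniteField.X_pow_card_sub_X_ne_zero _ (by omega)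
  rw [hn, derivative_sub, derivative_C, derivative_pow_succ, derivative_mul, derivative_sub,
    derivative_X, derivative_X_pow, map_natCast, hp0] at hd
  have key : C (n + 1 : ZMod p) * C c * derivative f + g * f = 0 := by
    by_contra hne
    have hdvd : (X ^ p - X) ∣ C (n + 1 : ZMod p) * C c * derivative f + g * f := by
      refine ⟨f * derivative g - C (n + 1 : ZMod p) * derivative f * g, ?_⟩
      rw [hn, pow_succ] at hg
      linear_combination f * hd - C (n + 1 : ZMod p) * derivative f * hg
    have := natDegree_le_of_dvd hdvd hne
    rw [FiniteField.X_pow_card_sub_X_natDegree_eq _ (by omega)] at this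
    refine absurd this (not_le.2 ((natDegree_add_le _ _).trans_lt (max_lt ?_ ?_)))
    · rw [← C_mul]
      have := natDegree_derivative_le f
      exact (natDegree_C_mul_le _ _).trans_lt (by omega)
    · exact natDegree_mul_le.trans_lt (by omega)
  have hn0 : (n + 1 : ZMod p) ≠ 0 := natCast_succ_ne_zero (by omega)
  have hdv : f ∣ derivative f := by
    rw [← (isUnit_C.2 (mul_ne_zero hn0 hc).isUnit).dvd_mul_left (b := derivative f), C_mul]
    exact ⟨-g, by linear_combination key⟩
  have h3 : derivative f ≠ 0 := fun h0 => by
    have := congrArg (coeff · 2) h0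
    rw [coeff_derivative, coeff_zero, mul_eq_zero, show 2 + 1 = f.natDegree by rw [hf]] at this
    exact this.elim (leadingCoeff_ne_zero.2 hf0) (natCast_succ_ne_zero (p := p) (j := 2) (by omega))
  have h1 := natDegree_le_of_dvd hdv h3
  have h2 := natDegree_derivative_lt (p := f) (by omega)
  omega

/-- The Weierstrass curve `y² = x³ + a x² + b x + c`. -/
def Wc {K : Type*} [Field K] (a b c : K) : WeierstrassCurve.Affine K := ⟨0, a, 0, b, c⟩

/-- The cubic polynomial defining the Weierstrass curve. -/
def fc {K : Type*} [Field K] (a b c : K) : K[X] := X ^ 3 + C a * X ^ 2 + C b * X + C c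

theorem natDegree_fc {K : Type*} [Field K] (a b c : K) : (fc a b c).natDegree = 3 := by
  rw [fc]; compute_degree!

theorem card_point (hp : 5 ≤ p) {a b c : ZMod p} (hΔ : (Wc a b c).Δ ≠ 0)
    (h : (fc a b c ^ (p / 2)).coeff (p - 1) = 0) : Nat.card (Wc a b c).Point = p + 1 := by
  classical
  have hp2 : ringChar (ZMod p) ≠ 2 := by rw [ZMod.ringChar_zmod_n]; omega
  have hodd : p = 2 * (p / 2) + 1 := by
    have := (Fact.out : p.Prime).eq_two_or_odd; omega
  have hχ (x : ZMod p) : ((quadraticChar (ZMod p) x : ℤ) : ZMod p) = x ^ (p / 2) := by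
    rw [quadraticChar_eq_pow_of_char_ne_two' hp2, ZMod.card]
  set S : ℤ := ∑ x, quadraticChar (ZMod p) ((fc a b c).eval x) with hS
  have hS0 : (p : ℤ) ∣ S := by
    rw [← ZMod.intCast_zmod_eq_zero_iff_dvd, hS, Int.cast_sum]
    simp_rw [hχ, ← eval_pow]
    refine sum_eval_eq_zero hp ?_ h
    rw [natDegree_pow, natDegree_fc]; omega
  have hσ (σ : ℤ) (h1 : σ = 1 ∨ σ = -1) : σ * S < p := by
    by_contra! hle
    refine not_forall_eval_pow hp (natDegree_fc a b c) (c := (σ : ZMod p))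
      (by rcases h1 with rfl | rfl <;> simp) fun x => ?_
    have hle1 (x : ZMod p) : 0 ≤ 1 - σ * quadraticChar (ZMod p) x := by
      rcases h1 with rfl | rfl <;>
      rcases (quadraticChar_isQuadratic (ZMod p)) x with h | h | h <;> rw [h] <;> norm_num
    have hsum : ∑ x, (1 - σ * quadraticChar (ZMod p) ((fc a b c).eval x)) = p - σ * S := by
      rw [Finset.sum_sub_distrib, ← Finset.mul_sum]; simp [hS]
    have h0 := (Finset.sum_eq_zero_iff_of_nonneg fun x _ => hle1 ((fc a b c).eval x)).1
      (le_antisymm (by rw [hsum]; omega) (Finset.sum_nonneg fun x _ => hle1 _)) x (mem_univ x)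
    have : quadraticChar (ZMod p) ((fc a b c).eval x) = σ := by
      rcases h1 with rfl | rfl <;> linarith
    rw [← hχ, this]
  have hS1 : S = 0 := by
    refine Int.eq_zero_of_abs_lt_dvd hS0 (abs_lt.2 ⟨?_, ?_⟩)
    · linarith [hσ (-1) (.inr rfl)]
    · linarith [hσ 1 (.inl rfl)]
  have hiff (x y : ZMod p) : (Wc a b c).Nonsingular x y ↔ y ^ 2 = (fc a b c).eval x := by
    rw [← WeierstrassCurve.Affine.equation_iff_nonsingular_of_Δ_ne_zero hΔ,
      WeierstrassCurve.Affine.equation_iff]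
    simp [Wc, fc]
  have hcount : (Nat.card (Wc a b c).Point : ℤ) = 1 + (p + S) := by
    let e : {xy : ZMod p × ZMod p // (Wc a b c).Nonsingular xy.1 xy.2} ≃
        (Σ x : ZMod p, {y | y ^ 2 = (fc a b c).eval x}.toFinset) :=
      { toFun := fun q => ⟨q.1.1, q.1.2, by simpa using (hiff _ _).1 q.2⟩
        invFun := fun q => ⟨(q.1, q.2.1), (hiff _ _).2 (by simpa using q.2.2)⟩
        left_inv := fun q => rfl
        right_inv := fun q => rfl }
    have hW : Nat.card (WithZero {xy : ZMod p × ZMod p // (Wc a b c).Nonsingular xy.1 xy.2}) =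
        Nat.card {xy : ZMod p × ZMod p // (Wc a b c).Nonsingular xy.1 xy.2} + 1 := Finite.card_option
    rw [Nat.card_congr (WeierstrassCurve.Affine.nonsingularPointEquiv _), hW, Nat.card_congr e,
      Nat.card_eq_fintype_card, Fintype.card_sigma]
    simp_rw [Fintype.card_coe]
    push_cast
    simp_rw [quadraticChar_card_sqrts hp2, sum_add_distrib]
    simp [hS]
    ring
  rw [hS1] at hcount
  omega

end Pts

section Flex
variable {p : ℕ} [Fact p.Prime] {K : Type*} [Field K]

/-- The line through `(x, y)` of slope `l` meets the curve `y² = x³ + a x² + b x + c` to order three. -/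
def IsFlex (a b c l x y : K) : Prop :=
  y ^ 2 = x ^ 3 + a * x ^ 2 + b * x + c ∧ 2 * y * l = 3 * x ^ 2 + 2 * a * x + b ∧ l ^ 2 = a + 3 * x

theorem IsFlex.taylor {a b c l x y : K} (h : IsFlex a b c l x y) :
    taylor x (fc a b c) = X ^ 3 + (C l * X + C y) ^ 2 := by
  obtain ⟨h1, h2, h3⟩ := h
  have h1 := congrArg C h1
  have h2 := congrArg C h2
  have h3 := congrArg C h3
  simp only [map_add, map_mul, map_pow, map_ofNat] at h1 h2 h3
  simp only [fc, taylor_apply, add_comp, mul_comp, pow_comp, X_comp, C_comp]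
  linear_combination (-1 : K[X]) * h1 - X * h2 - X ^ 2 * h3

theorem coeff_of_isFlex [Algebra (ZMod p) K] (hp : 5 ≤ p) {a b c l x y : K} (hl : l ≠ 0)
    (h : IsFlex a b c l x y) :
    (fc a b c ^ (p / 2)).coeff (p - 1) = 0 ↔ aeval (y / (4 * l ^ 3)) (gP p) = 0 :=
  coeff_of_flex hp (natDegree_fc a b c).le hl h.taylor

open WeierstrassCurve.Affine in
theorem three_dvd_card [Fintype K] {a b c l x y : K} (hΔ : (Wc a b c).Δ ≠ 0) (h2 : (2 : K) ≠ 0)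
    (hy : y ≠ 0) (h : IsFlex a b c l x y) : 3 ∣ Nat.card (Wc a b c).Point := by
  classical
  obtain ⟨h1, h3, h4⟩ := h
  have hN : (Wc a b c).Nonsingular x y := by
    rw [← equation_iff_nonsingular_of_Δ_ne_zero hΔ, equation_iff]
    simpa [Wc] using h1
  have hne : y ≠ (Wc a b c).negY x y := by
    simp only [Wc, negY]
    intro h0
    exact mul_ne_zero h2 hy (by linear_combination h0)
  have hs : (Wc a b c).slope x x y y = l := by
    rw [slope_of_Y_ne rfl hne, div_eq_iff (sub_ne_zero.2 hne)]
    simp only [Wc, negY]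
    linear_combination -h3
  have key : Point.some x y hN + Point.some x y hN = -Point.some x y hN := by
    rw [Point.add_self_of_Y_ne hne, Point.neg_some, Point.some.injEq]
    simp only [hs, addX, addY, negAddY, negY]
    simp only [Wc]
    constructor
    · linear_combination h4
    · linear_combination -l * h4
  have h3 : 3 • Point.some x y hN = 0 := by
    rw [succ_nsmul, two_nsmul, key, neg_add_cancel]
  have : Fact (Nat.Prime 3) := ⟨Nat.prime_three⟩
  rw [← addOrderOf_eq_prime h3 (Point.some_ne_zero hN)]
  exact addOrderOf_dvd_natCard _

open WeierstrassCurve.Affine in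
theorem exists_isFlex [Fintype K] {a b c : K} (h : 3 ∣ Nat.card (Wc a b c).Point)
    (h0 : Nat.card (Wc a b c).Point ≠ 0) : ∃ l x y, IsFlex a b c l x y := by
  classical
  have : Fact (Nat.Prime 3) := ⟨Nat.prime_three⟩
  have : Finite (Wc a b c).Point := Nat.finite_of_card_ne_zero h0
  obtain ⟨P, hP⟩ := exists_prime_addOrderOf_dvd_card' 3 h
  have h3 : P + P + P = 0 := by
    rw [← two_nsmul, ← succ_nsmul, show 2 + 1 = addOrderOf P from hP.symm, addOrderOf_nsmul_eq_zero]
  have hP0 : P ≠ 0 := fun h => by simp [h] at hP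
  rcases P with _ | ⟨x, y, hN⟩
  · exact absurd rfl hP0
  have h1 := (equation_iff _ _).1 hN.1
  by_cases hne : y = (Wc a b c).negY x y
  · rw [Point.add_self_of_Y_eq hne, zero_add] at h3
    exact absurd h3 hP0
  have key := eq_neg_of_add_eq_zero_left h3
  rw [Point.add_self_of_Y_ne hne, Point.neg_some, Point.some.injEq] at key
  refine ⟨(Wc a b c).slope x x y y, x, y, by simpa [Wc] using h1, ?_, ?_⟩
  · have hs := slope_of_Y_ne (W := Wc a b c) rfl hne
    rw [eq_div_iff (sub_ne_zero.2 hne)] at hs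
    simp only [Wc, negY] at hs ⊢
    linear_combination hs
  · have := key.1
    simp only [addX, Wc] at this ⊢
    linear_combination this

theorem Δ_Wc (a b c : K) : (Wc a b c).Δ =
    16 * (a ^ 2 * b ^ 2 - 4 * b ^ 3 - 4 * a ^ 3 * c - 27 * c ^ 2 + 18 * a * b * c) := by
  simp only [Wc, WeierstrassCurve.Δ, WeierstrassCurve.b₂, WeierstrassCurve.b₄, WeierstrassCurve.b₆,
    WeierstrassCurve.b₈]
  ring

theorem gP_ne_zero_of_mod (hp : 5 ≤ p) (h3 : p % 3 = 1) {u : ZMod p} (hu : u ≠ 0)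
    (hu' : 1 - 27 * u ≠ 0) : aeval u (gP p) ≠ 0 := by
  intro h
  have h2 : (2 : ZMod p) ≠ 0 := ofNat_ne_zero_of_dvd hp (by norm_num)
  have hf : IsFlex 1 (8 * u) (16 * u ^ 2) 1 0 (4 * u) := ⟨by ring, by ring, by ring⟩
  have hΔ : (Wc 1 (8 * u) (16 * u ^ 2)).Δ ≠ 0 := by
    rw [Δ_Wc, show 16 * ((1 : ZMod p) ^ 2 * (8 * u) ^ 2 - 4 * (8 * u) ^ 3 - 4 * 1 ^ 3 * (16 * u ^ 2) -
      27 * (16 * u ^ 2) ^ 2 + 18 * 1 * (8 * u) * (16 * u ^ 2)) = 2 ^ 12 * u ^ 3 * (1 - 27 * u) by ring]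
    exact mul_ne_zero (mul_ne_zero (pow_ne_zero _ h2) (pow_ne_zero _ hu)) hu'
  have h4 : (4 : ZMod p) ≠ 0 := ofNat_ne_zero_of_dvd hp (by norm_num)
  have hc := card_point hp hΔ ((coeff_of_isFlex hp one_ne_zero hf).2 (by
    rwa [one_pow, mul_one, mul_div_cancel_left₀ _ h4]))
  have := three_dvd_card hΔ h2 (mul_ne_zero h4 hu) hf
  omega

theorem IsFlex.param {b c l x y : K} (h2 : (2 : K) ≠ 0) (h3 : (3 : K) ≠ 0)
    (hD : 4 * b ^ 3 + 27 * c ^ 2 ≠ 0) {j : K}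
    (hj : j * (4 * b ^ 3 + 27 * c ^ 2) = 6912 * b ^ 3) (hl : l ≠ 0) (h : IsFlex 0 b c l x y) :
    ∃ u, u = y / (4 * l ^ 3) ∧ u ≠ 0 ∧ 1 - 27 * u ≠ 0 ∧
      j * (u ^ 3 * (1 - 27 * u)) = (1 - 24 * u) ^ 3 := by
  obtain ⟨h1, h4, h5⟩ := h
  obtain ⟨u, hu⟩ : ∃ u, u = y / (4 * l ^ 3) := ⟨_, rfl⟩
  have h44 : (4 : K) ≠ 0 := by rw [show (4 : K) = 2 * 2 by norm_num]; exact mul_ne_zero h2 h2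
  have hy : y = 4 * u * l ^ 3 := by rw [hu]; field_simp
  have hx : x = l ^ 2 / 3 := by field_simp; linear_combination -h5
  have hb : b = -(l ^ 4 * (1 - 24 * u) / 3) := by
    rw [hy, hx] at h4; field_simp at h4 ⊢; linear_combination -h4
  have h27 : (27 : K) ≠ 0 := by rw [show (27 : K) = 3 ^ 3 by norm_num]; exact pow_ne_zero 3 h3
  have hc : c = 2 * l ^ 6 * (1 - 36 * u + 216 * u ^ 2) / 27 := by
    rw [hy, hx, hb] at h1
    field_simp at h1 ⊢
    linear_combination -h1
  have e : 4 * b ^ 3 + 27 * c ^ 2 = -(256 * l ^ 12 * (u ^ 3 * (1 - 27 * u))) := by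
    rw [hb, hc]; field_simp; ring
  refine ⟨u, hu, ?_, ?_, ?_⟩
  · rintro rfl; exact hD (by rw [e]; ring)
  · intro h; exact hD (by rw [e, h]; ring)
  · have h256 : 256 * l ^ 12 ≠ 0 := by
      rw [show (256 : K) = 2 ^ 8 by norm_num]
      exact mul_ne_zero (pow_ne_zero _ h2) (pow_ne_zero _ hl)
    have hb' : 27 * b ^ 3 = -(l ^ 12 * (1 - 24 * u) ^ 3) := by rw [hb]; field_simp; ring
    refine mul_left_cancel₀ h256 ?_
    rw [e] at hj
    linear_combination -hj - 256 * hb'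

end Flex

section ExU
variable {p : ℕ} [Fact p.Prime] {K : Type*} [Field K]

theorem exists_short {j : K} (h2 : (2 : K) ≠ 0) (h3 : (3 : K) ≠ 0) (hj : j ≠ 0) :
    ∃ b c : K, b ≠ 0 ∧ 4 * b ^ 3 + 27 * c ^ 2 ≠ 0 ∧
      j * (4 * b ^ 3 + 27 * c ^ 2) = 6912 * b ^ 3 := by
  by_cases h : j = 1728
  · refine ⟨1, 0, one_ne_zero, ?_, by rw [h]; ring⟩
    rw [show 4 * (1 : K) ^ 3 + 27 * 0 ^ 2 = 2 ^ 2 by ring]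
    exact pow_ne_zero _ h2
  · have h' : j - 1728 ≠ 0 := sub_ne_zero.2 h
    refine ⟨-3 * j * (j - 1728), 2 * j * (j - 1728) ^ 2, ?_, ?_, by ring⟩
    · exact mul_ne_zero (mul_ne_zero (neg_ne_zero.2 h3) hj) h'
    · rw [show 4 * (-3 * j * (j - 1728)) ^ 3 + 27 * (2 * j * (j - 1728) ^ 2) ^ 2 =
        -(2 ^ 8 * 3 ^ 6 * j ^ 2 * (j - 1728) ^ 3) by ring]
      exact neg_ne_zero.2 (mul_ne_zero (mul_ne_zero (mul_ne_zero (pow_ne_zero _ h2)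
        (pow_ne_zero _ h3)) (pow_ne_zero _ hj)) (pow_ne_zero _ h'))

theorem IsFlex.slope_ne_zero {b c l x y : K} (h3 : (3 : K) ≠ 0) (hb : b ≠ 0)
    (h : IsFlex 0 b c l x y) : l ≠ 0 := by
  rintro rfl
  obtain ⟨-, h1, h4⟩ := h
  have hx : x = 0 := (mul_eq_zero.1 (by linear_combination -h4 : 3 * x = 0)).resolve_left h3
  subst hx
  exact hb (by linear_combination -h1)

theorem exists_isFlex_of_isAlgClosed [IsAlgClosed K] {b c : K} (h2 : (2 : K) ≠ 0)
    (h3 : (3 : K) ≠ 0) (hD : 4 * b ^ 3 + 27 * c ^ 2 ≠ 0) : ∃ l x y, IsFlex 0 b c l x y := by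
  obtain ⟨x, hx⟩ := IsAlgClosed.exists_root
    (C 3 * X ^ 4 + C (6 * b) * X ^ 2 + C (12 * c) * X + C (-b ^ 2) : K[X]) (by
      rw [show degree _ = 4 by compute_degree!]; norm_num)
  simp only [IsRoot.def, eval_add, eval_mul, eval_C, eval_pow, eval_X] at hx
  obtain ⟨y, hy⟩ := IsAlgClosed.exists_pow_nat_eq (x ^ 3 + b * x + c) two_pos
  have hy0 : y ≠ 0 := by
    rintro rfl
    have hb : 3 * x ^ 2 + b = 0 :=
      pow_eq_zero_iff two_ne_zero |>.1 (by linear_combination -hx - 12 * x * hy)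
    have hb' : b = -3 * x ^ 2 := by linear_combination hb
    have hc : c = 2 * x ^ 3 := by rw [hb'] at hy; linear_combination -hy
    exact hD (by rw [hb', hc]; ring)
  refine ⟨(3 * x ^ 2 + b) / (2 * y), x, y, by linear_combination hy, by field_simp; ring, ?_⟩
  rw [div_pow, div_eq_iff (pow_ne_zero _ (mul_ne_zero h2 hy0))]
  linear_combination -hx - 12 * x * hy

theorem exists_param (K : Type*) [Field K] [IsAlgClosed K] [Algebra (ZMod p) K]
    (hp : 5 ≤ p) (h3 : p % 3 = 2) {j : ZMod p}
    (hj : (ssPoly p).eval j = 0) :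
    ∃ u : ZMod p, u ≠ 0 ∧ 1 - 27 * u ≠ 0 ∧ j * (u ^ 3 * (1 - 27 * u)) = (1 - 24 * u) ^ 3 := by
  have n2 : (2 : ZMod p) ≠ 0 := ofNat_ne_zero_of_dvd hp (by norm_num)
  have n3 : (3 : ZMod p) ≠ 0 := ofNat_ne_zero_of_dvd hp (by norm_num)
  have n8 : (8 : ZMod p) ≠ 0 := ofNat_ne_zero_of_dvd hp (by norm_num)
  by_cases hj0 : j = 0
  · have n24 : (24 : ZMod p) ≠ 0 := ofNat_ne_zero_of_dvd hp (by norm_num)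
    refine ⟨1 / 24, one_div_ne_zero n24, ?_, ?_⟩
    · rw [show (1 : ZMod p) - 27 * (1 / 24) = -(3 / 24) by field_simp; norm_num]
      exact neg_ne_zero.2 (div_ne_zero n3 n24)
    · rw [hj0, mul_one_div_cancel n24]; ring
  obtain ⟨b, c, hb, hD, e⟩ := exists_short n2 n3 hj0
  obtain ⟨φ, hφ⟩ : ∃ φ, φ = algebraMap (ZMod p) K := ⟨_, rfl⟩
  have m (n : ZMod p) (h : n ≠ 0) : φ n ≠ 0 := (map_ne_zero φ).2 h
  have m2 : (2 : K) ≠ 0 := by rw [← map_ofNat φ 2]; exact m _ n2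
  have m3 : (3 : K) ≠ 0 := by rw [← map_ofNat φ 3]; exact m _ n3
  have mD : 4 * (φ b) ^ 3 + 27 * (φ c) ^ 2 ≠ 0 := by
    simpa only [map_add, map_mul, map_pow, map_ofNat] using m _ hD
  have me : φ j * (4 * (φ b) ^ 3 + 27 * (φ c) ^ 2) = 6912 * (φ b) ^ 3 := by
    simpa only [map_add, map_mul, map_pow, map_ofNat] using congrArg φ e
  obtain ⟨l, x, y, hf⟩ := exists_isFlex_of_isAlgClosed m2 m3 mD
  have hl := hf.slope_ne_zero m3 (m _ hb)
  obtain ⟨u, hu, u1, u2, u3⟩ := hf.param m2 m3 mD me hl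
  have hc : (fc 0 b c ^ (p / 2)).coeff (p - 1) = 0 := by
    refine (map_eq_zero φ).1 ?_
    rw [← coeff_map, Polynomial.map_pow, show (fc 0 b c).map φ = fc 0 (φ b) (φ c) by simp [fc],
      coeff_of_isFlex hp hl hf, ← hu, ← aeval_ssPoly_iff hp u1 u2 u3, hφ, aeval_algebraMap_apply,
      coe_aeval_eq_eval, hj, map_zero]
  have hΔ : (Wc 0 b c).Δ ≠ 0 := by
    rw [Δ_Wc, show 16 * ((0 : ZMod p) ^ 2 * b ^ 2 - 4 * b ^ 3 - 4 * 0 ^ 3 * c - 27 * c ^ 2 +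
      18 * 0 * b * c) = -(2 * 8 * (4 * b ^ 3 + 27 * c ^ 2)) by ring]
    exact neg_ne_zero.2 (mul_ne_zero (mul_ne_zero n2 n8) hD)
  have hcard := card_point hp hΔ hc
  obtain ⟨l, x, y, hf⟩ := exists_isFlex (by omega) (by omega : Nat.card (Wc 0 b c).Point ≠ 0)
  obtain ⟨u, -, hu⟩ := hf.param n2 n3 hD e (hf.slope_ne_zero n3 hb)
  exact ⟨u, hu⟩

end ExU

section Fib
variable {p : ℕ} [Fact p.Prime]

theorem pow_three_pow (h3 : p % 3 = 2) (x : ZMod p) : (x ^ 3) ^ (2 * (p / 3) + 1) = x := by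
  by_cases hx : x = 0
  · rw [hx]; simp
  · refine mul_right_cancel₀ hx ?_
    rw [← pow_mul, ← pow_succ, show 3 * (2 * (p / 3) + 1) + 1 = p * 2 by omega, pow_mul,
      ZMod.pow_card, sq]

theorem pow_three_injective (h3 : p % 3 = 2) : Function.Injective fun x : ZMod p => x ^ 3 :=
  Function.LeftInverse.injective (pow_three_pow h3)

theorem exists_pow_three (h3 : p % 3 = 2) (x : ZMod p) : ∃ v, v ^ 3 = x :=
  ⟨x ^ (2 * (p / 3) + 1), by rw [← pow_mul, mul_comm, pow_mul, pow_three_pow h3]⟩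

/-- The cube root of the `j`-invariant in terms of a parameter of level `9`. -/
def gam (v : ZMod p) : ZMod p := 3 * v * (v ^ 3 + 8) / (v ^ 3 - 1)

/-- The nontrivial deck transformation of `gam` over `𝔽_p`. -/
def deck (v : ZMod p) : ZMod p := if v ^ 2 - 2 * v - 2 = 0 then 2 - v else (v + 2) / (v - 1)

theorem pow_three_sub_one_ne (h3 : p % 3 = 2) {v : ZMod p} (hv : v ≠ 1) : v ^ 3 - 1 ≠ 0 := fun h =>
  hv (pow_three_injective h3 (by linear_combination h : v ^ 3 = 1 ^ 3))

theorem deck_ne (hp : 5 ≤ p) {v : ZMod p} (hv : v ≠ 1) : deck v ≠ v := by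
  have n2 : (2 : ZMod p) ≠ 0 := ofNat_ne_zero_of_dvd hp (by norm_num)
  have hv' := sub_ne_zero.2 hv
  unfold deck
  split_ifs with h <;> intro h'
  · exact mul_ne_zero n2 hv' (by linear_combination -h')
  · rw [div_eq_iff hv'] at h'
    exact h (by linear_combination -h')

theorem deck_ne_one (hp : 5 ≤ p) {v : ZMod p} (hv : v ≠ 1) : deck v ≠ 1 := by
  have n3 : (3 : ZMod p) ≠ 0 := ofNat_ne_zero_of_dvd hp (by norm_num)
  have hv' := sub_ne_zero.2 hv
  unfold deck
  split_ifs with h <;> intro h'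
  · exact hv (by linear_combination -h')
  · rw [div_eq_iff hv'] at h'
    exact n3 (by linear_combination h')

theorem gam_eq_iff (hp : 5 ≤ p) (h3 : p % 3 = 2) {v w : ZMod p} (hv : v ≠ 1) (hw : w ≠ 1) :
    gam w = gam v ↔ w = v ∨ w = deck v := by
  have n2 : (2 : ZMod p) ≠ 0 := ofNat_ne_zero_of_dvd hp (by norm_num)
  have n3 : (3 : ZMod p) ≠ 0 := ofNat_ne_zero_of_dvd hp (by norm_num)
  have hv' := sub_ne_zero.2 hv
  have hns (A B : ZMod p) (h : A ^ 2 + 3 * B ^ 2 = 0) : B = 0 := by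
    by_contra hB
    have := (legendreSym.eq_neg_one_iff p (a := -3)).1
      (by rw [legendreSym_neg_three hp, if_neg (by omega)])
    refine this ⟨A / B, ?_⟩
    push_cast
    field_simp
    linear_combination -h
  have e : gam w = gam v ↔ (w - v) * ((v - 1) * w - (v + 2)) *
      ((v ^ 2 + v + 1) * w ^ 2 + (v ^ 2 + 4 * v - 2) * w + (v ^ 2 - 2 * v + 4)) = 0 := by
    rw [gam, gam, div_eq_div_iff (pow_three_sub_one_ne h3 hw) (pow_three_sub_one_ne h3 hv)]
    refine ⟨fun h => mul_left_cancel₀ n3 ?_, fun h => ?_⟩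
    · linear_combination h
    · linear_combination 3 * h
  have d1 (h : v ^ 2 - 2 * v - 2 = 0) : deck v = 2 - v := if_pos h
  have d2 (h : v ^ 2 - 2 * v - 2 ≠ 0) : deck v = (v + 2) / (v - 1) := if_neg h
  rw [e, mul_eq_zero, mul_eq_zero, sub_eq_zero, or_assoc]
  constructor
  · rintro (h | h | h)
    · exact Or.inl h
    · by_cases hB : v ^ 2 - 2 * v - 2 = 0
      · exact Or.inl (mul_left_cancel₀ hv' (by linear_combination h - hB))
      · rw [d2 hB, eq_div_iff hv']
        exact Or.inr (by linear_combination h)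
    · have hB := hns (2 * (v ^ 2 + v + 1) * w + v ^ 2 + 4 * v - 2) (v ^ 2 - 2 * v - 2)
        (by linear_combination 4 * (v ^ 2 + v + 1) * h)
      have hA : 2 * (v ^ 2 + v + 1) * w + v ^ 2 + 4 * v - 2 = 0 :=
        (pow_eq_zero_iff two_ne_zero).1 (by
          linear_combination 4 * (v ^ 2 + v + 1) * h - 3 * (v ^ 2 - 2 * v - 2) * hB)
      have h1 : v + 1 ≠ 0 := fun h1 => one_ne_zero (α := ZMod p)
        (by linear_combination hB - (v - 3) * h1)
      refine Or.inr (mul_left_cancel₀ (mul_ne_zero (mul_ne_zero n2 n3) h1) ?_)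
      rw [d1 hB]
      linear_combination hA + (5 - 2 * w) * hB
  · rintro (h | h)
    · exact Or.inl h
    by_cases hB : v ^ 2 - 2 * v - 2 = 0
    · rw [d1 hB] at h
      rw [h]
      exact Or.inr (Or.inr (by linear_combination (v ^ 2 - 2 * v - 2) * hB))
    · rw [d2 hB, eq_div_iff hv'] at h
      exact Or.inr (Or.inl (by linear_combination h))

theorem eval_ss3Star_iff_gam (hp : 5 ≤ p) (h3 : p % 3 = 2) {r v : ZMod p} (hr : r ≠ 0)
    (hv : v ^ 3 = 1 + 27 * r) :
    (ss3Star p).eval ((1 + 27 * r) ^ 2 / r) = 0 ↔ (ssPoly p).eval (gam v ^ 3) = 0 := by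
  by_cases h0 : v = 0
  · subst h0
    rw [← hv, zero_pow three_ne_zero, zero_pow two_ne_zero, zero_div, eval_zero_ss3Star hp,
      ssPoly_eq, del_eq_one hp (by omega)]
    simp [gam]
  · have hr' : 1 + 27 * r ≠ 0 := hv ▸ pow_ne_zero 3 h0
    have n27 : (27 : ZMod p) ≠ 0 := ofNat_ne_zero_of_dvd hp (by norm_num)
    have hu : 1 - 27 * (r / (1 + 27 * r)) = 1 / (1 + 27 * r) := by field_simp; ring
    rw [← coe_aeval_eq_eval, aeval_ss3Star_iff hp hr hr', ← coe_aeval_eq_eval (gam v ^ 3),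
      aeval_ssPoly_iff hp (div_ne_zero hr hr') (hu ▸ one_div_ne_zero hr')]
    rw [hu, gam, hv, show 1 + 27 * r - 1 = 27 * r by ring,
      show 1 + 27 * r + 8 = 9 * (1 + 3 * r) by ring, div_pow, mul_pow, mul_pow 3 v, hv]
    field_simp
    ring

variable (p) in
/-- The parameters over `𝔽_p` of the roots of `ss3Star p`. -/
def rSet : Finset (ZMod p) :=
  univ.filter fun r => r ≠ 0 ∧ (ss3Star p).eval ((1 + 27 * r) ^ 2 / r) = 0

theorem ssPoly_ne_zero : ssPoly p ≠ 0 := by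
  rw [ssPoly_eq]
  exact mul_ne_zero (pow_ne_zero _ (X_sub_C_ne_zero _))
    (mul_ne_zero (pow_ne_zero _ X_ne_zero) (hypP_ne_zero _ _ _))

theorem card_rSet (hp : 5 ≤ p) : (rSet p).card = 2 * (del p * LL p) := by
  have n27 : (27 : ZMod p) ≠ 0 := ofNat_ne_zero_of_dvd hp (by norm_num)
  by_cases h1 : p % 3 = 1
  · rw [del_eq_zero hp h1, zero_mul, mul_zero, Finset.card_eq_zero, rSet,
      Finset.filter_eq_empty_iff]
    rintro r - ⟨hr, h⟩
    by_cases hr' : 1 + 27 * r = 0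
    · rw [hr', zero_pow two_ne_zero, zero_div, eval_zero_ss3Star hp, del_eq_zero hp h1] at h
      exact zero_ne_one h
    · rw [← coe_aeval_eq_eval, aeval_ss3Star_iff hp hr hr'] at h
      refine gP_ne_zero_of_mod hp h1 (div_ne_zero hr hr') ?_ h
      rw [show 1 - 27 * (r / (1 + 27 * r)) = 1 / (1 + 27 * r) by field_simp; ring]
      exact one_div_ne_zero hr'
  have h3 : p % 3 = 2 := by
    obtain ⟨h6, hd⟩ := del_spec hp
    omega
  rw [del_eq_one hp h1, one_mul]
  have hT : (rSet p).card =
      (univ.filter fun v : ZMod p => v ≠ 1 ∧ (ssPoly p).eval (gam v ^ 3) = 0).card := by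
    symm
    refine Finset.card_nbij' (fun v => (v ^ 3 - 1) / 27)
      (fun r => (1 + 27 * r) ^ (2 * (p / 3) + 1)) ?_ ?_ ?_ ?_
    · intro v hv
      simp only [rSet, coe_filter, mem_univ, true_and, Set.mem_ofPred_eq] at hv ⊢
      have hr : (v ^ 3 - 1) / 27 ≠ 0 := div_ne_zero (pow_three_sub_one_ne h3 hv.1) n27
      exact ⟨hr, (eval_ss3Star_iff_gam hp h3 hr (by field_simp; ring)).2 hv.2⟩
    · intro r hr
      simp only [rSet, coe_filter, mem_univ, true_and, Set.mem_ofPred_eq] at hr ⊢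
      obtain ⟨v, hv⟩ := exists_pow_three h3 (1 + 27 * r)
      rw [← hv, pow_three_pow h3]
      refine ⟨?_, (eval_ss3Star_iff_gam hp h3 hr.1 hv).1 hr.2⟩
      rintro rfl
      exact mul_ne_zero n27 hr.1 (by linear_combination -hv)
    · intro v _
      dsimp only
      rw [mul_div_cancel₀ _ n27, add_sub_cancel, pow_three_pow h3]
    · intro r _
      dsimp only
      obtain ⟨v, hv⟩ := exists_pow_three h3 (1 + 27 * r)
      rw [← hv, pow_three_pow h3, hv]
      field_simp
      ring
  rw [hT, Finset.card_eq_sum_card_fiberwise (f := fun v => gam v ^ 3)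
    (t := (ssPoly p).roots.toFinset), Finset.sum_const_nat (m := 2), mul_comm, LL]
  · intro j hj
    rw [Multiset.mem_toFinset, mem_roots ssPoly_ne_zero, IsRoot.def] at hj
    obtain ⟨u, hu, hu', e⟩ := exists_param (AlgebraicClosure (ZMod p)) hp h3 hj
    obtain ⟨v, hv⟩ := exists_pow_three h3 (1 / (1 - 27 * u))
    have hv1 : v ≠ 1 := by
      rintro rfl
      refine mul_ne_zero n27 hu ?_
      field_simp at hv
      linear_combination -hv
    have hj' : gam v ^ 3 = j := by
      have hu3 : u ^ 3 * (1 - 27 * u) ≠ 0 := mul_ne_zero (pow_ne_zero _ hu) hu'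
      refine mul_right_cancel₀ hu3 ?_
      rw [e, gam, div_pow, mul_pow, mul_pow 3 v, hv,
        show 1 / (1 - 27 * u) - 1 = 27 * u / (1 - 27 * u) by field_simp; ring,
        show 1 / (1 - 27 * u) + 8 = 9 * (1 - 24 * u) / (1 - 27 * u) by field_simp; ring]
      field_simp
      ring
    rw [← card_pair (deck_ne hp hv1).symm]
    congr 1
    ext w
    simp only [Finset.mem_filter, mem_univ, true_and, Finset.mem_insert,
      Finset.mem_singleton]
    constructor
    · rintro ⟨⟨hw, -⟩, h⟩
      exact (gam_eq_iff hp h3 hv1 hw).1 (pow_three_injective h3 (h.trans hj'.symm))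
    · intro h
      have hw : w ≠ 1 := by rcases h with rfl | rfl; exacts [hv1, deck_ne_one hp hv1]
      have : gam w ^ 3 = j := by rw [(gam_eq_iff hp h3 hv1 hw).2 h, hj']
      exact ⟨⟨hw, this ▸ hj⟩, this⟩
  · intro v hv
    simp only [coe_filter, mem_univ, true_and, Set.mem_ofPred_eq] at hv
    simp [ssPoly_ne_zero, hv.2]

end Fib

section Fin
variable {p : ℕ} [Fact p.Prime] {k : Type*} [Field k]

open Classical in
theorem exists_fiber [IsAlgClosed k] [CharP k p] (hp : 5 ≤ p) (f : ZMod p →+* k) (x : ZMod p) :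
    ∃ g : Finset k, (∀ r, r ∈ g ↔ 729 * r ^ 2 + (54 - f x) * r + 1 = 0) ∧
      (g.filter fun r => r ^ p = r).card + (g.filter fun r => 729 * r ^ (p + 1) = 1).card = 2 := by
  have n729 : (729 : k) ≠ 0 := by
    have h : (729 : ZMod p) ≠ 0 := ofNat_ne_zero_of_dvd hp (by norm_num)
    rw [← map_ofNat f 729]; exact (map_ne_zero f).2 h
  obtain ⟨r, hr⟩ := IsAlgClosed.exists_root (C 729 * X ^ 2 + C (54 - f x) * X + C 1 : k[X]) (by
    rw [show degree _ = 2 by compute_degree!]; norm_num)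
  simp only [IsRoot.def, eval_add, eval_mul, eval_C, eval_pow, eval_X] at hr
  have hr0 : r ≠ 0 := by rintro rfl; simp at hr
  obtain ⟨s, hs⟩ : ∃ s, 729 * r * s = 1 := ⟨1 / (729 * r), by field_simp⟩
  have hiff (t : k) : t = r ∨ t = s ↔ 729 * t ^ 2 + (54 - f x) * t + 1 = 0 := by
    rw [← sub_eq_zero, ← sub_eq_zero (b := s), ← mul_eq_zero]
    have : r * (729 * t ^ 2 + (54 - f x) * t + 1) = 729 * r * ((t - r) * (t - s)) := by
      linear_combination t * hr + (t - r) * hs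
    constructor <;> intro h
    · exact mul_left_cancel₀ hr0 (by rw [this, h, mul_zero, mul_zero])
    · exact mul_left_cancel₀ (mul_ne_zero n729 hr0) (by rw [← this, h, mul_zero, mul_zero])
  have hF : r ^ p = r ∨ r ^ p = s := by
    rw [hiff]
    have := congrArg (frobenius k p) hr
    simpa only [map_add, map_sub, map_mul, map_pow, map_ofNat, map_one, map_zero, frobenius_def,
      ← map_pow f, ZMod.pow_card] using this
  have hs' : 729 * r ^ p * s ^ p = 1 := by
    have := congrArg (frobenius k p) hs
    simpa only [map_mul, map_ofNat, map_one, frobenius_def] using this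
  refine ⟨{r, s}, fun t => by rw [Finset.mem_insert, Finset.mem_singleton, hiff], ?_⟩
  have hs0 : s ≠ 0 := by rintro rfl; simp at hs
  by_cases h : r = s
  · subst h
    have h1 : r ^ p = r := hF.elim id id
    have h2 : 729 * r ^ (p + 1) = 1 := by rw [pow_succ, h1, ← hs]; ring
    simp [filter_singleton, h1, h2]
  · rcases hF with h1 | h1
    · have h2 : s ^ p = s := by
        rw [h1] at hs'; exact mul_left_cancel₀ (mul_ne_zero n729 hr0) (hs'.trans hs.symm)
      have h3 : 729 * r ^ (p + 1) ≠ 1 := fun e => h <| mul_left_cancel₀ (mul_ne_zero n729 hr0) (by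
        rw [pow_succ, h1] at e; linear_combination e - hs)
      have h4 : 729 * s ^ (p + 1) ≠ 1 := fun e => h <| mul_left_cancel₀ (mul_ne_zero n729 hs0) (by
        rw [pow_succ, h2] at e; linear_combination hs - e)
      simp [Finset.filter_insert, filter_singleton, h1, h2, h3, h4, card_pair h]
    · have h2 : s ^ p = r := by
        rw [h1] at hs'; exact mul_left_cancel₀ (mul_ne_zero n729 hs0)
          (by linear_combination hs' - hs)
      have h3 : 729 * r ^ (p + 1) = 1 := by rw [pow_succ, h1, ← hs]; ring
      have h4 : 729 * s ^ (p + 1) = 1 := by rw [pow_succ, h2, ← hs]; ring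
      simp [Finset.filter_insert, filter_singleton, h1, h2, h3, h4, card_pair h,
        h, Ne.symm h]

theorem ss3Star_ne_zero : ss3Star p ≠ 0 := by
  rw [ss3Star_eq]
  exact mul_ne_zero (pow_ne_zero _ (X_sub_C_ne_zero _))
    (mul_ne_zero (pow_ne_zero _ X_ne_zero) (hypP_ne_zero _ _ _))

open Classical in
theorem card_add_ncard [IsAlgClosed k] [CharP k p] (hp : 5 ≤ p) (f : ZMod p →+* k) :
    (rSet p).card + Set.ncard {r : k | 729 * r ^ (p + 1) = 1 ∧
      ((ss3Star p).map f).eval ((1 + 27 * r) ^ 2 / r) = 0} = 2 * L3Star p := by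
  choose g hg hc using exists_fiber (k := k) hp f
  have h0 {x r} (h : r ∈ g x) : r ≠ 0 := by
    rintro rfl
    simpa using (hg x 0).1 h
  have hx {x r} (hr : r ≠ 0) : r ∈ g x ↔ (1 + 27 * r) ^ 2 / r = f x := by
    rw [hg, div_eq_iff hr]
    constructor <;> intro h <;> linear_combination h
  have hd : (((ss3Star p).roots.toFinset : Finset (ZMod p)) : Set (ZMod p)).PairwiseDisjoint g := by
    intro x _ y _ hxy
    refine Finset.disjoint_left.2 fun r h1 h2 => hxy (f.injective ?_)
    rw [← (hx (h0 h1)).1 h1, ← (hx (h0 h2)).1 h2]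
  have hsum (P : k → Prop) : (((ss3Star p).roots.toFinset.biUnion g).filter P).card =
      ∑ x ∈ (ss3Star p).roots.toFinset, ((g x).filter P).card := by
    rw [Finset.filter_biUnion, Finset.card_biUnion]
    exact fun x h1 y h2 h => (hd h1 h2 h).mono (Finset.filter_subset _ _) (Finset.filter_subset _ _)
  have hmem {r : k} (hr : r ≠ 0) (hf : ∃ x, f x = (1 + 27 * r) ^ 2 / r) :
      r ∈ (ss3Star p).roots.toFinset.biUnion g ↔
        ((ss3Star p).map f).eval ((1 + 27 * r) ^ 2 / r) = 0 := by
    obtain ⟨x, hf⟩ := hf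
    rw [← hf, eval_map, eval₂_at_apply, map_eq_zero]
    simp only [Finset.mem_biUnion, Multiset.mem_toFinset, mem_roots ss3Star_ne_zero, IsRoot.def,
      hx hr, ← hf, f.injective.eq_iff, exists_eq_right']
  have hfix {y : k} (hy : y ^ p = y) : ∃ x, f x = y :=
    (bot_le : ⊥ ≤ f.fieldRange) ((Subfield.mem_bot_iff_pow_eq_self k p).2 hy)
  have hA : (rSet p).card =
      (((ss3Star p).roots.toFinset.biUnion g).filter fun r => r ^ p = r).card := by
    rw [← Finset.card_image_of_injective _ f.injective]
    congr 1
    ext r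
    simp only [Finset.mem_image, rSet, Finset.mem_filter, mem_univ, true_and]
    constructor
    · rintro ⟨r, ⟨hr, h⟩, rfl⟩
      have e : f ((1 + 27 * r) ^ 2 / r) = (1 + 27 * f r) ^ 2 / f r := by
        simp only [map_div₀, map_pow, map_add, map_mul, map_one, map_ofNat]
      rw [hmem ((map_ne_zero f).2 hr) ⟨_, e⟩, ← e, eval_map, eval₂_at_apply, h, map_zero, ← map_pow,
        ZMod.pow_card]
      exact ⟨rfl, rfl⟩
    · rintro ⟨h, hr⟩
      obtain ⟨r, rfl⟩ := hfix hr
      have e : f ((1 + 27 * r) ^ 2 / r) = (1 + 27 * f r) ^ 2 / f r := by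
        simp only [map_div₀, map_pow, map_add, map_mul, map_one, map_ofNat]
      have hr0 : f r ≠ 0 := by
        obtain ⟨x, -, h⟩ := Finset.mem_biUnion.1 h
        exact h0 h
      rw [hmem hr0 ⟨_, e⟩, ← e, eval_map, eval₂_at_apply, map_eq_zero] at h
      exact ⟨r, ⟨(map_ne_zero f).1 hr0, h⟩, rfl⟩
  have hB : {r : k | 729 * r ^ (p + 1) = 1 ∧
      ((ss3Star p).map f).eval ((1 + 27 * r) ^ 2 / r) = 0} =
      ((ss3Star p).roots.toFinset.biUnion g).filter fun r => 729 * r ^ (p + 1) = 1 := by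
    ext r
    rw [coe_filter, Set.mem_ofPred_eq, Set.mem_ofPred_eq, and_comm]
    refine and_congr_left fun h => (hmem ?_ (hfix ?_)).symm
    · rintro rfl; simp at h
    · have hr0 : r ≠ 0 := by rintro rfl; simp at h
      have e : frobenius k p ((1 + 27 * r) ^ 2 / r) = (1 + 27 * r ^ p) ^ 2 / r ^ p := by
        simp only [map_div₀, map_pow, map_add, map_mul, map_one, map_ofNat, frobenius_def]
      rw [← frobenius_def, e, div_eq_div_iff (pow_ne_zero p hr0) hr0]
      rw [pow_succ] at h
      linear_combination (r ^ p - r) * h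
  rw [hB, Set.ncard_coe_finset, hA, hsum, hsum, ← sum_add_distrib, sum_congr rfl
    fun x _ => hc x, Finset.sum_const, smul_eq_mul, mul_comm, L3Star]

theorem L3Star_eq (hp : 5 ≤ p) : 4 * L3Star p = 4 * (del p * LL p) +
    (if p % 4 = 1 then if p % 8 = 1 then 4 else 2 else 1) * classNumberSqrtNeg (3 * p) := by
  obtain ⟨V, hV⟩ := exists_valuationSubring p
  have : CharP (ResidueField V) p := charP_residue hV
  let f := ZMod.castHom (dvd_refl p) (ResidueField V)
  have h1 := card_add_ncard hp f
  have h2 := ncard_TZ (V := V) hp f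
  rw [ncard_TZ_eq hp] at h2
  rw [card_rSet hp] at h1
  omega

end Fin

end SS3

/-- For every prime p ≥ 5, the number L^{(3*)}(p) of distinct roots of ss_p^{(3*)}(X) in 𝔽_p
equals δ·L(p) + (1/8)·(2 + (1 + (−1|p))·(2 + (−2|p)))·h(√−3p). -/
theorem number_of_linear_factors_of_ss3star (hp : 5 ≤ p) :
    (L3Star p : ℚ) =
      (del p : ℚ) * (LL p : ℚ)
        + 1 / 8 * (2 + (1 + (legendreSym p (-1) : ℚ)) * (2 + (legendreSym p (-2) : ℚ))) *
            (classNumberSqrtNeg (3 * p) : ℚ) := by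
  have hodd := (Fact.out : p.Prime).eq_two_or_odd.resolve_left (by omega)
  have h1 : legendreSym p (-1) = ZMod.χ₄ p := legendreSym.at_neg_one (by omega)
  have h2 : legendreSym p (-2) = ZMod.χ₈' p := legendreSym.at_neg_two (by omega)
  rw [ZMod.χ₄_nat_eq_if_mod_four] at h1
  rw [ZMod.χ₈'_nat_eq_if_mod_eight] at h2
  have h := SS3.L3Star_eq (p := p) hp
  generalize classNumberSqrtNeg (3 * p) = c at h ⊢
  have h : 4 * (L3Star p : ℚ) = 4 * (del p * LL p) +
      ((if p % 4 = 1 then if p % 8 = 1 then 4 else 2 else 1 : ℕ) : ℚ) * c := by exact_mod_cast h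
  rw [h1, h2]
  have h8 : p % 8 = 1 ∨ p % 8 = 3 ∨ p % 8 = 5 ∨ p % 8 = 7 := by omega
  rcases h8 with h8 | h8 | h8 | h8
  · have h4 : p % 4 = 1 := by omega
    simp only [hodd, h4, h8] at h ⊢
    norm_num at h ⊢
    linarith
  · have h4 : p % 4 = 3 := by omega
    simp only [hodd, h4, h8] at h ⊢
    norm_num at h ⊢
    linarith
  · have h4 : p % 4 = 1 := by omega
    simp only [hodd, h4, h8] at h ⊢
    norm_num at h ⊢
    linarith
  · have h4 : p % 4 = 3 := by omega
    simp only [hodd, h4, h8] at h ⊢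
    norm_num at h ⊢
    linarith
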